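/- Let N ≥ 2 and let B ⊂ ℝ^N be an open ball centered at the origin. Then there exists s* ∈ (0,1) such that for every s ∈ (s*,1) there exist continuous eigenfunctions v₁,…,v_N associated to μ₁^{(s)}(B) with the following properties: for each i = 1,…,N, v_i(σ_{e_i}(x)) = −v_i(x) for all x (antisymmetry with respect to the coordinate hyperplane {x_i = 0}, where e_i is the i-th standard unit vector and σ_{e_i}(x) = x − 2(x·e_i)e_i), the open set {x ∈ B : v_i(x) ≠ 0} has exactly two connected components, and every eigenfunction associated to μ₁^{(s)}(B) is a linear combination of v₁,…,v_N. -/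

import Mathlib

open MeasureTheory Filter Topology Bornology Set
open scoped ENNReal NNReal

noncomputable section

namespace FracNeumann

abbrev Euc (N : ℕ) : Type := EuclideanSpace ℝ (Fin N)

/-- The kernel weight `|x - y| ^ (N + 2s)`. -/
def kern (N : ℕ) (s : ℝ) (x y : Euc N) : ℝ := ‖x - y‖ ^ ((N : ℝ) + 2 * s)

/-- The region `ℝ^{2N} \ (Ω^c × Ω^c)`, where `Ω^c := ℝ^N \ closure Ω`. -/
def reg (N : ℕ) (Ω : Set (Euc N)) : Set (Euc N × Euc N) :=
  {q | q.1 ∈ closure Ω ∨ q.2 ∈ closure Ω}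

/-- The squared seminorm `[u]_{H^s_{Ω,0}}²`, as an extended real number. -/
def semiSq (N : ℕ) (s : ℝ) (Ω : Set (Euc N)) (u : Euc N → ℝ) : ℝ≥0∞ :=
  ∫⁻ q in reg N Ω, ENNReal.ofReal ((u q.1 - u q.2) ^ 2 / kern N s q.1 q.2)

/-- `∫_Ω u²`, as an extended real number. -/
def l2sq (N : ℕ) (Ω : Set (Euc N)) (u : Euc N → ℝ) : ℝ≥0∞ :=
  ∫⁻ x in Ω, ENNReal.ofReal ((u x) ^ 2)

/-- Membership in `H^s_{Ω,0}`. -/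
def memHs (N : ℕ) (s : ℝ) (Ω : Set (Euc N)) (u : Euc N → ℝ) : Prop :=
  Measurable u ∧ l2sq N Ω u < ⊤ ∧ semiSq N s Ω u < ⊤

/-- The squared Gagliardo seminorm `[u]_{H^s(Ω)}²`. -/
def semiSqOn (N : ℕ) (s : ℝ) (Ω : Set (Euc N)) (u : Euc N → ℝ) : ℝ≥0∞ :=
  ∫⁻ q in Ω ×ˢ Ω, ENNReal.ofReal ((u q.1 - u q.2) ^ 2 / kern N s q.1 q.2)

/-- Membership in `H^s(Ω)` (for functions defined on all of `ℝ^N`). -/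
def memHsOn (N : ℕ) (s : ℝ) (Ω : Set (Euc N)) (u : Euc N → ℝ) : Prop :=
  Measurable u ∧ l2sq N Ω u < ⊤ ∧ semiSqOn N s Ω u < ⊤

/-- The normalizing constant `c_{N,s}` of the fractional Laplacian. -/
def cNs (N : ℕ) (s : ℝ) : ℝ :=
  (4 : ℝ) ^ s * s * Real.Gamma ((N : ℝ) / 2 + s) /
    (Real.pi ^ ((N : ℝ) / 2) * Real.Gamma (1 - s))

/-- The nonlocal Neumann derivative `𝒩_s u`. -/
def Nneu (N : ℕ) (s : ℝ) (Ω : Set (Euc N)) (u : Euc N → ℝ) (x : Euc N) : ℝ :=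
  cNs N s * ∫ y in Ω, (u x - u y) / kern N s x y

/-- Membership in `H̃^s_{Ω,0}`: members of `H^s_{Ω,0}` with `𝒩_s u = 0` a.e. in `Ω^c`. -/
def memHsTilde (N : ℕ) (s : ℝ) (Ω : Set (Euc N)) (u : Euc N → ℝ) : Prop :=
  memHs N s Ω u ∧ ∀ᵐ x ∂(volume.restrict (closure Ω)ᶜ), Nneu N s Ω u x = 0

/-- The first nontrivial Neumann eigenvalue `μ₁^{(s)}(Ω)`. -/
def mu1 (N : ℕ) (s : ℝ) (Ω : Set (Euc N)) : ℝ :=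
  sInf {t : ℝ | ∃ u : Euc N → ℝ, memHs N s Ω u ∧ (∫ x in Ω, (u x) ^ 2) = 1 ∧
    (∫ x in Ω, u x) = 0 ∧ t = cNs N s / 2 * (semiSq N s Ω u).toReal}

/-- The bilinear form (without the constant). -/
def bform (N : ℕ) (s : ℝ) (Ω : Set (Euc N)) (u v : Euc N → ℝ) : ℝ :=
  ∫ q in reg N Ω, (u q.1 - u q.2) * (v q.1 - v q.2) / kern N s q.1 q.2

/-- First nontrivial eigenfunction: weak solution associated to `μ₁^{(s)}(Ω)`. -/
def IsFirstEigen (N : ℕ) (s : ℝ) (Ω : Set (Euc N)) (u : Euc N → ℝ) : Prop :=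
  memHs N s Ω u ∧ ¬ (u =ᵐ[volume.restrict Ω] 0) ∧ (∫ x in Ω, u x) = 0 ∧
    ∀ v : Euc N → ℝ, memHs N s Ω v →
      cNs N s / 2 * bform N s Ω u v = mu1 N s Ω * ∫ x in Ω, u x * v x

/-- Reflection `σ_e(x) = x - 2(x·e)e` across the hyperplane `{x·e = 0}`. -/
def reflect (N : ℕ) (e x : Euc N) : Euc N := x - (2 * (inner ℝ x e : ℝ)) • e

/-- The polarization `P_e u` with respect to the hyperplane `{x·e = 0}`. -/
def polarize (N : ℕ) (e : Euc N) (u : Euc N → ℝ) (x : Euc N) : ℝ :=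
  if 0 ≤ (inner ℝ x e : ℝ) then min (u x) (u (reflect N e x))
  else max (u x) (u (reflect N e x))

/-- Foliated Schwarz symmetry with respect to `p`. -/
def FoliatedSchwarz (N : ℕ) (p : Euc N) (u : Euc N → ℝ) : Prop :=
  ∃ uh : ℝ → ℝ → ℝ, (∀ r : ℝ, AntitoneOn (uh r) (Icc 0 Real.pi)) ∧
    ∀ x : Euc N, x ≠ 0 → u x = uh ‖x‖ (Real.arccos ((inner ℝ x p : ℝ) / ‖x‖))

/-- Radial symmetry (pointwise). -/
def Radial (N : ℕ) (u : Euc N → ℝ) : Prop := ∃ f : ℝ → ℝ, ∀ x, u x = f ‖x‖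

/-- Radial symmetry (a.e.). -/
def RadialAE (N : ℕ) (u : Euc N → ℝ) : Prop :=
  ∃ f : ℝ → ℝ, ∀ᵐ x : Euc N ∂volume, u x = f ‖x‖

/-- The set `{x ∈ Ω : u x ≠ 0}` has exactly two connected components. -/
def TwoNodal (N : ℕ) (Ω : Set (Euc N)) (u : Euc N → ℝ) : Prop :=
  Nat.card (ConnectedComponents {x : Euc N // x ∈ Ω ∧ u x ≠ 0}) = 2

/-- Bounded Lipschitz domain: open, bounded, connected, and near every boundary point the set
is the region above the graph of a Lipschitz function in some direction `e`. -/
def IsLipschitzDomain (N : ℕ) (Ω : Set (Euc N)) : Prop :=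
  IsOpen Ω ∧ IsBounded Ω ∧ IsConnected Ω ∧
    ∀ x ∈ frontier Ω, ∃ e : Euc N, ‖e‖ = 1 ∧ ∃ r : ℝ, 0 < r ∧
      ∃ (L : NNReal) (f : Euc N → ℝ), LipschitzWith L f ∧
        ∀ y ∈ Metric.ball x r,
          (y ∈ Ω ↔ f (y - ((inner ℝ y e : ℝ)) • e) < (inner ℝ y e : ℝ))

/-- `g` is a weak gradient of `u` in `Ω`, square-integrable on `Ω`. -/
def IsWeakGradient (N : ℕ) (Ω : Set (Euc N)) (u : Euc N → ℝ) (g : Euc N → Euc N) : Prop :=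
  Measurable g ∧ (∫⁻ x in Ω, ENNReal.ofReal (‖g x‖ ^ 2)) < ⊤ ∧
    ∀ φ : Euc N → ℝ, ContDiff ℝ (⊤ : ℕ∞) φ → HasCompactSupport φ → tsupport φ ⊆ Ω →
      ∀ i : Fin N, (∫ x in Ω, u x * fderiv ℝ φ x (EuclideanSpace.single i 1)) =
        - ∫ x in Ω, g x i * φ x

/-- Membership in `H¹(Ω)`. -/
def memH1 (N : ℕ) (Ω : Set (Euc N)) (u : Euc N → ℝ) : Prop :=
  Measurable u ∧ l2sq N Ω u < ⊤ ∧ ∃ g, IsWeakGradient N Ω u g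

/-- `∫_Ω |∇u|²`, as an extended real number. -/
def gradSq (N : ℕ) (Ω : Set (Euc N)) (u : Euc N → ℝ) : ℝ≥0∞ :=
  ⨅ (g : Euc N → Euc N) (_ : IsWeakGradient N Ω u g), ∫⁻ x in Ω, ENNReal.ofReal (‖g x‖ ^ 2)

/-- Rayleigh quotient for the fractional Neumann problem. -/
def rayleighS (N : ℕ) (s : ℝ) (Ω : Set (Euc N)) (u : Euc N → ℝ) : ℝ≥0∞ :=
  ENNReal.ofReal (cNs N s / 2) * semiSq N s Ω u / l2sq N Ω u

/-- Rayleigh quotient for the local Neumann problem. -/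
def rayleigh1 (N : ℕ) (Ω : Set (Euc N)) (u : Euc N → ℝ) : ℝ≥0∞ :=
  gradSq N Ω u / l2sq N Ω u

/-- The min-max value `μ_n^{(s)}(Ω)` over `n`-dimensional subspaces of `H^s_{Ω,0} ∩ L²₀(Ω)`. -/
def muNs (N : ℕ) (s : ℝ) (Ω : Set (Euc N)) (n : ℕ) : ℝ≥0∞ :=
  ⨅ (A : Submodule ℝ (Euc N → ℝ)) (_ : Module.finrank ℝ A = n ∧
      (∀ u ∈ A, memHs N s Ω u ∧ (∫ x in Ω, u x) = 0) ∧
      (∀ u ∈ A, u =ᵐ[(volume : Measure (Euc N))] 0 → u = 0)),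
    ⨆ (u : Euc N → ℝ) (_ : u ∈ A ∧ u ≠ 0), rayleighS N s Ω u

/-- The min-max value over `n`-dimensional subspaces of `H̃^s_{Ω,0} ∩ L²₀(Ω)`. -/
def muNsTilde (N : ℕ) (s : ℝ) (Ω : Set (Euc N)) (n : ℕ) : ℝ≥0∞ :=
  ⨅ (A : Submodule ℝ (Euc N → ℝ)) (_ : Module.finrank ℝ A = n ∧
      (∀ u ∈ A, memHsTilde N s Ω u ∧ (∫ x in Ω, u x) = 0) ∧
      (∀ u ∈ A, u =ᵐ[(volume : Measure (Euc N))] 0 → u = 0)),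
    ⨆ (u : Euc N → ℝ) (_ : u ∈ A ∧ u ≠ 0), rayleighS N s Ω u

/-- The min-max value `μ_n^{(1)}(Ω)` over `n`-dimensional subspaces of `H¹(Ω) ∩ L²₀(Ω)`. -/
def muN1 (N : ℕ) (Ω : Set (Euc N)) (n : ℕ) : ℝ≥0∞ :=
  ⨅ (A : Submodule ℝ (Euc N → ℝ)) (_ : Module.finrank ℝ A = n ∧
      (∀ u ∈ A, memH1 N Ω u ∧ (∫ x in Ω, u x) = 0) ∧
      (∀ u ∈ A, u =ᵐ[volume.restrict Ω] 0 → u = 0)),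
    ⨆ (u : Euc N → ℝ) (_ : u ∈ A ∧ u ≠ 0), rayleigh1 N Ω u

/-- `μ_n^{(s)}(Ω)` including `μ₀^{(s)}(Ω) := 0`. -/
def muNsFull (N : ℕ) (s : ℝ) (Ω : Set (Euc N)) (n : ℕ) : ℝ≥0∞ :=
  if n = 0 then 0 else muNs N s Ω n

/-- `μ_n^{(1)}(Ω)` including `μ₀^{(1)}(Ω) := 0`. -/
def muN1Full (N : ℕ) (Ω : Set (Euc N)) (n : ℕ) : ℝ≥0∞ :=
  if n = 0 then 0 else muN1 N Ω n

/-- The squared `H^s_{Ω,0}`-seminorm of the `s`-minimal extension of `u`: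
the minimal value of `[v]²` over `v ∈ H^s_{Ω,0}` with `v = u` a.e. in `Ω`. -/
def minExtSemiSq (N : ℕ) (s : ℝ) (Ω : Set (Euc N)) (u : Euc N → ℝ) : ℝ≥0∞ :=
  ⨅ (v : Euc N → ℝ) (_ : memHs N s Ω v ∧ v =ᵐ[volume.restrict Ω] u), semiSq N s Ω v

/-- `ω_{N-1}`: volume of the unit ball of `ℝ^{N-1}`. -/
def omegaPrev (N : ℕ) : ℝ := (volume (Metric.ball (0 : Euc (N - 1)) 1)).toReal

/-- Membership in `L²₀(Ω)`. -/
def memL20 (N : ℕ) (Ω : Set (Euc N)) (u : Euc N → ℝ) : Prop :=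
  Measurable u ∧ l2sq N Ω u < ⊤ ∧ (∫ x in Ω, u x) = 0

/-- The functional `F_s` (value `+∞` outside `H^s(Ω)`). -/
def Fs (N : ℕ) (s : ℝ) (Ω : Set (Euc N)) (u : Euc N → ℝ) : ℝ≥0∞ :=
  ENNReal.ofReal (1 - s) * minExtSemiSq N s Ω u

/-- The functional `F₁` (value `+∞` outside `H¹(Ω)`). -/
def F1 (N : ℕ) (Ω : Set (Euc N)) (u : Euc N → ℝ) : ℝ≥0∞ :=
  ENNReal.ofReal (omegaPrev N / (2 * N)) * gradSq N Ω u

end FracNeumann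

namespace FracNeumann

section

/-- difference function -/
def Df {N : ℕ} (u : Euc N → ℝ) (q : Euc N × Euc N) : ℝ := u q.1 - u q.2

/-- the weighted measure on the region -/
def nu (N : ℕ) (s : ℝ) (Ω : Set (Euc N)) : Measure (Euc N × Euc N) :=
  (volume.restrict (reg N Ω)).withDensity (fun q => ENNReal.ofReal (kern N s q.1 q.2)⁻¹)

variable {N : ℕ} {s : ℝ} {Ω : Set (Euc N)} {u v w : Euc N → ℝ}

lemma measurable_kern : Measurable (fun q : Euc N × Euc N => kern N s q.1 q.2) := by
  unfold kern
  fun_prop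

lemma measurable_kernInv :
    Measurable (fun q : Euc N × Euc N => ENNReal.ofReal (kern N s q.1 q.2)⁻¹) :=
  measurable_kern.inv.ennreal_ofReal

lemma kern_nonneg (x y : Euc N) : 0 ≤ kern N s x y := by
  unfold kern; positivity

lemma kern_symm (x y : Euc N) : kern N s x y = kern N s y x := by
  unfold kern; rw [norm_sub_rev]

lemma measurableSet_reg : MeasurableSet (reg N Ω) := by
  have h : reg N Ω = (Prod.fst ⁻¹' closure Ω) ∪ (Prod.snd ⁻¹' closure Ω) := rfl
  rw [h]
  exact (measurable_fst isClosed_closure.measurableSet).union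
    (measurable_snd isClosed_closure.measurableSet)

lemma measurable_Df (hu : Measurable u) : Measurable (Df u) := by
  unfold Df
  exact (hu.comp measurable_fst).sub (hu.comp measurable_snd)

instance : SigmaFinite (nu N s Ω) := by
  unfold nu
  exact SigmaFinite.withDensity_ofReal (μ := volume.restrict (reg N Ω)) (fun q => (kern N s q.1 q.2)⁻¹)

lemma lintegral_nu {f : Euc N × Euc N → ℝ≥0∞} (hf : Measurable f) :
    ∫⁻ q, f q ∂(nu N s Ω) = ∫⁻ q in reg N Ω, ENNReal.ofReal (kern N s q.1 q.2)⁻¹ * f q := by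
  unfold nu
  rw [lintegral_withDensity_eq_lintegral_mul _ measurable_kernInv hf]
  rfl

lemma integral_nu (f : Euc N × Euc N → ℝ) :
    ∫ q, f q ∂(nu N s Ω) = ∫ q in reg N Ω, f q / kern N s q.1 q.2 := by
  unfold nu
  rw [integral_withDensity_eq_integral_toReal_smul measurable_kernInv
    (by simp)]
  congr 1; ext q
  rw [ENNReal.toReal_ofReal (inv_nonneg.2 (kern_nonneg _ _)), smul_eq_mul, div_eq_inv_mul]

lemma semiSq_eq (hu : Measurable u) :
    semiSq N s Ω u = ∫⁻ q, ENNReal.ofReal (Df u q ^ 2) ∂(nu N s Ω) := by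
  rw [lintegral_nu ((measurable_Df hu).pow_const 2).ennreal_ofReal]
  unfold semiSq
  congr 1; ext q
  rw [← ENNReal.ofReal_mul (inv_nonneg.2 (kern_nonneg _ _)), div_eq_inv_mul]
  rfl

lemma bform_eq : bform N s Ω u v = ∫ q, Df u q * Df v q ∂(nu N s Ω) := by
  rw [integral_nu]; rfl

lemma memLp_two_iff {α : Type*} [MeasurableSpace α] {μ : Measure α} {f : α → ℝ}
    (hf : Measurable f) : MemLp f 2 μ ↔ ∫⁻ x, ENNReal.ofReal (f x ^ 2) ∂μ < ⊤ := by
  rw [memLp_two_iff_integrable_sq hf.aestronglyMeasurable]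
  constructor
  · intro h
    have := h.lintegral_lt_top
    exact this
  · intro h
    refine ⟨(hf.pow_const 2).aestronglyMeasurable, ?_⟩
    rw [hasFiniteIntegral_iff_ofReal (Eventually.of_forall fun x => sq_nonneg _)]
    exact h

lemma memHs_iff : memHs N s Ω u ↔ Measurable u ∧ MemLp u 2 (volume.restrict Ω) ∧
    MemLp (Df u) 2 (nu N s Ω) := by
  unfold memHs
  constructor
  · rintro ⟨h, h1, h2⟩
    exact ⟨h, (memLp_two_iff h).2 h1, (memLp_two_iff (measurable_Df h)).2 (by rwa [← semiSq_eq h])⟩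
  · rintro ⟨h, h1, h2⟩
    exact ⟨h, (memLp_two_iff h).1 h1, by rw [semiSq_eq h]; exact (memLp_two_iff (measurable_Df h)).1 h2⟩

lemma memHs.meas (h : memHs N s Ω u) : Measurable u := h.1
lemma memHs.memLp (h : memHs N s Ω u) : MemLp u 2 (volume.restrict Ω) := (memHs_iff.1 h).2.1
lemma memHs.memDf (h : memHs N s Ω u) : MemLp (Df u) 2 (nu N s Ω) := (memHs_iff.1 h).2.2

lemma Df_add : Df (fun x => u x + v x) = fun q => Df u q + Df v q := by
  ext q; simp only [Df]; ring
lemma Df_sub : Df (fun x => u x - v x) = fun q => Df u q - Df v q := by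
  ext q; simp only [Df]; ring
lemma Df_smul (c : ℝ) : Df (fun x => c * u x) = fun q => c * Df u q := by
  ext q; simp only [Df]; ring
lemma Df_const (c : ℝ) : Df (fun _ : Euc N => c) = fun _ => 0 := by
  ext q; simp only [Df]; ring
lemma Df_add_const (c : ℝ) : Df (fun x => u x + c) = Df u := by
  ext q; simp only [Df]; ring

lemma memHs.add (hu : memHs N s Ω u) (hv : memHs N s Ω v) : memHs N s Ω (fun x => u x + v x) := by
  rw [memHs_iff, Df_add]
  exact ⟨hu.meas.add hv.meas, hu.memLp.add hv.memLp, hu.memDf.add hv.memDf⟩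

lemma memHs.sub (hu : memHs N s Ω u) (hv : memHs N s Ω v) : memHs N s Ω (fun x => u x - v x) := by
  rw [memHs_iff, Df_sub]
  exact ⟨hu.meas.sub hv.meas, hu.memLp.sub hv.memLp, hu.memDf.sub hv.memDf⟩

lemma memHs.smul (hu : memHs N s Ω u) (c : ℝ) : memHs N s Ω (fun x => c * u x) := by
  rw [memHs_iff, Df_smul]
  exact ⟨hu.meas.const_mul c, hu.memLp.const_mul c, hu.memDf.const_mul c⟩

lemma memHs_const (hΩ : volume Ω ≠ ⊤) (c : ℝ) : memHs N s Ω (fun _ => c) := by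
  rw [memHs_iff, Df_const]
  have : IsFiniteMeasure (volume.restrict Ω) := ⟨by simpa using hΩ.lt_top⟩
  exact ⟨measurable_const, memLp_const c, MemLp.zero⟩

lemma memHs_zero : memHs N s Ω (fun _ => 0) := by
  rw [memHs_iff, Df_const]
  exact ⟨measurable_const, MemLp.zero, MemLp.zero⟩

/-- contraction -/
lemma memHs.of_le (hu : memHs N s Ω u) (hw : Measurable w) (h1 : ∀ x, |w x| ≤ |u x|)
    (h2 : ∀ x y, |w x - w y| ≤ |u x - u y|) : memHs N s Ω w := by
  rw [memHs_iff]
  exact ⟨hw, hu.memLp.mono hw.aestronglyMeasurable (Eventually.of_forall fun x => by simpa using h1 x),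
    hu.memDf.mono (measurable_Df hw).aestronglyMeasurable
      (Eventually.of_forall fun q => by simpa [Df] using h2 q.1 q.2)⟩

lemma memHs.pos (hu : memHs N s Ω u) : memHs N s Ω (fun x => max (u x) 0) := by
  refine hu.of_le (hu.meas.max measurable_const) (fun x => ?_) (fun x y => ?_)
  · rw [abs_of_nonneg (le_max_right _ _)]
    exact max_le (le_abs_self _) (abs_nonneg _)
  · exact abs_max_sub_max_le_abs _ _ _

lemma memHs.integrable_mul (hu : memHs N s Ω u) (hv : memHs N s Ω v) :
    Integrable (fun x => u x * v x) (volume.restrict Ω) := hu.memLp.integrable_mul hv.memLp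

lemma memHs.integrable_sq (hu : memHs N s Ω u) :
    Integrable (fun x => u x ^ 2) (volume.restrict Ω) := hu.memLp.integrable_sq

lemma memHs.integrable (hΩ : volume Ω ≠ ⊤) (hu : memHs N s Ω u) :
    Integrable u (volume.restrict Ω) := by
  have : IsFiniteMeasure (volume.restrict Ω) := ⟨by simpa using hΩ.lt_top⟩
  exact hu.memLp.integrable (by norm_num)

lemma memHs.integrable_Df (hu : memHs N s Ω u) (hv : memHs N s Ω v) :
    Integrable (fun q => Df u q * Df v q) (nu N s Ω) := hu.memDf.integrable_mul hv.memDf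

lemma bform_symm : bform N s Ω u v = bform N s Ω v u := by
  rw [bform_eq, bform_eq]; congr 1; ext q; ring

lemma bform_add_left (hu : memHs N s Ω u) (hv : memHs N s Ω v) (hw : memHs N s Ω w) :
    bform N s Ω (fun x => u x + v x) w = bform N s Ω u w + bform N s Ω v w := by
  rw [bform_eq, bform_eq, bform_eq, ← integral_add (hu.integrable_Df hw) (hv.integrable_Df hw), Df_add]
  congr 1; ext q; ring

lemma bform_sub_left (hu : memHs N s Ω u) (hv : memHs N s Ω v) (hw : memHs N s Ω w) :
    bform N s Ω (fun x => u x - v x) w = bform N s Ω u w - bform N s Ω v w := by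
  rw [bform_eq, bform_eq, bform_eq, ← integral_sub (hu.integrable_Df hw) (hv.integrable_Df hw), Df_sub]
  congr 1; ext q; ring

lemma bform_smul_left (c : ℝ) :
    bform N s Ω (fun x => c * u x) w = c * bform N s Ω u w := by
  rw [bform_eq, bform_eq, ← integral_const_mul, Df_smul]
  congr 1; ext q; ring

lemma bform_add_right (hu : memHs N s Ω u) (hv : memHs N s Ω v) (hw : memHs N s Ω w) :
    bform N s Ω w (fun x => u x + v x) = bform N s Ω w u + bform N s Ω w v := by
  rw [bform_symm, bform_add_left hu hv hw, bform_symm, bform_symm (v := w)]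

lemma bform_sub_right (hu : memHs N s Ω u) (hv : memHs N s Ω v) (hw : memHs N s Ω w) :
    bform N s Ω w (fun x => u x - v x) = bform N s Ω w u - bform N s Ω w v := by
  rw [bform_symm, bform_sub_left hu hv hw, bform_symm, bform_symm (v := w)]

lemma bform_smul_right (c : ℝ) :
    bform N s Ω w (fun x => c * u x) = c * bform N s Ω w u := by
  rw [bform_symm, bform_smul_left, bform_symm]

lemma bform_const_right (c : ℝ) : bform N s Ω u (fun _ => c) = 0 := by
  rw [bform_eq, Df_const]; simp

lemma bform_add_const_right (c : ℝ) : bform N s Ω u (fun x => v x + c) = bform N s Ω u v := by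
  rw [bform_eq, bform_eq, Df_add_const]

lemma bform_self_nonneg : 0 ≤ bform N s Ω u u := by
  rw [bform_eq]; exact integral_nonneg fun q => mul_self_nonneg _

lemma semiSq_toReal (hu : Measurable u) : (semiSq N s Ω u).toReal = bform N s Ω u u := by
  rw [semiSq_eq hu, bform_eq, integral_eq_lintegral_of_nonneg_ae]
  · congr 2; ext q; congr 1; ring
  · exact Eventually.of_forall fun q => mul_self_nonneg _
  · exact ((measurable_Df hu).mul (measurable_Df hu)).aestronglyMeasurable

lemma bform_add_self (hu : memHs N s Ω u) (hv : memHs N s Ω v) :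
    bform N s Ω (fun x => u x + v x) (fun x => u x + v x)
      = bform N s Ω u u + 2 * bform N s Ω u v + bform N s Ω v v := by
  rw [bform_add_left hu hv (hu.add hv), bform_add_right hu hv hu, bform_add_right hu hv hv,
    bform_symm (u := v) (v := u)]; ring

lemma bform_sub_self (hu : memHs N s Ω u) (hv : memHs N s Ω v) :
    bform N s Ω (fun x => u x - v x) (fun x => u x - v x)
      = bform N s Ω u u - 2 * bform N s Ω u v + bform N s Ω v v := by
  rw [bform_sub_left hu hv (hu.sub hv), bform_sub_right hu hv hu, bform_sub_right hu hv hv,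
    bform_symm (u := v) (v := u)]; ring

lemma nu_ac : nu N s Ω ≪ (volume : Measure (Euc N × Euc N)) := by
  unfold nu
  exact (withDensity_absolutelyContinuous _ _).trans Measure.restrict_le_self.absolutelyContinuous

lemma Df_congr_ae (h : u =ᵐ[volume] v) : Df u =ᵐ[nu N s Ω] Df v := by
  apply nu_ac.ae_le
  have h1 : ∀ᵐ q : Euc N × Euc N, u q.1 = v q.1 := Measure.quasiMeasurePreserving_fst.ae h
  have h2 : ∀ᵐ q : Euc N × Euc N, u q.2 = v q.2 := Measure.quasiMeasurePreserving_snd.ae h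
  filter_upwards [h1, h2] with q a b
  simp [Df, a, b]

lemma memHs.congr_ae (hu : memHs N s Ω u) (hv : Measurable v) (h : u =ᵐ[volume] v) :
    memHs N s Ω v := by
  rw [memHs_iff]
  exact ⟨hv, hu.memLp.ae_eq (ae_restrict_of_ae h), hu.memDf.ae_eq (Df_congr_ae h)⟩

lemma bform_congr_ae {u' v' : Euc N → ℝ} (h : u =ᵐ[volume] u') (h' : v =ᵐ[volume] v') :
    bform N s Ω u v = bform N s Ω u' v' := by
  rw [bform_eq, bform_eq]
  apply integral_congr_ae
  filter_upwards [Df_congr_ae (s := s) (Ω := Ω) h, Df_congr_ae (s := s) (Ω := Ω) h'] with q a b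
  rw [a, b]

lemma kern_pos {x y : Euc N} (h : x ≠ y) : 0 < kern N s x y := by
  unfold kern
  exact Real.rpow_pos_of_pos (norm_pos_iff.2 (sub_ne_zero.2 h)) _

/-- a.e. with respect to nu gives a.e. in the region -/
lemma ae_diag [NeZero N] : ∀ᵐ q : Euc N × Euc N, q.1 ≠ q.2 := by
  have hm : MeasurableSet {q : Euc N × Euc N | q.1 ≠ q.2} :=
    (measurableSet_eq_fun measurable_fst measurable_snd).compl
  refine (Measure.ae_prod_iff_ae_ae hm).2 (Eventually.of_forall fun x => ?_)
  have : (volume : Measure (Euc N)) {x} = 0 := measure_singleton x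
  filter_upwards [compl_mem_ae_iff.2 this] with y hy
  intro h; exact hy (by simp [h])

lemma ae_of_ae_nu [NeZero N] {p : Euc N × Euc N → Prop} (h : ∀ᵐ q ∂(nu N s Ω), p q) :
    ∀ᵐ q : Euc N × Euc N, q ∈ reg N Ω → p q := by
  unfold nu at h
  rw [ae_withDensity_iff measurable_kernInv, ae_restrict_iff' measurableSet_reg] at h
  filter_upwards [h, ae_diag] with q h1 h2 h3
  refine h1 h3 ?_
  simp [kern_pos h2]

end

section

variable {N : ℕ} {s : ℝ} {Ω : Set (Euc N)} {u v w : Euc N → ℝ}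

/-- elements of the first eigenspace (zero allowed) -/
def IsEig (N : ℕ) (s : ℝ) (Ω : Set (Euc N)) (u : Euc N → ℝ) : Prop :=
  memHs N s Ω u ∧ (∫ x in Ω, u x) = 0 ∧ ∀ v : Euc N → ℝ, memHs N s Ω v →
      cNs N s / 2 * bform N s Ω u v = mu1 N s Ω * ∫ x in Ω, u x * v x

lemma cNs_pos (hs : s ∈ Ioo (0 : ℝ) 1) : 0 < cNs N s := by
  have h1 := hs.1
  have h2 := hs.2
  have a : 0 < Real.Gamma ((N : ℝ) / 2 + s) := Real.Gamma_pos_of_pos (by positivity)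
  have b : 0 < Real.Gamma (1 - s) := Real.Gamma_pos_of_pos (by linarith)
  unfold cNs
  positivity

lemma mu1_set_bdd (hs : s ∈ Ioo (0 : ℝ) 1) : BddBelow {t : ℝ | ∃ u : Euc N → ℝ, memHs N s Ω u ∧ (∫ x in Ω, (u x) ^ 2) = 1 ∧
    (∫ x in Ω, u x) = 0 ∧ t = cNs N s / 2 * (semiSq N s Ω u).toReal} := by
  refine ⟨0, ?_⟩
  rintro t ⟨u, -, -, -, rfl⟩
  have := cNs_pos (N := N) hs
  positivity

lemma mu1_nonneg (hs : s ∈ Ioo (0 : ℝ) 1) : 0 ≤ mu1 N s Ω := by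
  apply Real.sInf_nonneg
  rintro t ⟨u, -, -, -, rfl⟩
  have := cNs_pos (N := N) hs
  positivity

lemma rayleigh (hs : s ∈ Ioo (0 : ℝ) 1) (hu : memHs N s Ω u) (h0 : ∫ x in Ω, u x = 0) :
    mu1 N s Ω * ∫ x in Ω, u x ^ 2 ≤ cNs N s / 2 * bform N s Ω u u := by
  have hc := cNs_pos (N := N) hs
  rcases (integral_nonneg (μ := volume.restrict Ω) (f := fun x => u x ^ 2)
    (fun x => sq_nonneg _)).eq_or_lt with h | h
  · rw [← h, mul_zero]
    exact mul_nonneg (by positivity) bform_self_nonneg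
  · set T := ∫ x in Ω, u x ^ 2 with hT
    have hT' : 0 < T := h
    set c := (√T)⁻¹ with hcdef
    have hc2 : c ^ 2 * T = 1 := by
      rw [hcdef, inv_pow, Real.sq_sqrt hT'.le]; field_simp
    have key : mu1 N s Ω ≤ cNs N s / 2 * bform N s Ω (fun x => c * u x) (fun x => c * u x) := by
      refine csInf_le (mu1_set_bdd hs) ⟨fun x => c * u x, hu.smul c, ?_, ?_, ?_⟩
      · simp only [mul_pow]; rw [integral_const_mul]; exact hc2
      · rw [integral_const_mul, h0, mul_zero]
      · rw [semiSq_toReal (hu.smul c).meas]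
    rw [bform_smul_left, bform_smul_right] at key
    calc mu1 N s Ω * T ≤ cNs N s / 2 * (c * (c * bform N s Ω u u)) * T := by gcongr
      _ = cNs N s / 2 * bform N s Ω u u * (c ^ 2 * T) := by ring
      _ = _ := by rw [hc2, mul_one]

lemma lin_zero {a b : ℝ} (h : ∀ t : ℝ, 0 ≤ 2 * t * a + t ^ 2 * b) : a = 0 := by
  by_contra ha
  have hb : 0 < |b| + 1 := by positivity
  have := h (-a / (|b| + 1))
  have e : 2 * (-a / (|b| + 1)) * a + (-a / (|b| + 1)) ^ 2 * b
      = a ^ 2 / (|b| + 1) ^ 2 * (b - 2 * (|b| + 1)) := by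
    field_simp
    ring
  rw [e] at this
  have h1 : 0 < a ^ 2 / (|b| + 1) ^ 2 := by positivity
  have h2 : b - 2 * (|b| + 1) < 0 := by
    have := le_abs_self b
    have := abs_nonneg b
    linarith
  nlinarith

lemma isEig_of_min (hΩ : volume Ω ≠ ⊤) (hΩ0 : volume Ω ≠ 0) (hs : s ∈ Ioo (0 : ℝ) 1) (hu : memHs N s Ω u)
    (h0 : ∫ x in Ω, u x = 0)
    (hm : cNs N s / 2 * bform N s Ω u u ≤ mu1 N s Ω * ∫ x in Ω, u x ^ 2) : IsEig N s Ω u := by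
  refine ⟨hu, h0, ?_⟩
  have key : ∀ v, memHs N s Ω v → (∫ x in Ω, v x = 0) →
      cNs N s / 2 * bform N s Ω u v = mu1 N s Ω * ∫ x in Ω, u x * v x := by
    intro v hv hv0
    have h : cNs N s / 2 * bform N s Ω u v - mu1 N s Ω * ∫ x in Ω, u x * v x = 0 := by
      apply lin_zero (b := cNs N s / 2 * bform N s Ω v v - mu1 N s Ω * ∫ x in Ω, v x ^ 2)
      intro t
      have r := rayleigh hs (hu.add (hv.smul t)) (by
        rw [integral_add (hu.integrable hΩ) ((hv.integrable hΩ).const_mul t), integral_const_mul,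
          h0, hv0]; simp)
      rw [bform_add_self hu (hv.smul t), bform_smul_left, bform_smul_right, bform_smul_right] at r
      have e : ∫ x in Ω, (u x + t * v x) ^ 2 = (∫ x in Ω, u x ^ 2) + 2 * t * (∫ x in Ω, u x * v x)
          + t ^ 2 * ∫ x in Ω, v x ^ 2 := by
        rw [← integral_const_mul, ← integral_const_mul, ← integral_add, ← integral_add]
        · congr 1; ext x; ring
        · exact hu.integrable_sq.add ((hu.integrable_mul hv).const_mul _)
        · exact hv.integrable_sq.const_mul _
        · exact hu.integrable_sq
        · exact (hu.integrable_mul hv).const_mul _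
      rw [e] at r
      nlinarith
    linarith
  intro v hv
  set m := (∫ x in Ω, v x) / volume.real Ω with hmdef
  have hvol : volume.real Ω ≠ 0 := by
    simp [Measure.real, ENNReal.toReal_eq_zero_iff, hΩ, hΩ0]
  have hIntg0 : ∫ x in Ω, (v x + -m) = 0 := by
    rw [integral_add (hv.integrable hΩ) ((memHs_const (s := s) hΩ _).integrable hΩ)]
    simp [hmdef]
    field_simp
    ring
  have k := key _ (hv.add (memHs_const hΩ (-m))) hIntg0
  rw [bform_add_const_right] at k
  rw [k]
  congr 1
  simp only [mul_add]
  rw [integral_add (hu.integrable_mul hv) ((hu.integrable hΩ).mul_const _), integral_mul_const, h0]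
  simp

lemma IsEig.mem (h : IsEig N s Ω u) : memHs N s Ω u := h.1
lemma IsEig.mean (h : IsEig N s Ω u) : ∫ x in Ω, u x = 0 := h.2.1
lemma IsEig.weak (h : IsEig N s Ω u) (hv : memHs N s Ω v) :
  cNs N s / 2 * bform N s Ω u v = mu1 N s Ω * ∫ x in Ω, u x * v x := h.2.2 v hv

/-- `2 μ / c` -/
def lam (N : ℕ) (s : ℝ) (Ω : Set (Euc N)) : ℝ := mu1 N s Ω / (cNs N s / 2)

lemma lam_nonneg (hs : s ∈ Ioo (0 : ℝ) 1) : 0 ≤ lam N s Ω :=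
  div_nonneg (mu1_nonneg hs) (by have := cNs_pos (N := N) hs; positivity)

lemma IsEig.weak' (hs : s ∈ Ioo (0 : ℝ) 1) (h : IsEig N s Ω u) (hv : memHs N s Ω v) :
    bform N s Ω u v = lam N s Ω * ∫ x in Ω, u x * v x := by
  have hc := cNs_pos (N := N) hs
  have := h.weak hv
  unfold lam
  field_simp
  linarith

lemma rayleigh' (hs : s ∈ Ioo (0 : ℝ) 1) (hu : memHs N s Ω u) (h0 : ∫ x in Ω, u x = 0) :
    lam N s Ω * ∫ x in Ω, u x ^ 2 ≤ bform N s Ω u u := by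
  have hc := cNs_pos (N := N) hs
  have := rayleigh hs hu h0
  unfold lam
  rw [div_mul_eq_mul_div, div_le_iff₀ (by positivity)]
  linarith

lemma IsEig.add (hΩ : volume Ω ≠ ⊤) (hu : IsEig N s Ω u) (hv : IsEig N s Ω v) :
    IsEig N s Ω (fun x => u x + v x) := by
  refine ⟨hu.mem.add hv.mem, ?_, fun w hw => ?_⟩
  · rw [integral_add (hu.mem.integrable hΩ) (hv.mem.integrable hΩ), hu.mean, hv.mean, add_zero]
  · rw [bform_add_left hu.mem hv.mem hw, mul_add, hu.weak hw, hv.weak hw, ← mul_add,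
      ← integral_add (hu.mem.integrable_mul hw) (hv.mem.integrable_mul hw)]
    congr 2; ext x; ring

lemma IsEig.smul (hu : IsEig N s Ω u) (c : ℝ) :
    IsEig N s Ω (fun x => c * u x) := by
  refine ⟨hu.mem.smul c, ?_, fun w hw => ?_⟩
  · rw [integral_const_mul, hu.mean, mul_zero]
  · rw [bform_smul_left, mul_left_comm, hu.weak hw, mul_left_comm, ← integral_const_mul]
    congr 2; ext x; ring

lemma IsEig.sub (hΩ : volume Ω ≠ ⊤) (hu : IsEig N s Ω u) (hv : IsEig N s Ω v) :
    IsEig N s Ω (fun x => u x - v x) := by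
  have := hu.add hΩ (hv.smul (-1))
  simpa [sub_eq_add_neg] using this

lemma isEig_zero : IsEig N s Ω (fun _ => 0) := by
  refine ⟨memHs_zero, by simp, fun w hw => ?_⟩
  rw [bform_symm, bform_const_right]; simp

lemma IsEig.sum {ι : Type*} (hΩ : volume Ω ≠ ⊤) (S : Finset ι) {f : ι → Euc N → ℝ} (h : ∀ i, IsEig N s Ω (f i)) :
    IsEig N s Ω (fun x => ∑ i ∈ S, f i x) := by
  classical
  induction S using Finset.induction_on with
  | empty => simpa using isEig_zero
  | insert a S ha ih => simpa [Finset.sum_insert ha] using (h a).add hΩ ih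

lemma IsEig.congr_ae (hu : IsEig N s Ω u) (hv : Measurable v) (h : u =ᵐ[volume] v) :
    IsEig N s Ω v := by
  refine ⟨hu.mem.congr_ae hv h, ?_, fun w hw => ?_⟩
  · rw [← hu.mean]; exact integral_congr_ae (ae_restrict_of_ae h.symm)
  · rw [← bform_congr_ae h (ae_eq_refl w), hu.weak hw]
    congr 1
    apply integral_congr_ae
    filter_upwards [ae_restrict_of_ae h] with x hx
    rw [hx]

lemma isFirstEigen_iff : IsFirstEigen N s Ω u ↔ IsEig N s Ω u ∧ ¬ (u =ᵐ[volume.restrict Ω] 0) := by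
  unfold IsFirstEigen IsEig; tauto

/-- zero in Ω implies zero -/
lemma IsEig.eq_zero_of [NeZero N] (hs : s ∈ Ioo (0 : ℝ) 1) (hΩ0 : volume Ω ≠ 0) (hu : IsEig N s Ω u)
    (h : u =ᵐ[volume.restrict Ω] 0) (hm : MeasurableSet Ω) : u =ᵐ[volume] 0 := by
  have hb : bform N s Ω u u = 0 := by
    rw [hu.weak' hs hu.mem]
    have : ∫ x in Ω, u x * u x = 0 := by
      rw [← integral_zero (Euc N) ℝ (μ := volume.restrict Ω)]
      apply integral_congr_ae
      filter_upwards [h] with x hx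
      simp [hx]
    rw [this, mul_zero]
  rw [bform_eq, integral_eq_zero_iff_of_nonneg (fun q => mul_self_nonneg _)
    (hu.mem.integrable_Df hu.mem)] at hb
  have h2 : ∀ᵐ q : Euc N × Euc N, q ∈ reg N Ω → Df u q * Df u q = 0 := ae_of_ae_nu hb
  have h3 : ∀ᵐ x : Euc N, ∀ᵐ y : Euc N, (x, y) ∈ reg N Ω → Df u (x, y) * Df u (x, y) = 0 :=
    Measure.ae_ae_of_ae_prod h2
  have h4 : ∀ᵐ x : Euc N, x ∈ Ω → u x = 0 := (ae_restrict_iff' hm).1 h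
  have : ∃ x, x ∈ Ω ∧ ((∀ᵐ y : Euc N, (x, y) ∈ reg N Ω → Df u (x, y) * Df u (x, y) = 0) ∧ (x ∈ Ω → u x = 0)) := by
    by_contra hc
    push Not at hc
    apply hΩ0
    have : ∀ᵐ x : Euc N, x ∉ Ω := by
      filter_upwards [h3, h4] with x a b hx
      exact (hc x hx a).2 (b hx)
    simpa [ae_iff] using this
  obtain ⟨x, hx, h5, h6⟩ := this
  filter_upwards [h5] with y hy
  have := hy (Or.inl (subset_closure hx))
  simp only [Df, mul_self_eq_zero, h6 hx] at this
  simp only [Pi.zero_apply]; linarith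

/-! isometries -/

lemma nu_mp {Ω : Set (Euc N)} (Q : Euc N ≃ₗᵢ[ℝ] Euc N) (hQ : ∀ x, Q x ∈ closure Ω ↔ x ∈ closure Ω) :
    MeasurePreserving (Prod.map Q Q) (nu N s Ω) (nu N s Ω) := by
  have hP : MeasurePreserving (Prod.map Q Q) (volume : Measure (Euc N × Euc N)) volume :=
    Q.measurePreserving.prod Q.measurePreserving
  have hPm : Measurable (Prod.map Q Q) := hP.measurable
  refine ⟨hPm, ?_⟩
  ext A hA
  rw [Measure.map_apply hPm hA]
  unfold nu
  rw [withDensity_apply _ (hPm hA), withDensity_apply _ hA, Measure.restrict_restrict hA,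
    Measure.restrict_restrict (hPm hA)]
  have e : (Prod.map Q Q) ⁻¹' A ∩ reg N Ω = (Prod.map Q Q) ⁻¹' (A ∩ reg N Ω) := by
    ext q; simp [reg, hQ]
  rw [e, ← hP.setLIntegral_comp_preimage (hA.inter measurableSet_reg) measurable_kernInv]
  congr 1; ext q
  simp [kern, ← map_sub]

lemma nu_swap {Ω : Set (Euc N)} :
    MeasurePreserving (Prod.swap) (nu N s Ω) (nu N s Ω) := by
  have hP : MeasurePreserving (Prod.swap) (volume : Measure (Euc N × Euc N)) volume :=
    Measure.measurePreserving_swap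
  have hPm : Measurable (Prod.swap : Euc N × Euc N → _) := hP.measurable
  refine ⟨hPm, ?_⟩
  ext A hA
  rw [Measure.map_apply hPm hA]
  unfold nu
  rw [withDensity_apply _ (hPm hA), withDensity_apply _ hA, Measure.restrict_restrict hA,
    Measure.restrict_restrict (hPm hA)]
  have e : (Prod.swap) ⁻¹' A ∩ reg N Ω = (Prod.swap) ⁻¹' (A ∩ reg N Ω) := by
    ext q; simp [reg, or_comm]
  rw [e, ← hP.setLIntegral_comp_preimage (hA.inter measurableSet_reg) measurable_kernInv]
  congr 1; ext q
  simp [kern_symm]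

end

section

variable {N : ℕ} {s : ℝ} {Ω : Set (Euc N)} {u v w : Euc N → ℝ}

/-- the kernel -/
def Kf (N : ℕ) (s : ℝ) (h : Euc N) : ℝ := (‖h‖ ^ ((N : ℝ) + 2 * s))⁻¹

lemma Kf_nonneg (h : Euc N) : 0 ≤ Kf N s h := by unfold Kf; positivity
lemma Kf_pos {h : Euc N} (hh : h ≠ 0) : 0 < Kf N s h := by
  unfold Kf; have := norm_pos_iff.2 hh; positivity
lemma measurable_Kf : Measurable (Kf N s) := by unfold Kf; fun_prop
lemma kern_inv (x y : Euc N) : (kern N s x y)⁻¹ = Kf N s (x - y) := rfl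
lemma Kf_neg (h : Euc N) : Kf N s (-h) = Kf N s h := by simp [Kf]
lemma Kf_sub_comm (x y : Euc N) : Kf N s (x - y) = Kf N s (y - x) := by
  rw [← Kf_neg, neg_sub]
lemma Kf_antitone (hs : 0 < s) {h h' : Euc N} (h0 : h ≠ 0) (hh : ‖h‖ ≤ ‖h'‖) :
    Kf N s h' ≤ Kf N s h := by
  unfold Kf
  have := norm_pos_iff.2 h0
  gcongr
lemma Kf_le_of_le (hs : 0 < s) {h : Euc N} {r : ℝ} (hr : 0 < r) (hh : r ≤ ‖h‖) :
    Kf N s h ≤ (r ^ ((N : ℝ) + 2 * s))⁻¹ := by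
  unfold Kf
  gcongr
lemma Kf_ge_of_le (hs : 0 < s) {h : Euc N} {r : ℝ} (h0 : h ≠ 0) (hh : ‖h‖ ≤ r) :
    (r ^ ((N : ℝ) + 2 * s))⁻¹ ≤ Kf N s h := by
  unfold Kf
  have := norm_pos_iff.2 h0
  gcongr

/-- volume of unit ball -/
def om (N : ℕ) : ℝ := volume.real (Metric.ball (0 : Euc N) 1)

lemma om_pos [NeZero N] : 0 < om N := by
  unfold om
  exact ENNReal.toReal_pos (Metric.measure_ball_pos _ _ one_pos).ne' measure_ball_lt_top.ne

instance [NeZero N] : Nontrivial (Euc N) := by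
  refine ⟨0, EuclideanSpace.single 0 1, fun h => ?_⟩
  have := congrArg (fun x : Euc N => x 0) h
  simp at this

lemma Kf_tail_aux [NeZero N] {t : ℝ} (ht : 0 < t) :
    t ^ (N - 1) * (t ^ ((N : ℝ) + 2 * s))⁻¹ = t ^ (-1 - 2 * s) := by
  have h1 : 1 ≤ N := NeZero.one_le
  rw [← Real.rpow_natCast, ← Real.rpow_neg ht.le, ← Real.rpow_add ht]
  congr 1
  push_cast [h1]
  ring

lemma measurableSet_tail (r : ℝ) : MeasurableSet {h : Euc N | r ≤ ‖h‖} :=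
  measurableSet_le measurable_const measurable_norm

lemma Kf_tail_integrableOn [NeZero N] (hs : 0 < s) {r : ℝ} (hr : 0 < r) :
    IntegrableOn (Kf N s) {h | r ≤ ‖h‖} := by
  rw [← integrable_indicator_iff (measurableSet_tail r)]
  have e : {h : Euc N | r ≤ ‖h‖}.indicator (Kf N s)
      = fun h => (Ici r).indicator (fun t : ℝ => (t ^ ((N : ℝ) + 2 * s))⁻¹) ‖h‖ := by
    ext h; simp [indicator, Kf]
  rw [e, integrable_fun_norm_addHaar volume
    (f := (Ici r).indicator (fun t : ℝ => (t ^ ((N : ℝ) + 2 * s))⁻¹))]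
  simp only [finrank_euclideanSpace, Fintype.card_fin, smul_eq_mul]
  have h2 : IntegrableOn (fun t : ℝ => t ^ (-1 - 2 * s)) (Ioi (r / 2)) :=
    integrableOn_Ioi_rpow_of_lt (by linarith) (by linarith)
  have h3 : IntegrableOn (fun t : ℝ => t ^ (-1 - 2 * s)) (Ici r) :=
    h2.mono_set (fun t ht => by simp at *; linarith)
  rw [← integrable_indicator_iff measurableSet_Ici] at h3
  refine h3.integrableOn.congr_fun (fun t ht => ?_) measurableSet_Ioi
  by_cases h : r ≤ t
  · simp [indicator, h, Kf_tail_aux (s := s) (N := N) (show 0 < t from ht)]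
  · simp [indicator, h]

lemma Kf_tail_integral [NeZero N] (hs : 0 < s) {r : ℝ} (hr : 0 < r) :
    ∫ h in {h | r ≤ ‖h‖}, Kf N s h = N * om N * (r ^ (-2 * s) / (2 * s)) := by
  rw [← integral_indicator (measurableSet_tail r)]
  have e : {h : Euc N | r ≤ ‖h‖}.indicator (Kf N s)
      = fun h => (Ici r).indicator (fun t : ℝ => (t ^ ((N : ℝ) + 2 * s))⁻¹) ‖h‖ := by
    ext h; simp [indicator, Kf]
  rw [e, integral_fun_norm_addHaar volume
    ((Ici r).indicator (fun t : ℝ => (t ^ ((N : ℝ) + 2 * s))⁻¹))]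
  simp only [finrank_euclideanSpace, Fintype.card_fin, smul_eq_mul, nsmul_eq_mul]
  have : ∫ t in Ioi (0 : ℝ), t ^ (N - 1) * (Ici r).indicator (fun t : ℝ => (t ^ ((N : ℝ) + 2 * s))⁻¹) t
      = r ^ (-2 * s) / (2 * s) := by
    have h1 : ∫ t in Ioi (0 : ℝ), t ^ (N - 1) * (Ici r).indicator (fun t : ℝ => (t ^ ((N : ℝ) + 2 * s))⁻¹) t
      = ∫ t in Ioi (0 : ℝ), (Ici r).indicator (fun t : ℝ => t ^ (-1 - 2 * s)) t := by
      refine setIntegral_congr_fun measurableSet_Ioi (fun t ht => ?_)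
      by_cases h : r ≤ t
      · simp [indicator, h, Kf_tail_aux (s := s) (N := N) (show 0 < t from ht)]
      · simp [indicator, h]
    rw [h1, setIntegral_indicator measurableSet_Ici]
    have h2 : Ioi (0 : ℝ) ∩ Ici r = Ici r := by
      ext t; simp; intro; linarith
    rw [h2, integral_Ici_eq_integral_Ioi, integral_Ioi_rpow_of_lt (by linarith) hr]
    have : (-1 - 2 * s + 1) = -2 * s := by ring
    rw [this]; field_simp
  rw [this]
  unfold om; ring

lemma Kf_sq_aux [NeZero N] {t : ℝ} (ht : 0 < t) :
    t ^ (N - 1) * (t ^ 2 * (t ^ ((N : ℝ) + 2 * s))⁻¹) = t ^ (1 - 2 * s) := by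
  rw [mul_left_comm, Kf_tail_aux ht, ← Real.rpow_natCast, ← Real.rpow_add ht]
  congr 1
  push_cast
  ring

lemma Kf_sq_integrableOn [NeZero N] (hs : s < 1) (r : ℝ) :
    IntegrableOn (fun h => ‖h‖ ^ 2 * Kf N s h) (Metric.ball 0 r) := by
  unfold Kf
  rw [integrableOn_fun_norm_addHaar volume (f := fun t : ℝ => t ^ 2 * (t ^ ((N : ℝ) + 2 * s))⁻¹)]
  simp only [finrank_euclideanSpace, Fintype.card_fin, smul_eq_mul]
  rcases le_or_gt r 0 with hr | hr
  · simp [Ioo_eq_empty_of_le hr]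
  have h2 : IntegrableOn (fun t : ℝ => t ^ (1 - 2 * s)) (Ioo 0 r) :=
    (intervalIntegral.integrableOn_Ioo_rpow_iff hr).2 (by linarith)
  exact h2.congr_fun (fun t ht => (Kf_sq_aux (s := s) (N := N) ht.1).symm) measurableSet_Ioo

lemma Kf_sq_integral [NeZero N] (hs : s < 1) {r : ℝ} (hr : 0 < r) :
    ∫ h in Metric.ball 0 r, ‖h‖ ^ 2 * Kf N s h = N * om N * (r ^ (2 - 2 * s) / (2 - 2 * s)) := by
  rw [← integral_indicator measurableSet_ball]
  have e : (Metric.ball (0 : Euc N) r).indicator (fun h => ‖h‖ ^ 2 * Kf N s h)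
      = fun h => (Iio r).indicator (fun t : ℝ => t ^ 2 * (t ^ ((N : ℝ) + 2 * s))⁻¹) ‖h‖ := by
    ext h; simp [indicator, Kf]
  rw [e, integral_fun_norm_addHaar volume
    ((Iio r).indicator (fun t : ℝ => t ^ 2 * (t ^ ((N : ℝ) + 2 * s))⁻¹))]
  simp only [finrank_euclideanSpace, Fintype.card_fin, smul_eq_mul, nsmul_eq_mul]
  have : ∫ t in Ioi (0 : ℝ), t ^ (N - 1) * (Iio r).indicator (fun t : ℝ => t ^ 2 * (t ^ ((N : ℝ) + 2 * s))⁻¹) t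
      = r ^ (2 - 2 * s) / (2 - 2 * s) := by
    have h1 : ∫ t in Ioi (0 : ℝ), t ^ (N - 1) * (Iio r).indicator (fun t : ℝ => t ^ 2 * (t ^ ((N : ℝ) + 2 * s))⁻¹) t
      = ∫ t in Ioi (0 : ℝ), (Iio r).indicator (fun t : ℝ => t ^ (1 - 2 * s)) t := by
      refine setIntegral_congr_fun measurableSet_Ioi (fun t ht => ?_)
      by_cases h : t < r
      · simp [indicator, h, Kf_sq_aux (s := s) (N := N) (show 0 < t from ht)]
      · simp [indicator, h]
    rw [h1, setIntegral_indicator measurableSet_Iio]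
    have h2 : Ioi (0 : ℝ) ∩ Iio r = Ioo 0 r := rfl
    rw [h2, ← integral_Ioc_eq_integral_Ioo, ← intervalIntegral.integral_of_le hr.le,
      integral_rpow (Or.inl (by linarith))]
    have : (1 - 2 * s + 1) = 2 - 2 * s := by ring
    rw [this, Real.zero_rpow (by linarith), sub_zero]
  rw [this]
  unfold om; ring

/-! Region inequality -/

lemma reg_eq : reg N Ω = (closure Ω ×ˢ univ) ∪ (univ ×ˢ closure Ω) := by
  ext q; simp [reg]

lemma lintegral_left {A : Set (Euc N)} {F : Euc N × Euc N → ℝ≥0∞} (hF : Measurable F) :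
    ∫⁻ q in A ×ˢ univ, F q = ∫⁻ x in A, ∫⁻ y, F (x, y) := by
  rw [Measure.volume_eq_prod, ← Measure.prod_restrict, Measure.restrict_univ,
    lintegral_prod _ hF.aemeasurable]

lemma lintegral_right {A : Set (Euc N)} {F : Euc N × Euc N → ℝ≥0∞} (hF : Measurable F) :
    ∫⁻ q in univ ×ˢ A, F q = ∫⁻ y in A, ∫⁻ x, F (x, y) := by
  rw [Measure.volume_eq_prod, ← Measure.prod_restrict, Measure.restrict_univ,
    lintegral_prod_symm _ hF.aemeasurable]

lemma lintegral_nu_le {F : Euc N × Euc N → ℝ≥0∞} (hF : Measurable F) :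
    ∫⁻ q, F q ∂(nu N s Ω) ≤ (∫⁻ x in closure Ω, ∫⁻ y, F (x, y) * ENNReal.ofReal (Kf N s (x - y))) +
      ∫⁻ y in closure Ω, ∫⁻ x, F (x, y) * ENNReal.ofReal (Kf N s (x - y)) := by
  have hm : Measurable fun q : Euc N × Euc N => F q * ENNReal.ofReal (Kf N s (q.1 - q.2)) :=
    hF.mul (measurable_Kf.comp (measurable_fst.sub measurable_snd)).ennreal_ofReal
  rw [lintegral_nu hF, reg_eq]
  refine (lintegral_union_le _ _ _).trans ?_
  rw [← lintegral_left (A := closure Ω) hm, ← lintegral_right (A := closure Ω) hm]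
  simp only [kern_inv, mul_comm, le_refl]

lemma lintegral_nu_ge {F : Euc N × Euc N → ℝ≥0∞} (hF : Measurable F) :
    ∫⁻ x in Ω, ∫⁻ y, F (x, y) * ENNReal.ofReal (Kf N s (x - y)) ≤ ∫⁻ q, F q ∂(nu N s Ω) := by
  have hm : Measurable fun q : Euc N × Euc N => F q * ENNReal.ofReal (Kf N s (q.1 - q.2)) :=
    hF.mul (measurable_Kf.comp (measurable_fst.sub measurable_snd)).ennreal_ofReal
  rw [lintegral_nu hF, ← lintegral_left (A := Ω) hm]
  refine (lintegral_mono_set (t := reg N Ω) ?_).trans (le_of_eq ?_)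
  · rintro q ⟨h, -⟩; exact Or.inl (subset_closure h)
  · simp only [kern_inv, mul_comm]

/-- finite energy criterion -/
lemma memHs_of_bound (hΩ : volume (closure Ω) ≠ ⊤) (hu : Measurable u) (hu2 : MemLp u 2 (volume.restrict Ω))
    {g : Euc N → ℝ} (hg : ∀ x y, (u x - u y) ^ 2 ≤ g (x - y))
    (hgi : Integrable (fun h => g h * Kf N s h)) : memHs N s Ω u := by
  have hg0 : ∀ h, 0 ≤ g h := fun h => by have := (sq_nonneg _).trans (hg h 0); simpa using this
  rw [memHs_iff]
  refine ⟨hu, hu2, (memLp_two_iff (measurable_Df hu)).2 ?_⟩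
  refine (lintegral_nu_le ((measurable_Df hu).pow_const 2).ennreal_ofReal).trans_lt ?_
  have hlt : ∫⁻ h, ENNReal.ofReal (g h * Kf N s h) < ⊤ := hgi.lintegral_lt_top
  have b : ∀ x y : Euc N, ENNReal.ofReal (Df u (x, y) ^ 2) * ENNReal.ofReal (Kf N s (x - y)) ≤
      ENNReal.ofReal (g (x - y) * Kf N s (x - y)) := by
    intro x y
    rw [← ENNReal.ofReal_mul (sq_nonneg _)]
    apply ENNReal.ofReal_le_ofReal
    exact mul_le_mul_of_nonneg_right (hg x y) (Kf_nonneg _)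
  refine ENNReal.add_lt_top.2 ⟨?_, ?_⟩
  · calc _ ≤ ∫⁻ x in closure Ω, ∫⁻ h, ENNReal.ofReal (g h * Kf N s h) := by
          refine lintegral_mono fun x => ?_
          refine (lintegral_mono (b x)).trans (le_of_eq ?_)
          exact lintegral_sub_left_eq_self (fun h => ENNReal.ofReal (g h * Kf N s h)) x
      _ < ⊤ := by
          rw [setLIntegral_const]; exact ENNReal.mul_lt_top hlt hΩ.lt_top
  · calc _ ≤ ∫⁻ x in closure Ω, ∫⁻ h, ENNReal.ofReal (g h * Kf N s h) := by
          refine lintegral_mono fun y => ?_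
          refine (lintegral_mono (fun x => b x y)).trans (le_of_eq ?_)
          exact lintegral_sub_right_eq_self (fun h => ENNReal.ofReal (g h * Kf N s h)) y
      _ < ⊤ := by
          rw [setLIntegral_const]; exact ENNReal.mul_lt_top hlt hΩ.lt_top

lemma integrable_min_Kf [NeZero N] (hs : s ∈ Ioo (0 : ℝ) 1) {L M : ℝ} (hL : 0 ≤ L) (hM : 0 ≤ M) :
    Integrable (fun h => min (L * ‖h‖ ^ 2) M * Kf N s h) := by
  have hU : (Metric.ball (0 : Euc N) 1) ∪ {h : Euc N | 1 ≤ ‖h‖} = univ := by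
    ext h; simp [lt_or_ge]
  have hm : Measurable (fun h : Euc N => min (L * ‖h‖ ^ 2) M * Kf N s h) :=
    ((measurable_norm.pow_const 2).const_mul L |>.min measurable_const).mul measurable_Kf
  rw [← integrableOn_univ, ← hU]
  apply IntegrableOn.union
  · refine ((Kf_sq_integrableOn (N := N) hs.2 1).const_mul |L|).mono' hm.aestronglyMeasurable ?_
    refine Eventually.of_forall fun h => ?_
    rw [norm_mul, Real.norm_eq_abs, Real.norm_eq_abs, abs_of_nonneg (Kf_nonneg h), ← mul_assoc]
    apply mul_le_mul_of_nonneg_right _ (Kf_nonneg h)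
    rw [abs_le]
    have h1 := neg_abs_le L
    have h2 := le_abs_self L
    have h3 : 0 ≤ ‖h‖ ^ 2 := by positivity
    have h4 := mul_nonneg (abs_nonneg L) h3
    constructor
    · apply le_min <;> nlinarith
    · exact (min_le_left _ _).trans (by nlinarith)
  · refine ((Kf_tail_integrableOn (N := N) hs.1 one_pos).const_mul (|L| + M)).mono' hm.aestronglyMeasurable ?_
    rw [ae_restrict_iff' (measurableSet_tail 1)]
    refine Eventually.of_forall fun h hh => ?_
    have hh' : 1 ≤ ‖h‖ := hh
    rw [norm_mul, Real.norm_eq_abs, Real.norm_eq_abs, abs_of_nonneg (Kf_nonneg h)]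
    apply mul_le_mul_of_nonneg_right _ (Kf_nonneg h)
    rw [abs_of_nonneg (le_min (by positivity) hM)]
    exact (min_le_right _ _).trans (by have := abs_nonneg L; linarith)

lemma memHs_of_lip [NeZero N] (hs : s ∈ Ioo (0 : ℝ) 1) (hΩ : volume (closure Ω) ≠ ⊤) {L M : ℝ}
    (hum : Measurable u)
    (hL : ∀ x y, |u x - u y| ≤ L * ‖x - y‖) (hM : ∀ x, |u x| ≤ M) : memHs N s Ω u := by
  have hM0 : 0 ≤ M := (abs_nonneg _).trans (hM 0)
  have hΩ' : volume Ω ≠ ⊤ := ((measure_mono subset_closure).trans_lt hΩ.lt_top).ne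
  have : IsFiniteMeasure (volume.restrict Ω) := ⟨by simpa using hΩ'.lt_top⟩
  refine memHs_of_bound hΩ hum ?_ (g := fun h => min (L ^ 2 * ‖h‖ ^ 2) (4 * M ^ 2)) (fun x y => ?_)
    (integrable_min_Kf hs (by positivity) (by positivity))
  · exact MemLp.of_bound hum.aestronglyMeasurable M (Eventually.of_forall fun x => by simpa using hM x)
  · refine le_min ?_ ?_
    · rw [← mul_pow, ← sq_abs (u x - u y)]
      exact pow_le_pow_left₀ (abs_nonneg _) (hL x y) 2
    · have h1 : |u x - u y| ≤ 2 * M := (abs_sub _ _).trans (by linarith [hM x, hM y])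
      rw [← sq_abs]
      calc |u x - u y| ^ 2 ≤ (2 * M) ^ 2 := pow_le_pow_left₀ (abs_nonneg _) h1 2
        _ = _ := by ring

/-- members are locally square integrable -/
lemma memHs.memLp_ball [NeZero N] (hs : s ∈ Ioo (0 : ℝ) 1) {R : ℝ} (hR : 0 < R)
    (hu : memHs N s (Metric.ball 0 R) u) (ρ : ℝ) : MemLp u 2 (volume.restrict (Metric.ball 0 ρ)) := by
  rcases le_or_gt ρ 0 with hρ | hρ
  · simp [Metric.ball_eq_empty.2 hρ]
  rw [memLp_two_iff hu.meas]
  set c : ℝ := ((R + ρ) ^ ((N : ℝ) + 2 * s))⁻¹ with hc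
  have hc0 : 0 < c := by positivity
  have hE := (memLp_two_iff (measurable_Df hu.meas)).1 hu.memDf
  have hT := (memLp_two_iff hu.meas).1 hu.memLp
  have h1 := (lintegral_nu_ge (Ω := Metric.ball 0 R) (s := s)
    ((measurable_Df hu.meas).pow_const 2).ennreal_ofReal).trans_lt hE
  have pt : ∀ x ∈ Metric.ball (0 : Euc N) R, ∀ y ∈ Metric.ball (0 : Euc N) ρ,
      ENNReal.ofReal (u y ^ 2) ≤ ENNReal.ofReal 2 * ENNReal.ofReal (u x ^ 2) +
        ENNReal.ofReal (2 * c⁻¹) * (ENNReal.ofReal (Df u (x, y) ^ 2) * ENNReal.ofReal (Kf N s (x - y))) := by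
    intro x hx y hy
    rw [← ENNReal.ofReal_mul (sq_nonneg _), ← ENNReal.ofReal_mul (p := 2 * c⁻¹) (by positivity),
      ← ENNReal.ofReal_mul (zero_le_two),
      ← ENNReal.ofReal_add (by positivity) (mul_nonneg (by positivity) (mul_nonneg (sq_nonneg _) (Kf_nonneg _)))]
    apply ENNReal.ofReal_le_ofReal
    by_cases hxy : x = y
    · subst hxy; simp [Df]; nlinarith [sq_nonneg (u x)]
    have hk : c ≤ Kf N s (x - y) := by
      apply Kf_ge_of_le hs.1 (sub_ne_zero.2 hxy)
      simp at hx hy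
      exact (norm_sub_le _ _).trans (by linarith)
    have h2 : Df u (x, y) ^ 2 ≤ c⁻¹ * (Df u (x, y) ^ 2 * Kf N s (x - y)) := by
      rw [inv_mul_eq_div, le_div_iff₀ hc0]
      exact mul_le_mul_of_nonneg_left hk (sq_nonneg _)
    have h3 : u y ^ 2 ≤ 2 * u x ^ 2 + 2 * Df u (x, y) ^ 2 := by
      simp only [Df]; nlinarith [sq_nonneg (2 * u x - u y)]
    calc _ ≤ _ := h3
      _ ≤ _ := by nlinarith
  have h2 : ∫⁻ x in Metric.ball (0 : Euc N) R, ∫⁻ y in Metric.ball (0 : Euc N) ρ, ENNReal.ofReal (u y ^ 2)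
      ≤ ∫⁻ x in Metric.ball (0 : Euc N) R, ((ENNReal.ofReal 2 * ENNReal.ofReal (u x ^ 2)) * volume (Metric.ball (0 : Euc N) ρ) +
         ENNReal.ofReal (2 * c⁻¹) * ∫⁻ y, (ENNReal.ofReal (Df u (x, y) ^ 2) * ENNReal.ofReal (Kf N s (x - y)))) := by
    refine setLIntegral_mono' measurableSet_ball fun x hx => ?_
    refine (setLIntegral_mono' measurableSet_ball (pt x hx)).trans ?_
    rw [lintegral_add_left measurable_const, setLIntegral_const]
    gcongr
    rw [lintegral_const_mul']
    · gcongr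
      exact Measure.restrict_le_self
    · exact ENNReal.ofReal_ne_top
  have h3 : ∫⁻ x in Metric.ball (0 : Euc N) R, ((ENNReal.ofReal 2 * ENNReal.ofReal (u x ^ 2)) * volume (Metric.ball (0 : Euc N) ρ) +
         ENNReal.ofReal (2 * c⁻¹) * ∫⁻ y, (ENNReal.ofReal (Df u (x, y) ^ 2) * ENNReal.ofReal (Kf N s (x - y)))) < ⊤ := by
    rw [lintegral_add_left ((hu.meas.pow_const 2).ennreal_ofReal.const_mul _ |>.mul_const _)]
    refine ENNReal.add_lt_top.2 ⟨?_, ?_⟩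
    · rw [lintegral_mul_const' _ _ measure_ball_lt_top.ne, lintegral_const_mul' _ _ ENNReal.ofReal_ne_top]
      exact ENNReal.mul_lt_top (ENNReal.mul_lt_top ENNReal.ofReal_lt_top hT) measure_ball_lt_top
    · rw [lintegral_const_mul' _ _ ENNReal.ofReal_ne_top]
      exact ENNReal.mul_lt_top ENNReal.ofReal_lt_top h1
  have h4 := h2.trans_lt h3
  rw [setLIntegral_const] at h4
  by_contra hcon
  rw [not_lt, top_le_iff] at hcon
  rw [hcon, ENNReal.top_mul (Metric.measure_ball_pos _ _ hR).ne'] at h4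
  exact lt_irrefl _ h4

end

section

variable {N : ℕ} {s : ℝ} {Ω : Set (Euc N)} {u v w : Euc N → ℝ}

lemma sq_integral_le {α : Type*} [MeasurableSpace α] {μ : Measure α} [IsFiniteMeasure μ] {f : α → ℝ}
    (hf : MemLp f 2 μ) : (∫ x, f x ∂μ) ^ 2 ≤ μ.real univ * ∫ x, f x ^ 2 ∂μ := by
  set m := μ.real univ with hm
  set I := ∫ x, f x ∂μ with hI
  have hfi : Integrable f μ := hf.integrable (by norm_num)
  have h0 : 0 ≤ ∫ x, (m * f x - I) ^ 2 ∂μ := integral_nonneg fun x => sq_nonneg _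
  have h1 : ∫ x, (m * f x - I) ^ 2 ∂μ = m ^ 2 * (∫ x, f x ^ 2 ∂μ) - 2 * m * I * I + I ^ 2 * m := by
    have : ∀ x, (m * f x - I) ^ 2 = m ^ 2 * f x ^ 2 - 2 * m * I * f x + I ^ 2 := fun x => by ring
    simp_rw [this]
    have hi : Integrable (fun x => m ^ 2 * f x ^ 2 - 2 * m * I * f x) μ :=
      (hf.integrable_sq.const_mul _).sub (hfi.const_mul _)
    rw [integral_add hi (integrable_const _),
      integral_sub (hf.integrable_sq.const_mul _) (hfi.const_mul _), integral_const_mul, integral_const_mul,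
      integral_const, smul_eq_mul]
    ring
  have hm0 : 0 ≤ m := measureReal_nonneg
  rcases hm0.eq_or_lt with h | h
  · have : μ = 0 := by
      rw [← Measure.measure_univ_eq_zero]
      simpa [hm, measureReal_def, ENNReal.toReal_eq_zero_iff] using h.symm
    simp [hI, this]
  · rw [h1] at h0
    have : 0 ≤ m * (m * (∫ x, f x ^ 2 ∂μ) - I ^ 2) := by nlinarith
    have := nonneg_of_mul_nonneg_right this h
    linarith

lemma avg_est [NeZero N] (hs : 0 < s) {D : Set (Euc N)} (hD : MeasurableSet D) (hDm : 0 < volume.real D)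
    (hDt : volume D ≠ ⊤) (hu : MemLp u 2 (volume.restrict D)) (x : Euc N) {d : ℝ}
    (hd : ∀ y ∈ D, ‖x - y‖ ≤ d) :
    ENNReal.ofReal ((u x - (∫ y in D, u y) / volume.real D) ^ 2) ≤
      ENNReal.ofReal (d ^ ((N : ℝ) + 2 * s) / volume.real D) *
        ∫⁻ y in D, ENNReal.ofReal ((u x - u y) ^ 2) * ENNReal.ofReal (Kf N s (x - y)) := by
  set m := volume.real D
  have : IsFiniteMeasure (volume.restrict D) := ⟨by simpa using hDt.lt_top⟩
  have hf : MemLp (fun y => u x - u y) 2 (volume.restrict D) := (memLp_const (u x)).sub hu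
  have h1 := sq_integral_le hf
  have h2 : (∫ y in D, (u x - u y)) = m * (u x - (∫ y in D, u y) / m) := by
    rw [integral_sub (integrable_const _) (hu.integrable (by norm_num)), integral_const, smul_eq_mul]
    simp only [measureReal_restrict_apply MeasurableSet.univ, univ_inter]
    field_simp
    change m * u x - _ = _
    ring
  rw [h2] at h1
  simp only [measureReal_restrict_apply MeasurableSet.univ, univ_inter] at h1
  have h3 : (u x - (∫ y in D, u y) / m) ^ 2 ≤ m⁻¹ * ∫ y in D, (u x - u y) ^ 2 := by
    rw [mul_pow, sq m, mul_assoc] at h1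
    have := le_of_mul_le_mul_left h1 hDm
    rw [inv_mul_eq_div, le_div_iff₀ hDm]; linarith
  refine (ENNReal.ofReal_le_ofReal h3).trans ?_
  rw [ENNReal.ofReal_mul (by positivity), ofReal_integral_eq_lintegral_ofReal hf.integrable_sq
    (ae_of_all _ fun _ => sq_nonneg _), div_eq_inv_mul, ENNReal.ofReal_mul (by positivity), mul_assoc]
  gcongr
  rw [← lintegral_const_mul' _ _ ENNReal.ofReal_ne_top]
  refine setLIntegral_mono_ae' hD (ae_of_all _ fun y hy => ?_)
  by_cases hxy : x = y
  · simp [hxy]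
  · have hxy' : x - y ≠ 0 := sub_ne_zero.2 hxy
    have hd0 : 0 < d := (norm_pos_iff.2 hxy').trans_le (hd y hy)
    rw [← ENNReal.ofReal_mul (sq_nonneg _), ← ENNReal.ofReal_mul (by positivity)]
    refine ENNReal.ofReal_le_ofReal ?_
    have := Kf_ge_of_le hs hxy' (hd y hy)
    have hp : 0 < d ^ ((N : ℝ) + 2 * s) := by positivity
    have h5 : 1 ≤ d ^ ((N : ℝ) + 2 * s) * Kf N s (x - y) := by
      rw [inv_le_iff_one_le_mul₀ hp] at this; linarith
    nlinarith [sq_nonneg (u x - u y)]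

end

section

variable {N : ℕ} {s : ℝ} {Ω : Set (Euc N)} {u v w : Euc N → ℝ}

/-- The shifted ball near `z` inside the ball of radius `R`. -/
def Dz (R τ : ℝ) (z : Euc N) : Set (Euc N) := Metric.ball ((1 - τ) • z) (τ * R)

lemma Dz_subset {R τ : ℝ} (h0 : 0 < τ) (h1 : τ < 1) {z : Euc N} (hz : ‖z‖ ≤ R) :
    Dz R τ z ⊆ Metric.ball 0 R := by
  intro y hy
  rw [Dz, mem_ball_iff_norm] at hy
  rw [mem_ball_zero_iff]
  have : ‖(1 - τ) • z‖ ≤ (1 - τ) * R := by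
    rw [norm_smul, Real.norm_of_nonneg (by linarith)]; gcongr
  calc ‖y‖ = ‖(y - (1 - τ) • z) + (1 - τ) • z‖ := by congr 1; abel
    _ ≤ ‖y - (1 - τ) • z‖ + ‖(1 - τ) • z‖ := norm_add_le _ _
    _ < R := by linarith

lemma Dz_dist {R τ d : ℝ} (h0 : 0 < τ) {z x y : Euc N} (hz : ‖z‖ ≤ R)
    (hx : ‖x - z‖ ≤ d) (hy : y ∈ Dz R τ z) : ‖x - y‖ ≤ d + 2 * (τ * R) := by
  rw [Dz, mem_ball_iff_norm] at hy
  have : ‖τ • z‖ ≤ τ * R := by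
    rw [norm_smul, Real.norm_of_nonneg h0.le]; gcongr
  calc ‖x - y‖ = ‖(x - z) + τ • z - (y - (1 - τ) • z)‖ := by
        congr 1; rw [sub_smul, one_smul]; abel
    _ ≤ ‖x - z‖ + ‖τ • z‖ + ‖y - (1 - τ) • z‖ :=
        (norm_sub_le _ _).trans (by gcongr; exact norm_add_le _ _)
    _ ≤ _ := by linarith

lemma vol_ball [NeZero N] {r : ℝ} (hr : 0 ≤ r) (x : Euc N) : volume.real (Metric.ball x r) = r ^ N * om N := by
  rw [measureReal_def, Measure.addHaar_ball _ _ hr, ENNReal.toReal_mul, ENNReal.toReal_ofReal (by positivity)]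
  simp [om, measureReal_def]

lemma bform_ofReal (hw : memHs N s Ω w) : ENNReal.ofReal (bform N s Ω w w) =
    ∫⁻ q, ENNReal.ofReal (Df w q ^ 2) ∂(nu N s Ω) := by
  rw [← semiSq_eq hw.meas, ← semiSq_toReal hw.meas, ENNReal.ofReal_toReal hw.2.2.ne]

lemma l2_est [NeZero N] (hs : s ∈ Ioo (0 : ℝ) 1) {R : ℝ} (hR : 0 < R) {τ : ℝ} (h0 : 0 < τ) (h1 : τ < 1)
    (hw : memHs N s (Metric.ball 0 R) w) (t : Set (Euc N)) (ht : ∀ z ∈ t, ‖z‖ ≤ R)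
    (hcov : ∀ x ∈ Metric.ball (0 : Euc N) R, ∃ z ∈ t, ‖x - z‖ ≤ τ * R) {η : ℝ} 
    (hav : ∀ z ∈ t, ((∫ y in Dz R τ z, w y) / volume.real (Dz R τ z)) ^ 2 ≤ η) :
    ∫ x in Metric.ball 0 R, w x ^ 2 ≤ 2 * η * volume.real (Metric.ball (0 : Euc N) R) +
      2 * ((3 * (τ * R)) ^ ((N : ℝ) + 2 * s) / ((τ * R) ^ N * om N)) * bform N s (Metric.ball 0 R) w w := by
  have hτR : 0 < τ * R := by positivity
  have hom := om_pos (N := N)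
  have hη : 0 ≤ η := by
    obtain ⟨z, hz, -⟩ := hcov 0 (by simpa using hR)
    exact (sq_nonneg _).trans (hav z hz)
  set C := (3 * (τ * R)) ^ ((N : ℝ) + 2 * s) / ((τ * R) ^ N * om N) with hC
  have hC0 : 0 ≤ C := by positivity
  have hpt : ∀ x ∈ Metric.ball (0 : Euc N) R, ENNReal.ofReal (w x ^ 2) ≤ ENNReal.ofReal (2 * η) +
      ENNReal.ofReal (2 * C) * ∫⁻ y, ENNReal.ofReal ((w x - w y) ^ 2) * ENNReal.ofReal (Kf N s (x - y)) := by
    intro x hx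
    obtain ⟨z, hz, hxz⟩ := hcov x hx
    have hv : volume.real (Dz R τ z) = (τ * R) ^ N * om N := vol_ball hτR.le _
    have hvp : 0 < (τ * R) ^ N * om N := by positivity
    have key := avg_est (u := w) hs.1 (D := Dz R τ z) measurableSet_ball (by rw [hv]; exact hvp)
      measure_ball_lt_top.ne (hw.memLp.mono_measure (Measure.restrict_mono (Dz_subset h0 h1 (ht z hz)) le_rfl))
      x (d := 3 * (τ * R)) (fun y hy => by have := Dz_dist h0 (ht z hz) hxz hy; linarith)
    have ha := hav z hz
    set a := (∫ y in Dz R τ z, w y) / volume.real (Dz R τ z)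
    calc ENNReal.ofReal (w x ^ 2) ≤ ENNReal.ofReal (2 * η + 2 * (w x - a) ^ 2) := by
          apply ENNReal.ofReal_le_ofReal
          nlinarith [sq_nonneg (w x - 2 * a)]
      _ = ENNReal.ofReal (2 * η) + ENNReal.ofReal 2 * ENNReal.ofReal ((w x - a) ^ 2) := by
          rw [ENNReal.ofReal_add (by positivity) (by positivity), ENNReal.ofReal_mul (p := 2) (q := (w x - a) ^ 2) (by norm_num)]
      _ ≤ _ := by
          refine add_le_add le_rfl ?_
          rw [ENNReal.ofReal_mul (p := 2) (by norm_num), mul_assoc]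
          refine mul_le_mul le_rfl ?_ zero_le zero_le
          refine key.trans ?_
          rw [hv]
          gcongr
          exact Measure.restrict_le_self
  have hF : Measurable (fun q : Euc N × Euc N => ENNReal.ofReal (Df w q ^ 2)) :=
    ((measurable_Df hw.meas).pow_const 2).ennreal_ofReal
  have : ENNReal.ofReal (∫ x in Metric.ball 0 R, w x ^ 2) ≤ ENNReal.ofReal (2 * η * volume.real (Metric.ball (0 : Euc N) R) +
      2 * C * bform N s (Metric.ball 0 R) w w) := by
    rw [ofReal_integral_eq_lintegral_ofReal hw.integrable_sq (ae_of_all _ fun _ => sq_nonneg _)]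
    refine (setLIntegral_mono_ae' measurableSet_ball (ae_of_all _ hpt)).trans ?_
    rw [lintegral_add_left measurable_const, setLIntegral_const, lintegral_const_mul' _ _ ENNReal.ofReal_ne_top,
      ENNReal.ofReal_add (by positivity) (mul_nonneg (by positivity) bform_self_nonneg),
      ENNReal.ofReal_mul (p := 2 * η) (by positivity), ENNReal.ofReal_mul (p := 2 * C) (by positivity),
      bform_ofReal hw, measureReal_def, ENNReal.ofReal_toReal measure_ball_lt_top.ne]
    gcongr
    exact lintegral_nu_ge hF
  exact (ENNReal.ofReal_le_ofReal_iff (add_nonneg (by positivity) (mul_nonneg (by positivity) bform_self_nonneg))).1 this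

lemma const_tendsto [NeZero N] (hs : s ∈ Ioo (0 : ℝ) 1) {R : ℝ} (hR : 0 < R) :
    Tendsto (fun τ : ℝ => (3 * (τ * R)) ^ ((N : ℝ) + 2 * s) / ((τ * R) ^ N * om N)) (𝓝[>] 0) (𝓝 0) := by
  have hom := om_pos (N := N)
  have h1 : ∀ᶠ τ : ℝ in 𝓝[>] 0, 3 ^ ((N : ℝ) + 2 * s) / om N * (τ * R) ^ (2 * s) =
      (3 * (τ * R)) ^ ((N : ℝ) + 2 * s) / ((τ * R) ^ N * om N) := by
    filter_upwards [self_mem_nhdsWithin] with τ hτ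
    have hτ : 0 < τ := hτ
    have hp : 0 < τ * R := by positivity
    rw [Real.mul_rpow (by norm_num) hp.le, Real.rpow_add hp, Real.rpow_natCast]
    field_simp
  refine Tendsto.congr' h1 ?_
  have : Tendsto (fun τ : ℝ => 3 ^ ((N : ℝ) + 2 * s) / om N * (τ * R) ^ (2 * s)) (𝓝 0)
      (𝓝 (3 ^ ((N : ℝ) + 2 * s) / om N * (0 * R) ^ (2 * s))) := by
    refine Tendsto.const_mul _ ?_
    have hc : Continuous (fun τ : ℝ => (τ * R) ^ (2 * s)) :=
      (by fun_prop : Continuous (fun τ : ℝ => τ * R)).rpow_const (fun _ => Or.inr (by linarith [hs.1]))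
    exact hc.tendsto 0
  rw [zero_mul, Real.zero_rpow (by linarith [hs.1]), mul_zero] at this
  exact this.mono_left nhdsWithin_le_nhds

end

section

variable {N : ℕ} {s : ℝ} {Ω : Set (Euc N)} {u v w : Euc N → ℝ}

lemma bform_sub_le (hu : memHs N s Ω u) (hv : memHs N s Ω v) :
    bform N s Ω (fun x => u x - v x) (fun x => u x - v x) ≤ 2 * bform N s Ω u u + 2 * bform N s Ω v v := by
  have h1 := bform_add_self hu hv
  have h2 := bform_sub_self hu hv
  have h3 : 0 ≤ bform N s Ω (fun x => u x + v x) (fun x => u x + v x) := bform_self_nonneg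
  linarith

lemma compact_seq [NeZero N] (hs : s ∈ Ioo (0 : ℝ) 1) {R : ℝ} (hR : 0 < R) {C : ℝ} {f : ℕ → Euc N → ℝ}
    (hf : ∀ n, memHs N s (Metric.ball 0 R) (f n)) (h2 : ∀ n, ∫ x in Metric.ball 0 R, f n x ^ 2 ≤ C)
    (hE : ∀ n, bform N s (Metric.ball 0 R) (f n) (f n) ≤ C) :
    ∃ φ : ℕ → ℕ, StrictMono φ ∧ ∀ ε > 0, ∃ n0, ∀ i ≥ n0, ∀ j ≥ n0,
      ∫ x in Metric.ball 0 R, (f (φ i) x - f (φ j) x) ^ 2 ≤ ε := by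
  have hom := om_pos (N := N)
  have hC0 : 0 ≤ C := bform_self_nonneg.trans (hE 0)
  have hnet : ∀ m : ℕ, ∃ t : Set (Euc N), t ⊆ Metric.closedBall 0 R ∧ t.Finite ∧
      Metric.closedBall 0 R ⊆ ⋃ x ∈ t, Metric.ball x (1 / ((m : ℝ) + 2) * R) := fun m =>
    (isCompact_closedBall 0 R).finite_cover_balls (by positivity)
  choose t ht1 ht2 ht3 using hnet
  have : ∀ m, Countable (t m) := fun m => (ht2 m).countable
  let ι := Σ m : ℕ, t m
  let a : ℕ → ι → ℝ := fun n i =>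
    (∫ y in Dz R (1 / ((i.1 : ℝ) + 2)) (i.2 : Euc N), f n y) / volume.real (Dz R (1 / ((i.1 : ℝ) + 2)) (i.2 : Euc N))
  have hτ0 : ∀ m : ℕ, 0 < 1 / ((m : ℝ) + 2) := fun m => by positivity
  have hτ1 : ∀ m : ℕ, 1 / ((m : ℝ) + 2) < 1 := fun m => by
    rw [div_lt_one (by positivity)]; linarith [(Nat.cast_nonneg m : (0 : ℝ) ≤ m)]
  have hzR : ∀ m, ∀ z ∈ t m, ‖z‖ ≤ R := fun m z hz => by simpa using ht1 m hz
  let M : ι → ℝ := fun i => √(C / volume.real (Dz R (1 / ((i.1 : ℝ) + 2)) (i.2 : Euc N)))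
  have ha : ∀ n, a n ∈ Set.pi univ (fun i => Icc (-M i) (M i)) := by
    intro n i _
    rw [mem_Icc, ← abs_le]
    apply Real.abs_le_sqrt
    set D := Dz R (1 / ((i.1 : ℝ) + 2)) (i.2 : Euc N) with hD
    have hsub : D ⊆ Metric.ball 0 R := Dz_subset (hτ0 _) (hτ1 _) (hzR _ _ i.2.2)
    have hv : 0 < volume.real D := by
      rw [hD, Dz, vol_ball (by have := hτ0 i.1; positivity)]; have := hτ0 i.1; positivity
    have : IsFiniteMeasure (volume.restrict D) := ⟨by rw [Measure.restrict_apply_univ]; exact measure_ball_lt_top⟩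
    have h := sq_integral_le ((hf n).memLp.mono_measure (Measure.restrict_mono hsub le_rfl))
    simp only [measureReal_restrict_apply MeasurableSet.univ, univ_inter] at h
    have h' : ∫ x in D, f n x ^ 2 ≤ C := le_trans (setIntegral_mono_set (hf n).integrable_sq
      (ae_of_all _ fun _ => sq_nonneg _) (LE.le.eventuallyLE hsub)) (h2 n)
    rw [div_pow, div_le_div_iff₀ (by positivity) hv]
    nlinarith
  obtain ⟨L, -, φ, hφ, hL⟩ := (isCompact_univ_pi fun i => isCompact_Icc (a := -M i) (b := M i)).tendsto_subseq ha
  refine ⟨φ, hφ, fun ε hε => ?_⟩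
  set V := volume.real (Metric.ball (0 : Euc N) R) with hV
  have hVp : 0 < V := by rw [hV, vol_ball hR.le]; positivity
  -- choose τ
  have hτt : Tendsto (fun m : ℕ => 1 / ((m : ℝ) + 2)) atTop (𝓝[>] 0) := by
    refine tendsto_nhdsWithin_iff.2 ⟨?_, Eventually.of_forall fun m => hτ0 m⟩
    have := (tendsto_add_atTop_iff_nat (f := fun n : ℕ => 1 / (n : ℝ)) 2).2 tendsto_one_div_atTop_nhds_zero_nat
    simpa using this
  have hsm := ((const_tendsto (N := N) hs hR).comp hτt).eventually (gt_mem_nhds (show 0 < ε / (16 * C + 1) by positivity))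
  obtain ⟨m, hm⟩ := hsm.exists
  simp only [Function.comp] at hm
  set η := ε / (4 * V) with hη
  have hη0 : 0 < η := by positivity
  have hLi : ∀ i : ι, Tendsto (fun n => a (φ n) i) atTop (𝓝 (L i)) := fun i => (tendsto_pi_nhds.1 hL) i
  have : Finite (t m) := (ht2 m).to_subtype
  have hev : ∀ᶠ n in atTop, ∀ z : t m, |a (φ n) ⟨m, z⟩ - L ⟨m, z⟩| < √η / 2 := by
    rw [eventually_all]
    intro z
    exact (Metric.tendsto_nhds.1 (hLi ⟨m, z⟩)) _ (by positivity)
  obtain ⟨n0, hn0⟩ := eventually_atTop.1 hev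
  refine ⟨n0, fun i hi j hj => ?_⟩
  have hmem := (hf (φ i)).sub (hf (φ j))
  have := l2_est hs hR (hτ0 m) (hτ1 m) hmem (t m) (hzR m) (fun x hx => by
    have := ht3 m (Metric.ball_subset_closedBall hx)
    simp only [mem_iUnion, exists_prop] at this
    obtain ⟨z, hz, hxz⟩ := this
    exact ⟨z, hz, (mem_ball_iff_norm.1 hxz).le⟩) (η := η) (fun z hz => by
      have h1 := hn0 i hi ⟨z, hz⟩
      have h2 := hn0 j hj ⟨z, hz⟩
      have hsub : Dz R (1 / ((m : ℝ) + 2)) z ⊆ Metric.ball 0 R := Dz_subset (hτ0 _) (hτ1 _) (hzR _ _ hz)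
      have hIntg0 : ∀ n, IntegrableOn (f n) (Dz R (1 / ((m : ℝ) + 2)) z) := fun n =>
        IntegrableOn.mono_set ((hf n).integrable measure_ball_lt_top.ne) hsub
      rw [integral_sub (hIntg0 _) (hIntg0 _), sub_div]
      change (a (φ i) ⟨m, ⟨z, hz⟩⟩ - a (φ j) ⟨m, ⟨z, hz⟩⟩) ^ 2 ≤ η
      rw [← Real.sq_sqrt hη0.le]
      apply sq_le_sq'
      · have := abs_lt.1 h1; have := abs_lt.1 h2; linarith
      · have := abs_lt.1 h1; have := abs_lt.1 h2; linarith)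
  have hb := bform_sub_le (hf (φ i)) (hf (φ j))
  have hb2 : bform N s (Metric.ball 0 R) (fun x => f (φ i) x - f (φ j) x) (fun x => f (φ i) x - f (φ j) x) ≤ 4 * C := by
    have := hE (φ i); have := hE (φ j); linarith
  have hb0 : 0 ≤ bform N s (Metric.ball 0 R) (fun x => f (φ i) x - f (φ j) x) (fun x => f (φ i) x - f (φ j) x) :=
    bform_self_nonneg
  refine this.trans ?_
  have e1 : 2 * η * V = ε / 2 := by rw [hη]; field_simp; norm_num
  rw [e1]
  have hK : ε / (16 * C + 1) * (4 * C) ≤ ε / 4 := by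
    rw [div_mul_eq_mul_div, div_le_div_iff₀ (by positivity) (by norm_num)]; nlinarith
  have := mul_le_mul hm.le hb2 hb0 (by positivity)
  linarith

end

section

variable {N : ℕ} {s : ℝ} {Ω : Set (Euc N)} {u v w : Euc N → ℝ}

lemma toLp_norm_sq {α : Type*} [MeasurableSpace α] {μ : Measure α} {f : α → ℝ} (hf : MemLp f 2 μ) :
    ‖hf.toLp f‖ ^ 2 = ∫ x, f x ^ 2 ∂μ := by
  rw [← real_inner_self_eq_norm_sq, L2.inner_def]
  refine integral_congr_ae ?_
  filter_upwards [hf.coeFn_toLp] with x hx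
  simp [hx, sq]

lemma lp_lim {α : Type*} [MeasurableSpace α] {μ : Measure α} {f : ℕ → α → ℝ} (hf : ∀ n, MemLp (f n) 2 μ)
    (hc : ∀ ε > 0, ∃ n0, ∀ i ≥ n0, ∀ j ≥ n0, ∫ x, (f i x - f j x) ^ 2 ∂μ ≤ ε) :
    ∃ F : α → ℝ, MemLp F 2 μ ∧ Tendsto (fun n => ∫ x, (f n x - F x) ^ 2 ∂μ) atTop (𝓝 0) ∧
      Tendsto (fun n => ∫ x, f n x ^ 2 ∂μ) atTop (𝓝 (∫ x, F x ^ 2 ∂μ)) ∧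
      ∃ φ : ℕ → ℕ, StrictMono φ ∧ ∀ᵐ x ∂μ, Tendsto (fun n => f (φ n) x) atTop (𝓝 (F x)) := by
  have hcau : CauchySeq (fun n => (hf n).toLp (f n)) := by
    rw [Metric.cauchySeq_iff]
    intro ε hε
    obtain ⟨n0, h0⟩ := hc (ε ^ 2 / 2) (by positivity)
    refine ⟨n0, fun i hi j hj => ?_⟩
    rw [dist_eq_norm, ← MemLp.toLp_sub]
    have := toLp_norm_sq ((hf i).sub (hf j))
    have h1 := h0 i hi j hj
    simp only [Pi.sub_apply] at this
    exact lt_of_pow_lt_pow_left₀ 2 hε.le (by rw [this]; nlinarith)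
  obtain ⟨G, hG⟩ := cauchySeq_tendsto_of_complete hcau
  have hGm := Lp.memLp G
  have hGG : hGm.toLp G = G := Lp.toLp_coeFn _ _
  refine ⟨G, hGm, ?_, ?_, ?_⟩
  · have h := (tendsto_iff_norm_sub_tendsto_zero.1 hG).pow 2
    rw [zero_pow two_ne_zero] at h
    refine h.congr fun n => ?_
    rw [← toLp_norm_sq (f := fun x => f n x - G x) ((hf n).sub hGm)]
    have : ((hf n).sub hGm).toLp _ = (hf n).toLp (f n) - G := by
      rw [MemLp.toLp_sub (hf n) hGm, hGG]
    rw [← this]; rfl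
  · have h := (hG.norm).pow 2
    rw [← hGG, toLp_norm_sq] at h
    exact h.congr fun n => toLp_norm_sq _
  · have h := tendstoInMeasure_of_tendsto_Lp hG
    obtain ⟨φ, hφ, h2⟩ := h.exists_seq_tendsto_ae
    refine ⟨φ, hφ, ?_⟩
    have : ∀ᵐ x ∂μ, ∀ n, (hf n).toLp (f n) x = f n x := ae_all_iff.2 fun n => (hf n).coeFn_toLp
    filter_upwards [h2, this] with x hx h3
    simpa [h3] using hx

/-- Clamped coordinate. -/
def cl (N : ℕ) (ρ : ℝ) (i : Fin N) (x : Euc N) : ℝ := max (-ρ) (min ρ (x i))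

lemma measurable_cl (ρ : ℝ) (i : Fin N) : Measurable (cl N ρ i) := by
  unfold cl; fun_prop

lemma cl_lip (ρ : ℝ) (i : Fin N) (x y : Euc N) : |cl N ρ i x - cl N ρ i y| ≤ |x i - y i| := by
  unfold cl
  refine (abs_max_sub_max_le_max _ _ _ _).trans ?_
  simp only [sub_self, abs_zero]
  refine max_le (abs_nonneg _) ((abs_min_sub_min_le_max _ _ _ _).trans ?_)
  simp

lemma coord_le_norm (x : Euc N) (i : Fin N) : |x i| ≤ ‖x‖ := by
  simpa using PiLp.norm_apply_le x i

lemma cl_lip' (ρ : ℝ) (i : Fin N) (x y : Euc N) : |cl N ρ i x - cl N ρ i y| ≤ 1 * ‖x - y‖ := by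
  rw [one_mul]
  exact (cl_lip ρ i x y).trans (by simpa using coord_le_norm (x - y) i)

lemma cl_bdd {ρ : ℝ} (hρ : 0 ≤ ρ) (i : Fin N) (x : Euc N) : |cl N ρ i x| ≤ ρ := by
  unfold cl
  rw [abs_le]
  exact ⟨le_max_left _ _, max_le (by linarith) (min_le_left _ _)⟩

lemma cl_eq {ρ : ℝ} (i : Fin N) {x : Euc N} (h : |x i| ≤ ρ) : cl N ρ i x = x i := by
  unfold cl
  rw [abs_le] at h
  rw [min_eq_right h.2, max_eq_right h.1]

lemma memHs_cl [NeZero N] (hs : s ∈ Ioo (0 : ℝ) 1) (hΩ : volume (closure Ω) ≠ ⊤) {ρ : ℝ} (hρ : 0 ≤ ρ) (i : Fin N) :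
    memHs N s Ω (cl N ρ i) := memHs_of_lip hs hΩ (measurable_cl ρ i) (cl_lip' ρ i) (cl_bdd hρ i)

lemma vol_closure_ball (R : ℝ) : volume (closure (Metric.ball (0 : Euc N) R)) ≠ ⊤ :=
  ((measure_mono Metric.closure_ball_subset_closedBall).trans_lt measure_closedBall_lt_top).ne

lemma setIntegral_comp_iso {R : ℝ} (Q : Euc N ≃ₗᵢ[ℝ] Euc N) (f : Euc N → ℝ) :
    ∫ x in Metric.ball 0 R, f (Q x) = ∫ x in Metric.ball 0 R, f x := by
  have h := (Q.measurePreserving).setIntegral_preimage_emb Q.toMeasurableEquiv.measurableEmbedding f (Metric.ball 0 R)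
  rw [← h]
  congr 2
  ext x; simp

lemma mean_cl {R : ℝ} (ρ : ℝ) (hρ : 0 ≤ ρ) (i : Fin N) : ∫ x in Metric.ball 0 R, cl N ρ i x = 0 := by
  have h := setIntegral_comp_iso (R := R) (LinearIsometryEquiv.neg ℝ (E := Euc N)) (cl N ρ i)
  have : ∀ x : Euc N, cl N ρ i (LinearIsometryEquiv.neg ℝ (E := Euc N) x) = - cl N ρ i x := by
    intro x
    simp only [cl, LinearIsometryEquiv.coe_neg, PiLp.neg_apply]
    rcases le_total (x i) ρ with h1 | h1 <;> rcases le_total (-ρ) (x i) with h2 | h2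
    · rw [min_eq_right (by linarith), max_eq_right (by linarith), min_eq_right h1, max_eq_right h2]
    · rw [min_eq_left (by linarith), max_eq_right (by linarith), min_eq_right h1, max_eq_left h2]; simp
    · rw [min_eq_right (by linarith), max_eq_left (by linarith), min_eq_left h1, max_eq_right (by linarith)]
    · have : ρ = 0 := by linarith
      have : x i = 0 := by linarith
      simp [*]
  simp_rw [this] at h
  rw [integral_neg] at h
  linarith

lemma cl_sq_pos [NeZero N] {R : ℝ} (hR : 0 < R) {ρ : ℝ} (hρ : 0 < ρ) (i : Fin N) :
    0 < ∫ x in Metric.ball 0 R, cl N ρ i x ^ 2 := by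
  have hcont : Continuous (fun x : Euc N => cl N ρ i x ^ 2) := by unfold cl; fun_prop
  rw [setIntegral_pos_iff_support_of_nonneg_ae (ae_of_all _ fun _ => sq_nonneg _)
    ((hcont.continuousOn.integrableOn_compact (isCompact_closedBall 0 R)).mono_set Metric.ball_subset_closedBall)]
  · refine IsOpen.measure_pos _ ((hcont.isOpen_support).inter Metric.isOpen_ball) ⟨EuclideanSpace.single i (min ρ (R/2)), ?_, ?_⟩
    · have : 0 < min ρ (R / 2) := lt_min hρ (by linarith)
      simp only [Function.mem_support]
      rw [cl_eq]
      · simp [this.ne']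
      · simp [abs_of_pos this]
    · have : 0 < min ρ (R / 2) := lt_min hρ (by linarith)
      simp only [mem_ball_zero_iff, EuclideanSpace.norm_single, Real.norm_eq_abs, abs_of_pos this]
      exact (min_le_right _ _).trans_lt (by linarith)

end

section

variable {N : ℕ} {s : ℝ} {Ω : Set (Euc N)} {u v w : Euc N → ℝ}

lemma mu1_set_ne [NeZero N] (hs : s ∈ Ioo (0 : ℝ) 1) {R : ℝ} (hR : 0 < R) :
    {t : ℝ | ∃ u : Euc N → ℝ, memHs N s (Metric.ball 0 R) u ∧ (∫ x in Metric.ball 0 R, (u x) ^ 2) = 1 ∧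
    (∫ x in Metric.ball 0 R, u x) = 0 ∧ t = cNs N s / 2 * (semiSq N s (Metric.ball 0 R) u).toReal}.Nonempty := by
  have hp := cl_sq_pos (N := N) hR hR 0
  set I := ∫ x in Metric.ball 0 R, cl N R 0 x ^ 2 with hI
  refine ⟨_, fun x => (√I)⁻¹ * cl N R 0 x, (memHs_cl hs (vol_closure_ball R) hR.le 0).smul _, ?_, ?_, rfl⟩
  · simp_rw [mul_pow]
    rw [integral_const_mul, inv_pow, Real.sq_sqrt hp.le, ← hI]
    field_simp
  · rw [integral_const_mul, mean_cl _ hR.le, mul_zero]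

lemma exists_min_seq [NeZero N] (hs : s ∈ Ioo (0 : ℝ) 1) {R : ℝ} (hR : 0 < R) :
    ∃ g : ℕ → Euc N → ℝ, (∀ n, memHs N s (Metric.ball 0 R) (g n)) ∧
      (∀ n, ∫ x in Metric.ball 0 R, g n x ^ 2 = 1) ∧ (∀ n, ∫ x in Metric.ball 0 R, g n x = 0) ∧
      Tendsto (fun n => bform N s (Metric.ball 0 R) (g n) (g n)) atTop (𝓝 (lam N s (Metric.ball 0 R))) := by
  obtain ⟨t, -, ht, hmem⟩ := exists_seq_tendsto_sInf (mu1_set_ne (N := N) hs hR) (mu1_set_bdd hs)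
  choose g h1 h2 h3 h4 using hmem
  refine ⟨g, h1, h2, h3, ?_⟩
  have hc := cNs_pos (N := N) hs
  have := ht.div_const (cNs N s / 2)
  refine this.congr fun n => ?_
  rw [h4 n, semiSq_toReal (h1 n).meas]
  field_simp

lemma ae_left {p : Euc N × Euc N → Prop} (h : ∀ᵐ q : Euc N × Euc N, q ∈ reg N Ω → p q) :
    ∀ᵐ x : Euc N, x ∈ Ω → ∀ᵐ y, p (x, y) := by
  have := Measure.ae_ae_of_ae_prod (μ := (volume : Measure (Euc N))) (ν := (volume : Measure (Euc N))) h
  filter_upwards [this] with x hx hxΩ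
  filter_upwards [hx] with y hy
  exact hy (Or.inl (subset_closure hxΩ))

theorem exists_eig [NeZero N] (hs : s ∈ Ioo (0 : ℝ) 1) {R : ℝ} (hR : 0 < R) :
    ∃ u, IsEig N s (Metric.ball 0 R) u ∧ ∫ x in Metric.ball 0 R, u x ^ 2 = 1 := by
  obtain ⟨g0, hg1, hg2, hg3, hg4⟩ := exists_min_seq (N := N) hs hR
  set B := Metric.ball (0 : Euc N) R with hB
  set l := lam N s B with hl
  have hl0 : 0 ≤ l := lam_nonneg hs
  obtain ⟨C, hC⟩ := hg4.bddAbove_range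
  have hCE : ∀ n, bform N s B (g0 n) (g0 n) ≤ max C 1 := fun n =>
    (hC ⟨n, rfl⟩).trans (le_max_left _ _)
  obtain ⟨φ, hφ, hcau⟩ := compact_seq hs hR hg1 (fun n => (hg2 n).le.trans (le_max_right C 1)) hCE
  -- pass to the subsequence
  set g : ℕ → Euc N → ℝ := fun n => g0 (φ n) with hg
  have k1 : ∀ n, memHs N s B (g n) := fun n => hg1 _
  have k2 : ∀ n, ∫ x in B, g n x ^ 2 = 1 := fun n => hg2 _
  have k3 : ∀ n, ∫ x in B, g n x = 0 := fun n => hg3 _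
  have k4 : Tendsto (fun n => bform N s B (g n) (g n)) atTop (𝓝 l) := hg4.comp hφ.tendsto_atTop
  have hBf : volume B ≠ ⊤ := measure_ball_lt_top.ne
  have par : ∀ i j, bform N s B (fun x => g i x - g j x) (fun x => g i x - g j x) ≤
      2 * bform N s B (g i) (g i) + 2 * bform N s B (g j) (g j) - 4 * l + l * ∫ x in B, (g i x - g j x) ^ 2 := by
    intro i j
    have h1 := bform_add_self (k1 i) (k1 j)
    have h2 := bform_sub_self (k1 i) (k1 j)
    have h3 := rayleigh' hs ((k1 i).add (k1 j)) (by
      rw [integral_add ((k1 i).integrable hBf) ((k1 j).integrable hBf), k3, k3, add_zero])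
    have h4 : (∫ x in B, (g i x + g j x) ^ 2) = 4 - ∫ x in B, (g i x - g j x) ^ 2 := by
      have : ∀ x, (g i x + g j x) ^ 2 = 2 * g i x ^ 2 + 2 * g j x ^ 2 - (g i x - g j x) ^ 2 := fun x => by ring
      simp_rw [this]
      have i1 : Integrable (fun x => 2 * g i x ^ 2) (volume.restrict B) := (k1 i).integrable_sq.const_mul 2
      have i2 : Integrable (fun x => 2 * g j x ^ 2) (volume.restrict B) := (k1 j).integrable_sq.const_mul 2
      have i12 : Integrable (fun x => 2 * g i x ^ 2 + 2 * g j x ^ 2) (volume.restrict B) := i1.add i2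
      rw [integral_sub i12 ((k1 i).sub (k1 j)).integrable_sq,
        integral_add i1 i2, integral_const_mul, integral_const_mul, k2, k2]
      norm_num
    rw [h4] at h3
    linarith
  obtain ⟨G, hGm, hG0, hG1, ψ, hψ, hψae⟩ := lp_lim (μ := nu N s B) (f := fun n => Df (g n)) (fun n => (k1 n).memDf) (by
    intro ε hε
    obtain ⟨n0, h0⟩ := hcau (ε / (2 * l + 1)) (by positivity)
    have := (Metric.tendsto_atTop.1 k4) (ε / 8) (by positivity)
    obtain ⟨n1, h1⟩ := this
    refine ⟨max n0 n1, fun i hi j hj => ?_⟩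
    have e1 : ∫ x, (Df (g i) x - Df (g j) x) ^ 2 ∂(nu N s B) = 
        bform N s B (fun x => g i x - g j x) (fun x => g i x - g j x) := by
      rw [bform_eq, Df_sub]; simp [sq]
    rw [e1]
    refine (par i j).trans ?_
    have a1 := h0 i (le_of_max_le_left hi) j (le_of_max_le_left hj)
    have a2 := h1 i (le_of_max_le_right hi)
    have a3 := h1 j (le_of_max_le_right hj)
    rw [Real.dist_eq, abs_lt] at a2 a3
    have a4 : l * ∫ x in B, (g i x - g j x) ^ 2 ≤ l * (ε / (2 * l + 1)) := by gcongr
    have a5 : l * (ε / (2 * l + 1)) ≤ ε / 2 := by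
      rw [mul_div_assoc', div_le_div_iff₀ (by positivity) (by norm_num)]; nlinarith
    linarith)
  obtain ⟨U, hUm, hU0, hU1, θ, hθ, hθae⟩ := lp_lim (μ := volume.restrict B) (f := fun n => g (ψ n)) (fun n => (k1 _).memLp) (by
    intro ε hε
    obtain ⟨n0, h0⟩ := hcau ε hε
    exact ⟨n0, fun i hi j hj => h0 _ (hi.trans (hψ.le_apply)) _ (hj.trans (hψ.le_apply))⟩)
  set f : ℕ → Euc N → ℝ := fun n => g (ψ (θ n)) with hf
  have hfD : ∀ᵐ q ∂(nu N s B), Tendsto (fun n => Df (f n) q) atTop (𝓝 (G q)) := by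
    filter_upwards [hψae] with q hq
    exact hq.comp hθ.tendsto_atTop
  have hfB : ∀ᵐ x, x ∈ B → Tendsto (fun n => f n x) atTop (𝓝 (U x)) :=
    (ae_restrict_iff' measurableSet_ball).1 hθae
  have hB0 : volume B ≠ 0 := (Metric.measure_ball_pos volume (0 : Euc N) hR).ne'
  obtain ⟨x0, hx0B, hx1, hx2⟩ : ∃ x0 ∈ B, Tendsto (fun n => f n x0) atTop (𝓝 (U x0)) ∧
      ∀ᵐ y, Tendsto (fun n => Df (f n) (x0, y)) atTop (𝓝 (G (x0, y))) := by
    by_contra hcon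
    apply hB0
    have hae := ae_left (ae_of_ae_nu hfD)
    have : ∀ᵐ x : Euc N, x ∉ B := by
      filter_upwards [hae, hfB] with x h1 h2 h3
      exact hcon ⟨x, h3, h2 h3, h1 h3⟩
    simpa [ae_iff] using this
  have hconv : ∀ᵐ y, ∃ L, Tendsto (fun n => f n y) atTop (𝓝 L) := by
    filter_upwards [hx2] with y hy
    refine ⟨_, (hx1.sub hy).congr fun n => ?_⟩
    simp [Df]
  obtain ⟨u, hum, hu⟩ := measurable_limit_of_tendsto_metrizable_ae
    (fun n => ((k1 (ψ (θ n))).meas.aemeasurable)) hconv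
  have hDu : G =ᵐ[nu N s B] Df u := by
    have e1 : ∀ᵐ q : Euc N × Euc N, Tendsto (fun n => f n q.1) atTop (𝓝 (u q.1)) :=
      (Measure.quasiMeasurePreserving_fst (μ := (volume : Measure (Euc N))) (ν := (volume : Measure (Euc N)))).ae hu
    have e2 : ∀ᵐ q : Euc N × Euc N, Tendsto (fun n => f n q.2) atTop (𝓝 (u q.2)) :=
      (Measure.quasiMeasurePreserving_snd (μ := (volume : Measure (Euc N))) (ν := (volume : Measure (Euc N)))).ae hu
    filter_upwards [hfD, nu_ac.ae_le e1, nu_ac.ae_le e2] with q h1 h2 h3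
    exact tendsto_nhds_unique h1 (h2.sub h3)
  have hUu : U =ᵐ[volume.restrict B] u := by
    filter_upwards [hθae, ae_restrict_of_ae hu] with x h1 h2
    exact tendsto_nhds_unique h1 h2
  have hmem : memHs N s B u := memHs_iff.2 ⟨hum, (memLp_congr_ae hUu).1 hUm, (memLp_congr_ae hDu).1 hGm⟩
  have hE : bform N s B u u = l := by
    have : Tendsto (fun n => bform N s B (g n) (g n)) atTop (𝓝 (bform N s B u u)) := by
      have e : bform N s B u u = ∫ q, G q ^ 2 ∂(nu N s B) := by
        rw [bform_eq]; refine integral_congr_ae ?_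
        filter_upwards [hDu] with q hq; rw [hq, sq]
      rw [e]
      refine hG1.congr fun n => ?_
      rw [bform_eq]; simp [sq]
    exact tendsto_nhds_unique this k4
  have hu2 : ∫ x in B, u x ^ 2 = 1 := by
    have e : ∫ x in B, u x ^ 2 = ∫ x in B, U x ^ 2 := integral_congr_ae (by
      filter_upwards [hUu] with x hx; rw [hx])
    rw [e]
    refine tendsto_nhds_unique hU1 ?_
    simp only [k2]
    exact tendsto_const_nhds
  have hu0 : ∫ x in B, u x = 0 := by
    have : IsFiniteMeasure (volume.restrict B) := ⟨by rw [Measure.restrict_apply_univ]; exact measure_ball_lt_top⟩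
    rw [← integral_congr_ae hUu]
    have e : ∀ n, (∫ x in B, U x) ^ 2 ≤ (volume.restrict B).real univ * ∫ x in B, (g (ψ n) x - U x) ^ 2 := by
      intro n
      have := sq_integral_le ((k1 (ψ n)).memLp.sub hUm)
      simp only [Pi.sub_apply] at this
      rw [integral_sub ((k1 _).integrable hBf) (hUm.integrable (by norm_num)), k3] at this
      simpa using this
    have h0 := ge_of_tendsto' (hU0.const_mul ((volume.restrict B).real univ)) e
    rw [mul_zero] at h0
    exact pow_eq_zero_iff two_ne_zero |>.1 (le_antisymm h0 (sq_nonneg _))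
  refine ⟨u, isEig_of_min hBf hB0 hs hmem hu0 ?_, hu2⟩
  have hc := cNs_pos (N := N) hs
  rw [hE, hu2, hl, lam]
  field_simp
  exact le_rfl

end

section

variable {N : ℕ} {s : ℝ} {Ω : Set (Euc N)} {u v w : Euc N → ℝ} {R : ℝ}

/-- Abbreviation for the centered ball. -/
abbrev BB (N : ℕ) (R : ℝ) : Set (Euc N) := Metric.ball (0 : Euc N) R

lemma iso_closure (hR : 0 < R) (Q : Euc N ≃ₗᵢ[ℝ] Euc N) (x : Euc N) :
    Q x ∈ closure (BB N R) ↔ x ∈ closure (BB N R) := by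
  rw [closure_ball _ hR.ne']; simp

lemma emb_prod (Q Q' : Euc N ≃ₗᵢ[ℝ] Euc N) : MeasurableEmbedding (Prod.map Q Q') :=
  (MeasurableEquiv.prodCongr Q.toMeasurableEquiv Q'.toMeasurableEquiv).measurableEmbedding

lemma memHs.comp (hR : 0 < R) (Q : Euc N ≃ₗᵢ[ℝ] Euc N) (hu : memHs N s (BB N R) u) :
    memHs N s (BB N R) (fun x => u (Q x)) := by
  rw [memHs_iff]
  refine ⟨hu.meas.comp Q.continuous.measurable, ?_, ?_⟩
  · have h := Q.measurePreserving.restrict_preimage_emb Q.toMeasurableEquiv.measurableEmbedding (BB N R)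
    have e : Q ⁻¹' (BB N R) = BB N R := by ext x; simp
    rw [e] at h
    exact hu.memLp.comp_measurePreserving h
  · exact hu.memDf.comp_measurePreserving (nu_mp Q (iso_closure hR Q))

lemma bform_comp (hR : 0 < R) (Q : Euc N ≃ₗᵢ[ℝ] Euc N) :
    bform N s (BB N R) (fun x => u (Q x)) (fun x => v (Q x)) = bform N s (BB N R) u v := by
  rw [bform_eq, bform_eq]
  exact (nu_mp Q (iso_closure hR Q)).integral_comp (emb_prod Q Q) (fun q => Df u q * Df v q)

lemma IsEig.comp (hR : 0 < R) (Q : Euc N ≃ₗᵢ[ℝ] Euc N) (hu : IsEig N s (BB N R) u) :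
    IsEig N s (BB N R) (fun x => u (Q x)) := by
  refine ⟨hu.mem.comp hR Q, ?_, fun v hv => ?_⟩
  · rw [setIntegral_comp_iso Q u, hu.mean]
  · have h := hu.weak (hv.comp hR Q.symm)
    rw [← bform_comp hR Q, ← setIntegral_comp_iso Q] at h
    simpa using h

/-- reflection as a linear isometry -/
def refl (e : Euc N) : Euc N ≃ₗᵢ[ℝ] Euc N := (ℝ ∙ e)ᗮ.reflection

lemma refl_apply {e : Euc N} (he : ‖e‖ = 1) (x : Euc N) : refl e x = x - (2 * (inner ℝ x e : ℝ)) • e := by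
  rw [refl, Submodule.reflection_orthogonal_apply, Submodule.reflection_singleton_apply]
  simp [he, real_inner_comm, mul_smul, two_smul]

lemma refl_eq {e : Euc N} (he : ‖e‖ = 1) (x : Euc N) : refl e x = reflect N e x := refl_apply he x

lemma refl_refl (e : Euc N) (x : Euc N) : refl e (refl e x) = x :=
  Submodule.reflection_reflection _ _

lemma inner_refl {e : Euc N} (he : ‖e‖ = 1) (x : Euc N) : (inner ℝ (refl e x) e : ℝ) = - inner ℝ x e := by
  rw [refl_apply he, inner_sub_left, inner_smul_left, real_inner_self_eq_norm_sq, he]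
  simp; ring

lemma norm_sub_refl {e : Euc N} (he : ‖e‖ = 1) (x y : Euc N) :
    ‖x - refl e y‖ ^ 2 = ‖x - y‖ ^ 2 + 4 * (inner ℝ x e : ℝ) * (inner ℝ y e : ℝ) := by
  rw [refl_apply he, ← sub_add, norm_add_sq_real, norm_smul, he, inner_smul_right, inner_sub_left]
  rw [mul_one, Real.norm_eq_abs, sq_abs]
  ring

/-- pointwise antisymmetry -/
def Asym (e : Euc N) (u : Euc N → ℝ) : Prop := ∀ x, u (refl e x) = - u x

lemma Asym.sub {e : Euc N} (hu : Asym e u) (hv : Asym e v) : Asym e (fun x => u x - v x) := fun x => by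
  simp only [hu x, hv x]; ring
lemma Asym.smul {e : Euc N} (hu : Asym e u) (c : ℝ) : Asym e (fun x => c * u x) := fun x => by
  simp only [hu x]; ring
lemma Asym.mk (e : Euc N) (u : Euc N → ℝ) : Asym e (fun x => u x - u (refl e x)) := fun x => by
  simp only [refl_refl]; ring

lemma Asym.zero {e : Euc N} (he : ‖e‖ = 1) (hu : Asym e u) {x : Euc N} (hx : (inner ℝ x e : ℝ) = 0) : u x = 0 := by
  have := hu x
  rw [refl_apply he, hx] at this
  simp at this; linarith

lemma Asym.mean {e : Euc N} (hu : Asym e u) : ∫ x in BB N R, u x = 0 := by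
  have h := setIntegral_comp_iso (R := R) (refl e) u
  simp_rw [hu _] at h
  rw [integral_neg] at h; linarith

/-- the region measure -/
abbrev rv (N : ℕ) (R : ℝ) : Measure (Euc N × Euc N) := volume.restrict (reg N (BB N R))

lemma rv_mp (hR : 0 < R) (Q Q' : Euc N ≃ₗᵢ[ℝ] Euc N) : MeasurePreserving (Prod.map Q Q') (rv N R) (rv N R) := by
  have h := (Q.measurePreserving.prod Q'.measurePreserving).restrict_preimage_emb (emb_prod Q Q') (reg N (BB N R))
  have e : Prod.map Q Q' ⁻¹' (reg N (BB N R)) = reg N (BB N R) := by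
    ext q
    simp only [mem_preimage, reg, mem_ofPred_eq, Prod.map_fst, Prod.map_snd, iso_closure hR]
  rw [e] at h
  exact h

lemma bform_rv : bform N s (BB N R) u v = ∫ q, (u q.1 - u q.2) * (v q.1 - v q.2) * Kf N s (q.1 - q.2) ∂(rv N R) := rfl

lemma integrable_rv (hu : memHs N s (BB N R) u) (hv : memHs N s (BB N R) v) :
    Integrable (fun q => (u q.1 - u q.2) * (v q.1 - v q.2) * Kf N s (q.1 - q.2)) (rv N R) := by
  have := hu.integrable_Df hv
  unfold nu at this
  rw [integrable_withDensity_iff_integrable_smul' measurable_kernInv (ae_of_all _ fun _ => ENNReal.ofReal_lt_top)] at this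
  refine this.congr (ae_of_all _ fun q => ?_)
  simp only [Df, kern_inv, ENNReal.toReal_ofReal (Kf_nonneg _), smul_eq_mul]
  ring

lemma Kf_norm {h h' : Euc N} (hh : ‖h‖ = ‖h'‖) : Kf N s h = Kf N s h' := by unfold Kf; rw [hh]

lemma Kf_refl_comm (e x y : Euc N) : Kf N s (refl e x - y) = Kf N s (x - refl e y) := by
  apply Kf_norm
  rw [← (refl e).norm_map (refl e x - y), map_sub, refl_refl]

/-- two point symmetrization -/
lemma integrable_rv' (hR : 0 < R) {e : Euc N} (hu : memHs N s (BB N R) u) (hv : memHs N s (BB N R) v) (au : Asym e u) (av : Asym e v) :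
    Integrable (fun q => (u q.1 + u q.2) * (v q.1 + v q.2) * Kf N s (q.1 - refl e q.2)) (rv N R) := by
  have := (rv_mp hR (LinearIsometryEquiv.refl ℝ _) (refl e)).integrable_comp_of_integrable (integrable_rv hu hv)
  refine this.congr (ae_of_all _ fun q => ?_)
  simp [au _, av _]

lemma bform_rv' (hR : 0 < R) {e : Euc N} (au : Asym e u) (av : Asym e v) :
    bform N s (BB N R) u v = ∫ q, (u q.1 + u q.2) * (v q.1 + v q.2) * Kf N s (q.1 - refl e q.2) ∂(rv N R) := by
  rw [bform_rv, ← (rv_mp hR (LinearIsometryEquiv.refl ℝ _) (refl e)).integral_comp (emb_prod _ _)]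
  simp [au _, av _]

/-- kernel difference -/
def dK (N : ℕ) (s : ℝ) (e : Euc N) (q : Euc N × Euc N) : ℝ := Kf N s (q.1 - q.2) - Kf N s (q.1 - refl e q.2)

lemma cross_formula (hR : 0 < R) {e : Euc N} (hu : memHs N s (BB N R) u) (hv : memHs N s (BB N R) v) (au : Asym e u) (av : Asym e v)
    (huv : ∀ x, u x * v x = 0) :
    Integrable (fun q => (u q.1 * v q.2 + u q.2 * v q.1) * dK N s e q) (rv N R) ∧
    bform N s (BB N R) u v = - (1 / 2) * ∫ q, (u q.1 * v q.2 + u q.2 * v q.1) * dK N s e q ∂(rv N R) := by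
  have i1 := integrable_rv hu hv
  have i2 := integrable_rv' hR hu hv au av
  have e0 : ∀ q : Euc N × Euc N, (u q.1 - u q.2) * (v q.1 - v q.2) * Kf N s (q.1 - q.2) +
      (u q.1 + u q.2) * (v q.1 + v q.2) * Kf N s (q.1 - refl e q.2) =
      - ((u q.1 * v q.2 + u q.2 * v q.1) * dK N s e q) := by
    intro q
    have h1 := huv q.1
    have h2 := huv q.2
    unfold dK
    linear_combination (Kf N s (q.1 - q.2) + Kf N s (q.1 - refl e q.2)) * (h1 + h2)
  have i3 := i1.add i2
  constructor
  · refine i3.neg.congr (ae_of_all _ fun q => ?_)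
    simp only [Pi.neg_apply, Pi.add_apply, e0, neg_neg]
  · have h1 : bform N s (BB N R) u v = _ := bform_rv
    have h2 : bform N s (BB N R) u v = _ := bform_rv' hR au av
    have h3 := integral_add i1 i2
    rw [← h1, ← h2] at h3
    simp_rw [e0] at h3
    rw [integral_neg] at h3
    linarith

end

section

variable {N : ℕ} {s : ℝ} {Ω : Set (Euc N)} {u v w : Euc N → ℝ} {R : ℝ} {e : Euc N}

/-- open half space -/
def HH (e : Euc N) : Set (Euc N) := {x | 0 < (inner ℝ x e : ℝ)}

lemma isOpen_HH : IsOpen (HH e) := isOpen_lt continuous_const (by fun_prop)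
lemma measurableSet_HH : MeasurableSet (HH e) := isOpen_HH.measurableSet
lemma mem_HH {x : Euc N} : x ∈ HH e ↔ 0 < (inner ℝ x e : ℝ) := Iff.rfl

lemma refl_mem_HH (he : ‖e‖ = 1) {x : Euc N} : refl e x ∈ HH e ↔ (inner ℝ x e : ℝ) < 0 := by
  rw [mem_HH, inner_refl he]; constructor <;> intro h <;> linarith

/-- `K(x-y) ≥ K(x-σy)` on the same side -/
lemma dK_nonneg (hs : 0 < s) (he : ‖e‖ = 1) {x y : Euc N} (hxy : x ≠ y) 
    (h : 0 ≤ (inner ℝ x e : ℝ) * (inner ℝ y e : ℝ)) : 0 ≤ dK N s e (x, y) := by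
  unfold dK
  refine sub_nonneg.2 (Kf_antitone hs (sub_ne_zero.2 hxy) ?_)
  refine le_of_sq_le_sq ?_ (norm_nonneg _)
  rw [norm_sub_refl he]; nlinarith

lemma dK_nonpos (hs : 0 < s) (he : ‖e‖ = 1) {x y : Euc N} (hxy : x ≠ refl e y) 
    (h : (inner ℝ x e : ℝ) * (inner ℝ y e : ℝ) ≤ 0) : dK N s e (x, y) ≤ 0 := by
  unfold dK
  refine sub_nonpos.2 (Kf_antitone hs (sub_ne_zero.2 hxy) ?_)
  refine le_of_sq_le_sq ?_ (norm_nonneg _)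
  rw [norm_sub_refl he]; nlinarith

lemma dK_pos [NeZero N] (hs : 0 < s) (he : ‖e‖ = 1) {x y : Euc N} (hxy : x ≠ y) 
    (h : 0 < (inner ℝ x e : ℝ) * (inner ℝ y e : ℝ)) : 0 < dK N s e (x, y) := by
  unfold dK Kf
  refine sub_pos.2 ?_
  have h0 : 0 < ‖x - y‖ := norm_pos_iff.2 (sub_ne_zero.2 hxy)
  have : ‖x - y‖ < ‖x - refl e y‖ := by
    refine lt_of_pow_lt_pow_left₀ 2 (norm_nonneg _) ?_
    rw [norm_sub_refl he]; nlinarith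
  simp only
  gcongr

lemma ae_ne_refl [NeZero N] : ∀ᵐ q : Euc N × Euc N, q.1 ≠ q.2 ∧ q.1 ≠ refl e q.2 := by
  refine ae_diag.and ?_
  have h := (MeasurePreserving.id (volume : Measure (Euc N))).prod (refl e).measurePreserving
  exact h.quasiMeasurePreserving.ae ae_diag

lemma memHs_half [NeZero N] (hs : s ∈ Ioo (0 : ℝ) 1) (hR : 0 < R) (he : ‖e‖ = 1) (hu : memHs N s (BB N R) u) (au : Asym e u) :
    memHs N s (BB N R) ((HH e).indicator u) := by
  have hm : Measurable ((HH e).indicator u) := hu.meas.indicator measurableSet_HH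
  refine ⟨hm, ?_, ?_⟩
  · refine lt_of_le_of_lt (lintegral_mono fun x => ENNReal.ofReal_le_ofReal ?_) hu.2.1
    by_cases h : x ∈ HH e
    · simp [h]
    · simp [h, sq_nonneg]
  · set F : Euc N × Euc N → ℝ≥0∞ := fun q => ENNReal.ofReal ((u q.1 - u q.2) ^ 2 / kern N s q.1 q.2)
    have hF : ∫⁻ q, F q ∂(rv N R) < ⊤ := hu.2.2
    have hFm : Measurable F := by
      have := hu.meas
      have := measurable_kern (N := N) (s := s)
      fun_prop
    have hF2 : ∫⁻ q, F (q.1, refl e q.2) ∂(rv N R) = ∫⁻ q, F q ∂(rv N R) :=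
      (rv_mp hR (LinearIsometryEquiv.refl ℝ _) (refl e)).lintegral_comp hFm
    have : semiSq N s (BB N R) ((HH e).indicator u) ≤ ∫⁻ q, (F q + F (q.1, refl e q.2)) ∂(rv N R) := by
      refine lintegral_mono_ae ?_
      filter_upwards [ae_restrict_of_ae (ae_ne_refl (e := e))] with q hq
      have hpos : ∀ a b : ℝ, ∀ x y : Euc N, ENNReal.ofReal ((a - b) ^ 2 / kern N s x y) = 
        ENNReal.ofReal ((a - b) ^ 2 * Kf N s (x - y)) := fun a b x y => rfl
      rw [show F q = _ from hpos _ _ _ _, show F (q.1, refl e q.2) = _ from hpos _ _ _ _, hpos,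
        ← ENNReal.ofReal_add (mul_nonneg (sq_nonneg _) (Kf_nonneg _)) (mul_nonneg (sq_nonneg _) (Kf_nonneg _))]
      apply ENNReal.ofReal_le_ofReal
      simp only
      rw [au]
      have k1 := Kf_nonneg (N := N) (s := s) (q.1 - q.2)
      have k2 := Kf_nonneg (N := N) (s := s) (q.1 - refl e q.2)
      have hopp : (inner ℝ q.1 e : ℝ) * (inner ℝ q.2 e : ℝ) ≤ 0 → Kf N s (q.1 - q.2) ≤ Kf N s (q.1 - refl e q.2) := fun h => by
        have := dK_nonpos (N := N) hs.1 he hq.2 h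
        unfold dK at this; simp only at this; linarith
      have hp1 := mul_nonneg (sq_nonneg (u q.1 - u q.2)) k1
      have hp2 := mul_nonneg (sq_nonneg (u q.1 - -u q.2)) k2
      by_cases h1 : q.1 ∈ HH e <;> by_cases h2 : q.2 ∈ HH e
      · simp only [h1, h2, indicator_of_mem]; linarith
      · simp only [h1, h2, indicator_of_mem, not_false_eq_true, indicator_of_notMem]
        rw [mem_HH] at h1 h2
        have := hopp (by nlinarith)
        have h3 := mul_le_mul_of_nonneg_left this (sq_nonneg (u q.1 - -u q.2))
        nlinarith [mul_nonneg (sq_nonneg (u q.2)) k1, mul_nonneg (sq_nonneg (u q.1)) k1]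
      · simp only [h1, h2, indicator_of_mem, not_false_eq_true, indicator_of_notMem]
        rw [mem_HH] at h1 h2
        have := hopp (by nlinarith)
        have h3 := mul_le_mul_of_nonneg_left this (sq_nonneg (u q.1 - -u q.2))
        nlinarith [mul_nonneg (sq_nonneg (u q.2)) k1, mul_nonneg (sq_nonneg (u q.1)) k1]
      · simp only [h1, h2, not_false_eq_true, indicator_of_notMem]; linarith
    refine this.trans_lt ?_
    rw [lintegral_add_left hFm, hF2]
    exact ENNReal.add_lt_top.2 ⟨hF, hF⟩

/-- Antisymmetrized positive part on the half space. -/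
def pp (e : Euc N) (u : Euc N → ℝ) (x : Euc N) : ℝ :=
  max ((HH e).indicator u x) 0 - max ((HH e).indicator u (refl e x)) 0

lemma pp_asym (e : Euc N) (u : Euc N → ℝ) : Asym e (pp e u) := fun x => by
  simp only [pp, refl_refl]; ring

lemma pp_mem [NeZero N] (hs : s ∈ Ioo (0 : ℝ) 1) (hR : 0 < R) (he : ‖e‖ = 1) (hu : memHs N s (BB N R) u) (au : Asym e u) :
    memHs N s (BB N R) (pp e u) :=
  (memHs_half hs hR he hu au).pos.sub ((memHs_half hs hR he hu au).pos.comp hR (refl e))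

lemma pp_of_pos (he : ‖e‖ = 1) {x : Euc N} (hx : 0 < (inner ℝ x e : ℝ)) : pp e u x = max (u x) 0 := by
  have h1 : x ∈ HH e := hx
  have h2 : refl e x ∉ HH e := by rw [refl_mem_HH he]; linarith
  simp [pp, h1, h2]

lemma pp_of_neg (he : ‖e‖ = 1) (au : Asym e u) {x : Euc N} (hx : (inner ℝ x e : ℝ) < 0) : pp e u x = min (u x) 0 := by
  have h1 : x ∉ HH e := by rw [mem_HH]; linarith
  have h2 : refl e x ∈ HH e := by rw [refl_mem_HH he]; linarith
  simp only [pp, h1, h2, indicator_of_mem, not_false_eq_true, indicator_of_notMem, au x, max_self, zero_sub]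
  rw [← min_neg_neg]; simp

lemma pp_of_zero (he : ‖e‖ = 1) {x : Euc N} (hx : (inner ℝ x e : ℝ) = 0) : pp e u x = 0 :=
  (pp_asym e u).zero he hx

lemma pp_nonneg (he : ‖e‖ = 1) {x : Euc N} (hx : 0 ≤ (inner ℝ x e : ℝ)) : 0 ≤ pp e u x := by
  rcases hx.eq_or_lt with h | h
  · rw [pp_of_zero he h.symm]
  · rw [pp_of_pos he h]; exact le_max_right _ _

lemma pp_nonpos (he : ‖e‖ = 1) {x : Euc N} (hx : (inner ℝ x e : ℝ) ≤ 0) : pp e u x ≤ 0 := by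
  have h := pp_nonneg (u := u) (x := refl e x) he (by rw [inner_refl he]; linarith)
  rw [pp_asym] at h; linarith

lemma pp_sub (he : ‖e‖ = 1) (au : Asym e u) (x : Euc N) : u x = pp e u x - pp e (fun y => - u y) x := by
  have au' : Asym e (fun y => - u y) := fun y => by simp [au y]
  rcases lt_trichotomy (inner ℝ x e : ℝ) 0 with h | h | h
  · rw [pp_of_neg he au h, pp_of_neg he au' h]
    rcases le_total (u x) 0 with h | h <;> simp [h]
  · rw [pp_of_zero he h, pp_of_zero he h, au.zero he h]; simp
  · rw [pp_of_pos he h, pp_of_pos he h]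
    rcases le_total (u x) 0 with h | h <;> simp [h]

lemma pp_mul (he : ‖e‖ = 1) (au : Asym e u) (x : Euc N) : pp e u x * pp e (fun y => - u y) x = 0 := by
  have au' : Asym e (fun y => - u y) := fun y => by simp [au y]
  rcases lt_trichotomy (inner ℝ x e : ℝ) 0 with h | h | h
  · rw [pp_of_neg he au h, pp_of_neg he au' h]
    rcases le_total (u x) 0 with h | h <;> simp [h]
  · rw [pp_of_zero he h, pp_of_zero he h]; simp
  · rw [pp_of_pos he h, pp_of_pos he h]
    rcases le_total (u x) 0 with h | h <;> simp [h]

/-- sign of the cross term -/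
lemma cross_nonneg [NeZero N] (hs : 0 < s) (he : ‖e‖ = 1) {a b : Euc N → ℝ} 
    (ha : ∀ x, 0 ≤ (inner ℝ x e : ℝ) → 0 ≤ a x) (ha' : ∀ x, (inner ℝ x e : ℝ) ≤ 0 → a x ≤ 0)
    (hb : ∀ x, 0 ≤ (inner ℝ x e : ℝ) → 0 ≤ b x) (hb' : ∀ x, (inner ℝ x e : ℝ) ≤ 0 → b x ≤ 0) :
    ∀ᵐ q : Euc N × Euc N, 0 ≤ (a q.1 * b q.2 + a q.2 * b q.1) * dK N s e q := by
  filter_upwards [ae_ne_refl (e := e)] with q hq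
  rcases le_total 0 (inner ℝ q.1 e : ℝ) with h1 | h1 <;> rcases le_total 0 (inner ℝ q.2 e : ℝ) with h2 | h2
  · exact mul_nonneg (add_nonneg (mul_nonneg (ha _ h1) (hb _ h2)) (mul_nonneg (ha _ h2) (hb _ h1)))
      (dK_nonneg hs he hq.1 (mul_nonneg h1 h2))
  · refine mul_nonneg_of_nonpos_of_nonpos ?_ (dK_nonpos hs he hq.2 (mul_nonpos_of_nonneg_of_nonpos h1 h2))
    exact add_nonpos (mul_nonpos_of_nonneg_of_nonpos (ha _ h1) (hb' _ h2)) (mul_nonpos_of_nonpos_of_nonneg (ha' _ h2) (hb _ h1))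
  · refine mul_nonneg_of_nonpos_of_nonpos ?_ (dK_nonpos hs he hq.2 (mul_nonpos_of_nonpos_of_nonneg h1 h2))
    exact add_nonpos (mul_nonpos_of_nonpos_of_nonneg (ha' _ h1) (hb _ h2)) (mul_nonpos_of_nonneg_of_nonpos (ha _ h2) (hb' _ h1))
  · exact mul_nonneg (add_nonneg (mul_nonneg_of_nonpos_of_nonpos (ha' _ h1) (hb' _ h2)) (mul_nonneg_of_nonpos_of_nonpos (ha' _ h2) (hb' _ h1)))
      (dK_nonneg hs he hq.1 (mul_nonneg_of_nonpos_of_nonpos h1 h2))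

lemma cross_le [NeZero N] (hs : s ∈ Ioo (0 : ℝ) 1) (hR : 0 < R) (he : ‖e‖ = 1) (hu : memHs N s (BB N R) u) (au : Asym e u) :
    bform N s (BB N R) (pp e u) (pp e (fun y => - u y)) ≤ 0 := by
  have au' : Asym e (fun y => - u y) := fun y => by simp [au y]
  have hu' : memHs N s (BB N R) (fun y => - u y) := by simpa using hu.smul (-1)
  have h := (cross_formula hR (pp_mem hs hR he hu au) (pp_mem hs hR he hu' au') (pp_asym _ _) (pp_asym _ _)
    (pp_mul he au)).2
  rw [h]
  have := integral_nonneg_of_ae (μ := rv N R) (ae_restrict_of_ae (cross_nonneg (a := pp e u) (b := pp e (fun y => - u y)) hs.1 he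
    (fun x => pp_nonneg he) (fun x => pp_nonpos he) (fun x => pp_nonneg he) (fun x => pp_nonpos he)))
  linarith

/-- Testing with the positive part. -/
lemma pp_test [NeZero N] (hs : s ∈ Ioo (0 : ℝ) 1) (hR : 0 < R) (he : ‖e‖ = 1) (hu : memHs N s (BB N R) u) (au : Asym e u) :
    bform N s (BB N R) u (pp e u) = bform N s (BB N R) (pp e u) (pp e u) -
      bform N s (BB N R) (pp e u) (pp e (fun y => - u y)) := by
  have au' : Asym e (fun y => - u y) := fun y => by simp [au y]
  have hu' : memHs N s (BB N R) (fun y => - u y) := by simpa using hu.smul (-1)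
  have e1 : u = fun x => pp e u x - pp e (fun y => - u y) x := funext (pp_sub he au)
  conv_lhs => rw [show bform N s (BB N R) u (pp e u) = bform N s (BB N R) (fun x => pp e u x - pp e (fun y => - u y) x) (pp e u) by rw [← e1]]
  rw [bform_sub_left (pp_mem hs hR he hu au) (pp_mem hs hR he hu' au') (pp_mem hs hR he hu au), 
    bform_symm (u := pp e (fun y => - u y))]

theorem sign_const [NeZero N] (hs : s ∈ Ioo (0 : ℝ) 1) (hR : 0 < R) (he : ‖e‖ = 1) (hu : IsEig N s (BB N R) u) (au : Asym e u) :
    (∀ᵐ x, x ∈ HH e → x ∈ BB N R → 0 ≤ u x) ∨ (∀ᵐ x, x ∈ HH e → x ∈ BB N R → u x ≤ 0) := by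
  have au' : Asym e (fun y => - u y) := fun y => by simp [au y]
  have hu' : memHs N s (BB N R) (fun y => - u y) := by simpa using hu.mem.smul (-1)
  have hp := pp_mem hs hR he hu.mem au
  have hq := pp_mem hs hR he hu' au'
  have h1 := pp_test hs hR he hu.mem au
  have h2 := hu.weak' hs hp
  have h3 := rayleigh' hs hp (pp_asym e u).mean
  have h4 : ∫ x in BB N R, u x * pp e u x = ∫ x in BB N R, pp e u x ^ 2 := by
    congr 1; ext x
    have a1 := pp_sub he au x
    have a2 := pp_mul he au x
    linear_combination pp e u x * a1 - a2
  obtain ⟨hIntg0, hcf⟩ := cross_formula hR hp hq (pp_asym _ _) (pp_asym _ _) (pp_mul he au)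
  have hle := cross_le hs hR he hu.mem au
  have hnn := (ae_restrict_of_ae (s := reg N (BB N R)) (cross_nonneg (a := pp e u) (b := pp e (fun y => - u y)) hs.1 he
    (fun x => pp_nonneg he) (fun x => pp_nonpos he) (fun x => pp_nonneg he) (fun x => pp_nonpos he)))
  have h0 : ∫ q, (pp e u q.1 * pp e (fun y => - u y) q.2 + pp e u q.2 * pp e (fun y => - u y) q.1) * dK N s e q ∂(rv N R) = 0 := by
    rw [h4] at h2
    have := integral_nonneg_of_ae hnn
    have := this.trans_eq rfl
    linarith
  rw [integral_eq_zero_iff_of_nonneg_ae hnn hIntg0] at h0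
  have h5 := (ae_restrict_iff' (measurableSet_reg (N := N) (Ω := BB N R))).1 h0
  have h6 := ae_left (h5.and ae_diag |>.mono fun q hq hr => (⟨hq.1 hr, hq.2⟩ : _ ∧ q.1 ≠ q.2))
  by_contra hcon
  push Not at hcon
  obtain ⟨c1, c2⟩ := hcon
  obtain ⟨x, ⟨hxH, hxB, hxu⟩, hx6⟩ := (c2.and_eventually h6).exists
  apply c1
  filter_upwards [hx6 hxB] with y hy
  rintro ⟨hyH, hyB, hyu⟩
  obtain ⟨hy1, hy2⟩ := hy
  simp only [Pi.zero_apply] at hy1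
  have hd := dK_pos (N := N) hs.1 he hy2 (mul_pos hxH hyH)
  have := (mul_eq_zero.1 hy1).resolve_right hd.ne'
  rw [pp_of_pos he hxH, pp_of_pos he hyH, pp_of_pos he hxH, pp_of_pos he hyH, max_eq_left hxu.le,
    max_eq_right (show -u x ≤ 0 by linarith)] at this
  rw [max_eq_left (show 0 ≤ - u y by linarith)] at this
  nlinarith

end

section

variable {N : ℕ} {s : ℝ} {Ω : Set (Euc N)} {u v w : Euc N → ℝ} {R : ℝ} {e : Euc N}

lemma ae_iso {p : Euc N → Prop} (Q : Euc N ≃ₗᵢ[ℝ] Euc N) (h : ∀ᵐ x, p x) : ∀ᵐ x, p (Q x) :=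
  (LinearIsometryEquiv.measurePreserving Q).quasiMeasurePreserving.ae h

lemma vol_BB_ne_top : volume (BB N R) ≠ ⊤ := measure_ball_lt_top.ne
lemma vol_BB_ne_zero (hR : 0 < R) : volume (BB N R) ≠ 0 := (Metric.measure_ball_pos _ _ hR).ne'
lemma meas_BB : MeasurableSet (BB N R) := Metric.isOpen_ball.measurableSet

lemma refl_mem_BB {x : Euc N} : refl e x ∈ BB N R ↔ x ∈ BB N R := by simp
lemma iso_mem_BB (Q : Euc N ≃ₗᵢ[ℝ] Euc N) {x : Euc N} : Q x ∈ BB N R ↔ x ∈ BB N R := by simp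

lemma Asym.zero_of_half [NeZero N] (hs : s ∈ Ioo (0 : ℝ) 1) (hR : 0 < R) (he : ‖e‖ = 1) (hu : IsEig N s (BB N R) u) (au : Asym e u)
    (h : ∀ᵐ x, x ∈ HH e → x ∈ BB N R → u x = 0) : u =ᵐ[volume] 0 := by
  refine hu.eq_zero_of hs (vol_BB_ne_zero hR) ?_ meas_BB
  have h' := ae_iso (refl e) h
  rw [Filter.EventuallyEq, ae_restrict_iff' meas_BB]
  filter_upwards [h, h'] with x h1 h2 hx
  rcases lt_trichotomy (inner ℝ x e : ℝ) 0 with h3 | h3 | h3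
  · have := h2 ((refl_mem_HH he).2 h3) (refl_mem_BB.2 hx)
    rw [au] at this; simpa using this
  · exact au.zero he h3
  · exact h1 h3 hx

lemma half_zero [NeZero N] (hs : s ∈ Ioo (0 : ℝ) 1) (hR : 0 < R) (he : ‖e‖ = 1) (hu : IsEig N s (BB N R) u) (au : Asym e u)
    (h : ∫ x in HH e ∩ BB N R, u x = 0) : u =ᵐ[volume] 0 := by
  have hm : MeasurableSet (HH e ∩ BB N R) := measurableSet_HH.inter meas_BB
  have hi : IntegrableOn u (HH e ∩ BB N R) := IntegrableOn.mono_set (hu.mem.integrable vol_BB_ne_top) inter_subset_right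
  refine au.zero_of_half hs hR he hu ?_
  rcases sign_const hs hR he hu au with h1 | h1
  · have h2 : 0 ≤ᵐ[volume.restrict (HH e ∩ BB N R)] u := by
      rw [Filter.EventuallyLE, ae_restrict_iff' hm]
      filter_upwards [h1] with x hx hh using hx hh.1 hh.2
    rw [integral_eq_zero_iff_of_nonneg_ae h2 hi, Filter.EventuallyEq, ae_restrict_iff' hm] at h
    filter_upwards [h] with x hx h3 h4 using hx ⟨h3, h4⟩
  · have h2 : 0 ≤ᵐ[volume.restrict (HH e ∩ BB N R)] (fun x => - u x) := by
      rw [Filter.EventuallyLE, ae_restrict_iff' hm]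
      filter_upwards [h1] with x hx hh
      simpa using hx hh.1 hh.2
    have h' : ∫ x in HH e ∩ BB N R, - u x = 0 := by rw [integral_neg, h, neg_zero]
    rw [integral_eq_zero_iff_of_nonneg_ae h2 hi.neg, Filter.EventuallyEq, ae_restrict_iff' hm] at h'
    filter_upwards [h'] with x hx h3 h4
    simpa using hx ⟨h3, h4⟩

/-- The space of antisymmetric eigenfunctions is at most one-dimensional. -/
theorem asym_dim [NeZero N] (hs : s ∈ Ioo (0 : ℝ) 1) (hR : 0 < R) (he : ‖e‖ = 1) (hu : IsEig N s (BB N R) u) (au : Asym e u)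
    (hw : IsEig N s (BB N R) w) (aw : Asym e w) (hw0 : ¬ w =ᵐ[volume] 0) :
    ∃ t : ℝ, ∀ᵐ x, u x = t * w x := by
  have hI : ∫ x in HH e ∩ BB N R, w x ≠ 0 := fun h => hw0 (half_zero hs hR he hw aw h)
  set t := (∫ x in HH e ∩ BB N R, u x) / ∫ x in HH e ∩ BB N R, w x with ht
  refine ⟨t, ?_⟩
  have hiu : IntegrableOn u (HH e ∩ BB N R) := IntegrableOn.mono_set (hu.mem.integrable vol_BB_ne_top) inter_subset_right
  have hiw : IntegrableOn w (HH e ∩ BB N R) := IntegrableOn.mono_set (hw.mem.integrable vol_BB_ne_top) inter_subset_right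
  have := half_zero hs hR he (hu.sub vol_BB_ne_top (hw.smul t)) (au.sub (aw.smul t)) (by
    rw [integral_sub hiu (hiw.const_mul t), integral_const_mul, ht, div_mul_cancel₀ _ hI, sub_self])
  filter_upwards [this] with x hx
  simpa [sub_eq_zero] using hx

end

section

variable {N : ℕ} {s : ℝ} {Ω : Set (Euc N)} {u v w : Euc N → ℝ} {R : ℝ} {e : Euc N}

lemma wcs {a b : ℝ} (hab : a ≤ b) {w g : ℝ → ℝ} (hw : Continuous w) (hg : Continuous g) (hw0 : ∀ t ∈ Icc a b, 0 ≤ w t) :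
    (∫ t in a..b, w t * g t) ^ 2 ≤ (∫ t in a..b, w t) * ∫ t in a..b, w t * g t ^ 2 := by
  set W := ∫ t in a..b, w t with hW
  set G := ∫ t in a..b, w t * g t with hG
  set V := ∫ t in a..b, w t * g t ^ 2 with hV
  have hW0 : 0 ≤ W := intervalIntegral.integral_nonneg hab hw0
  have key : ∀ c d : ℝ, 0 ≤ c ^ 2 * V - 2 * c * d * G + d ^ 2 * W := by
    intro c d
    have h1 : ∫ t in a..b, w t * (c * g t - d) ^ 2 = c ^ 2 * V - 2 * c * d * G + d ^ 2 * W := by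
      rw [hV, hG, hW, ← intervalIntegral.integral_const_mul, ← intervalIntegral.integral_const_mul, ← intervalIntegral.integral_const_mul,
        ← intervalIntegral.integral_sub, ← intervalIntegral.integral_add]
      · congr 1; ext t; ring
      all_goals apply Continuous.intervalIntegrable; fun_prop
    rw [← h1]
    exact intervalIntegral.integral_nonneg hab fun t ht => mul_nonneg (hw0 t ht) (sq_nonneg _)
  by_contra hcon
  push Not at hcon
  have hG0 : G ^ 2 > 0 := lt_of_le_of_lt (mul_nonneg hW0 (by simpa using key 1 0)) hcon
  rcases hW0.eq_or_lt with h0 | h0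
  · have h2 := key 1 ((V + 1) / (2 * G) )
    have hGne : G ≠ 0 := by rintro h; simp [h] at hG0
    rw [← h0] at h2
    have : 2 * 1 * ((V + 1) / (2 * G)) * G = V + 1 := by field_simp
    rw [this] at h2; linarith
  · have h2 := key W G
    nlinarith

lemma poincare1 (n : ℕ) (hR : 0 < R) {F F' : ℝ → ℝ} (hF : ∀ t, HasDerivAt F (F' t) t) (hc : Continuous F') :
    ∃ m : ℝ, ∫ t in (0:ℝ)..R, t ^ n * (F t - m) ^ 2 ≤ R ^ 2 / (2 * (n + 3)) * ∫ t in (0:ℝ)..R, t ^ n * F' t ^ 2 := by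
  have hFc : Continuous F := continuous_iff_continuousAt.2 fun t => (hF t).continuousAt
  set m := (∫ t in (0:ℝ)..R, t ^ n * F t) / (R ^ (n + 1) / (n + 1)) with hm
  refine ⟨m, ?_⟩
  set V := ∫ t in (0:ℝ)..R, t ^ n * (F t - m) ^ 2 with hV
  set c := R ^ 2 / (2 * ((n:ℝ) + 3)) with hcc
  have hc0 : 0 < c := by positivity
  let H : ℝ → ℝ := fun t => ∫ x in (0:ℝ)..t, x ^ n * (F x - m)
  have hgc : Continuous fun x : ℝ => x ^ n * (F x - m) := by fun_prop
  have hH : ∀ t, HasDerivAt H (t ^ n * (F t - m)) t := fun t =>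
    intervalIntegral.integral_hasDerivAt_right (hgc.intervalIntegrable _ _) (hgc.stronglyMeasurableAtFilter _ _) hgc.continuousAt
  have hHc : Continuous H := continuous_iff_continuousAt.2 fun t => (hH t).continuousAt
  have hH0 : H 0 = 0 := by simp [H]
  have hHR : H R = 0 := by
    have : H R = (∫ t in (0:ℝ)..R, t ^ n * F t) - m * (R ^ (n+1) / (n+1)) := by
      have h1 : ∫ t in (0:ℝ)..R, t ^ n = R ^ (n+1) / (n+1) := by simp
      rw [← h1, ← intervalIntegral.integral_const_mul, ← intervalIntegral.integral_sub]
      · simp only [H]; congr 1; ext t; ring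
      all_goals apply Continuous.intervalIntegrable; fun_prop
    rw [this, hm, div_mul_cancel₀, sub_self]; positivity
  have hV0 : 0 ≤ V := intervalIntegral.integral_nonneg hR.le fun t ht => by have := ht.1; positivity
  -- integration by parts
  have ibp : V = - ∫ t in (0:ℝ)..R, F' t * H t := by
    have := intervalIntegral.integral_mul_deriv_eq_deriv_mul (a := 0) (b := R) (u := fun t => F t - m) (v := H) (u' := F') (v' := fun t => t ^ n * (F t - m))
      (fun t _ => (hF t).sub_const m) (fun t _ => hH t) (hc.intervalIntegrable _ _) (hgc.intervalIntegrable _ _)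
    rw [hHR, hH0] at this
    rw [hV]
    simp only [mul_zero, sub_zero, zero_sub] at this
    rw [← this]; congr 1; ext t; ring
  -- bound on H
  have hb : ∀ t ∈ Icc 0 R, H t ^ 2 ≤ t ^ n * (t * (R ^ (n+1) - t ^ (n+1)) / ((n+1) * R ^ (n+1))) * V := by
    intro t ht
    have h1 := wcs ht.1 (w := fun t => t ^ n) (g := fun t => F t - m) (by fun_prop) (by fun_prop) (fun x hx => by have := hx.1; positivity)
    have h2 := wcs ht.2 (w := fun t => t ^ n) (g := fun t => F t - m) (by fun_prop) (by fun_prop) (fun x hx => by have := ht.1.trans hx.1; positivity)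
    have e1 : H t + ∫ x in t..R, x ^ n * (F x - m) = 0 := by
      rw [← hHR]; exact intervalIntegral.integral_add_adjacent_intervals (hgc.intervalIntegrable _ _) (hgc.intervalIntegrable _ _)
    have hg2 : Continuous fun x : ℝ => x ^ n * (F x - m) ^ 2 := by fun_prop
    have e2 : (∫ x in (0:ℝ)..t, x ^ n * (F x - m) ^ 2) + ∫ x in t..R, x ^ n * (F x - m) ^ 2 = V :=
      intervalIntegral.integral_add_adjacent_intervals (hg2.intervalIntegrable _ _) (hg2.intervalIntegrable _ _)
    have e3 : (∫ x in t..R, x ^ n * (F x - m)) ^ 2 = H t ^ 2 := by rw [← neg_eq_of_add_eq_zero_right e1]; ring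
    rw [e3] at h2
    change H t ^ 2 ≤ _ at h1
    simp only [integral_pow] at h1 h2
    set V1 := ∫ x in (0:ℝ)..t, x ^ n * (F x - m) ^ 2
    set V2 := ∫ x in t..R, x ^ n * (F x - m) ^ 2
    have hA : 0 < R ^ (n+1) := by positivity
    have ha : 0 ≤ t ^ (n+1) := pow_nonneg ht.1 _
    have hbb : 0 ≤ R ^ (n+1) - t ^ (n+1) := sub_nonneg.2 (pow_le_pow_left₀ ht.1 ht.2 _)
    have q : t ^ n * (t * (R ^ (n+1) - t ^ (n+1)) / ((n+1) * R ^ (n+1))) * V = (t ^ (n+1) * (R ^ (n+1) - t ^ (n+1)) / (n+1) * (V1 + V2)) / R ^ (n+1) := by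
      rw [← e2]; field_simp; ring
    rw [q, le_div_iff₀ hA]
    have i1 := mul_le_mul_of_nonneg_left h1 hbb
    have i2 := mul_le_mul_of_nonneg_left h2 ha
    simp only [ne_eq, Nat.add_eq_zero_iff, one_ne_zero, and_false, not_false_eq_true, zero_pow, sub_zero] at i1
    have e4 : t ^ (n+1) * (R ^ (n+1) - t ^ (n+1)) / (n+1) * (V1 + V2) = (R ^ (n+1) - t ^ (n+1)) * (t ^ (n+1) / (n+1) * V1) + t ^ (n+1) * ((R ^ (n+1) - t ^ (n+1)) / (n+1) * V2) := by ring
    rw [e4]; nlinarith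
  have hIntg0 : ∫ t in (0:ℝ)..R, t * (R ^ (n+1) - t ^ (n+1)) / ((n+1) * R ^ (n+1)) = c := by
    have : ∀ t : ℝ, t * (R ^ (n+1) - t ^ (n+1)) / ((n+1) * R ^ (n+1)) = (1 / (n+1)) * t - (1 / ((n+1) * R ^ (n+1))) * t ^ (n+2) := by
      intro t; field_simp; ring
    simp only [this]
    rw [intervalIntegral.integral_sub, intervalIntegral.integral_const_mul, intervalIntegral.integral_const_mul, integral_id, integral_pow, hcc]
    · push_cast; field_simp; ring
    all_goals apply Continuous.intervalIntegrable; fun_prop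
  have hfin : V ≤ ∫ t in (0:ℝ)..R, ((c / 2) * (t ^ n * F' t ^ 2) + (V / (2 * c)) * (t * (R ^ (n+1) - t ^ (n+1)) / ((n+1) * R ^ (n+1)))) := by
    rw [← intervalIntegral.integral_neg] at ibp
    refine ibp.trans_le ?_
    apply intervalIntegral.integral_mono_on hR.le
    · apply Continuous.intervalIntegrable; fun_prop
    · apply Continuous.intervalIntegrable; fun_prop
    intro t ht
    have hbt := hb t ht
    set q := t * (R ^ (n+1) - t ^ (n+1)) / ((n+1) * R ^ (n+1))
    have hq : 0 ≤ q := div_nonneg (mul_nonneg ht.1 (sub_nonneg.2 (pow_le_pow_left₀ ht.1 ht.2 _))) (by positivity)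
    have hw : 0 ≤ t ^ n := pow_nonneg ht.1 _
    have h1 : (F' t * H t) ^ 2 ≤ (c * (t ^ n * F' t ^ 2)) * (V / c * q) := by
      have : (c * (t ^ n * F' t ^ 2)) * (V / c * q) = F' t ^ 2 * (t ^ n * q * V) := by field_simp
      rw [this, mul_pow]; exact mul_le_mul_of_nonneg_left hbt (sq_nonneg _)
    have hX : 0 ≤ c * (t ^ n * F' t ^ 2) := by positivity
    have hY : 0 ≤ V / c * q := by positivity
    have e5 : V / (2 * c) * q = (V / c * q) / 2 := by field_simp
    rw [e5]
    set X := c * (t ^ n * F' t ^ 2)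
    set Y := V / c * q
    have : |F' t * H t| ≤ (X + Y) / 2 := by
      refine abs_le_of_sq_le_sq ?_ (by positivity)
      refine h1.trans ?_
      nlinarith [sq_nonneg (X - Y)]
    have := (abs_le.1 this).1
    have e6 : c / 2 * (t ^ n * F' t ^ 2) = X / 2 := by simp only [X]; ring
    rw [e6]; linarith
  rw [intervalIntegral.integral_add, intervalIntegral.integral_const_mul, intervalIntegral.integral_const_mul, hIntg0] at hfin
  · have : V / (2 * c) * c = V / 2 := by field_simp
    rw [this] at hfin; linarith
  all_goals apply Continuous.intervalIntegrable; fun_prop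

end

section

variable {N : ℕ} {s : ℝ} {Ω : Set (Euc N)} {u v w : Euc N → ℝ} {R : ℝ} {e : Euc N}

structure Moll (N : ℕ) (s ε r : ℝ) (κ ψ : ℝ → ℝ) : Prop where
  cont : Continuous κ
  nonneg : ∀ v, 0 ≤ κ v
  der : ∀ w, HasDerivAt ψ (-(κ w) / 2) w
  van : ∀ w, r ^ 2 ≤ w → κ w = 0 ∧ ψ w = 0
  psi0 : ∀ w, 0 ≤ w → 0 ≤ ψ w
  psi1 : ∀ w, 0 ≤ w → ψ w ≤ r ^ 2 / 2 * κ w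
  le : ∀ h : Euc N, h ≠ 0 → κ (‖h‖ ^ 2) ≤ Kf N s h
  ge : ∀ h : Euc N, ε ≤ ‖h‖ → Kf N s h - (r ^ ((N:ℝ) + 2 * s))⁻¹ ≤ κ (‖h‖ ^ 2)

lemma exists_moll (hs : s ∈ Ioo (0 : ℝ) 1) {ε r : ℝ} (hε : 0 < ε) (hr : 0 < r) :
    ∃ κ ψ, Moll N s ε r κ ψ := by
  set p : ℝ := ((N:ℝ) + 2 * s) / 2 with hp
  have hp0 : 0 < p := by have := hs.1; positivity
  let κ : ℝ → ℝ := fun v => max 0 ((max v (ε^2)) ^ (-p) - (r^2) ^ (-p))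
  have hmax : ∀ v : ℝ, 0 < max v (ε^2) := fun v => lt_max_of_lt_right (by positivity)
  have hc : Continuous κ := by
    apply continuous_const.max
    refine Continuous.sub ?_ continuous_const
    exact Continuous.rpow_const (by fun_prop) fun v => Or.inl (hmax v).ne'
  have h0 : ∀ v, 0 ≤ κ v := fun v => le_max_left _ _
  have hanti : Antitone κ := by
    intro a b hab
    apply max_le_max le_rfl
    apply sub_le_sub_right
    exact Real.rpow_le_rpow_of_nonpos (hmax a) (max_le_max hab le_rfl) (by linarith)
  have hvan : ∀ w, r ^ 2 ≤ w → κ w = 0 := by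
    intro w hw
    apply max_eq_left
    rw [sub_nonpos]
    exact Real.rpow_le_rpow_of_nonpos (by positivity) (hw.trans (le_max_left _ _)) (by linarith)
  have hpow : ∀ t : ℝ, 0 ≤ t → (t ^ 2) ^ (-p) = (t ^ ((N:ℝ) + 2 * s))⁻¹ := by
    intro t ht
    rw [← Real.rpow_natCast, ← Real.rpow_mul ht, ← Real.rpow_neg ht]; congr 1; rw [hp]; push_cast; ring
  let ψ : ℝ → ℝ := fun w => (∫ x in w..(r^2), κ x) / 2
  have hpsivan : ∀ w, r ^ 2 ≤ w → ψ w = 0 := by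
    intro w hw
    have : ∫ x in w..(r^2), κ x = 0 := by
      rw [intervalIntegral.integral_symm, neg_eq_zero]
      apply intervalIntegral.integral_zero_ae
      refine Eventually.of_forall fun x hx => ?_
      rw [uIoc_of_le hw] at hx
      exact hvan x hx.1.le
    simp [ψ, this]
  refine ⟨κ, ψ, hc, h0, fun w => ?_, fun w hw => ⟨hvan w hw, hpsivan w hw⟩, fun w hw => ?_, fun w hw => ?_, fun h hh => ?_, fun h hh => ?_⟩
  · exact (intervalIntegral.integral_hasDerivAt_left (hc.intervalIntegrable _ _) (hc.stronglyMeasurableAtFilter _ _) hc.continuousAt).div_const 2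
  · rcases le_total (r^2) w with h | h
    · rw [hpsivan w h]
    · exact div_nonneg (intervalIntegral.integral_nonneg h fun x _ => h0 x) two_pos.le
  · rcases le_total (r^2) w with h | h
    · rw [hpsivan w h]; exact mul_nonneg (by positivity) (h0 _)
    · have : ∫ x in w..(r^2), κ x ≤ ∫ x in w..(r^2), κ w := by
        apply intervalIntegral.integral_mono_on h (hc.intervalIntegrable _ _) (by simp)
        intro x hx; exact hanti hx.1
      simp only [intervalIntegral.integral_const, smul_eq_mul] at this
      simp only [ψ]
      nlinarith [h0 w]
  · have hn : 0 < ‖h‖ := norm_pos_iff.2 hh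
    apply max_le (Kf_nonneg _)
    have h1 : (max (‖h‖^2) (ε^2)) ^ (-p) ≤ (‖h‖^2) ^ (-p) :=
      Real.rpow_le_rpow_of_nonpos (by positivity) (le_max_left _ _) (by linarith)
    rw [hpow _ hn.le] at h1
    have : 0 ≤ (r^2) ^ (-p) := by positivity
    unfold Kf; linarith
  · have : max (‖h‖^2) (ε^2) = ‖h‖^2 := max_eq_left (pow_le_pow_left₀ hε.le hh 2)
    refine le_trans (le_of_eq ?_) (le_max_right _ _)
    rw [this, hpow _ (norm_nonneg _), hpow _ hr.le]; rfl

section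
variable {ε r : ℝ} {κ ψ : ℝ → ℝ}

/-- the mollifier -/
def Ph (N : ℕ) (ψ : ℝ → ℝ) (h : Euc N) : ℝ := ψ (‖h‖ ^ 2)

lemma Moll.hasFDerivAt (m : Moll N s ε r κ ψ) (h : Euc N) :
    HasFDerivAt (Ph N ψ) ((-(κ (‖h‖^2))) • innerSL ℝ h) h := by
  have h1 : HasFDerivAt (fun h : Euc N => ‖h‖ ^ 2) (2 • innerSL ℝ h) h := (hasStrictFDerivAt_norm_sq h).hasFDerivAt
  have := (m.der (‖h‖^2)).comp_hasFDerivAt h h1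
  have e : (-(κ (‖h‖^2)) / 2) • (2 • innerSL ℝ h) = (-(κ (‖h‖^2))) • innerSL ℝ h := by
    ext y; simp; ring
  rw [e] at this; exact this

lemma Moll.fderiv (m : Moll N s ε r κ ψ) (h : Euc N) : fderiv ℝ (Ph N ψ) h = (-(κ (‖h‖^2))) • innerSL ℝ h := (m.hasFDerivAt h).fderiv

lemma Moll.contDiff (m : Moll N s ε r κ ψ) : ContDiff ℝ 1 (Ph N ψ) := by
  rw [contDiff_one_iff_fderiv]
  refine ⟨fun h => (m.hasFDerivAt h).differentiableAt, ?_⟩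
  have : _root_.fderiv ℝ (Ph N ψ) = fun h => (-(κ (‖h‖^2))) • innerSL ℝ h := funext m.fderiv
  rw [this]
  have := m.cont
  fun_prop

lemma Moll.continuous (m : Moll N s ε r κ ψ) : Continuous (Ph N ψ) := m.contDiff.continuous

lemma Moll.supp (m : Moll N s ε r κ ψ) (hr : 0 < r) : HasCompactSupport (Ph N ψ) := by
  refine HasCompactSupport.intro (isCompact_closedBall (0 : Euc N) r) fun x hx => ?_
  simp only [Metric.mem_closedBall, dist_zero_right, not_le] at hx
  exact (m.van _ (pow_le_pow_left₀ hr.le hx.le 2)).2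

lemma Moll.suppk (m : Moll N s ε r κ ψ) (hr : 0 < r) : HasCompactSupport (fun h : Euc N => κ (‖h‖^2)) := by
  refine HasCompactSupport.intro (isCompact_closedBall (0 : Euc N) r) fun x hx => ?_
  simp only [Metric.mem_closedBall, dist_zero_right, not_le] at hx
  exact (m.van _ (pow_le_pow_left₀ hr.le hx.le 2)).1

lemma Moll.integrable_mul (m : Moll N s ε r κ ψ) (hr : 0 < r) {g : Euc N → ℝ} (hg : Continuous g) :
    Integrable fun h => g h * κ (‖h‖^2) := by
  have := m.cont
  exact Continuous.integrable_of_hasCompactSupport (by fun_prop) ((m.suppk hr).mul_left)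

lemma Moll.J_eq (m : Moll N s ε r κ ψ) (hr : 0 < r) {a : Euc N} (ha : ‖a‖ = 1) :
    ∫ h, (inner ℝ h a : ℝ) ^ 2 * κ (‖h‖^2) = ∫ h, Ph N ψ h := by
  have hd : Differentiable ℝ (fun h : Euc N => (inner ℝ h a : ℝ)) := differentiable_id.inner ℝ (differentiable_const a)
  have hfd : ∀ h, _root_.fderiv ℝ (fun h : Euc N => (inner ℝ h a : ℝ)) h a = 1 := by
    intro h
    have e : (fun h : Euc N => (inner ℝ h a : ℝ)) = fun h => innerSL ℝ a h := by ext; simp [real_inner_comm]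
    rw [e, ContinuousLinearMap.fderiv]; simp [ha]
  have key := integral_mul_fderiv_eq_neg_fderiv_mul_of_integrable (μ := (volume : Measure (Euc N))) (f := fun h : Euc N => (inner ℝ h a : ℝ)) (g := Ph N ψ) (v := a)
    ?_ ?_ ?_ (fun h _ => hd h) (fun h _ => (m.hasFDerivAt h).differentiableAt)
  · simp only [hfd, m.fderiv, one_mul] at key
    rw [← neg_inj, ← key, ← integral_neg]; congr 1; ext h
    simp; ring
  · simp only [hfd, one_mul]; exact m.continuous.integrable_of_hasCompactSupport (m.supp hr)
  · simp only [m.fderiv]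
    have := m.integrable_mul hr (g := fun h => - (inner ℝ h a : ℝ)^2) (by fun_prop)
    refine this.congr (Eventually.of_forall fun h => ?_)
    simp; ring
  · have := m.continuous
    exact Continuous.integrable_of_hasCompactSupport (by fun_prop) ((m.supp hr).mul_left)

end

end

section
open scoped Convolution

variable {N : ℕ} {s : ℝ} {Ω : Set (Euc N)} {u v w : Euc N → ℝ} {R : ℝ} {e : Euc N}

lemma cs_w {α : Type*} [MeasurableSpace α] {μ : Measure α} {f g w : α → ℝ} (hw : ∀ x, 0 ≤ w x)
    (hf : Integrable (fun x => f x ^ 2 * w x) μ) (hg : Integrable (fun x => g x ^ 2 * w x) μ)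
    (hfg : Integrable (fun x => f x * g x * w x) μ) :
    (∫ x, f x * g x * w x ∂μ) ^ 2 ≤ (∫ x, f x ^ 2 * w x ∂μ) * ∫ x, g x ^ 2 * w x ∂μ := by
  set A := ∫ x, f x ^ 2 * w x ∂μ with hA
  set C := ∫ x, g x ^ 2 * w x ∂μ with hC
  set B := ∫ x, f x * g x * w x ∂μ with hB
  have key : ∀ t : ℝ, 0 ≤ C * (t * t) + (2 * B) * t + A := by
    intro t
    have h1 : ∫ x, (t * g x + f x) ^ 2 * w x ∂μ = C * (t * t) + (2 * B) * t + A := by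
      have e1 : ∀ x, (t * g x + f x) ^ 2 * w x = ((t * t) * (g x ^ 2 * w x) + (2 * t) * (f x * g x * w x)) + f x ^ 2 * w x := by
        intro x; ring
      have i1 : Integrable (fun x => (t * t) * (g x ^ 2 * w x) + (2 * t) * (f x * g x * w x)) μ := (hg.const_mul _).add (hfg.const_mul _)
      simp only [e1]
      rw [integral_add i1 hf, integral_add (hg.const_mul _) (hfg.const_mul _), integral_const_mul, integral_const_mul]
      ring
    rw [← h1]
    exact integral_nonneg fun x => mul_nonneg (sq_nonneg _) (hw x)
  have := discrim_le_zero key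
  rw [discrim] at this
  nlinarith

section
variable {ε r : ℝ} {κ ψ : ℝ → ℝ}

lemma memHs.memLp_cball [NeZero N] (hs : s ∈ Ioo (0 : ℝ) 1) (hR : 0 < R) (hu : memHs N s (BB N R) u) (x : Euc N) (ρ : ℝ) :
    MemLp u 2 (volume.restrict (Metric.closedBall x ρ)) := by
  refine (hu.memLp_ball hs hR (‖x‖ + ρ + 1)).mono_measure (Measure.restrict_mono ?_ le_rfl)
  intro y hy
  simp only [Metric.mem_closedBall, Metric.mem_ball, dist_zero_right] at *
  rw [dist_eq_norm] at hy
  have := norm_add_le (y - x) x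
  simp at this; linarith

lemma memHs.locInt [NeZero N] (hs : s ∈ Ioo (0 : ℝ) 1) (hR : 0 < R) (hu : memHs N s (BB N R) u) : LocallyIntegrable u := by
  intro x
  refine ⟨Metric.closedBall x 1, Metric.closedBall_mem_nhds x one_pos, ?_⟩
  have : IsFiniteMeasure (volume.restrict (Metric.closedBall x 1)) := ⟨by rw [Measure.restrict_apply_univ]; exact measure_closedBall_lt_top⟩
  exact (hu.memLp_cball hs hR x 1).integrable (by norm_num)

/-- if `g` is continuous, supported in `closedBall 0 r`, and `f ∈ L¹_loc`, then `f * g(x - .)` integrable -/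
lemma integrable_mul_shift {f g : Euc N → ℝ} (hf : LocallyIntegrable f) (hg : Continuous g) (hgs : HasCompactSupport g) (x : Euc N) :
    Integrable fun y => f y * g (x - y) := by
  have := hgs.convolutionExists_right (L := ContinuousLinearMap.mul ℝ ℝ) (μ := (volume : Measure (Euc N))) hf hg x
  simpa [ConvolutionExistsAt] using this

lemma memHs.locInt_sq [NeZero N] (hs : s ∈ Ioo (0 : ℝ) 1) (hR : 0 < R) (hu : memHs N s (BB N R) u) (c : ℝ) :
    LocallyIntegrable (fun y => (c - u y) ^ 2) := by
  intro x
  refine ⟨Metric.closedBall x 1, Metric.closedBall_mem_nhds x one_pos, ?_⟩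
  have : IsFiniteMeasure (volume.restrict (Metric.closedBall x 1)) := ⟨by rw [Measure.restrict_apply_univ]; exact measure_closedBall_lt_top⟩
  exact ((memLp_const c).sub (hu.memLp_cball hs hR x 1)).integrable_sq

/-- mollified function (not normalized) -/
def Um (ψ : ℝ → ℝ) (u : Euc N → ℝ) (x : Euc N) : ℝ := ∫ y, u y * Ph N ψ (x - y)

lemma Um_conv : Um ψ u = (u ⋆[ContinuousLinearMap.mul ℝ ℝ, volume] (Ph N ψ)) := by
  ext x; simp [Um, convolution]

lemma Um_contDiff (m : Moll N s ε r κ ψ) (hr : 0 < r) (hu : LocallyIntegrable u) : ContDiff ℝ 1 (Um ψ u) := by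
  rw [Um_conv]
  exact (m.supp hr).contDiff_convolution_right (n := 1) _ hu m.contDiff

lemma Um_fderiv (m : Moll N s ε r κ ψ) (hr : 0 < r) (hu : LocallyIntegrable u) (x a : Euc N) :
    fderiv ℝ (Um ψ u) x a = - ∫ y, u y * (inner ℝ (x - y) a * κ (‖x - y‖ ^ 2)) := by
  have h := (m.supp hr).hasFDerivAt_convolution_right (ContinuousLinearMap.mul ℝ ℝ) (μ := volume) hu m.contDiff x
  rw [← Um_conv] at h
  rw [h.fderiv, convolution, ContinuousLinearMap.integral_apply]
  · rw [← integral_neg]; congr 1; ext y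
    simp [m.fderiv, inner_sub_left]; ring
  · have hc : Continuous (fderiv ℝ (Ph N ψ)) := (contDiff_one_iff_fderiv.1 m.contDiff).2
    exact (HasCompactSupport.fderiv ℝ (m.supp hr)).convolutionExists_right (L := (ContinuousLinearMap.mul ℝ ℝ).precompR (Euc N)) hu hc x

lemma integral_shift (g : Euc N → ℝ) (x : Euc N) : ∫ y, g (x - y) = ∫ y, g y := integral_sub_left_eq_self g volume x

lemma Um_grad_est [NeZero N] (hs : s ∈ Ioo (0 : ℝ) 1) (hR : 0 < R) (m : Moll N s ε r κ ψ) (hr : 0 < r) (hu : memHs N s (BB N R) u) (x : Euc N) 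
    {a : Euc N} (ha : ‖a‖ = 1) (c : ℝ) :
    (fderiv ℝ (Um ψ u) x a) ^ 2 ≤ (∫ y, (c - u y) ^ 2 * κ (‖x - y‖ ^ 2)) * ∫ h, Ph N ψ h := by
  have hul := hu.locInt hs hR
  have hkc := m.cont
  have e1 : fderiv ℝ (Um ψ u) x a = ∫ y, (c - u y) * inner ℝ (x - y) a * κ (‖x - y‖ ^ 2) := by
    rw [Um_fderiv m hr hul]
    have i1 := integrable_mul_shift hul (g := fun h => inner ℝ h a * κ (‖h‖^2)) (by fun_prop) ((m.suppk hr).mul_left) x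
    have i2 : Integrable fun y => c * (inner ℝ (x - y) a * κ (‖x - y‖^2)) := 
      ((m.integrable_mul hr (g := fun h => inner ℝ h a) (by fun_prop)).comp_sub_left x).const_mul c
    have z : ∫ y, c * (inner ℝ (x - y) a * κ (‖x - y‖^2)) = 0 := by
      rw [integral_const_mul, integral_shift (fun h => inner ℝ h a * κ (‖h‖^2)) x]
      have := integral_neg_eq_self (fun h : Euc N => inner ℝ h a * κ (‖h‖^2)) volume
      simp only [inner_neg_left, norm_neg, neg_mul, integral_neg] at this
      have : ∫ h : Euc N, inner ℝ h a * κ (‖h‖^2) = 0 := by linarith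
      rw [this, mul_zero]
    rw [← zero_sub, ← z, ← integral_sub i2 i1]
    congr 1; ext y; ring
  rw [e1, ← m.J_eq hr ha, ← integral_shift (fun h => inner ℝ h a ^ 2 * κ (‖h‖^2)) x]
  refine cs_w (f := fun y => c - u y) (g := fun y => inner ℝ (x - y) a) (w := fun y => κ (‖x - y‖^2)) (fun y => m.nonneg _) ?_ ?_ ?_
  · exact integrable_mul_shift (hu.locInt_sq hs hR c) (g := fun h => κ (‖h‖^2)) (by fun_prop) (m.suppk hr) x
  · exact (m.integrable_mul hr (g := fun h => inner ℝ h a ^ 2) (by fun_prop)).comp_sub_left x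
  · have i1 := integrable_mul_shift (((locallyIntegrable_const c).sub hul)) (g := fun h => inner ℝ h a * κ (‖h‖^2)) (by fun_prop) ((m.suppk hr).mul_left) x
    refine i1.congr (Eventually.of_forall fun y => ?_)
    simp; ring

lemma Um_est [NeZero N] (hs : s ∈ Ioo (0 : ℝ) 1) (hR : 0 < R) (m : Moll N s ε r κ ψ) (hr : 0 < r) (hu : memHs N s (BB N R) u) (x : Euc N) (c : ℝ) :
    (c * (∫ h, Ph N ψ h) - Um ψ u x) ^ 2 ≤ (r ^ 2 / 2 * ∫ y, (c - u y) ^ 2 * κ (‖x - y‖ ^ 2)) * ∫ h, Ph N ψ h := by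
  have hul := hu.locInt hs hR
  have hkc := m.cont
  have iP : Integrable (Ph N ψ) := m.continuous.integrable_of_hasCompactSupport (m.supp hr)
  have iu := integrable_mul_shift hul m.continuous (m.supp hr) x
  have i3 := integrable_mul_shift (hu.locInt_sq hs hR c) m.continuous (m.supp hr) x
  have e1 : c * (∫ h, Ph N ψ h) - Um ψ u x = ∫ y, (c - u y) * 1 * Ph N ψ (x - y) := by
    rw [← integral_shift (Ph N ψ) x, ← integral_const_mul, Um, ← integral_sub ((iP.comp_sub_left x).const_mul c) iu]
    congr 1; ext y; ring
  rw [e1]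
  have h1 := cs_w (μ := volume) (f := fun y => c - u y) (g := fun y => 1) (w := fun y => Ph N ψ (x - y)) (fun y => m.psi0 _ (by positivity)) 
    i3 (by simpa using iP.comp_sub_left x) (by
      refine ((iP.comp_sub_left x).const_mul c |>.sub iu).congr (Eventually.of_forall fun y => ?_)
      simp; ring)
  refine h1.trans ?_
  simp only [one_pow, one_mul]
  rw [integral_shift (Ph N ψ) x, ← integral_const_mul (r ^ 2 / 2)]
  refine mul_le_mul_of_nonneg_right ?_ (integral_nonneg (f := Ph N ψ) fun y => m.psi0 _ (by positivity))
  refine integral_mono i3 ((integrable_mul_shift (hu.locInt_sq hs hR c) (g := fun h => κ (‖h‖^2)) (by fun_prop) (m.suppk hr) x).const_mul _) fun y => ?_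
  have := m.psi1 (‖x - y‖^2) (by positivity)
  have := mul_le_mul_of_nonneg_left this (sq_nonneg (c - u y))
  simp only [Ph]; linarith

end

end

section
open scoped Convolution

variable {N : ℕ} {s : ℝ} {Ω : Set (Euc N)} {u v w : Euc N → ℝ} {R : ℝ} {e : Euc N}

lemma ball_radial [NeZero N] (hR : 0 < R) (g : ℝ → ℝ) :
    ∫ x in BB N R, g ‖x‖ = N * om N * ∫ t in (0:ℝ)..R, t ^ (N - 1) * g t := by
  rw [← integral_indicator measurableSet_ball]
  have e : (BB N R).indicator (fun h => g ‖h‖) = fun h => (Iio R).indicator g ‖h‖ := by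
    ext h; simp [indicator]
  rw [e, integral_fun_norm_addHaar volume ((Iio R).indicator g)]
  simp only [finrank_euclideanSpace, Fintype.card_fin, smul_eq_mul, nsmul_eq_mul]
  have e2 : ∫ t in Ioi (0:ℝ), t ^ (N-1) * (Iio R).indicator g t = ∫ t in (0:ℝ)..R, t ^ (N - 1) * g t := by
    rw [intervalIntegral.integral_of_le hR.le, integral_Ioc_eq_integral_Ioo]
    have : (fun t : ℝ => t ^ (N-1) * (Iio R).indicator g t) = (Iio R).indicator fun t => t ^ (N-1) * g t := by
      ext t; by_cases h : t < R <;> simp [indicator, h]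
    rw [this, setIntegral_indicator measurableSet_Iio]; rfl
  rw [e2]; simp [om, measureReal_def, mul_assoc]

lemma exists_refl {x y : Euc N} (h : ‖x‖ = ‖y‖) (hxy : x ≠ y) : ∃ f : Euc N, ‖f‖ = 1 ∧ refl f x = y := by
  have hn : 0 < ‖x - y‖ := norm_pos_iff.2 (sub_ne_zero.2 hxy)
  have hf : ‖(‖x - y‖⁻¹) • (x - y)‖ = 1 := by rw [norm_smul, norm_inv, norm_norm, inv_mul_cancel₀ hn.ne']
  refine ⟨_, hf, ?_⟩
  rw [refl_apply hf, inner_smul_right, inner_sub_right, real_inner_self_eq_norm_sq]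
  have h2 : ‖x - y‖ ^ 2 = 2 * (‖x‖ ^ 2 - inner ℝ x y) := by rw [norm_sub_sq_real, ← h]; ring
  rw [smul_smul]
  have : 2 * (‖x - y‖⁻¹ * (‖x‖ ^ 2 - inner ℝ x y)) * ‖x - y‖⁻¹ = 1 := by
    field_simp; linarith
  rw [this]; simp

section
variable {ε r : ℝ} {κ ψ : ℝ → ℝ}

lemma Um_refl (f : Euc N) (h : ∀ᵐ x, u (refl f x) = u x) (x : Euc N) : Um ψ u (refl f x) = Um ψ u x := by
  have hmp := LinearIsometryEquiv.measurePreserving (refl f)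
  have := hmp.integral_comp (refl f).toHomeomorph.measurableEmbedding (fun y => u y * Ph N ψ (refl f x - y))
  unfold Um
  rw [← this]
  apply integral_congr_ae
  filter_upwards [h] with y hy
  rw [hy, ← map_sub]; simp only [Ph, LinearIsometryEquiv.norm_map]

lemma Um_radial (h : ∀ f : Euc N, ‖f‖ = 1 → ∀ᵐ x, u (refl f x) = u x) {x y : Euc N} (hxy : ‖x‖ = ‖y‖) : Um ψ u x = Um ψ u y := by
  by_cases he : x = y
  · rw [he]
  · obtain ⟨f, hf, hfx⟩ := exists_refl hxy he
    rw [← hfx, Um_refl f (h f hf)]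

lemma Q_est [NeZero N] (hs : s ∈ Ioo (0 : ℝ) 1) (hR : 0 < R) (m : Moll N s ε r κ ψ) (hr : 0 < r) (hu : memHs N s (BB N R) u) :
    IntegrableOn (fun x => ∫ y, (u x - u y) ^ 2 * κ (‖x - y‖ ^ 2)) (BB N R) ∧
    ∫ x in BB N R, ∫ y, (u x - u y) ^ 2 * κ (‖x - y‖ ^ 2) ≤ bform N s (BB N R) u u := by
  have hm : Measurable fun q : Euc N × Euc N => (u q.1 - u q.2) ^ 2 * κ (‖q.1 - q.2‖ ^ 2) := by
    have h1 := measurable_Df hu.meas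
    have h2 : Measurable fun q : Euc N × Euc N => κ (‖q.1 - q.2‖ ^ 2) := by
      have := m.cont
      exact Continuous.measurable (by fun_prop)
    exact (h1.pow_const 2).mul h2
  have hQm : StronglyMeasurable (fun x => ∫ y, (u x - u y) ^ 2 * κ (‖x - y‖ ^ 2)) := hm.stronglyMeasurable.integral_prod_right'
  have hQ0 : ∀ x, 0 ≤ ∫ y, (u x - u y) ^ 2 * κ (‖x - y‖ ^ 2) := fun x => integral_nonneg fun y => mul_nonneg (sq_nonneg _) (m.nonneg _)
  have hb : ∫⁻ x in BB N R, ENNReal.ofReal (∫ y, (u x - u y) ^ 2 * κ (‖x - y‖ ^ 2)) ≤ ENNReal.ofReal (bform N s (BB N R) u u) := by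
    rw [bform_ofReal hu]
    refine le_trans ?_ (lintegral_nu_ge ((measurable_Df hu.meas).pow_const 2).ennreal_ofReal)
    refine lintegral_mono fun x => ?_
    have hi : Integrable fun y => (u x - u y) ^ 2 * κ (‖x - y‖ ^ 2) := by
      have := m.cont
      exact integrable_mul_shift (hu.locInt_sq hs hR (u x)) (g := fun h => κ (‖h‖^2)) (by fun_prop) (m.suppk hr) x
    rw [ofReal_integral_eq_lintegral_ofReal hi (Eventually.of_forall fun y => mul_nonneg (sq_nonneg _) (m.nonneg _))]
    refine lintegral_mono_ae ?_
    filter_upwards [compl_mem_ae_iff.2 (measure_singleton x)] with y hy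
    rw [ENNReal.ofReal_mul (sq_nonneg _)]
    refine mul_le_mul le_rfl (ENNReal.ofReal_le_ofReal (m.le _ ?_)) zero_le zero_le
    rw [sub_ne_zero]; exact fun h => hy h.symm
  have hIntg0 : IntegrableOn (fun x => ∫ y, (u x - u y) ^ 2 * κ (‖x - y‖ ^ 2)) (BB N R) := by
    refine ⟨hQm.aestronglyMeasurable, ?_⟩
    rw [hasFiniteIntegral_iff_ofReal (Eventually.of_forall hQ0)]
    exact hb.trans_lt ENNReal.ofReal_lt_top
  refine ⟨hIntg0, ?_⟩
  rw [← ofReal_integral_eq_lintegral_ofReal hIntg0 (Eventually.of_forall hQ0)] at hb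
  exact (ENNReal.ofReal_le_ofReal_iff bform_self_nonneg).1 hb

lemma radial_J [NeZero N] (hs : s ∈ Ioo (0 : ℝ) 1) (hR : 0 < R) (m : Moll N s ε r κ ψ) (hr : 0 < r) (hu : memHs N s (BB N R) u) 
    (h0 : ∫ x in BB N R, u x = 0) (h : ∀ f : Euc N, ‖f‖ = 1 → ∀ᵐ x, u (refl f x) = u x) :
    (∫ h, Ph N ψ h) * ∫ x in BB N R, u x ^ 2 ≤ (5 / 4 * (R ^ 2 / (2 * (N + 2))) + 5 / 2 * r ^ 2) * bform N s (BB N R) u u := by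
  obtain ⟨hQi, hQ⟩ := Q_est hs hR m hr hu
  set Q : Euc N → ℝ := fun x => ∫ y, (u x - u y) ^ 2 * κ (‖x - y‖ ^ 2) with hQd
  set J := ∫ h, Ph N ψ h with hJ
  have hJ0 : 0 ≤ J := integral_nonneg (f := Ph N ψ) fun y => m.psi0 _ (by positivity)
  set E := bform N s (BB N R) u u with hE
  have hE0 : 0 ≤ E := bform_self_nonneg
  have hfin : IsFiniteMeasure (volume.restrict (BB N R)) := ⟨by rw [Measure.restrict_apply_univ]; exact measure_ball_lt_top⟩
  have hUd := Um_contDiff m hr (hu.locInt hs hR)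
  have hUc : Continuous (Um ψ u) := hUd.continuous
  have hUf := (contDiff_one_iff_fderiv.1 hUd)
  obtain ⟨e0, he0⟩ : ∃ e0 : Euc N, ‖e0‖ = 1 := ⟨EuclideanSpace.single 0 1, by simp⟩
  have hline : ∀ (a : Euc N) (t : ℝ), HasDerivAt (fun t : ℝ => Um ψ u (t • a)) (fderiv ℝ (Um ψ u) (t • a) a) t := by
    intro a t
    have h1 : HasDerivAt (fun t : ℝ => t • a) a t := by simpa using (hasDerivAt_id t).smul_const a
    exact (hUf.1 (t • a)).hasFDerivAt.comp_hasDerivAt t h1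
  let F : ℝ → ℝ := fun t => Um ψ u (t • e0)
  let F' : ℝ → ℝ := fun t => fderiv ℝ (Um ψ u) (t • e0) e0
  have hF'c : Continuous F' := by
    have := hUf.2
    exact (this.comp (by fun_prop : Continuous fun t : ℝ => t • e0)).clm_apply continuous_const
  have hUF : ∀ x, Um ψ u x = F ‖x‖ := fun x => Um_radial h (by rw [norm_smul, he0]; simp)
  have hgrad : ∀ x : Euc N, x ≠ 0 → F' ‖x‖ ^ 2 ≤ Q x * J := by
    intro x hx
    have hn : 0 < ‖x‖ := norm_pos_iff.2 hx
    set a := ‖x‖⁻¹ • x with ha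
    have han : ‖a‖ = 1 := by rw [ha, norm_smul, norm_inv, norm_norm, inv_mul_cancel₀ hn.ne']
    have hxa : ‖x‖ • a = x := by rw [ha, smul_smul, mul_inv_cancel₀ hn.ne', one_smul]
    have e1 : (fun t : ℝ => Um ψ u (t • a)) = F := by
      ext t; exact Um_radial h (by rw [norm_smul t a, norm_smul t e0, han, he0])
    have h1 := hline a ‖x‖
    rw [e1] at h1
    have h2 := h1.unique (hline e0 ‖x‖)
    rw [hxa] at h2
    change F' ‖x‖ ^ 2 ≤ _
    have h3 := Um_grad_est hs hR m hr hu x han (u x)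
    rw [h2] at h3
    exact h3
  obtain ⟨c, hc⟩ := poincare1 (N - 1) hR (F := F) (F' := F') (fun t => hline e0 t) hF'c
  have hN1 : ((N - 1 : ℕ) : ℝ) + 3 = N + 2 := by
    have : 1 ≤ N := NeZero.one_le
    push_cast [this]; ring
  rw [hN1] at hc
  have hom : 0 < om N := om_pos
  have hP : ∫ x in BB N R, (Um ψ u x - c) ^ 2 ≤ R ^ 2 / (2 * (N + 2)) * ∫ x in BB N R, F' ‖x‖ ^ 2 := by
    simp only [hUF]
    rw [ball_radial hR (fun t => (F t - c) ^ 2), ball_radial hR (fun t => F' t ^ 2)]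
    have := mul_le_mul_of_nonneg_left hc (show 0 ≤ (N:ℝ) * om N by positivity)
    linarith
  have hbd : ∀ g : Euc N → ℝ, Continuous g → IntegrableOn g (BB N R) := fun g hg =>
    (hg.continuousOn.integrableOn_compact (isCompact_closedBall (0 : Euc N) R)).mono_set Metric.ball_subset_closedBall
  have hG : ∫ x in BB N R, F' ‖x‖ ^ 2 ≤ E * J := by
    refine le_trans (integral_mono_ae (hbd _ (by fun_prop)) (hQi.mul_const J) ?_) ?_
    · filter_upwards [ae_restrict_of_ae (compl_mem_ae_iff.2 (measure_singleton (0 : Euc N)))] with x hx using hgrad x hx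
    · rw [integral_mul_const]; exact mul_le_mul_of_nonneg_right hQ hJ0
  have hu2 : MemLp u 2 (volume.restrict (BB N R)) := hu.memLp
  have hU2 : MemLp (Um ψ u) 2 (volume.restrict (BB N R)) := by
    rw [memLp_two_iff_integrable_sq hUc.aestronglyMeasurable]
    exact hbd _ (by fun_prop)
  have hD : ∫ x in BB N R, (u x * J - Um ψ u x) ^ 2 ≤ r ^ 2 / 2 * E * J := by
    have i1 : Integrable (fun x => (u x * J - Um ψ u x) ^ 2) (volume.restrict (BB N R)) := ((hu2.mul_const J).sub hU2).integrable_sq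
    refine le_trans (integral_mono i1 ((hQi.const_mul (r^2/2)).mul_const J) fun x => Um_est hs hR m hr hu x (u x)) ?_
    rw [integral_mul_const, integral_const_mul]
    have := mul_le_mul_of_nonneg_left hQ (show 0 ≤ r^2/2 by positivity)
    exact mul_le_mul_of_nonneg_right this hJ0
  have hmain : J ^ 2 * ∫ x in BB N R, u x ^ 2 ≤ 5/4 * (∫ x in BB N R, (Um ψ u x - c) ^ 2) + 5 * ∫ x in BB N R, (u x * J - Um ψ u x) ^ 2 := by
    have iu := hu2.integrable (by norm_num)
    have iu2 := hu2.integrable_sq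
    have i1 : Integrable (fun x => (u x * J - Um ψ u x) ^ 2) (volume.restrict (BB N R)) := ((hu2.mul_const J).sub hU2).integrable_sq
    have i2 : Integrable (fun x => (Um ψ u x - c) ^ 2) (volume.restrict (BB N R)) := (hU2.sub (memLp_const c)).integrable_sq
    have i3 : Integrable (fun x => J ^ 2 * u x ^ 2 - 2 * J * c * u x) (volume.restrict (BB N R)) := (iu2.const_mul _).sub (iu.const_mul _)
    have e1 : J ^ 2 * ∫ x in BB N R, u x ^ 2 = ∫ x in BB N R, (J ^ 2 * u x ^ 2 - 2 * J * c * u x) := by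
      rw [integral_sub (iu2.const_mul _) (iu.const_mul _), integral_const_mul, integral_const_mul, h0]; ring
    rw [e1, ← integral_const_mul (5/4), ← integral_const_mul 5, ← integral_add (i2.const_mul _) (i1.const_mul _)]
    refine integral_mono i3 ((i2.const_mul _).add (i1.const_mul _)) fun x => ?_
    have := sq_nonneg ((Um ψ u x - c) / 2 - 2 * (u x * J - Um ψ u x))
    simp only
    nlinarith [sq_nonneg c]
  rcases hJ0.eq_or_lt with hz | hp
  · rw [← hz]; simp; positivity
  · have hcP : 0 < R ^ 2 / (2 * ((N:ℝ) + 2)) := by positivity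
    have h1 : ∫ x in BB N R, (Um ψ u x - c) ^ 2 ≤ R ^ 2 / (2 * (N + 2)) * (E * J) := hP.trans (mul_le_mul_of_nonneg_left hG hcP.le)
    have h2 : J * (J * ∫ x in BB N R, u x ^ 2) ≤ J * ((5 / 4 * (R ^ 2 / (2 * (N + 2))) + 5 / 2 * r ^ 2) * E) := by
      nlinarith
    exact le_of_mul_le_mul_left h2 hp

lemma J_lower [NeZero N] (hs : s ∈ Ioo (0 : ℝ) 1) (m : Moll N s ε r κ ψ) (hε : 0 < ε) (hr : ε < r) :
    om N * ((r ^ (2 - 2 * s) - ε ^ (2 - 2 * s)) / (2 - 2 * s)) - om N * r ^ (2 - 2 * s) ≤ ∫ h, Ph N ψ h := by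
  have hr0 : 0 < r := hε.trans hr
  have hkc := m.cont
  have hN : (1:ℝ) ≤ N := by exact_mod_cast NeZero.one_le
  have hom : 0 < om N := om_pos
  have e1 : N * ∫ h, Ph N ψ h = ∫ h : Euc N, ‖h‖ ^ 2 * κ (‖h‖ ^ 2) := by
    have : ∀ i : Fin N, ∫ h : Euc N, (h i) ^ 2 * κ (‖h‖^2) = ∫ h, Ph N ψ h := by
      intro i
      rw [← m.J_eq hr0 (a := EuclideanSpace.single i 1) (by simp)]
      refine integral_congr_ae (Eventually.of_forall fun h => ?_)
      simp [EuclideanSpace.inner_single_right]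
    have h2 : ∀ h : Euc N, ‖h‖ ^ 2 * κ (‖h‖ ^ 2) = ∑ i, (h i) ^ 2 * κ (‖h‖^2) := by
      intro h; rw [← Finset.sum_mul, EuclideanSpace.real_norm_sq_eq]
    simp only [h2]
    rw [integral_finsetSum]
    · simp [this]
    · intro i _; exact m.integrable_mul hr0 (g := fun h => (h i)^2) (by fun_prop)
  have i1 : Integrable (fun h : Euc N => ‖h‖ ^ 2 * κ (‖h‖ ^ 2)) := m.integrable_mul hr0 (g := fun h => ‖h‖^2) (by fun_prop)
  set A : Set (Euc N) := Metric.ball 0 r \ Metric.ball 0 ε with hA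
  have hAm : MeasurableSet A := measurableSet_ball.diff measurableSet_ball
  have hsub : Metric.ball (0 : Euc N) ε ⊆ Metric.ball 0 r := Metric.ball_subset_ball hr.le
  have iK := Kf_sq_integrableOn (N := N) hs.2 r
  set C : ℝ := r ^ 2 * (r ^ ((N:ℝ) + 2 * s))⁻¹ with hC
  have hC0 : 0 ≤ C := by positivity
  have hfinA : volume A ≠ ⊤ := ((measure_mono sdiff_subset).trans_lt measure_ball_lt_top).ne
  have h3 : ∫ h in A, (‖h‖ ^ 2 * Kf N s h - C) ≤ ∫ h : Euc N, ‖h‖ ^ 2 * κ (‖h‖ ^ 2) := by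
    refine le_trans ?_ (setIntegral_le_integral (s := A) i1 (Eventually.of_forall fun h => mul_nonneg (by positivity) (m.nonneg _)))
    refine setIntegral_mono_on ((iK.mono_set sdiff_subset).sub (integrableOn_const hfinA)) i1.integrableOn hAm fun h hh => ?_
    have h1 : ε ≤ ‖h‖ := by simpa using hh.2
    have h2 : ‖h‖ < r := by simpa using hh.1
    have h4 := mul_le_mul_of_nonneg_left (m.ge h h1) (sq_nonneg ‖h‖)
    have h5 : ‖h‖ ^ 2 * (r ^ ((N:ℝ) + 2 * s))⁻¹ ≤ C := mul_le_mul_of_nonneg_right (pow_le_pow_left₀ (norm_nonneg _) h2.le 2) (by positivity)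
    linarith
  rw [integral_sub (iK.mono_set sdiff_subset) (integrableOn_const hfinA), setIntegral_sdiff measurableSet_ball iK hsub,
    Kf_sq_integral hs.2 hr0, Kf_sq_integral hs.2 hε, setIntegral_const, smul_eq_mul, ← e1] at h3
  have h6 : volume.real A * C ≤ om N * r ^ (2 - 2 * s) := by
    have : volume.real A ≤ r ^ N * om N := by
      rw [← vol_ball hr0.le 0]
      exact measureReal_mono sdiff_subset measure_ball_lt_top.ne
    refine (mul_le_mul_of_nonneg_right this hC0).trans (le_of_eq ?_)
    rw [hC, ← Real.rpow_neg hr0.le, ← Real.rpow_natCast, ← Real.rpow_natCast, mul_comm _ (om N), mul_assoc, ← Real.rpow_add hr0, ← Real.rpow_add hr0]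
    congr 2; push_cast; ring
  have h7 : 0 < 2 - 2 * s := by have := hs.2; linarith
  have h8 : N * (om N * ((r ^ (2 - 2 * s) - ε ^ (2 - 2 * s)) / (2 - 2 * s)) - om N * r ^ (2 - 2 * s)) ≤ N * ∫ h, Ph N ψ h := by
    refine le_trans ?_ h3
    have h9 : 0 < om N * r ^ (2 - 2 * s) := by positivity
    rw [sub_div]
    nlinarith
  exact le_of_mul_le_mul_left h8 (by linarith)

end

theorem radial_lower [NeZero N] (hs : s ∈ Ioo (0 : ℝ) 1) (hR : 0 < R) {r : ℝ} (hr : 0 < r) (hu : memHs N s (BB N R) u) 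
    (h0 : ∫ x in BB N R, u x = 0) (h : ∀ f : Euc N, ‖f‖ = 1 → ∀ᵐ x, u (refl f x) = u x) :
    (om N * (r ^ (2 - 2 * s) / (2 - 2 * s)) - om N * r ^ (2 - 2 * s)) * ∫ x in BB N R, u x ^ 2 ≤
     (5 / 4 * (R ^ 2 / (2 * (N + 2))) + 5 / 2 * r ^ 2) * bform N s (BB N R) u u := by
  have h7 : 0 < 2 - 2 * s := by have := hs.2; linarith
  have ht : Tendsto (fun ε : ℝ => (om N * ((r ^ (2 - 2 * s) - ε ^ (2 - 2 * s)) / (2 - 2 * s)) - om N * r ^ (2 - 2 * s)) * ∫ x in BB N R, u x ^ 2)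
      (𝓝[>] 0) (𝓝 ((om N * ((r ^ (2 - 2 * s) - 0 ^ (2 - 2 * s)) / (2 - 2 * s)) - om N * r ^ (2 - 2 * s)) * ∫ x in BB N R, u x ^ 2)) := by
    have : Continuous fun ε : ℝ => (om N * ((r ^ (2 - 2 * s) - ε ^ (2 - 2 * s)) / (2 - 2 * s)) - om N * r ^ (2 - 2 * s)) * ∫ x in BB N R, u x ^ 2 := by
      have := Real.continuous_rpow_const h7.le
      fun_prop
    exact (this.tendsto 0).mono_left nhdsWithin_le_nhds
  rw [Real.zero_rpow h7.ne', sub_zero] at ht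
  refine le_of_tendsto ht ?_
  filter_upwards [Ioo_mem_nhdsGT hr] with ε hε
  obtain ⟨κ, ψ, m⟩ := exists_moll (N := N) hs hε.1 hr
  refine le_trans (mul_le_mul_of_nonneg_right (J_lower hs m hε.1 hε.2) (integral_nonneg fun x => sq_nonneg _)) (radial_J hs hR m hr hu h0 h)

end

section

variable {N : ℕ} {s : ℝ} {Ω : Set (Euc N)} {u v w : Euc N → ℝ} {R : ℝ} {e : Euc N}

lemma ball_sq [NeZero N] (hR : 0 < R) : ∫ x in BB N R, ‖x‖ ^ 2 = N * om N * (R ^ (N + 2) / (N + 2)) := by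
  rw [ball_radial hR (fun t => t ^ 2)]
  have h1 : 1 ≤ N := NeZero.one_le
  have : ∀ t : ℝ, t ^ (N - 1) * t ^ 2 = t ^ (N + 1) := fun t => by rw [← pow_add]; congr 1; omega
  simp only [this]
  rw [integral_pow]
  push_cast
  simp
  left
  ring

lemma sum_cl_energy [NeZero N] (hs : s ∈ Ioo (0 : ℝ) 1) (hR : 0 < R) {r : ℝ} (hr : 0 < r) :
    ∑ i, bform N s (BB N R) (cl N R i) (cl N R i) ≤
      (R + r) ^ N * om N * (N * om N * (r ^ (2 - 2 * s) / (2 - 2 * s))) +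
      2 * (R ^ N * om N * (4 * N * R ^ 2 * (N * om N * (r ^ (-2 * s) / (2 * s))))) := by
  have hom : 0 < om N := om_pos
  have hmem := fun i => memHs_cl (N := N) (s := s) hs (vol_closure_ball R) hR.le i
  have h7 : 0 < 2 - 2 * s := by have := hs.2; linarith
  have h8 : 0 < s := hs.1
  set f1 : Euc N → ℝ≥0∞ := fun h => (Metric.ball (0 : Euc N) r).indicator (fun h => ENNReal.ofReal (‖h‖ ^ 2 * Kf N s h)) h with hf1
  set f2 : Euc N → ℝ≥0∞ := fun h => {h : Euc N | r ≤ ‖h‖}.indicator (fun h => ENNReal.ofReal (4 * N * R ^ 2 * Kf N s h)) h with hf2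
  have mf1 : Measurable f1 := ((measurable_norm.pow_const 2).mul measurable_Kf).ennreal_ofReal.indicator measurableSet_ball
  have mf2 : Measurable f2 := (measurable_Kf.const_mul _).ennreal_ofReal.indicator (measurableSet_tail r)
  have I1 : ∫⁻ h, f1 h = ENNReal.ofReal (N * om N * (r ^ (2 - 2 * s) / (2 - 2 * s))) := by
    rw [hf1, lintegral_indicator measurableSet_ball, ← ofReal_integral_eq_lintegral_ofReal (Kf_sq_integrableOn hs.2 r)
      (Eventually.of_forall fun h => mul_nonneg (sq_nonneg _) (Kf_nonneg h)), Kf_sq_integral hs.2 hr]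
  have I2 : ∫⁻ h, f2 h = ENNReal.ofReal (4 * N * R ^ 2 * (N * om N * (r ^ (-2 * s) / (2 * s)))) := by
    rw [hf2, lintegral_indicator (measurableSet_tail r), ← ofReal_integral_eq_lintegral_ofReal ((Kf_tail_integrableOn hs.1 hr).const_mul _)
      (Eventually.of_forall fun h => mul_nonneg (by positivity) (Kf_nonneg h)), integral_const_mul, Kf_tail_integral hs.1 hr]
  have vb : ∀ {t : ℝ}, 0 ≤ t → volume (Metric.closedBall (0 : Euc N) t) = ENNReal.ofReal (t ^ N * om N) := by
    intro t ht
    rw [Measure.addHaar_closedBall_eq_addHaar_ball, ← vol_ball ht (0 : Euc N), measureReal_def, ENNReal.ofReal_toReal measure_ball_lt_top.ne]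
  have hcl : closure (BB N R) = Metric.closedBall 0 R := closure_ball _ hR.ne'
  have key : ∑ i, ENNReal.ofReal (bform N s (BB N R) (cl N R i) (cl N R i)) ≤
      ENNReal.ofReal ((R + r) ^ N * om N) * ENNReal.ofReal (N * om N * (r ^ (2 - 2 * s) / (2 - 2 * s))) +
      (ENNReal.ofReal (R ^ N * om N) * ENNReal.ofReal (4 * N * R ^ 2 * (N * om N * (r ^ (-2 * s) / (2 * s)))) +
       ENNReal.ofReal (R ^ N * om N) * ENNReal.ofReal (4 * N * R ^ 2 * (N * om N * (r ^ (-2 * s) / (2 * s))))) := by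
    simp only [fun i => bform_ofReal (hmem i)]
    have mD := fun i => ((measurable_Df (hmem i).meas).pow_const 2).ennreal_ofReal
    rw [← lintegral_finsetSum _ (fun i _ => mD i), lintegral_nu (Finset.measurable_sum _ (fun i _ => mD i))]
    set A : Set (Euc N × Euc N) := Metric.closedBall (0 : Euc N) (R + r) ×ˢ univ
    set A1 : Set (Euc N × Euc N) := Metric.closedBall (0 : Euc N) R ×ˢ univ
    set A2 : Set (Euc N × Euc N) := univ ×ˢ Metric.closedBall (0 : Euc N) R
    have mA : MeasurableSet A := Metric.isClosed_closedBall.measurableSet.prod MeasurableSet.univ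
    have mA1 : MeasurableSet A1 := Metric.isClosed_closedBall.measurableSet.prod MeasurableSet.univ
    have mA2 : MeasurableSet A2 := MeasurableSet.univ.prod Metric.isClosed_closedBall.measurableSet
    have mF1 : Measurable fun q : Euc N × Euc N => f1 (q.1 - q.2) := mf1.comp (measurable_fst.sub measurable_snd)
    have mF2 : Measurable fun q : Euc N × Euc N => f2 (q.1 - q.2) := mf2.comp (measurable_fst.sub measurable_snd)
    calc _ ≤ ∫⁻ q, (A.indicator (fun q => f1 (q.1 - q.2)) q + (A1.indicator (fun q => f2 (q.1 - q.2)) q + A2.indicator (fun q => f2 (q.1 - q.2)) q)) := by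
          rw [← lintegral_indicator measurableSet_reg]
          refine lintegral_mono fun q => ?_
          by_cases hq : q ∈ reg N (BB N R)
          swap
          · rw [indicator_of_notMem hq]; exact zero_le
          rw [indicator_of_mem hq]
          rw [← ENNReal.ofReal_sum_of_nonneg (fun i _ => sq_nonneg _)]
          rw [mul_comm]; change _ * ENNReal.ofReal (Kf N s (q.1 - q.2)) ≤ _
          rw [← ENNReal.ofReal_mul (Finset.sum_nonneg fun i _ => sq_nonneg _)]
          have hq' : q.1 ∈ Metric.closedBall (0 : Euc N) R ∨ q.2 ∈ Metric.closedBall (0 : Euc N) R := by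
            rw [← hcl]; exact hq
          rcases lt_or_ge ‖q.1 - q.2‖ r with hlt | hge
          · have hA : q ∈ A := by
              refine ⟨?_, mem_univ _⟩
              rw [mem_closedBall_zero_iff]
              rcases hq' with h | h
              · rw [mem_closedBall_zero_iff] at h; linarith
              · rw [mem_closedBall_zero_iff] at h
                have := norm_add_le (q.1 - q.2) q.2
                rw [sub_add_cancel] at this
                linarith
            rw [indicator_of_mem hA]
            refine le_add_right ?_
            rw [hf1]
            simp only
            rw [indicator_of_mem (by simpa using hlt)]
            apply ENNReal.ofReal_le_ofReal
            apply mul_le_mul_of_nonneg_right _ (Kf_nonneg _)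
            rw [EuclideanSpace.real_norm_sq_eq]
            refine Finset.sum_le_sum fun i _ => ?_
            have := cl_lip R i q.1 q.2
            exact sq_le_sq.2 (by simpa [Df] using this)
          · have hb : ENNReal.ofReal ((∑ i, Df (cl N R i) q ^ 2) * Kf N s (q.1 - q.2)) ≤ f2 (q.1 - q.2) := by
              rw [hf2]
              simp only
              rw [indicator_of_mem (by simpa using hge)]
              apply ENNReal.ofReal_le_ofReal
              apply mul_le_mul_of_nonneg_right _ (Kf_nonneg _)
              have : ∀ i ∈ Finset.univ, Df (cl N R i) q ^ 2 ≤ 4 * R ^ 2 := by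
                intro i _
                have h1 := abs_le.1 (cl_bdd hR.le i q.1)
                have h2 := abs_le.1 (cl_bdd hR.le i q.2)
                have : |Df (cl N R i) q| ≤ |2 * R| := by
                  rw [abs_of_pos (by linarith : 0 < 2 * R), abs_le]; unfold Df; constructor <;> linarith
                have := sq_le_sq.2 this
                linarith
              refine (Finset.sum_le_sum this).trans (le_of_eq ?_)
              simp; ring
            refine hb.trans (le_add_left ?_)
            rcases hq' with h | h
            · refine le_add_right ?_
              rw [indicator_of_mem (show q ∈ A1 from ⟨h, mem_univ _⟩)]
            · refine le_add_left ?_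
              rw [indicator_of_mem (show q ∈ A2 from ⟨mem_univ _, h⟩)]
      _ ≤ _ := by
          rw [lintegral_add_left (mF1.indicator mA), lintegral_add_left (mF2.indicator mA1), lintegral_indicator mA, lintegral_indicator mA1,
            lintegral_indicator mA2, lintegral_left mF1, lintegral_left mF2, lintegral_right mF2]
          simp only [lintegral_sub_left_eq_self, lintegral_sub_right_eq_self]
          rw [setLIntegral_const, setLIntegral_const, vb (by linarith), vb hR.le, I1, I2, mul_comm (ENNReal.ofReal (4 * _ * _ * _)), mul_comm (ENNReal.ofReal (_ * _ * (r ^ (2 - 2 * s) / _)))]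
  rw [← ENNReal.ofReal_sum_of_nonneg (fun i _ => bform_self_nonneg), ← ENNReal.ofReal_mul (by positivity), ← ENNReal.ofReal_mul (by positivity),
    ← ENNReal.ofReal_add (by positivity) (by positivity), ← ENNReal.ofReal_add (by positivity) (by positivity), ENNReal.ofReal_le_ofReal_iff (by positivity)] at key
  linarith

lemma lam_upper [NeZero N] (hs : s ∈ Ioo (0 : ℝ) 1) (hR : 0 < R) {r : ℝ} (hr : 0 < r) :
    lam N s (BB N R) * (N * om N * (R ^ (N + 2) / (N + 2))) ≤
      (R + r) ^ N * om N * (N * om N * (r ^ (2 - 2 * s) / (2 - 2 * s))) +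
      2 * (R ^ N * om N * (4 * N * R ^ 2 * (N * om N * (r ^ (-2 * s) / (2 * s))))) := by
  refine le_trans ?_ (sum_cl_energy hs hR hr)
  have hmem := fun i => memHs_cl (N := N) (s := s) hs (vol_closure_ball R) hR.le i
  have h1 : ∀ i : Fin N, lam N s (BB N R) * ∫ x in BB N R, (x i) ^ 2 ≤ bform N s (BB N R) (cl N R i) (cl N R i) := by
    intro i
    have := rayleigh' hs (hmem i) (mean_cl R hR.le i)
    refine le_trans (le_of_eq ?_) this
    congr 1
    refine setIntegral_congr_fun measurableSet_ball fun x hx => ?_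
    simp only
    rw [cl_eq i ((coord_le_norm x i).trans (by simpa using (mem_ball_zero_iff.1 hx).le))]
  refine le_trans (le_of_eq ?_) (Finset.sum_le_sum fun i _ => h1 i)
  rw [← Finset.mul_sum, ← integral_finsetSum, ← ball_sq hR]
  · simp only [EuclideanSpace.real_norm_sq_eq]
  · intro i _
    exact (Continuous.continuousOn (by fun_prop)).integrableOn_compact (isCompact_closedBall (0 : Euc N) R) |>.mono_set Metric.ball_subset_closedBall

/-- threshold -/
def sst (N : ℕ) : ℝ := 1 - 1 / (8 * (800 * (N:ℝ) ^ 3 + 1))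

lemma sst_mem [NeZero N] : 1/2 ≤ sst N ∧ sst N < 1 := by
  unfold sst
  have hN : (1:ℝ) ≤ N := by exact_mod_cast NeZero.one_le
  have h3 : (1:ℝ) ≤ (N:ℝ)^3 := one_le_pow₀ hN
  have : 1 / (8 * (800 * (N:ℝ) ^ 3 + 1)) ≤ 1 / 2 := one_div_le_one_div_of_le (by norm_num) (by linarith)
  have : 0 < 1 / (8 * (800 * (N:ℝ) ^ 3 + 1)) := by positivity
  constructor <;> linarith

set_option maxHeartbeats 1000000 in
theorem radial_zero [NeZero N] (hN2 : 2 ≤ N) (hs : s ∈ Ioo (sst N) 1) (hR : 0 < R) (hu : IsEig N s (BB N R) u)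
    (h : ∀ f : Euc N, ‖f‖ = 1 → ∀ᵐ x, u (refl f x) = u x) : u =ᵐ[volume.restrict (BB N R)] 0 := by
  have hs12 : 1/2 < s := lt_of_le_of_lt sst_mem.1 hs.1
  have hs' : s ∈ Ioo (0:ℝ) 1 := ⟨by linarith, hs.2⟩
  have hN : (1:ℝ) ≤ N := by exact_mod_cast NeZero.one_le
  have hN2' : (2:ℝ) ≤ N := by exact_mod_cast hN2
  have hom : 0 < om N := om_pos
  have hT0 : 0 ≤ ∫ x in BB N R, u x ^ 2 := integral_nonneg fun x => sq_nonneg _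
  rcases hT0.eq_or_lt with hT | hT
  · have := (integral_eq_zero_iff_of_nonneg (fun x => sq_nonneg (u x)) hu.mem.memLp.integrable_sq).1 hT.symm
    filter_upwards [this] with x hx
    simpa using hx
  exfalso
  set T := ∫ x in BB N R, u x ^ 2
  have hE : bform N s (BB N R) u u = lam N s (BB N R) * T := by
    rw [hu.weak' hs' hu.mem]; simp only [← pow_two]; rfl
  set θ : ℝ := 1 / (10 * N) with hθ
  have hθ0 : 0 < θ := by positivity
  have hNθ : N * θ = 1 / 10 := by rw [hθ]; field_simp
  set r := θ * R with hr
  have hr0 : 0 < r := by positivity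
  have L := radial_lower hs' hR hr0 hu.mem hu.mean h
  rw [hE, ← mul_assoc] at L
  have L1 := le_of_mul_le_mul_right L hT
  have L2 := lam_upper (N := N) hs' hR hr0
  set l := lam N s (BB N R)
  have hpow : (1 + θ) ^ N ≤ 10 / 9 := by
    have h1 : (1 + θ) ^ N ≤ Real.exp (1/10) := by
      rw [← hNθ, Real.exp_nat_mul]
      exact pow_le_pow_left₀ (by positivity) (by linarith [Real.add_one_le_exp θ]) N
    have h2 : Real.exp (1/10) * Real.exp (-(1/10)) = 1 := by rw [← Real.exp_add]; simp
    have h3 := Real.add_one_le_exp (-(1/10))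
    have h4 := Real.exp_pos (1/10)
    nlinarith
  have h7 : 0 < 2 - 2 * s := by have := hs.2; linarith
  set p := r ^ (-2 * s) with hp
  have hp0 : 0 < p := by positivity
  have hrp : r ^ (2 - 2 * s) = r ^ 2 * p := by
    rw [hp, ← Real.rpow_natCast, ← Real.rpow_add hr0]; congr 1; push_cast; ring
  rw [hrp] at L1 L2
  have hRr : (R + r) ^ N = R ^ N * (1 + θ) ^ N := by rw [← mul_pow]; congr 1; rw [hr]; ring
  rw [hRr] at L2
  set d := 2 - 2 * s with hd
  have hRN : 0 < R ^ N := by positivity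
  -- L2 simplified
  have L3 : l * (R ^ 2 / (N + 2)) ≤ (10 / 9) * (om N * (r ^ 2 * p / d)) + 8 * N * R ^ 2 * om N * p := by
    have hsp : p / (2 * s) ≤ p := by
      rw [div_le_iff₀ (by linarith)]; nlinarith
    have a1 : R ^ N * (1 + θ) ^ N * om N * (N * om N * (r ^ 2 * p / d)) ≤ (R ^ N * om N * N) * ((10 / 9) * (om N * (r ^ 2 * p / d))) := by
      have : 0 ≤ R ^ N * om N * (N * om N * (r ^ 2 * p / d)) := by positivity
      nlinarith
    have a2 : 2 * (R ^ N * om N * (4 * N * R ^ 2 * (N * om N * (p / (2 * s))))) ≤ (R ^ N * om N * N) * (8 * N * R ^ 2 * om N * p) := by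
      have : 0 ≤ R ^ N * om N * N * (8 * N * R ^ 2 * om N) := by positivity
      have := mul_le_mul_of_nonneg_left hsp this
      nlinarith
    have a3 : l * (N * om N * (R ^ (N + 2) / (N + 2))) = (R ^ N * om N * N) * (l * (R ^ 2 / (N + 2))) := by
      rw [pow_add]; ring
    have hc : 0 < R ^ N * om N * N := by positivity
    refine le_of_mul_le_mul_left ?_ hc
    rw [← a3, mul_add]
    linarith
  have hl0 : 0 ≤ l := lam_nonneg hs'
  have L4 : (5 / 4 * (R ^ 2 / (2 * (N + 2))) + 5 / 2 * r ^ 2) * l ≤ (13/20) * (l * (R ^ 2 / (N + 2))) := by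
    have : 5 / 2 * r ^ 2 ≤ (1 / 40) * (R ^ 2 / (N + 2)) := by
      have : θ ^ 2 * (N + 2) ≤ 1 / 100 := by
        rw [hθ, div_pow, one_pow, div_mul_eq_mul_div, one_mul, div_le_div_iff₀ (by positivity) (by norm_num)]
        nlinarith
      rw [hr, mul_pow, ← sub_nonneg]
      have e1 : 1 / 40 * (R ^ 2 / (N + 2)) - 5 / 2 * (θ ^ 2 * R ^ 2) = (R^2 / (N+2)) * (1/40 - 5/2 * (θ ^ 2 * (N + 2))) := by
        field_simp
      rw [e1]
      apply mul_nonneg (by positivity); linarith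
    have e2 : R ^ 2 / (2 * ((N:ℝ) + 2)) = (1/2) * (R ^ 2 / (N + 2)) := by field_simp
    rw [e2]
    nlinarith
  have L5 : om N * (r ^ 2 * p / d) - om N * (r ^ 2 * p) ≤ (13/20) * ((10 / 9) * (om N * (r ^ 2 * p / d)) + 8 * N * R ^ 2 * om N * p) :=
    L1.trans (L4.trans (mul_le_mul_of_nonneg_left L3 (by norm_num)))
  have hop : 0 < om N * p := by positivity
  have L6 : r ^ 2 / d / 4 ≤ r ^ 2 + 8 * N * R ^ 2 := by
    refine le_of_mul_le_mul_left ?_ hop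
    have e3 : om N * (r ^ 2 * p / d) = om N * p * (r ^ 2 / d) := by ring
    rw [e3] at L5
    have p1 : 0 ≤ om N * p * (r ^ 2 / d) := by positivity
    have p2 : 0 ≤ om N * p * (8 * N * R ^ 2) := by positivity
    have e4 : 8 * N * R ^ 2 * om N * p = om N * p * (8 * N * R ^ 2) := by ring
    have e5 : om N * (r ^ 2 * p) = om N * p * r ^ 2 := by ring
    have e6 : om N * p * (r ^ 2 / d / 4) = om N * p * (r ^ 2 / d) / 4 := by ring
    rw [e4, e5] at L5
    rw [e6, mul_add]
    linarith
  have hR2 : R ^ 2 = 100 * N ^ 2 * r ^ 2 := by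
    rw [hr, mul_pow, hθ]; field_simp; norm_num
  rw [hR2] at L6
  have L7 : 1 / d / 4 ≤ 1 + 800 * N ^ 3 := by
    refine le_of_mul_le_mul_left ?_ (show 0 < r ^ 2 by positivity)
    have : r ^ 2 * (1 / d / 4) = r ^ 2 / d / 4 := by ring
    rw [this]; nlinarith
  have hs1 := hs.1
  unfold sst at hs1
  rw [div_div, div_le_iff₀ (by positivity)] at L7
  have hq : 0 < 800 * (N:ℝ) ^ 3 + 1 := by positivity
  have : (1 - s) * (8 * (800 * (N:ℝ) ^ 3 + 1)) < 1 := by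
    rw [← lt_div_iff₀ (by positivity)]; linarith
  rw [hd] at L7
  nlinarith

end

section

variable {N : ℕ} {s : ℝ} {Ω : Set (Euc N)} {u v w : Euc N → ℝ} {R : ℝ} {e : Euc N}

/-- pairing with linear functions -/
def Pr (R : ℝ) (u : Euc N → ℝ) (f : Euc N) : ℝ := ∫ x in BB N R, (inner ℝ x f : ℝ) * u x

lemma Pr_int (hu : memHs N s (BB N R) u) (f : Euc N) : IntegrableOn (fun x => (inner ℝ x f : ℝ) * u x) (BB N R) := by
  have h1 : IntegrableOn u (BB N R) := hu.integrable vol_BB_ne_top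
  refine Integrable.bdd_mul (c := R * ‖f‖) h1 (Continuous.aestronglyMeasurable (by fun_prop)) ?_
  rw [ae_restrict_iff' meas_BB]
  refine Eventually.of_forall fun x hx => ?_
  refine (norm_inner_le_norm x f).trans (mul_le_mul_of_nonneg_right ?_ (norm_nonneg _))
  exact (mem_ball_zero_iff.1 hx).le

lemma Pr_comp (Q : Euc N ≃ₗᵢ[ℝ] Euc N) (f : Euc N) : Pr R (fun x => u (Q x)) f = Pr R u (Q f) := by
  unfold Pr
  rw [← setIntegral_comp_iso Q (fun x => (inner ℝ x (Q f) : ℝ) * u x)]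
  simp

lemma Pr_congr (h : u =ᵐ[volume] v) (f : Euc N) : Pr R u f = Pr R v f := by
  refine integral_congr_ae (ae_restrict_of_ae ?_)
  filter_upwards [h] with x hx; rw [hx]

lemma Pr_sub (hu : memHs N s (BB N R) u) (hv : memHs N s (BB N R) v) (f : Euc N) :
    Pr R (fun x => u x - v x) f = Pr R u f - Pr R v f := by
  unfold Pr
  rw [← integral_sub (Pr_int hu f) (Pr_int hv f)]
  simp [mul_sub]

lemma Pr_smul (c : ℝ) (f : Euc N) : Pr R (fun x => c * u x) f = c * Pr R u f := by
  unfold Pr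
  rw [← integral_const_mul]
  congr 1; ext x; ring

lemma Pr_sum {ι : Type*} (S : Finset ι) {g : ι → Euc N → ℝ} (h : ∀ i, memHs N s (BB N R) (g i)) (f : Euc N) :
    Pr R (fun x => ∑ i ∈ S, g i x) f = ∑ i ∈ S, Pr R (g i) f := by
  unfold Pr
  rw [← integral_finsetSum _ (fun i _ => Pr_int (h i) f)]
  simp [Finset.mul_sum]

lemma Pr_neg_right (f : Euc N) : Pr R u (-f) = - Pr R u f := by
  unfold Pr; rw [← integral_neg]; simp

lemma Pr_right_sum (hu : memHs N s (BB N R) u) (f : Euc N) : Pr R u f = ∑ i, f i * Pr R u (EuclideanSpace.single i 1) := by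
  unfold Pr
  simp only [← integral_const_mul]
  rw [← integral_finsetSum _ (fun i _ => (Pr_int hu _).const_mul _)]
  congr 1; ext x
  simp only [EuclideanSpace.inner_single_right, one_mul, conj_trivial]
  rw [PiLp.inner_apply, Finset.sum_mul]
  refine Finset.sum_congr rfl fun i _ => ?_
  simp; ring

lemma Pr_asym (au : Asym e u) (f : Euc N) (hf : refl e f = f) : Pr R u f = 0 := by
  have h := Pr_comp (R := R) (u := u) (refl e) f
  rw [hf] at h
  have h2 : Pr R (fun x => u (refl e x)) f = (-1) * Pr R u f := by
    rw [← Pr_smul]; congr 1; ext x; rw [au x]; ring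
  linarith

lemma refl_self (he : ‖e‖ = 1) : refl e e = -e := by
  rw [refl_apply he, real_inner_self_eq_norm_sq, he]
  simp [two_smul]

lemma refl_ortho (he : ‖e‖ = 1) {f : Euc N} (h : (inner ℝ f e : ℝ) = 0) : refl e f = f := by
  rw [refl_apply he, h]; simp

lemma Pr_pos [NeZero N] (hs : s ∈ Ioo (0 : ℝ) 1) (hR : 0 < R) (he : ‖e‖ = 1) (hu : IsEig N s (BB N R) u) (au : Asym e u)
    (hn : ∀ᵐ x, x ∈ HH e → x ∈ BB N R → 0 ≤ u x) (h0 : ¬ u =ᵐ[volume] 0) : 0 < Pr R u e := by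
  have hnn : 0 ≤ᵐ[volume.restrict (BB N R)] fun x => (inner ℝ x e : ℝ) * u x := by
    rw [EventuallyLE, ae_restrict_iff' meas_BB]
    filter_upwards [hn, ae_iso (refl e) hn] with x h1 h2 hx
    rcases lt_trichotomy (inner ℝ x e : ℝ) 0 with h | h | h
    · have := h2 ((refl_mem_HH he).2 h) (refl_mem_BB.2 hx)
      rw [au x] at this
      exact mul_nonneg_of_nonpos_of_nonpos h.le (by linarith)
    · simp [h]
    · exact mul_nonneg h.le (h1 h hx)
  refine lt_of_le_of_ne (integral_nonneg_of_ae hnn) fun hz => h0 ?_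
  have := (integral_eq_zero_iff_of_nonneg_ae hnn (Pr_int hu.mem e)).1 hz.symm
  rw [EventuallyEq, ae_restrict_iff' meas_BB] at this
  refine au.zero_of_half hs hR he hu ?_
  filter_upwards [this] with x hx h1 h2
  rcases mul_eq_zero.1 (hx h2) with h | h
  · exact absurd h (ne_of_gt h1)
  · exact h

lemma exists_iso {e f : Euc N} (he : ‖e‖ = 1) (hf : ‖f‖ = 1) : ∃ Q : Euc N ≃ₗᵢ[ℝ] Euc N, Q e = f := by
  by_cases h : e = f
  · exact ⟨LinearIsometryEquiv.refl ℝ _, h⟩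
  · obtain ⟨g, -, hg⟩ := exists_refl (he.trans hf.symm) h
    exact ⟨refl g, hg⟩

lemma refl_conj (he : ‖e‖ = 1) (Q : Euc N ≃ₗᵢ[ℝ] Euc N) (x : Euc N) : Q (refl e x) = refl (Q e) (Q x) := by
  rw [refl_apply he, refl_apply (by rw [Q.norm_map, he])]
  simp

lemma Asym.comp {f : Euc N} (hf : ‖f‖ = 1) (Q : Euc N ≃ₗᵢ[ℝ] Euc N) (hQ : Q f = e) (au : Asym e u) : Asym f (fun x => u (Q x)) := by
  intro x
  simp only
  rw [refl_conj hf, hQ, au]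

lemma memHH_comp {f : Euc N} (Q : Euc N ≃ₗᵢ[ℝ] Euc N) (hQ : Q f = e) {x : Euc N} : Q x ∈ HH e ↔ x ∈ HH f := by
  rw [mem_HH, mem_HH, ← hQ, Q.inner_map_map]

/-- coordinate vectors -/
abbrev E1 (N : ℕ) (i : Fin N) : Euc N := EuclideanSpace.single i (1:ℝ)

lemma E1_norm (i : Fin N) : ‖E1 N i‖ = 1 := by simp

lemma inner_E1 (x : Euc N) (i : Fin N) : (inner ℝ x (E1 N i) : ℝ) = x i := by
  simp [EuclideanSpace.inner_single_right]

structure Fam (N : ℕ) (s R α : ℝ) (w : Fin N → Euc N → ℝ) : Prop where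
  eig : ∀ i, IsEig N s (BB N R) (w i)
  asym : ∀ i, Asym (E1 N i) (w i)
  pair : ∀ i, Pr R (w i) (E1 N i) = α
  pos : 0 < α
  nonneg : ∀ i, ∀ᵐ x, x ∈ HH (E1 N i) → x ∈ BB N R → 0 ≤ w i x

lemma Fam.pair_ne {α : ℝ} {w : Fin N → Euc N → ℝ} (F : Fam N s R α w) {i j : Fin N} (h : i ≠ j) : Pr R (w i) (E1 N j) = 0 := by
  apply Pr_asym (F.asym i)
  apply refl_ortho (E1_norm i)
  rw [inner_E1]; simp [h]

lemma Fam.ne_zero {α : ℝ} {w : Fin N → Euc N → ℝ} (F : Fam N s R α w) (i : Fin N) : ¬ w i =ᵐ[volume] 0 := by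
  intro h
  have h1 := Pr_congr (R := R) h (E1 N i)
  rw [F.pair i] at h1
  have : Pr R (0 : Euc N → ℝ) (E1 N i) = 0 := by unfold Pr; simp
  linarith [F.pos]

theorem exists_fam [NeZero N] (hN2 : 2 ≤ N) (hs : s ∈ Ioo (sst N) 1) (hR : 0 < R) : ∃ (α : ℝ) (w : Fin N → Euc N → ℝ), Fam N s R α w := by
  have hs' : s ∈ Ioo (0:ℝ) 1 := ⟨by linarith [hs.1, (sst_mem (N := N)).1], hs.2⟩
  obtain ⟨u, hu, hu1⟩ := exists_eig (N := N) hs' hR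
  have hex : ∃ f : Euc N, ‖f‖ = 1 ∧ ¬ ∀ᵐ x, u (refl f x) = u x := by
    by_contra hcon
    push Not at hcon
    have h0 := radial_zero hN2 hs hR hu (fun f hf => hcon f hf)
    have : ∫ x in BB N R, u x ^ 2 = 0 := by
      rw [integral_congr_ae (g := fun _ => 0) (by filter_upwards [h0] with x hx; simp [hx])]; simp
    rw [this] at hu1
    exact zero_ne_one hu1
  obtain ⟨f, hf, hne⟩ := hex
  obtain ⟨w, hw, aw, nw, w0⟩ : ∃ w, IsEig N s (BB N R) w ∧ Asym f w ∧ (∀ᵐ x, x ∈ HH f → x ∈ BB N R → 0 ≤ w x) ∧ ¬ w =ᵐ[volume] 0 := by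
    have hw := hu.sub vol_BB_ne_top (hu.comp hR (refl f))
    have aw := Asym.mk f u
    have w0 : ¬ (fun x => u x - u (refl f x)) =ᵐ[volume] 0 := by
      intro h; apply hne
      filter_upwards [h] with x hx
      have : u x - u (refl f x) = 0 := hx
      linarith
    rcases sign_const hs' hR hf hw aw with h | h
    · exact ⟨_, hw, aw, h, w0⟩
    · refine ⟨_, hw.smul (-1), aw.smul (-1), ?_, ?_⟩
      · filter_upwards [h] with x hx h1 h2
        have := hx h1 h2; linarith
      · intro h; apply w0
        filter_upwards [h] with x hx
        have : (-1) * (u x - u (refl f x)) = 0 := hx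
        show u x - u (refl f x) = 0
        linarith
  choose Q hQ using fun i : Fin N => exists_iso (E1_norm i) hf
  refine ⟨Pr R w f, fun i x => w (Q i x), fun i => hw.comp hR (Q i), fun i => aw.comp (E1_norm i) (Q i) (hQ i), fun i => ?_, Pr_pos hs' hR hf hw aw nw w0, fun i => ?_⟩
  · rw [Pr_comp, hQ]
  · filter_upwards [ae_iso (Q i) nw] with x hx h1 h2
    exact hx ((memHH_comp (Q i) (hQ i)).2 h1) ((iso_mem_BB _).2 h2)

theorem Fam.span [NeZero N] (hN2 : 2 ≤ N) (hs : s ∈ Ioo (sst N) 1) (hR : 0 < R) {α : ℝ} {w : Fin N → Euc N → ℝ} (F : Fam N s R α w)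
    (hu : IsEig N s (BB N R) u) : ∃ b : Fin N → ℝ, ∀ᵐ x, u x = ∑ i, b i * w i x := by
  have hs' : s ∈ Ioo (0:ℝ) 1 := ⟨by linarith [hs.1, (sst_mem (N := N)).1], hs.2⟩
  have hc : ∀ i, ∃ t, ∀ᵐ x, u x - u (refl (E1 N i) x) = t * w i x := fun i =>
    asym_dim hs' hR (E1_norm i) (hu.sub vol_BB_ne_top (hu.comp hR _)) (Asym.mk _ u) (F.eig i) (F.asym i) (F.ne_zero i)
  choose c hc using hc
  have hinv : ∀ i j, i ≠ j → ∀ᵐ x, w j (refl (E1 N i) x) = w j x := by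
    intro i j hij
    have hfix : refl (E1 N i) (E1 N j) = E1 N j := by
      apply refl_ortho (E1_norm i); rw [inner_E1]; simp [hij]
    obtain ⟨t, ht⟩ := asym_dim hs' hR (E1_norm j) ((F.eig j).comp hR (refl (E1 N i))) ((F.asym j).comp (E1_norm j) _ hfix) (F.eig j) (F.asym j) (F.ne_zero j)
    have h1 := Pr_congr (R := R) ht (E1 N j)
    rw [Pr_comp, hfix, Pr_smul, F.pair] at h1
    have : t = 1 := by
      have := F.pos
      have h2 : α * (t - 1) = 0 := by linarith
      rcases mul_eq_zero.1 h2 with h | h <;> linarith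
    rw [this] at ht
    filter_upwards [ht] with x hx; rw [hx, one_mul]
  set r : Euc N → ℝ := fun x => u x - ∑ i, (c i / 2) * w i x with hr
  have hrE : IsEig N s (BB N R) r := hu.sub vol_BB_ne_top (IsEig.sum vol_BB_ne_top _ fun i => (F.eig i).smul _)
  have heven : ∀ i, ∀ᵐ x, r (refl (E1 N i) x) = r x := by
    intro i
    have hall : ∀ᵐ x, ∀ j, i ≠ j → w j (refl (E1 N i) x) = w j x := by
      rw [ae_all_iff]; intro j
      by_cases h : i = j
      · simp [h]
      · filter_upwards [hinv i j h] with x hx _ using hx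
    filter_upwards [hc i, hall] with x h1 h2
    simp only [hr]
    have e1 : ∑ j, c j / 2 * w j (refl (E1 N i) x) = ∑ j, c j / 2 * w j x - c i * w i x := by
      rw [← Finset.add_sum_erase _ _ (Finset.mem_univ i), ← Finset.add_sum_erase _ (fun j => c j / 2 * w j x) (Finset.mem_univ i),
        Finset.sum_congr rfl (fun j hj => by rw [h2 j (Finset.ne_of_mem_erase hj).symm]), F.asym i x]
      ring
    rw [e1]; linarith
  have hPr : ∀ f, Pr R r f = 0 := by
    intro f
    rw [Pr_right_sum hrE.mem]
    refine Finset.sum_eq_zero fun i _ => ?_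
    have h1 := Pr_congr (R := R) (heven i) (E1 N i)
    rw [Pr_comp, refl_self (E1_norm i), Pr_neg_right] at h1
    have : Pr R r (E1 N i) = 0 := by linarith
    rw [this, mul_zero]
  have hrad : ∀ f : Euc N, ‖f‖ = 1 → ∀ᵐ x, r (refl f x) = r x := by
    intro f hf
    obtain ⟨Q, hQ⟩ := exists_iso hf (E1_norm (0 : Fin N))
    have hw := (F.eig 0).comp hR Q
    have aw := (F.asym 0).comp hf Q hQ
    have hpair : Pr R (fun x => w 0 (Q x)) f = α := by rw [Pr_comp, hQ, F.pair]
    have w0 : ¬ (fun x => w 0 (Q x)) =ᵐ[volume] 0 := by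
      intro h
      have h1 := Pr_congr (R := R) h f
      rw [hpair] at h1
      have : Pr R (0 : Euc N → ℝ) f = 0 := by unfold Pr; simp
      linarith [F.pos]
    obtain ⟨t, ht⟩ := asym_dim hs' hR hf (hrE.sub vol_BB_ne_top (hrE.comp hR _)) (Asym.mk f r) hw aw w0
    have h1 := Pr_congr (R := R) ht f
    rw [Pr_sub hrE.mem (hrE.comp hR _).mem, Pr_smul, hpair, Pr_comp, hPr, hPr] at h1
    have ht0 : t = 0 := by
      have := F.pos
      have h2 : t * α = 0 := by linarith
      rcases mul_eq_zero.1 h2 with h | h <;> linarith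
    filter_upwards [ht] with x hx
    rw [ht0] at hx; linarith
  have h0 := hrE.eq_zero_of hs' (vol_BB_ne_zero hR) (radial_zero hN2 hs hR hrE hrad) meas_BB
  refine ⟨fun i => c i / 2, ?_⟩
  filter_upwards [h0] with x hx
  have : u x - ∑ i, (c i / 2) * w i x = 0 := hx
  linarith

theorem Fam.equi [NeZero N] (hN2 : 2 ≤ N) (hs : s ∈ Ioo (sst N) 1) (hR : 0 < R) {α : ℝ} {w : Fin N → Euc N → ℝ} (F : Fam N s R α w)
    (Q : Euc N ≃ₗᵢ[ℝ] Euc N) (i : Fin N) : ∀ᵐ x, w i (Q x) = ∑ j, (Q (E1 N j)) i * w j x := by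
  obtain ⟨b, hb⟩ := F.span hN2 hs hR ((F.eig i).comp hR Q)
  have : ∀ j, b j = (Q (E1 N j)) i := by
    intro j
    have h1 := Pr_congr (R := R) hb (E1 N j)
    rw [Pr_comp, Pr_sum _ (fun k => ((F.eig k).mem.smul (b k))), Pr_right_sum (F.eig i).mem] at h1
    simp only [Pr_smul] at h1
    rw [Finset.sum_eq_single i, Finset.sum_eq_single j, F.pair, F.pair] at h1
    · exact (mul_right_cancel₀ F.pos.ne' h1).symm
    · intro k _ hk; rw [F.pair_ne hk, mul_zero]
    · simp
    · intro k _ hk; rw [F.pair_ne hk.symm, mul_zero]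
    · simp
  simpa only [this] using hb

end

section

variable {N : ℕ} {s : ℝ} {Ω : Set (Euc N)} {u v w : Euc N → ℝ} {R : ℝ} {e : Euc N}

/-- exact equivariance of a family of functions -/
def Equi (a : Fin N → Euc N → ℝ) : Prop :=
  ∀ (Q : Euc N ≃ₗᵢ[ℝ] Euc N) (z : Euc N) (i : Fin N), a i (Q z) = ∑ j, (Q (E1 N j)) i * a j z

lemma Equi.form [NeZero N] {a : Fin N → Euc N → ℝ} (h : Equi a) {z : Euc N} (hz : z ≠ 0) (i : Fin N) :
    a i z = z i / ‖z‖ * a 0 (‖z‖ • E1 N 0) := by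
  have hzn : 0 < ‖z‖ := norm_pos_iff.2 hz
  have h0 : ∀ j : Fin N, j ≠ 0 → a j (‖z‖ • E1 N 0) = 0 := by
    intro j hj
    have h1 := h (refl (E1 N j)) (‖z‖ • E1 N 0) j
    rw [refl_ortho (E1_norm j) (by rw [inner_E1]; simp [hj]), Finset.sum_eq_single j] at h1
    · rw [refl_self (E1_norm j)] at h1
      simp at h1; linarith
    · intro k _ hk
      rw [refl_ortho (E1_norm j) (by rw [inner_E1]; simp [Ne.symm hk])]
      simp [Ne.symm hk]
    · simp
  obtain ⟨Q, hQ⟩ := exists_iso (E1_norm (0 : Fin N)) (f := ‖z‖⁻¹ • z)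
    (by rw [norm_smul, norm_inv, norm_norm, inv_mul_cancel₀ hzn.ne'])
  have h1 := h Q (‖z‖ • E1 N 0) i
  rw [Finset.sum_eq_single 0 (fun j _ hj => by rw [h0 j hj, mul_zero]) (by simp), map_smul, hQ, smul_smul,
    mul_inv_cancel₀ hzn.ne', one_smul] at h1
  rw [h1]
  simp only [PiLp.smul_apply, smul_eq_mul]
  ring

/-- interior averages -/
def Av (R τ : ℝ) (u : Euc N → ℝ) (z : Euc N) : ℝ := (∫ y in Dz R τ z, u y) / volume.real (Dz R τ z)

lemma setIntegral_ball_iso (Q : Euc N ≃ₗᵢ[ℝ] Euc N) (f : Euc N → ℝ) (c : Euc N) (r : ℝ) :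
    ∫ x in Metric.ball c r, f (Q x) = ∫ x in Metric.ball (Q c) r, f x := by
  have h := (Q.measurePreserving).setIntegral_preimage_emb Q.toMeasurableEquiv.measurableEmbedding f (Metric.ball (Q c) r)
  rw [← h]
  congr 2
  ext x; simp

lemma Av_equi [NeZero N] (hR : 0 < R) {τ : ℝ} (hτ : 0 < τ) {w : Fin N → Euc N → ℝ} (hl : ∀ i, LocallyIntegrable (w i))
    (hq : ∀ (Q : Euc N ≃ₗᵢ[ℝ] Euc N) i, ∀ᵐ x, w i (Q x) = ∑ j, (Q (E1 N j)) i * w j x) :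
    Equi (fun i => Av R τ (w i)) := by
  intro Q z i
  have hv : ∀ z : Euc N, volume.real (Dz R τ z) = (τ * R) ^ N * om N := fun z => vol_ball (by positivity) _
  simp only [Av, hv]
  have h1 : ∫ y in Dz R τ (Q z), w i y = ∑ j, (Q (E1 N j)) i * ∫ y in Dz R τ z, w j y := by
    simp only [Dz]
    rw [← map_smul, ← setIntegral_ball_iso Q (w i)]
    rw [integral_congr_ae (ae_restrict_of_ae (hq Q i)), integral_finsetSum]
    · simp [integral_const_mul]
    · intro j _
      exact (((hl j).integrableOn_isCompact (isCompact_closedBall _ _)).mono_set Metric.ball_subset_closedBall).const_mul _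
  rw [h1, Finset.sum_div]
  simp [mul_div_assoc]

lemma Av_cont [NeZero N] (hR : 0 < R) {τ : ℝ} (hτ : 0 < τ) (hl : LocallyIntegrable u) : Continuous (Av R τ u) := by
  have hv : ∀ z : Euc N, volume.real (Dz R τ z) = (τ * R) ^ N * om N := fun z => vol_ball (by positivity) _
  have hτR : 0 < τ * R := by positivity
  suffices h : Continuous (fun c : Euc N => ∫ y in Metric.ball c (τ * R), u y) by
    have h2 : Av R τ u = fun z => (fun c : Euc N => ∫ y in Metric.ball c (τ * R), u y) ((1 - τ) • z) / ((τ * R) ^ N * om N) := by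
      ext z; simp only [Av, hv]; rfl
    rw [h2]
    exact (h.comp (continuous_const_smul (1 - τ))).div_const _
  rw [continuous_iff_continuousAt]
  intro c
  have he : (fun c : Euc N => ∫ y in Metric.ball c (τ * R), u y) = fun c => ∫ y, (Metric.ball c (τ * R)).indicator u y := by
    ext c; rw [integral_indicator measurableSet_ball]
  rw [he]
  refine continuousAt_of_dominated (bound := (Metric.closedBall c (τ * R + 1)).indicator (fun y => ‖u y‖)) ?_ ?_ ?_ ?_
  · refine Eventually.of_forall fun x => ?_
    exact hl.aestronglyMeasurable.indicator measurableSet_ball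
  · filter_upwards [Metric.ball_mem_nhds c one_pos] with x hx
    refine Eventually.of_forall fun y => ?_
    rw [norm_indicator_eq_indicator_norm]
    refine indicator_le_indicator_of_subset ?_ (fun _ => norm_nonneg _) y
    intro y hy
    rw [Metric.mem_ball] at hy hx
    rw [Metric.mem_closedBall]
    linarith [dist_triangle y x c]
  · rw [integrable_indicator_iff measurableSet_closedBall]
    exact (hl.integrableOn_isCompact (isCompact_closedBall _ _)).norm
  · have hn : ∀ᵐ y : Euc N, y ∉ Metric.sphere c (τ * R) := by
      exact compl_mem_ae_iff.2 (Measure.addHaar_sphere volume c (τ * R))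
    filter_upwards [hn] with y hy
    rw [Metric.mem_sphere] at hy
    have hc : ContinuousAt (fun x : Euc N => dist y x) c := by fun_prop
    rcases lt_or_gt_of_ne hy with h | h
    · refine (continuousAt_const (y := u y)).congr ?_
      filter_upwards [hc.eventually (Iio_mem_nhds h)] with x hx
      rw [indicator_of_mem]; simpa using hx
    · refine (continuousAt_const (y := (0:ℝ))).congr ?_
      filter_upwards [hc.eventually (Ioi_mem_nhds h)] with x hx
      rw [indicator_of_notMem]; simp at hx ⊢; exact hx.le

lemma ball_ae_eq_cball [NeZero N] (c : Euc N) (r : ℝ) : Metric.ball c r =ᵐ[volume] Metric.closedBall c r :=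
  ae_eq_of_subset_of_measure_ge Metric.ball_subset_closedBall
    (Measure.addHaar_closedBall_eq_addHaar_ball volume c r).le measurableSet_ball.nullMeasurableSet measure_closedBall_lt_top.ne

lemma Av_tendsto [NeZero N] (hR : 0 < R) (hl : LocallyIntegrable u) :
    ∀ᵐ z, z ∈ BB N R → Tendsto (fun k : ℕ => Av R ((1/2:ℝ)^(k+1)) u z) atTop (𝓝 (u z)) := by
  filter_upwards [IsUnifLocDoublingMeasure.ae_tendsto_average (μ := volume) hl 1] with z hz hzB
  have h := hz (l := atTop) (fun k : ℕ => (1 - (1/2:ℝ)^(k+1)) • z) (fun k => (1/2:ℝ)^(k+1) * R) ?_ ?_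
  · refine h.congr fun k => ?_
    rw [Av, Dz, setAverage_eq, measureReal_def, measureReal_def, Measure.addHaar_closedBall_eq_addHaar_ball, smul_eq_mul,
      setIntegral_congr_set (ball_ae_eq_cball _ _).symm, mul_comm, ← div_eq_mul_inv]
  · rw [tendsto_nhdsWithin_iff]
    refine ⟨?_, Eventually.of_forall fun k => by simp only [mem_Ioi]; positivity⟩
    have := ((tendsto_pow_atTop_nhds_zero_of_lt_one (r := (1/2:ℝ)) (by norm_num) (by norm_num)).comp (tendsto_add_atTop_nat 1)).mul_const R
    simpa using this
  · refine Eventually.of_forall fun k => ?_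
    rw [Metric.mem_closedBall, dist_eq_norm, sub_smul, one_smul, sub_sub_cancel, norm_smul, Real.norm_of_nonneg (by positivity), one_mul]
    gcongr
    exact (mem_ball_zero_iff.1 hzB).le

end

section

variable {N : ℕ} {s : ℝ} {Ω : Set (Euc N)} {u v : Euc N → ℝ} {R : ℝ} {e : Euc N} {w : Fin N → Euc N → ℝ}

/-- energy density of the whole family -/
def EW (s : ℝ) (w : Fin N → Euc N → ℝ) (x y : Euc N) : ℝ≥0∞ :=
  ENNReal.ofReal (∑ i, (w i x - w i y) ^ 2) * ENNReal.ofReal (Kf N s (x - y))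

lemma measurable_EW (hm : ∀ i, Measurable (w i)) : Measurable (fun q : Euc N × Euc N => EW s w q.1 q.2) := by
  unfold EW
  refine Measurable.mul (Measurable.ennreal_ofReal ?_) (measurable_Kf.comp (measurable_fst.sub measurable_snd)).ennreal_ofReal
  refine Finset.measurable_sum _ fun i _ => ?_
  exact (((hm i).comp measurable_fst).sub ((hm i).comp measurable_snd)).pow_const 2

lemma sum_sq_iso (Q : Euc N ≃ₗᵢ[ℝ] Euc N) (d : Fin N → ℝ) :
    ∑ i, (∑ j, (Q (E1 N j)) i * d j) ^ 2 = ∑ i, d i ^ 2 := by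
  have h : Q (∑ j, d j • E1 N j) = WithLp.toLp 2 (fun i => ∑ j, (Q (E1 N j)) i * d j) := by
    ext i
    simp [map_sum, mul_comm]
  have h2 : (∑ j, d j • E1 N j) = WithLp.toLp 2 d := by
    ext i
    simp [Finset.sum_apply, Pi.single_apply]
  have h3 := Q.norm_map (∑ j, d j • E1 N j)
  rw [h, h2, EuclideanSpace.norm_eq, EuclideanSpace.norm_eq, Real.sqrt_inj (by positivity) (by positivity)] at h3
  simpa using h3

lemma EW_rot (hq : ∀ (Q : Euc N ≃ₗᵢ[ℝ] Euc N) i, ∀ᵐ x, w i (Q x) = ∑ j, (Q (E1 N j)) i * w j x)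
    (Q : Euc N ≃ₗᵢ[ℝ] Euc N) : ∀ᵐ x, ∀ᵐ y, EW s w (Q x) (Q y) = EW s w x y := by
  have h := ae_all_iff.2 (hq Q)
  filter_upwards [h] with x hx
  filter_upwards [h] with y hy
  unfold EW
  rw [← map_sub, Kf_norm (Q.norm_map (x - y))]
  congr 2
  rw [← sum_sq_iso Q (fun i => w i x - w i y)]
  refine Finset.sum_congr rfl fun i _ => ?_
  rw [hx, hy, ← Finset.sum_sub_distrib]
  simp [mul_sub]

/-- local energy -/
def GE (s R : ℝ) (w : Fin N → Euc N → ℝ) (ρ : ℝ) (c : Euc N) : ℝ≥0∞ :=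
  ∫⁻ x in Metric.ball c ρ ∩ BB N R, ∫⁻ y in Metric.ball c ρ ∩ BB N R, EW s w x y

def GT (s R : ℝ) (w : Fin N → Euc N → ℝ) : ℝ≥0∞ := ∫⁻ x in BB N R, ∫⁻ y in BB N R, EW s w x y

lemma GE_rot (hq : ∀ (Q : Euc N ≃ₗᵢ[ℝ] Euc N) i, ∀ᵐ x, w i (Q x) = ∑ j, (Q (E1 N j)) i * w j x)
    (Q : Euc N ≃ₗᵢ[ℝ] Euc N) (ρ : ℝ) (c : Euc N) : GE s R w ρ (Q c) = GE s R w ρ c := by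
  unfold GE
  have hp : Q ⁻¹' (Metric.ball (Q c) ρ ∩ BB N R) = Metric.ball c ρ ∩ BB N R := by ext x; simp
  have hE := Q.toMeasurableEquiv.measurableEmbedding
  have hM := Q.measurePreserving
  rw [← hM.setLIntegral_comp_preimage_emb hE, hp]
  refine lintegral_congr_ae (ae_restrict_of_ae ?_)
  filter_upwards [EW_rot (s := s) hq Q] with x hx
  rw [← hM.setLIntegral_comp_preimage_emb hE, hp]
  exact lintegral_congr_ae (ae_restrict_of_ae hx)

lemma GE_mono {ρ ρ' : ℝ} {c c' : Euc N} (h : Metric.ball c ρ ⊆ Metric.ball c' ρ') : GE s R w ρ c ≤ GE s R w ρ' c' := by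
  unfold GE
  refine (lintegral_mono_set (inter_subset_inter_left _ h)).trans (lintegral_mono fun x => ?_)
  exact lintegral_mono_set (inter_subset_inter_left _ h)

lemma GE_int [NeZero N] (hm : ∀ i, Measurable (w i)) {ρ : ℝ} (hρ : 0 < ρ) :
    ∫⁻ c, GE s R w ρ c ≤ ENNReal.ofReal (ρ ^ N * om N) * GT s R w := by
  set Φ : Euc N → ℝ≥0∞ := fun x => ∫⁻ y in BB N R, EW s w x y with hΦ
  have hΦm : Measurable Φ := Measurable.lintegral_prod_right (measurable_EW hm)
  have hset : MeasurableSet {q : Euc N × Euc N | ‖q.2 - q.1‖ < ρ} :=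
    measurableSet_lt (measurable_snd.sub measurable_fst).norm measurable_const
  calc ∫⁻ c, GE s R w ρ c ≤ ∫⁻ c, ∫⁻ x in BB N R, {q : Euc N × Euc N | ‖q.2 - q.1‖ < ρ}.indicator (fun q => Φ q.2) (c, x) := by
        refine lintegral_mono fun c => ?_
        unfold GE
        rw [inter_comm, ← Measure.restrict_restrict_of_subset (inter_subset_left : BB N R ∩ Metric.ball c ρ ⊆ BB N R)]
        have h1 : ∫⁻ x in BB N R, {q : Euc N × Euc N | ‖q.2 - q.1‖ < ρ}.indicator (fun q => Φ q.2) (c, x)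
            = ∫⁻ x in BB N R, (Metric.ball c ρ).indicator Φ x := by
          refine lintegral_congr fun x => ?_
          by_cases hx : ‖x - c‖ < ρ
          · rw [indicator_of_mem (by exact hx), indicator_of_mem (by rwa [mem_ball_iff_norm])]
          · rw [indicator_of_notMem (by exact hx), indicator_of_notMem (by rwa [mem_ball_iff_norm])]
        rw [h1, lintegral_indicator measurableSet_ball]
        rw [Measure.restrict_restrict_of_subset inter_subset_left, Measure.restrict_restrict measurableSet_ball, inter_comm]
        refine lintegral_mono fun x => ?_
        exact lintegral_mono_set inter_subset_right
    _ = ∫⁻ x in BB N R, ∫⁻ c, {q : Euc N × Euc N | ‖q.2 - q.1‖ < ρ}.indicator (fun q => Φ q.2) (c, x) := by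
        rw [lintegral_lintegral_swap]
        exact ((hΦm.comp measurable_snd).indicator hset).aemeasurable
    _ = ∫⁻ x in BB N R, ENNReal.ofReal (ρ ^ N * om N) * Φ x := by
        refine lintegral_congr fun x => ?_
        have h1 : ∫⁻ c, {q : Euc N × Euc N | ‖q.2 - q.1‖ < ρ}.indicator (fun q => Φ q.2) (c, x) = ∫⁻ c, (Metric.ball x ρ).indicator (fun _ => Φ x) c := by
          refine lintegral_congr fun c => ?_
          by_cases hx : ‖x - c‖ < ρ
          · rw [indicator_of_mem (by exact hx), indicator_of_mem (by rwa [mem_ball_iff_norm, norm_sub_rev])]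
          · rw [indicator_of_notMem (by exact hx), indicator_of_notMem (by rwa [mem_ball_iff_norm, norm_sub_rev])]
        rw [h1, lintegral_indicator measurableSet_ball, setLIntegral_const, mul_comm, ← vol_ball hρ.le x, measureReal_def,
          ENNReal.ofReal_toReal measure_ball_lt_top.ne]
    _ = _ := by rw [lintegral_const_mul _ hΦm]; rfl

lemma GT_fin (hm : ∀ i, memHs N s (BB N R) (w i)) : GT s R w ≠ ⊤ := by
  have h1 : GT s R w ≤ ∑ i, ∫⁻ x in BB N R, ∫⁻ y, ENNReal.ofReal (Df (w i) (x, y) ^ 2) * ENNReal.ofReal (Kf N s (x - y)) := by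
    have hme : ∀ i, Measurable fun q : Euc N × Euc N => ENNReal.ofReal (Df (w i) q ^ 2) * ENNReal.ofReal (Kf N s (q.1 - q.2)) := fun i =>
      ((measurable_Df (hm i).meas).pow_const 2).ennreal_ofReal.mul (measurable_Kf.comp (measurable_fst.sub measurable_snd)).ennreal_ofReal
    rw [← lintegral_finsetSum _ (fun i _ => Measurable.lintegral_prod_right (hme i))]
    unfold GT
    refine lintegral_mono fun x => ?_
    have hme2 : ∀ i, Measurable fun y : Euc N => ENNReal.ofReal (Df (w i) (x, y) ^ 2) * ENNReal.ofReal (Kf N s (x - y)) :=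
      fun i => (hme i).comp measurable_prodMk_left
    rw [← lintegral_finsetSum _ (fun i _ => hme2 i)]
    refine (setLIntegral_le_lintegral _ _).trans (lintegral_mono fun y => ?_)
    unfold EW
    rw [ENNReal.ofReal_sum_of_nonneg (fun i _ => sq_nonneg _), Finset.sum_mul]
    rfl
  refine (h1.trans_lt ?_).ne
  refine ENNReal.sum_lt_top.2 fun i _ => ?_
  refine (lintegral_nu_ge ((measurable_Df (hm i).meas).pow_const 2).ennreal_ofReal).trans_lt ?_
  rw [← bform_ofReal (hm i)]
  exact ENNReal.ofReal_lt_top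

lemma GE_bound [NeZero N] (hm : ∀ i, Measurable (w i))
    (hq : ∀ (Q : Euc N ≃ₗᵢ[ℝ] Euc N) i, ∀ᵐ x, w i (Q x) = ∑ j, (Q (E1 N j)) i * w j x)
    {ρ : ℝ} (hρ : 0 < ρ) {z : Euc N} (hz : ρ ≤ ‖z‖) :
    ENNReal.ofReal (ρ * ‖z‖ ^ (N - 1) * om N) * GE s R w ρ z ≤ ENNReal.ofReal ((2 * ρ) ^ N * om N) * GT s R w := by
  refine le_trans ?_ (GE_int (s := s) (R := R) hm (ρ := 2 * ρ) (by positivity))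
  set S : Set (Euc N) := Metric.ball 0 ‖z‖ \ Metric.closedBall 0 (‖z‖ - ρ) with hS
  have hSm : MeasurableSet S := measurableSet_ball.diff measurableSet_closedBall
  have hSv : ENNReal.ofReal (ρ * ‖z‖ ^ (N - 1) * om N) ≤ volume S := by
    rw [hS, measure_sdiff (Metric.closedBall_subset_ball (by linarith)) measurableSet_closedBall.nullMeasurableSet measure_closedBall_lt_top.ne,
      Measure.addHaar_closedBall_eq_addHaar_ball, ← ENNReal.ofReal_toReal (measure_ball_lt_top (μ := volume) (x := (0 : Euc N)) (r := ‖z‖)).ne,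
      ← ENNReal.ofReal_toReal (measure_ball_lt_top (μ := volume) (x := (0 : Euc N)) (r := ‖z‖ - ρ)).ne, ← measureReal_def, ← measureReal_def,
      vol_ball (norm_nonneg z), vol_ball (by linarith), ← ENNReal.ofReal_sub _ (by have := om_pos (N := N); have : 0 ≤ ‖z‖ - ρ := by linarith
                                                                                   positivity)]
    apply ENNReal.ofReal_le_ofReal
    have h1 : (‖z‖ - ρ) ^ N ≤ ‖z‖ ^ (N - 1) * (‖z‖ - ρ) := by
      obtain ⟨n, hn⟩ : ∃ n, N = n + 1 := ⟨N - 1, (Nat.succ_pred_eq_of_ne_zero (NeZero.ne N)).symm⟩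
      have h3 : (‖z‖ - ρ) ^ N = (‖z‖ - ρ) ^ (N - 1) * (‖z‖ - ρ) := by rw [← pow_succ]; congr 1; omega
      rw [h3]
      have : 0 ≤ ‖z‖ - ρ := by linarith
      gcongr; linarith
    have h2 : ‖z‖ ^ N = ‖z‖ ^ (N - 1) * ‖z‖ := by rw [← pow_succ]; congr 1; have := NeZero.ne N; omega
    have := om_pos (N := N)
    rw [h2, ← sub_mul]
    gcongr
    linarith
  calc ENNReal.ofReal (ρ * ‖z‖ ^ (N - 1) * om N) * GE s R w ρ z ≤ volume S * GE s R w ρ z := mul_le_mul hSv le_rfl zero_le zero_le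
    _ = ∫⁻ c in S, GE s R w ρ z := by rw [setLIntegral_const, mul_comm]
    _ ≤ ∫⁻ c in S, GE s R w (2 * ρ) c := by
        refine setLIntegral_mono' hSm fun c hc => ?_
        have hc1 : ‖c‖ < ‖z‖ := by simpa using hc.1
        have hc2 : ‖z‖ - ρ < ‖c‖ := by simpa using hc.2
        have hc0 : 0 < ‖c‖ := by linarith
        have hz0 : 0 < ‖z‖ := by linarith
        obtain ⟨Q, hQ⟩ := exists_iso (e := ‖z‖⁻¹ • z) (f := ‖c‖⁻¹ • c) (by rw [norm_smul, norm_inv, norm_norm, inv_mul_cancel₀ hz0.ne'])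
          (by rw [norm_smul, norm_inv, norm_norm, inv_mul_cancel₀ hc0.ne'])
        have hQz : Q z = (‖z‖ / ‖c‖) • c := by
          rw [map_smul] at hQ
          have := congrArg (fun y => ‖z‖ • y) hQ
          simpa [smul_smul, mul_inv_cancel₀ hz0.ne', div_eq_mul_inv] using this
        rw [← GE_rot hq Q]
        apply GE_mono
        intro y hy
        rw [mem_ball_iff_norm] at hy ⊢
        have h4 : ‖Q z - c‖ < ρ := by
          have : Q z - c = (‖z‖ / ‖c‖ - 1) • c := by rw [hQz, sub_smul, one_smul]
          rw [this, norm_smul, Real.norm_of_nonneg (by rw [sub_nonneg, le_div_iff₀ hc0]; linarith), sub_mul, div_mul_cancel₀ _ hc0.ne']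
          linarith
        have : ‖y - c‖ ≤ ‖y - Q z‖ + ‖Q z - c‖ := norm_sub_le_norm_sub_add_norm_sub _ _ _
        linarith
    _ ≤ _ := setLIntegral_le_lintegral _ _

lemma Av_diff [NeZero N] (hs : s ∈ Ioo (0:ℝ) 1) (hR : 0 < R) (hm : ∀ i, memHs N s (BB N R) (w i)) (i : Fin N)
    {τ : ℝ} (h0 : 0 < τ) (h1 : τ < 1) {z : Euc N} (hz : ‖z‖ ≤ R) :
    ENNReal.ofReal ((Av R τ (w i) z - Av R (τ / 2) (w i) z) ^ 2) ≤
      ENNReal.ofReal ((3 * (τ * R)) ^ ((N:ℝ) + 2 * s) / ((τ / 2 * R) ^ N * om N) / ((τ * R) ^ N * om N)) * GE s R w (2 * (τ * R)) z := by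
  have hom := om_pos (N := N)
  have hv : ∀ τ : ℝ, 0 < τ → volume.real (Dz R τ z) = (τ * R) ^ N * om N := fun τ h => vol_ball (by positivity) _
  have hL : ∀ τ : ℝ, 0 < τ → τ < 1 → MemLp (w i) 2 (volume.restrict (Dz R τ z)) := fun τ h h' =>
    (hm i).memLp.mono_measure (Measure.restrict_mono (Dz_subset h h' hz) le_rfl)
  have hfin : ∀ τ : ℝ, IsFiniteMeasure (volume.restrict (Dz R τ z)) := fun τ =>
    ⟨by rw [Measure.restrict_apply_univ]; exact measure_ball_lt_top⟩
  have hτ2 : 0 < τ / 2 := by positivity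
  set a := Av R (τ / 2) (w i) z with ha
  set V := (τ * R) ^ N * om N with hV
  have hVp : 0 < V := by positivity
  have hf : MemLp (fun x => w i x - a) 2 (volume.restrict (Dz R τ z)) := (hL τ h0 h1).sub (memLp_const a)
  have e1 := sq_integral_le hf
  have e2 : ∫ x in Dz R τ z, (w i x - a) = V * (Av R τ (w i) z - a) := by
    rw [integral_sub ((hL τ h0 h1).integrable (by norm_num)) (integrable_const a), integral_const, Av, hv τ h0,
      measureReal_restrict_apply_univ, hv τ h0, smul_eq_mul]
    field_simp
    rw [hV]; ring
  rw [e2, measureReal_restrict_apply_univ, hv τ h0] at e1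
  have e3 : (Av R τ (w i) z - a) ^ 2 ≤ V⁻¹ * ∫ x in Dz R τ z, (w i x - a) ^ 2 := by
    rw [inv_mul_eq_div, le_div_iff₀ hVp]
    have : V * ((Av R τ (w i) z - a) ^ 2 * V) ≤ V * ∫ x in Dz R τ z, (w i x - a) ^ 2 := by linarith
    exact le_of_mul_le_mul_left this hVp
  set C := (3 * (τ * R)) ^ ((N:ℝ) + 2 * s) / ((τ / 2 * R) ^ N * om N) with hC
  have hCp : 0 ≤ C := by positivity
  have hsub : ∀ σ, 0 < σ → σ < 1 → σ ≤ τ → Dz R σ z ⊆ Metric.ball z (2 * (τ * R)) ∩ BB N R := by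
    intro σ h h' hle y hy
    refine ⟨?_, Dz_subset h h' hz hy⟩
    rw [Dz, mem_ball_iff_norm] at hy
    rw [mem_ball_iff_norm]
    have e : ‖y - z‖ ≤ ‖y - (1 - σ) • z‖ + ‖(1 - σ) • z - z‖ := norm_sub_le_norm_sub_add_norm_sub _ _ _
    have e' : ‖(1 - σ) • z - z‖ ≤ σ * R := by
      rw [sub_smul, one_smul, sub_sub_cancel_left, norm_neg, norm_smul, Real.norm_of_nonneg h.le]; gcongr
    have : σ * R ≤ τ * R := by gcongr
    linarith
  calc ENNReal.ofReal ((Av R τ (w i) z - a) ^ 2) ≤ ENNReal.ofReal (V⁻¹ * ∫ x in Dz R τ z, (w i x - a) ^ 2) := ENNReal.ofReal_le_ofReal e3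
    _ = ENNReal.ofReal V⁻¹ * ∫⁻ x in Dz R τ z, ENNReal.ofReal ((w i x - a) ^ 2) := by
        rw [ENNReal.ofReal_mul (by positivity), ofReal_integral_eq_lintegral_ofReal hf.integrable_sq (Eventually.of_forall fun x => sq_nonneg _)]
    _ ≤ ENNReal.ofReal V⁻¹ * ∫⁻ x in Dz R τ z, ENNReal.ofReal C * ∫⁻ y in Dz R (τ / 2) z, EW s w x y := by
        refine mul_le_mul le_rfl ?_ zero_le zero_le
        refine setLIntegral_mono' measurableSet_ball fun x hx => ?_
        have key := avg_est (u := w i) hs.1 (D := Dz R (τ/2) z) measurableSet_ball (by rw [hv _ hτ2]; positivity)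
          measure_ball_lt_top.ne (hL _ hτ2 (by linarith)) x (d := 3 * (τ * R)) (fun y hy => by
            have h5 := (hsub τ h0 h1 le_rfl hx).1
            rw [mem_ball_iff_norm] at h5
            have := Dz_dist hτ2 hz h5.le hy; linarith)
        rw [hv _ hτ2] at key
        have ha' : a = (∫ y in Dz R (τ/2) z, w i y) / ((τ / 2 * R) ^ N * om N) := by rw [ha, Av, hv _ hτ2]
        rw [← ha'] at key
        refine key.trans (mul_le_mul le_rfl (lintegral_mono fun y => ?_) zero_le zero_le)
        unfold EW
        refine mul_le_mul (ENNReal.ofReal_le_ofReal ?_) le_rfl zero_le zero_le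
        exact Finset.single_le_sum (f := fun i => (w i x - w i y) ^ 2) (fun j _ => sq_nonneg _) (Finset.mem_univ i)
    _ ≤ ENNReal.ofReal V⁻¹ * (ENNReal.ofReal C * GE s R w (2 * (τ * R)) z) := by
        refine mul_le_mul le_rfl ?_ zero_le zero_le
        rw [lintegral_const_mul _ (Measurable.lintegral_prod_right (measurable_EW fun i => (hm i).meas))]
        refine mul_le_mul le_rfl ?_ zero_le zero_le
        unfold GE
        refine (lintegral_mono_set (hsub τ h0 h1 le_rfl)).trans (lintegral_mono fun x => ?_)
        exact lintegral_mono_set (hsub (τ/2) hτ2 (by linarith) (by linarith))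
    _ = _ := by
        rw [← mul_assoc, ← ENNReal.ofReal_mul (by positivity), mul_comm V⁻¹, ← div_eq_mul_inv]

lemma Av_cauchy [NeZero N] (hs : s ∈ Ioo (0:ℝ) 1) (hR : 0 < R) (hm : ∀ i, memHs N s (BB N R) (w i))
    (hq : ∀ (Q : Euc N ≃ₗᵢ[ℝ] Euc N) i, ∀ᵐ x, w i (Q x) = ∑ j, (Q (E1 N j)) i * w j x) (i : Fin N) {a : ℝ} (ha : 0 < a) :
    ∃ C : ℝ, 0 ≤ C ∧ ∀ τ : ℝ, 0 < τ → τ < 1 → 2 * (τ * R) ≤ a → ∀ z : Euc N, a ≤ ‖z‖ → ‖z‖ ≤ R →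
      (Av R τ (w i) z - Av R (τ / 2) (w i) z) ^ 2 ≤ C * (τ * R) ^ (2 * s - 1) := by
  have hom := om_pos (N := N)
  set G := (GT s R w).toReal with hG
  have hGE : GT s R w = ENNReal.ofReal G := (ENNReal.ofReal_toReal (GT_fin hm)).symm
  have hG0 : 0 ≤ G := ENNReal.toReal_nonneg
  refine ⟨(3:ℝ) ^ ((N:ℝ) + 2 * s) * 2 ^ N / om N / om N * (4 ^ N / (2 * a ^ (N - 1)) * G), by positivity, ?_⟩
  intro τ h0 h1 h2 z hz hzR
  have hθ : 0 < τ * R := by positivity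
  have b1 := Av_diff hs hR hm i h0 h1 hzR
  have b2 := GE_bound (s := s) (R := R) (fun i => (hm i).meas) hq (ρ := 2 * (τ * R)) (by positivity) (h2.trans hz)
  have hτ : τ / 2 * R = τ * R / 2 := by ring
  rw [hτ] at b1
  set θ := τ * R with hθd
  have b3 : GE s R w (2 * θ) z ≤ ENNReal.ofReal (4 ^ N * θ ^ N / (2 * θ * a ^ (N - 1)) * G) := by
    have hp : 0 < 2 * θ * a ^ (N - 1) * om N := by positivity
    have b4 : ENNReal.ofReal (2 * θ * a ^ (N - 1) * om N) * GE s R w (2 * θ) z ≤ ENNReal.ofReal ((2 * (2 * θ)) ^ N * om N * G) := by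
      rw [ENNReal.ofReal_mul (q := G) (by positivity), ← hGE]
      refine le_trans (mul_le_mul (ENNReal.ofReal_le_ofReal ?_) le_rfl zero_le zero_le) b2
      gcongr
    have b5 : GE s R w (2 * θ) z ≤ ENNReal.ofReal ((2 * (2 * θ)) ^ N * om N * G) / ENNReal.ofReal (2 * θ * a ^ (N - 1) * om N) := by
      rw [ENNReal.le_div_iff_mul_le (Or.inl (by simpa using hp)) (Or.inl ENNReal.ofReal_ne_top), mul_comm]
      exact b4
    rw [← ENNReal.ofReal_div_of_pos hp] at b5
    refine b5.trans (ENNReal.ofReal_le_ofReal (le_of_eq ?_))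
    have : (2 * (2 * θ)) ^ N = 4 ^ N * θ ^ N := by rw [← mul_pow]; ring
    rw [this]; field_simp
  have b6 := b1.trans (mul_le_mul le_rfl b3 zero_le zero_le)
  rw [← ENNReal.ofReal_mul (by positivity), ENNReal.ofReal_le_ofReal_iff (by positivity)] at b6
  refine b6.trans (le_of_eq ?_)
  have hr : (3 * θ) ^ ((N:ℝ) + 2 * s) = 3 ^ ((N:ℝ) + 2 * s) * (θ ^ N * (θ ^ (2 * s - 1) * θ)) := by
    rw [Real.mul_rpow (by norm_num) hθ.le, ← Real.rpow_natCast θ N, ← Real.rpow_add_one hθ.ne', ← Real.rpow_add hθ]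
    congr 2; ring
  rw [hr, div_pow]
  field_simp

end

section

variable {N : ℕ} {s : ℝ} {Ω : Set (Euc N)} {u v : Euc N → ℝ} {R : ℝ} {e : Euc N} {w : Fin N → Euc N → ℝ}

theorem Fam.radial_form [NeZero N] (hN2 : 2 ≤ N) (hs : s ∈ Ioo (sst N) 1) (hR : 0 < R) {α : ℝ} (F : Fam N s R α w) :
    ∃ γ : ℝ → ℝ, ContinuousOn γ (Ioc 0 R) ∧ ∀ i, ∀ᵐ x, x ∈ BB N R → w i x = x i / ‖x‖ * γ ‖x‖ := by
  have hs' : s ∈ Ioo (0:ℝ) 1 := ⟨by linarith [hs.1, (sst_mem (N := N)).1], hs.2⟩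
  have hs2 : 0 < 2 * s - 1 := by linarith [hs.1, (sst_mem (N := N)).1]
  have hm : ∀ i, memHs N s (BB N R) (w i) := fun i => (F.eig i).mem
  have hq := F.equi hN2 hs hR
  have hl : ∀ i, LocallyIntegrable (w i) := fun i => (hm i).locInt hs' hR
  set g : ℕ → ℝ → ℝ := fun k t => Av R ((1/2:ℝ)^(k+1)) (w 0) (t • E1 N 0) with hg
  have hgc : ∀ k, Continuous (g k) := fun k => (Av_cont hR (by positivity) (hl 0)).comp (by fun_prop)
  set q : ℝ := (1/2:ℝ) ^ ((2 * s - 1) / 2) with hqd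
  have hq0 : 0 < q := by positivity
  have hq1 : q < 1 := Real.rpow_lt_one (by norm_num) (by norm_num) (by linarith)
  have key : ∀ a, 0 < a → a ≤ R → ∃ (k0 : ℕ) (C : ℝ), ∀ t ∈ Icc a R, ∀ k, dist (g (k + k0) t) (g (k + 1 + k0) t) ≤ C * q ^ k := by
    intro a ha haR
    obtain ⟨C, hC0, hC⟩ := Av_cauchy hs' hR hm hq 0 ha
    obtain ⟨k0, hk0⟩ := exists_pow_lt_of_lt_one (show 0 < a / (2 * R) by positivity) (show (1/2:ℝ) < 1 by norm_num)
    refine ⟨k0, Real.sqrt (C * R ^ (2 * s - 1)), fun t ht k => ?_⟩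
    have hle : ((1/2:ℝ)^(k + k0 + 1)) ≤ (1/2) ^ k0 := pow_le_pow_of_le_one (by norm_num) (by norm_num) (by omega)
    have htn : ‖t • E1 N (0 : Fin N)‖ = t := by rw [norm_smul, E1_norm, mul_one, Real.norm_of_nonneg (ha.le.trans ht.1)]
    have h1 := hC ((1/2:ℝ)^(k + k0 + 1)) (by positivity) (pow_lt_one₀ (by norm_num) (by norm_num) (by omega)) (by
      rw [lt_div_iff₀ (by positivity)] at hk0
      nlinarith) (t • E1 N 0) (by rw [htn]; exact ht.1) (by rw [htn]; exact ht.2)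
    have h2 : (1/2:ℝ)^(k + k0 + 1) / 2 = (1/2:ℝ)^(k + 1 + k0 + 1) := by
      rw [show k + 1 + k0 + 1 = (k + k0 + 1) + 1 by ring, pow_succ (1/2:ℝ) (k + k0 + 1)]; ring
    rw [h2] at h1
    rw [Real.dist_eq]
    have h3 : (g (k + k0) t - g (k + 1 + k0) t) ^ 2 ≤ (Real.sqrt (C * R ^ (2 * s - 1)) * q ^ k) ^ 2 := by
      refine h1.trans ?_
      rw [mul_pow, Real.sq_sqrt (by positivity), Real.mul_rpow (by positivity) hR.le, mul_assoc, mul_comm (R ^ _)]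
      refine mul_le_mul_of_nonneg_left ?_ hC0
      refine mul_le_mul_of_nonneg_right ?_ (by positivity)
      have : (q ^ k) ^ 2 = ((1/2:ℝ) ^ k) ^ (2 * s - 1) := by
        rw [← pow_mul, mul_comm k 2, pow_mul, hqd, ← Real.rpow_natCast ((1/2:ℝ) ^ ((2*s-1)/2)) 2, ← Real.rpow_mul (by norm_num),
          ← Real.rpow_natCast _ k, ← Real.rpow_mul (by norm_num), ← Real.rpow_natCast (1/2:ℝ) k, ← Real.rpow_mul (by norm_num)]
        congr 1; push_cast; ring
      rw [this]
      exact Real.rpow_le_rpow (by positivity) (pow_le_pow_of_le_one (by norm_num) (by norm_num) (by omega)) hs2.le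
    exact abs_le_of_sq_le_sq h3 (by positivity)
  have hlim : ∀ t, 0 < t → t ≤ R → ∃ l, Tendsto (fun k => g k t) atTop (𝓝 l) := by
    intro t h0 h1
    obtain ⟨k0, C, h⟩ := key t h0 h1
    have hc := cauchySeq_of_le_geometric q C hq1 (f := fun k => g (k + k0) t) (h t ⟨le_rfl, h1⟩)
    obtain ⟨l, hl⟩ := cauchySeq_tendsto_of_complete hc
    exact ⟨l, (tendsto_add_atTop_iff_nat (f := fun k => g k t) k0).1 hl⟩
  choose! γ hγ using hlim
  refine ⟨γ, ?_, ?_⟩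
  · have hIcc : ∀ a, 0 < a → a ≤ R → ContinuousOn γ (Icc a R) := by
      intro a ha haR
      obtain ⟨k0, C, h⟩ := key a ha haR
      have hu : TendstoUniformlyOn (fun k => g (k + k0)) γ atTop (Icc a R) := by
        rw [Metric.tendstoUniformlyOn_iff]
        intro ε hε
        have ht : Tendsto (fun k : ℕ => C * q ^ k / (1 - q)) atTop (𝓝 0) := by
          have := ((tendsto_pow_atTop_nhds_zero_of_lt_one hq0.le hq1).const_mul C).div_const (1 - q)
          simpa using this
        filter_upwards [ht.eventually (Iio_mem_nhds hε)] with k hk t ht'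
        rw [dist_comm]
        refine lt_of_le_of_lt ?_ hk
        exact dist_le_of_le_geometric_of_tendsto q C hq1 (h t ht')
          ((tendsto_add_atTop_iff_nat (f := fun k => g k t) k0).2 (hγ t (ha.trans_le ht'.1) ht'.2)) k
      exact hu.continuousOn (Eventually.of_forall fun k => (hgc _).continuousOn).frequently
    intro t ht
    have h1 : Icc (t/2) R ∈ 𝓝[Ioc 0 R] t := by
      rw [mem_nhdsWithin]
      refine ⟨Ioi (t/2), isOpen_Ioi, by simp only [mem_Ioi]; linarith [ht.1], ?_⟩
      rintro y ⟨h1, h2⟩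
      exact ⟨le_of_lt h1, h2.2⟩
    exact ((hIcc (t/2) (by linarith [ht.1]) (by linarith [ht.1, ht.2])) t ⟨by linarith [ht.1], ht.2⟩).mono_of_mem_nhdsWithin h1
  · intro i
    have hne : ∀ᵐ x : Euc N, x ≠ 0 := by
      rw [ae_iff]; simp
    filter_upwards [Av_tendsto hR (hl i), hne] with z hz hz0 hzB
    have hzn : 0 < ‖z‖ := norm_pos_iff.2 hz0
    have h1 := hz hzB
    have h2 : Tendsto (fun k : ℕ => Av R ((1/2:ℝ)^(k+1)) (w i) z) atTop (𝓝 (z i / ‖z‖ * γ ‖z‖)) := by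
      have h3 := (hγ ‖z‖ hzn (mem_ball_zero_iff.1 hzB).le).const_mul (z i / ‖z‖)
      refine h3.congr fun k => ?_
      exact ((Av_equi hR (by positivity) hl hq).form hz0 i).symm
    exact tendsto_nhds_unique h1 h2

end

section

variable {N : ℕ} {s : ℝ} {Ω : Set (Euc N)} {u v : Euc N → ℝ} {R : ℝ} {e : Euc N} {w : Fin N → Euc N → ℝ}

lemma closure_BB (hR : 0 < R) : closure (BB N R) = Metric.closedBall 0 R := closure_ball 0 hR.ne'

lemma memHs_ext [NeZero N] (hs : s ∈ Ioo (0 : ℝ) 1) (hR : 0 < R) {A : Set (Euc N)} (hA : MeasurableSet A) {δ : ℝ} (hδ : 0 < δ)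
    (hAs : ∀ y ∈ A, R + δ ≤ ‖y‖) : memHs N s (BB N R) (A.indicator (fun _ => (1:ℝ))) := by
  have hm : Measurable (A.indicator (fun _ => (1:ℝ))) := measurable_const.indicator hA
  have hfin : IsFiniteMeasure (volume.restrict (BB N R)) := ⟨by rw [Measure.restrict_apply_univ]; exact measure_ball_lt_top⟩
  rw [memHs_iff]
  refine ⟨hm, ?_, (memLp_two_iff (measurable_Df hm)).2 ?_⟩
  · exact MemLp.of_bound hm.aestronglyMeasurable 1 (Eventually.of_forall fun x => by
      by_cases h : x ∈ A <;> simp [h])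
  · set T := ∫⁻ h, {h : Euc N | δ ≤ ‖h‖}.indicator (fun h => ENNReal.ofReal (Kf N s h)) h with hT
    have hTf : T < ⊤ := by
      rw [hT, lintegral_indicator (measurableSet_tail δ)]
      exact (Kf_tail_integrableOn hs.1 hδ).lintegral_lt_top
    have hcl : ∀ x ∈ closure (BB N R), ‖x‖ ≤ R := by
      intro x hx; rw [closure_BB hR] at hx; simpa using hx
    have b1 : ∀ x ∈ closure (BB N R), ∀ y, ENNReal.ofReal ((A.indicator (fun _ => (1:ℝ)) x - A.indicator (fun _ => (1:ℝ)) y) ^ 2) * ENNReal.ofReal (Kf N s (x - y))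
        ≤ {h : Euc N | δ ≤ ‖h‖}.indicator (fun h => ENNReal.ofReal (Kf N s h)) (x - y) := by
      intro x hx y
      have hxA : x ∉ A := fun h => by linarith [hAs x h, hcl x hx]
      rw [indicator_of_notMem hxA]
      by_cases hy : y ∈ A
      · have : x - y ∈ {h : Euc N | δ ≤ ‖h‖} := by
          change δ ≤ ‖x - y‖
          have := norm_sub_norm_le y x
          rw [norm_sub_rev] at this
          linarith [hAs y hy, hcl x hx]
        rw [indicator_of_mem hy, indicator_of_mem this]; simp
      · rw [indicator_of_notMem hy]; simp
    refine (lintegral_nu_le ((measurable_Df hm).pow_const 2).ennreal_ofReal).trans_lt ?_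
    have b2 : ∀ x ∈ closure (BB N R), ∫⁻ y, ENNReal.ofReal (Df (A.indicator (fun _ => (1:ℝ))) (x, y) ^ 2) * ENNReal.ofReal (Kf N s (x - y)) ≤ T := by
      intro x hx
      refine (lintegral_mono (b1 x hx)).trans (le_of_eq ?_)
      exact lintegral_sub_left_eq_self ({h : Euc N | δ ≤ ‖h‖}.indicator (fun h => ENNReal.ofReal (Kf N s h))) x
    have b3 : ∀ y ∈ closure (BB N R), ∫⁻ x, ENNReal.ofReal (Df (A.indicator (fun _ => (1:ℝ))) (x, y) ^ 2) * ENNReal.ofReal (Kf N s (x - y)) ≤ T := by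
      intro y hy
      refine le_trans (le_of_eq ?_) (b2 y hy)
      refine lintegral_congr fun x => ?_
      rw [Kf_sub_comm]
      congr 2
      simp only [Df]; ring
    have hv : volume (closure (BB N R)) < ⊤ := by rw [closure_BB hR]; exact measure_closedBall_lt_top
    refine ENNReal.add_lt_top.2 ⟨?_, ?_⟩
    · refine (setLIntegral_mono' isClosed_closure.measurableSet b2).trans_lt ?_
      rw [setLIntegral_const]; exact ENNReal.mul_lt_top hTf hv
    · refine (setLIntegral_mono' isClosed_closure.measurableSet b3).trans_lt ?_
      rw [setLIntegral_const]; exact ENNReal.mul_lt_top hTf hv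

lemma ext_test [NeZero N] (hs : s ∈ Ioo (0 : ℝ) 1) (hR : 0 < R) (hu : IsEig N s (BB N R) u) {A : Set (Euc N)} (hA : MeasurableSet A) {δ : ℝ} (hδ : 0 < δ)
    (hAs : ∀ y ∈ A, R + δ ≤ ‖y‖) :
    IntegrableOn (fun q : Euc N × Euc N => (u q.1 - u q.2) * Kf N s (q.1 - q.2)) (A ×ˢ closure (BB N R)) ∧
    ∫ q in A ×ˢ closure (BB N R), (u q.1 - u q.2) * Kf N s (q.1 - q.2) = 0 := by
  set f : Euc N → ℝ := A.indicator (fun _ => (1:ℝ)) with hf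
  have hfm : memHs N s (BB N R) f := memHs_ext hs hR hA hδ hAs
  have hcl : ∀ x ∈ closure (BB N R), ‖x‖ ≤ R := by
    intro x hx; rw [closure_BB hR] at hx; simpa using hx
  have hclA : ∀ x ∈ closure (BB N R), x ∉ A := fun x hx h => by linarith [hAs x h, hcl x hx]
  have hw := hu.weak' hs hfm
  have h0 : ∫ x in BB N R, u x * f x = 0 := by
    rw [setIntegral_congr_fun (g := fun _ => (0:ℝ)) meas_BB]
    · simp
    · intro x hx
      simp only [hf]
      rw [indicator_of_notMem (hclA x (subset_closure hx)), mul_zero]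
  rw [h0, mul_zero, bform_rv] at hw
  have hi := integrable_rv hu.mem hfm
  unfold rv at hi hw
  set P := A ×ˢ closure (BB N R) with hP
  have hPm : MeasurableSet P := hA.prod isClosed_closure.measurableSet
  have hPr : P ⊆ reg N (BB N R) := fun q hq => Or.inr hq.2
  have hi1 : IntegrableOn (fun q : Euc N × Euc N => (u q.1 - u q.2) * Kf N s (q.1 - q.2)) P := by
    have := IntegrableOn.mono_set hi hPr
    refine this.congr_fun (fun q hq => ?_) hPm
    simp only [hf]
    rw [indicator_of_mem hq.1, indicator_of_notMem (hclA _ hq.2)]; ring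
  refine ⟨hi1, ?_⟩
  set G : Euc N × Euc N → ℝ := P.indicator (fun q => (u q.1 - u q.2) * Kf N s (q.1 - q.2)) with hG
  have hGi : Integrable G := (integrable_indicator_iff hPm).2 hi1
  have hGs : Integrable (fun q : Euc N × Euc N => G q.swap) := hGi.swap
  have hGP : ∫ q, G q = ∫ q in P, (u q.1 - u q.2) * Kf N s (q.1 - q.2) := integral_indicator hPm
  have hsw : ∫ q : Euc N × Euc N, G q.swap = ∫ q, G q := integral_prod_swap G
  have e1 : ∫ q in reg N (BB N R), ((u q.1 - u q.2) * (f q.1 - f q.2) * Kf N s (q.1 - q.2)) = ∫ q, (G q + G q.swap) := by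
    rw [← integral_indicator measurableSet_reg]
    congr 1; ext q
    by_cases hq : q ∈ reg N (BB N R)
    · rw [indicator_of_mem hq]
      by_cases h1 : q.1 ∈ A
      · have h2 : q.2 ∈ closure (BB N R) := by
          rcases hq with h | h
          · exact absurd h1 (hclA _ h)
          · exact h
        have h3 : q.swap ∉ P := fun h => hclA _ h2 h.1
        rw [hG, indicator_of_mem (show q ∈ P from ⟨h1, h2⟩), indicator_of_notMem h3, hf, indicator_of_mem h1, indicator_of_notMem (hclA _ h2)]
        ring
      · have h3 : q ∉ P := fun h => h1 h.1
        by_cases h4 : q.2 ∈ A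
        · have h2 : q.1 ∈ closure (BB N R) := by
            rcases hq with h | h
            · exact h
            · exact absurd h4 (hclA _ h)
          rw [hG, indicator_of_notMem h3, indicator_of_mem (show q.swap ∈ P from ⟨h4, h2⟩), hf, indicator_of_mem h4, indicator_of_notMem h1,
            Kf_sub_comm]
          simp only [Prod.fst_swap, Prod.snd_swap]
          ring
        · have h5 : q.swap ∉ P := fun h => h4 h.1
          rw [hG, indicator_of_notMem h3, indicator_of_notMem h5, hf, indicator_of_notMem h1, indicator_of_notMem h4]; ring
    · have h3 : q ∉ P := fun h => hq (hPr h)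
      have h5 : q.swap ∉ P := fun h => hq (Or.inl h.2)
      rw [indicator_of_notMem hq, hG, indicator_of_notMem h3, indicator_of_notMem h5, add_zero]
  rw [e1, integral_add hGi hGs, hsw, hGP] at hw
  linarith

theorem ext_formula [NeZero N] (hs : s ∈ Ioo (0 : ℝ) 1) (hR : 0 < R) (hu : IsEig N s (BB N R) u) :
    ∀ᵐ y, R < ‖y‖ → u y = (∫ x in BB N R, u x * Kf N s (y - x)) / ∫ x in BB N R, Kf N s (y - x) := by
  have main : ∀ n : ℕ, ∀ᵐ y, y ∈ {y : Euc N | R + 1 / ((n:ℝ) + 1) ≤ ‖y‖} → ∫ x in closure (BB N R), (u y - u x) * Kf N s (y - x) = 0 := by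
    intro n
    have hδ : 0 < 1 / ((n:ℝ) + 1) := by positivity
    set S := {y : Euc N | R + 1 / ((n:ℝ) + 1) ≤ ‖y‖} with hS
    have hSm : MeasurableSet S := measurableSet_le measurable_const measurable_norm
    obtain ⟨h1, -⟩ := ext_test hs hR hu hSm hδ (fun y hy => hy)
    have h1' : Integrable (fun q : Euc N × Euc N => (u q.1 - u q.2) * Kf N s (q.1 - q.2)) ((volume.restrict S).prod (volume.restrict (closure (BB N R)))) := by
      rw [Measure.prod_restrict]; exact h1
    have h2 := h1'.integral_prod_left
    rw [← ae_restrict_iff' hSm]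
    refine h2.ae_eq_zero_of_forall_setIntegral_eq_zero ?_
    intro A hA _
    rw [Measure.restrict_restrict hA]
    obtain ⟨h3, h4⟩ := ext_test hs hR hu (hA.inter hSm) hδ (fun y hy => hy.2)
    rw [Measure.volume_eq_prod, setIntegral_prod _ h3] at h4
    exact h4
  filter_upwards [ae_all_iff.2 main] with y hy hyR
  obtain ⟨n, hn⟩ := exists_nat_one_div_lt (sub_pos.2 hyR)
  have h1 := hy n (by change R + 1 / ((n:ℝ) + 1) ≤ ‖y‖; linarith)
  have hcb : closure (BB N R) =ᵐ[volume] BB N R := by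
    rw [closure_BB hR]; exact (ball_ae_eq_cball _ _).symm
  rw [setIntegral_congr_set hcb] at h1
  have hd : 0 < ‖y‖ - R := sub_pos.2 hyR
  have hKb : ∀ x ∈ BB N R, Kf N s (y - x) ≤ ((‖y‖ - R) ^ ((N:ℝ) + 2 * s))⁻¹ := by
    intro x hx
    have hx' := mem_ball_zero_iff.1 hx
    have : ‖y‖ - R ≤ ‖y - x‖ := by linarith [norm_sub_norm_le y x]
    exact Kf_le_of_le hs.1 hd this
  have hfin : IsFiniteMeasure (volume.restrict (BB N R)) := ⟨by rw [Measure.restrict_apply_univ]; exact measure_ball_lt_top⟩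
  have hKm : Measurable (fun x => Kf N s (y - x)) := measurable_Kf.comp (measurable_const.sub measurable_id)
  have hKi : IntegrableOn (fun x => Kf N s (y - x)) (BB N R) := by
    refine Integrable.mono' (integrable_const (((‖y‖ - R) ^ ((N:ℝ) + 2 * s))⁻¹)) hKm.aestronglyMeasurable ?_
    rw [ae_restrict_iff' meas_BB]
    exact Eventually.of_forall fun x hx => by rw [Real.norm_of_nonneg (Kf_nonneg _)]; exact hKb x hx
  have hui : IntegrableOn (fun x => u x * Kf N s (y - x)) (BB N R) := by
    refine Integrable.mul_bdd (c := ((‖y‖ - R) ^ ((N:ℝ) + 2 * s))⁻¹) (hu.mem.integrable vol_BB_ne_top) hKm.aestronglyMeasurable ?_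
    rw [ae_restrict_iff' meas_BB]
    exact Eventually.of_forall fun x hx => by rw [Real.norm_of_nonneg (Kf_nonneg _)]; exact hKb x hx
  have hpos : 0 < ∫ x in BB N R, Kf N s (y - x) := by
    rw [setIntegral_pos_iff_support_of_nonneg_ae (Eventually.of_forall fun x => Kf_nonneg _) hKi]
    refine lt_of_lt_of_le (Metric.measure_ball_pos volume (0 : Euc N) hR) (measure_mono fun x hx => ⟨?_, hx⟩)
    have hx' := mem_ball_zero_iff.1 hx
    have : 0 < ‖y - x‖ := by linarith [norm_sub_norm_le y x]
    exact (Kf_pos (norm_pos_iff.1 this)).ne'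
  rw [eq_div_iff hpos.ne', ← integral_const_mul, ← sub_eq_zero, ← integral_sub (hKi.const_mul (u y)) hui]
  simpa only [sub_mul] using h1

end

section

variable {N : ℕ} {s : ℝ} {Ω : Set (Euc N)} {u v : Euc N → ℝ} {R : ℝ} {e : Euc N} {w : Fin N → Euc N → ℝ}

/-- Numerator of the exterior formula. -/
def UK (s R : ℝ) (u : Euc N → ℝ) (y : Euc N) : ℝ := ∫ x in BB N R, u x * Kf N s (y - x)

/-- Denominator of the exterior formula. -/
def KB (N : ℕ) (s R : ℝ) (y : Euc N) : ℝ := ∫ x in BB N R, Kf N s (y - x)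

/-- The exterior formula. -/
def Xf (s R : ℝ) (u : Euc N → ℝ) (y : Euc N) : ℝ := UK s R u y / KB N s R y

lemma dist_BB {y x : Euc N} (hx : x ∈ BB N R) : ‖y‖ - R ≤ ‖y - x‖ := by
  have hx' := mem_ball_zero_iff.1 hx
  linarith [norm_sub_norm_le y x]

lemma Kf_BB_le (hs : 0 < s) {y x : Euc N} {d : ℝ} (hd : 0 < d) (hy : R + d ≤ ‖y‖) (hx : x ∈ BB N R) :
    Kf N s (y - x) ≤ (d ^ ((N:ℝ) + 2 * s))⁻¹ :=
  Kf_le_of_le hs hd (by linarith [dist_BB (y := y) hx])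

lemma uK_int (hs : 0 < s) (hu : IntegrableOn u (BB N R)) {y : Euc N} (hy : R < ‖y‖) :
    IntegrableOn (fun x => u x * Kf N s (y - x)) (BB N R) := by
  have hd : 0 < ‖y‖ - R := sub_pos.2 hy
  refine Integrable.mul_bdd (c := ((‖y‖ - R) ^ ((N:ℝ) + 2 * s))⁻¹) hu
    (measurable_Kf.comp (measurable_const.sub measurable_id)).aestronglyMeasurable ?_
  rw [ae_restrict_iff' meas_BB]
  refine Eventually.of_forall fun x hx => ?_
  rw [Real.norm_of_nonneg (Kf_nonneg _)]
  exact Kf_BB_le hs hd (by linarith) hx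

lemma one_intOn (c : ℝ) : IntegrableOn (fun _ : Euc N => c) (BB N R) :=
  integrableOn_const (vol_BB_ne_top)

lemma K_int (hs : 0 < s) {y : Euc N} (hy : R < ‖y‖) :
    IntegrableOn (fun x => Kf N s (y - x)) (BB N R) := by
  have := uK_int hs (one_intOn (N := N) (R := R) 1) hy
  simpa using this

lemma KB_pos [NeZero N] (hs : 0 < s) (hR : 0 < R) {y : Euc N} (hy : R < ‖y‖) : 0 < KB N s R y := by
  unfold KB
  rw [setIntegral_pos_iff_support_of_nonneg_ae (Eventually.of_forall fun x => Kf_nonneg _) (K_int hs hy)]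
  refine lt_of_lt_of_le (pos_iff_ne_zero.2 (vol_BB_ne_zero (N := N) hR)) (measure_mono fun x hx => ⟨?_, hx⟩)
  refine (Kf_pos ?_).ne'
  intro h
  have := dist_BB (y := y) hx
  rw [h, norm_zero] at this; linarith

lemma Kf_continuousAt (hs : 0 < s) {h : Euc N} (hh : h ≠ 0) : ContinuousAt (Kf N s) h := by
  unfold Kf
  have : 0 < ‖h‖ := norm_pos_iff.2 hh
  refine ContinuousAt.inv₀ ?_ (Real.rpow_pos_of_pos this _).ne'
  exact continuousAt_id.norm.rpow_const (Or.inl this.ne')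

lemma UK_cont (hs : 0 < s) (hu : IntegrableOn u (BB N R)) {y0 : Euc N} (hy : R < ‖y0‖) : ContinuousAt (UK s R u) y0 := by
  have hd : 0 < (‖y0‖ - R) / 2 := by linarith
  have hev : ∀ᶠ y in 𝓝 y0, R + (‖y0‖ - R) / 2 < ‖y‖ :=
    continuous_norm.continuousAt.eventually (lt_mem_nhds (by linarith))
  refine continuousAt_of_dominated (bound := fun x => |u x| * (((‖y0‖ - R) / 2) ^ ((N:ℝ) + 2 * s))⁻¹) ?_ ?_ ?_ ?_
  · filter_upwards [hev] with y hy'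
    exact (uK_int hs hu (by linarith)).aestronglyMeasurable
  · filter_upwards [hev] with y hy'
    rw [ae_restrict_iff' meas_BB]
    refine Eventually.of_forall fun x hx => ?_
    rw [Real.norm_eq_abs, abs_mul, abs_of_nonneg (Kf_nonneg (y - x))]
    exact mul_le_mul_of_nonneg_left (Kf_BB_le hs hd hy'.le hx) (abs_nonneg _)
  · exact hu.abs.mul_const _
  · rw [ae_restrict_iff' meas_BB]
    refine Eventually.of_forall fun x hx => ?_
    refine continuousAt_const.mul ?_
    have h1 : y0 - x ≠ 0 := by
      intro h
      have := dist_BB (y := y0) hx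
      rw [h, norm_zero] at this; linarith
    exact (Kf_continuousAt hs h1).comp (f := fun y => y - x) (continuousAt_id.sub continuousAt_const)

lemma UK_one (y : Euc N) : UK s R (fun _ => 1) y = KB N s R y := by
  unfold UK KB; simp

lemma Xf_cont [NeZero N] (hs : 0 < s) (hR : 0 < R) (hu : IntegrableOn u (BB N R)) {y0 : Euc N} (hy : R < ‖y0‖) : ContinuousAt (Xf s R u) y0 := by
  have h2 : ContinuousAt (KB N s R) y0 := by
    have := UK_cont hs (one_intOn (N := N) (R := R) 1) hy
    exact this.congr (Eventually.of_forall fun y => UK_one y)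
  exact (UK_cont hs hu hy).div h2 (KB_pos hs hR hy).ne'

lemma Xf_bdd [NeZero N] (hs : 0 < s) (hR : 0 < R) (hu : IntegrableOn u (BB N R)) :
    ∃ C, ∀ y : Euc N, 2 * R ≤ ‖y‖ → |Xf s R u y| ≤ C := by
  set V := volume.real (BB N R) with hV
  have hVp : 0 < V := ENNReal.toReal_pos (vol_BB_ne_zero hR) vol_BB_ne_top
  refine ⟨3 ^ ((N:ℝ) + 2 * s) * (∫ x in BB N R, |u x|) / V, fun y hy => ?_⟩
  have hy' : R < ‖y‖ := by linarith
  have hd : 0 < ‖y‖ - R := by linarith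
  have hp : 0 < (N:ℝ) + 2 * s := by positivity
  have h1 : |UK s R u y| ≤ ((‖y‖ - R) ^ ((N:ℝ) + 2 * s))⁻¹ * ∫ x in BB N R, |u x| := by
    unfold UK
    refine (abs_integral_le_integral_abs).trans ?_
    rw [← integral_const_mul]
    refine setIntegral_mono_on (uK_int hs hu hy').abs (hu.abs.const_mul _) meas_BB fun x hx => ?_
    rw [abs_mul, abs_of_nonneg (Kf_nonneg (y - x)), mul_comm]
    exact mul_le_mul_of_nonneg_right (Kf_BB_le hs hd (by linarith) hx) (abs_nonneg _)
  have h2 : ((3 * (‖y‖ - R)) ^ ((N:ℝ) + 2 * s))⁻¹ * V ≤ KB N s R y := by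
    unfold KB
    have : ((3 * (‖y‖ - R)) ^ ((N:ℝ) + 2 * s))⁻¹ * V = ∫ x in BB N R, ((3 * (‖y‖ - R)) ^ ((N:ℝ) + 2 * s))⁻¹ := by
      rw [setIntegral_const, smul_eq_mul, mul_comm]
    rw [this]
    refine setIntegral_mono_on (one_intOn _) (K_int hs hy') meas_BB fun x hx => ?_
    have hx' := mem_ball_zero_iff.1 hx
    have h1 : y - x ≠ 0 := by
      intro h
      have := dist_BB (y := y) hx
      rw [h, norm_zero] at this; linarith
    refine Kf_ge_of_le hs h1 ?_
    linarith [norm_sub_le y x]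
  have hK := KB_pos hs hR hy'
  have hI : 0 ≤ ∫ x in BB N R, |u x| := integral_nonneg fun x => abs_nonneg _
  unfold Xf
  rw [abs_div, abs_of_pos hK, div_le_div_iff₀ hK hVp]
  have e1 : ((‖y‖ - R) ^ ((N:ℝ) + 2 * s))⁻¹ = 3 ^ ((N:ℝ) + 2 * s) * ((3 * (‖y‖ - R)) ^ ((N:ℝ) + 2 * s))⁻¹ := by
    rw [Real.mul_rpow (by norm_num) hd.le, mul_inv, ← mul_assoc, mul_inv_cancel₀ (by positivity), one_mul]
  calc |UK s R u y| * V ≤ (((‖y‖ - R) ^ ((N:ℝ) + 2 * s))⁻¹ * ∫ x in BB N R, |u x|) * V := mul_le_mul_of_nonneg_right h1 hVp.le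
    _ = 3 ^ ((N:ℝ) + 2 * s) * (∫ x in BB N R, |u x|) * (((3 * (‖y‖ - R)) ^ ((N:ℝ) + 2 * s))⁻¹ * V) := by rw [e1]; ring
    _ ≤ _ := mul_le_mul_of_nonneg_left h2 (by positivity)

end

section

variable {N : ℕ} {s : ℝ} {Ω : Set (Euc N)} {u v : Euc N → ℝ} {R : ℝ} {e : Euc N} {w : Fin N → Euc N → ℝ}

lemma KB_lower [NeZero N] (hs : 0 < s) (he : ‖e‖ = 1) {t : ℝ} (ht : R < t) (ht' : t - R < R) :
    om N * (3 ^ ((N:ℝ) + 2 * s))⁻¹ * (t - R) ^ (-(2 * s)) ≤ KB N s R (t • e) := by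
  set d := t - R with hd
  have hd0 : 0 < d := by linarith
  have hte : ‖t • e‖ = t := by rw [norm_smul, he, mul_one, Real.norm_of_nonneg (by linarith)]
  set c : Euc N := (R - d) • e with hc
  have hcn : ‖c‖ = R - d := by rw [hc, norm_smul, he, mul_one, Real.norm_of_nonneg (by linarith)]
  have hsub : Metric.ball c d ⊆ BB N R := by
    intro x hx
    rw [mem_ball_zero_iff]
    have h1 : ‖x - c‖ < d := by rwa [← mem_ball_iff_norm]
    have h2 := norm_add_le (x - c) c
    rw [sub_add_cancel] at h2; linarith
  have hy : R < ‖t • e‖ := by rw [hte]; exact ht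
  have h1 : ∫ x in Metric.ball c d, Kf N s (t • e - x) ≤ KB N s R (t • e) :=
    setIntegral_mono_set (K_int hs hy) (Eventually.of_forall fun x => Kf_nonneg _) hsub.eventuallyLE
  refine le_trans ?_ h1
  have h2 : ∫ x in Metric.ball c d, ((3 * d) ^ ((N:ℝ) + 2 * s))⁻¹ ≤ ∫ x in Metric.ball c d, Kf N s (t • e - x) := by
    refine setIntegral_mono_on (integrableOn_const measure_ball_lt_top.ne) ((K_int hs hy).mono_set hsub) measurableSet_ball fun x hx => ?_
    have hne : t • e - x ≠ 0 := by
      intro h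
      have := dist_BB (y := t • e) (hsub hx)
      rw [h, norm_zero] at this; linarith
    refine Kf_ge_of_le hs hne ?_
    have h3 : ‖x - c‖ < d := by rwa [← mem_ball_iff_norm]
    have h4 : t • e - x = (2 * d) • e - (x - c) := by
      rw [hc, show t = 2 * d + (R - d) by linarith, add_smul]; abel
    rw [h4]
    have h5 := norm_sub_le ((2 * d) • e) (x - c)
    rw [norm_smul, he, mul_one, Real.norm_of_nonneg (by linarith)] at h5
    linarith
  refine le_trans (le_of_eq ?_) h2
  rw [setIntegral_const, smul_eq_mul, vol_ball hd0.le, Real.mul_rpow (by norm_num) hd0.le, Real.rpow_add hd0, Real.rpow_neg hd0.le, Real.rpow_natCast]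
  field_simp

lemma Xf_lim [NeZero N] (hs : 0 < s) (hR : 0 < R) (he : ‖e‖ = 1) (hu : IntegrableOn u (BB N R)) {l : ℝ}
    (h : ∀ ε > 0, ∃ η > 0, ∀ᵐ x, x ∈ BB N R → ‖x - R • e‖ < η → |u x - l| ≤ ε) :
    Tendsto (fun t => Xf s R u (t • e)) (𝓝[>] R) (𝓝 l) := by
  have hi : IntegrableOn (fun x => u x - l) (BB N R) := hu.sub (one_intOn l)
  have hKtop : Tendsto (fun t => KB N s R (t • e)) (𝓝[>] R) atTop := by
    have hc : 0 < om N * (3 ^ ((N:ℝ) + 2 * s))⁻¹ := mul_pos om_pos (by positivity)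
    have h1 : Tendsto (fun t : ℝ => t - R) (𝓝[>] R) (𝓝[>] 0) := by
      refine tendsto_nhdsWithin_iff.2 ⟨?_, ?_⟩
      · have : Tendsto (fun t : ℝ => t - R) (𝓝 R) (𝓝 (R - R)) := (continuous_id.sub continuous_const).tendsto R
        rw [sub_self] at this; exact this.mono_left nhdsWithin_le_nhds
      · filter_upwards [self_mem_nhdsWithin] with t ht
        exact sub_pos.2 (mem_Ioi.1 ht)
    have h2 : Tendsto (fun d : ℝ => d ^ (-(2 * s))) (𝓝[>] 0) atTop := tendsto_rpow_neg_nhdsGT_zero (by linarith)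
    refine tendsto_atTop_mono' _ ?_ ((h2.comp h1).const_mul_atTop hc)
    filter_upwards [Ioo_mem_nhdsGT (show R < 2 * R by linarith)] with t ht
    exact KB_lower hs he ht.1 (by linarith [ht.2])
  rw [Metric.tendsto_nhds]
  intro ε hε
  obtain ⟨η, hη, hη'⟩ := h (ε / 2) (by positivity)
  set C := ((η / 2) ^ ((N:ℝ) + 2 * s))⁻¹ with hC
  set I := ∫ x in BB N R, |u x - l| with hI
  filter_upwards [Ioo_mem_nhdsGT (show R < R + η / 2 by linarith), hKtop.eventually_gt_atTop (C * I / (ε / 2))] with t ht hK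
  have hte : ‖t • e‖ = t := by rw [norm_smul, he, mul_one, Real.norm_of_nonneg (by linarith [ht.1])]
  have hy : R < ‖t • e‖ := by rw [hte]; exact ht.1
  have hKp := KB_pos hs hR hy
  have hbound : |∫ x in BB N R, (u x - l) * Kf N s (t • e - x)| ≤ (ε / 2) * KB N s R (t • e) + C * I := by
    refine (abs_integral_le_integral_abs).trans ?_
    have hIntg0 : IntegrableOn (fun x => (ε / 2) * Kf N s (t • e - x) + C * |u x - l|) (BB N R) :=
      ((K_int hs hy).const_mul _).add (hi.abs.const_mul _)
    have e1 : (ε / 2) * KB N s R (t • e) + C * I = ∫ x in BB N R, ((ε / 2) * Kf N s (t • e - x) + C * |u x - l|) := by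
      rw [integral_add ((K_int hs hy).const_mul _) (hi.abs.const_mul _), integral_const_mul, integral_const_mul]; rfl
    rw [e1]
    refine integral_mono_ae (uK_int hs hi hy).abs hIntg0 ?_
    change ∀ᵐ x ∂(volume.restrict (BB N R)), |(u x - l) * Kf N s (t • e - x)| ≤ (ε / 2) * Kf N s (t • e - x) + C * |u x - l|
    rw [ae_restrict_iff' meas_BB]
    filter_upwards [hη'] with x hx hxB
    rw [abs_mul, abs_of_nonneg (Kf_nonneg (t • e - x))]
    have hK0 := Kf_nonneg (N := N) (s := s) (t • e - x)
    have hC0 : 0 ≤ C := by positivity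
    by_cases hn : ‖x - R • e‖ < η
    · have := mul_le_mul_of_nonneg_right (hx hxB hn) hK0
      have := mul_nonneg hC0 (abs_nonneg (u x - l))
      linarith
    · have h3 : η / 2 ≤ ‖t • e - x‖ := by
        have h4 := norm_add_le (x - t • e) ((t - R) • e)
        have h5 : x - t • e + (t - R) • e = x - R • e := by rw [sub_smul]; abel
        rw [h5, norm_smul, he, mul_one, Real.norm_of_nonneg (by linarith [ht.1]), norm_sub_rev x (t • e)] at h4
        linarith [ht.2, not_lt.1 hn]
      have h6 := Kf_le_of_le (N := N) hs (by positivity) h3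
      have := mul_le_mul_of_nonneg_left h6 (abs_nonneg (u x - l))
      have : 0 ≤ ε / 2 * Kf N s (t • e - x) := by positivity
      linarith [mul_comm C |u x - l|]
  have e2 : ∫ x in BB N R, (u x - l) * Kf N s (t • e - x) = UK s R u (t • e) - l * KB N s R (t • e) := by
    unfold UK KB
    rw [← integral_const_mul, ← integral_sub (uK_int hs hu hy) ((K_int hs hy).const_mul l)]
    congr 1; ext x; ring
  rw [e2] at hbound
  rw [Real.dist_eq]
  have e3 : Xf s R u (t • e) - l = (UK s R u (t • e) - l * KB N s R (t • e)) / KB N s R (t • e) := by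
    unfold Xf; field_simp
  rw [e3, abs_div, abs_of_pos hKp, div_lt_iff₀ hKp]
  rw [div_lt_iff₀ (by positivity)] at hK
  linarith [mul_comm (KB N s R (t • e)) (ε / 2)]

lemma KB_iso (Q : Euc N ≃ₗᵢ[ℝ] Euc N) (y : Euc N) : KB N s R (Q y) = KB N s R y := by
  unfold KB
  rw [← setIntegral_comp_iso Q]
  refine integral_congr_ae (Eventually.of_forall fun x => ?_)
  exact Kf_norm (by rw [← map_sub, Q.norm_map])

lemma Xf_equi (hs : 0 < s) (hw : ∀ i, IntegrableOn (w i) (BB N R))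
    (he : ∀ (Q : Euc N ≃ₗᵢ[ℝ] Euc N) i, ∀ᵐ x, w i (Q x) = ∑ j, (Q (E1 N j)) i * w j x) :
    Equi (fun i z => if R < ‖z‖ then Xf s R (w i) z else 0) := by
  intro Q z i
  simp only [Q.norm_map]
  by_cases hz : R < ‖z‖
  · simp only [if_pos hz]
    unfold Xf
    rw [KB_iso]
    have : UK s R (w i) (Q z) = ∑ j, (Q (E1 N j)) i * UK s R (w j) z := by
      unfold UK
      rw [← setIntegral_comp_iso Q]
      have h1 : ∀ᵐ x ∂(volume.restrict (BB N R)), w i (Q x) * Kf N s (Q z - Q x) = ∑ j, (Q (E1 N j)) i * (w j x * Kf N s (z - x)) := by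
        filter_upwards [ae_restrict_of_ae (he Q i)] with x hx
        rw [hx, Kf_norm (h' := z - x) (by rw [← map_sub, Q.norm_map]), Finset.sum_mul]
        exact Finset.sum_congr rfl fun j _ => by ring
      rw [integral_congr_ae h1, integral_finsetSum]
      · exact Finset.sum_congr rfl fun j _ => integral_const_mul _ _
      · intro j _
        exact (uK_int hs (hw j) hz).const_mul _
    rw [this, Finset.sum_div]
    exact Finset.sum_congr rfl fun j _ => by ring
  · simp only [if_neg hz]; simp

lemma UK_half [NeZero N] (hs : s ∈ Ioo (0:ℝ) 1) (he : ‖e‖ = 1) (hu : IntegrableOn u (BB N R)) (au : Asym e u) {y : Euc N} (hy : R < ‖y‖) :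
    UK s R u y = (1/2) * ∫ x in BB N R, u x * dK N s e (y, x) := by
  have hr : ∀ x, Kf N s (y - refl e x) = Kf N s (refl e y - x) := fun x => by
    refine Kf_norm ?_
    have := (refl e).norm_map (y - refl e x)
    rw [map_sub, refl_refl] at this; exact this.symm
  have hy' : R < ‖refl e y‖ := by rwa [(refl e).norm_map]
  have h1 : ∫ x in BB N R, u x * Kf N s (refl e y - x) = - UK s R u y := by
    unfold UK
    rw [← setIntegral_comp_iso (refl e), ← integral_neg]
    refine integral_congr_ae (Eventually.of_forall fun x => ?_)
    simp only
    rw [au x, ← hr, refl_refl]; ring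
  have h2 : ∫ x in BB N R, u x * dK N s e (y, x) = UK s R u y - ∫ x in BB N R, u x * Kf N s (refl e y - x) := by
    unfold UK
    rw [← integral_sub (uK_int hs.1 hu hy) (uK_int hs.1 hu hy')]
    refine integral_congr_ae (Eventually.of_forall fun x => ?_)
    simp only [dK]
    rw [hr]; ring
  rw [h2, h1]; ring

lemma Xf_pos [NeZero N] (hs : s ∈ Ioo (0:ℝ) 1) (hR : 0 < R) (he : ‖e‖ = 1) (hu : IsEig N s (BB N R) u) (au : Asym e u)
    (hne : ¬ u =ᵐ[volume] 0) (hnn : ∀ᵐ x, x ∈ HH e → x ∈ BB N R → 0 ≤ u x) {y : Euc N} (hy : R < ‖y‖) (hyH : y ∈ HH e) : 0 < Xf s R u y := by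
  have hui : IntegrableOn u (BB N R) := hu.mem.integrable vol_BB_ne_top
  refine div_pos ?_ (KB_pos hs.1 hR hy)
  rw [UK_half hs he hui au hy]
  have hne' : ∀ x ∈ BB N R, y ≠ x := fun x hx h => by
    have := dist_BB (y := y) hx
    rw [h, sub_self, norm_zero, ← h] at this; linarith
  have hnn' := ae_iso (refl e) hnn
  have hpt : ∀ᵐ x ∂(volume.restrict (BB N R)), 0 ≤ u x * dK N s e (y, x) := by
    rw [ae_restrict_iff' meas_BB]
    filter_upwards [hnn, hnn'] with x h1 h2 hx
    rw [mem_HH] at hyH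
    rcases lt_trichotomy (inner ℝ x e : ℝ) 0 with h3 | h3 | h3
    · have h4 := h2 ((refl_mem_HH he).2 h3) ((iso_mem_BB (refl e)).2 hx)
      rw [au x] at h4
      exact mul_nonneg_of_nonpos_of_nonpos (by linarith) (dK_nonpos hs.1 he (by
        intro h
        have h5 := dist_BB (y := y) ((iso_mem_BB (refl e)).2 hx)
        rw [h, sub_self, norm_zero, ← h] at h5; linarith) (mul_nonpos_of_nonneg_of_nonpos hyH.le h3.le))
    · have : u x = 0 := by
        have h5 := au x
        rw [refl_apply he, h3] at h5; simp at h5; linarith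
      rw [this, zero_mul]
    · exact mul_nonneg (h1 h3 hx) (dK_nonneg hs.1 he (hne' x hx) (mul_nonneg hyH.le h3.le))
  have hIntg0 : IntegrableOn (fun x => u x * dK N s e (y, x)) (BB N R) := by
    have hy' : R < ‖refl e y‖ := by rwa [(refl e).norm_map]
    refine ((uK_int hs.1 hui hy).sub (uK_int hs.1 hui hy')).congr (Eventually.of_forall fun x => ?_)
    simp only [dK, Pi.sub_apply]
    have : Kf N s (y - refl e x) = Kf N s (refl e y - x) := by
      refine Kf_norm ?_
      have := (refl e).norm_map (y - refl e x)
      rw [map_sub, refl_refl] at this; exact this.symm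
    rw [this]; ring
  refine mul_pos (by norm_num) (lt_of_le_of_ne (integral_nonneg_of_ae hpt) fun h0 => hne ?_)
  refine hu.1 |> fun _ => Asym.zero_of_half hs hR he hu au ?_
  have h1 := (integral_eq_zero_iff_of_nonneg_ae hpt hIntg0).1 h0.symm
  have h2 := (ae_restrict_iff' meas_BB).1 h1
  filter_upwards [h2] with x hx hxH hxB
  have h3 := hx hxB
  simp only [Pi.zero_apply] at h3
  exact (mul_eq_zero.1 h3).resolve_right (dK_pos hs.1 he (hne' x hxB) (mul_pos hyH hxH)).ne'

end

section

variable {N : ℕ} {s : ℝ} {Ω : Set (Euc N)} {u v : Euc N → ℝ} {R : ℝ} {e : Euc N} {w : Fin N → Euc N → ℝ}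

/-- The candidate eigenfunctions. -/
def Vf (g : ℝ → ℝ) (i : Fin N) (x : Euc N) : ℝ := x i / ‖x‖ * g ‖x‖

lemma coord_continuous (i : Fin N) : Continuous (fun x : Euc N => x i) := by fun_prop

lemma Vf_contAt {g : ℝ → ℝ} (hg : ContinuousOn g (Ioi 0)) (i : Fin N) {x : Euc N} (hx : x ≠ 0) : ContinuousAt (Vf g i) x := by
  have h0 : 0 < ‖x‖ := norm_pos_iff.2 hx
  have h1 : ContinuousAt (fun x : Euc N => g ‖x‖) x :=
    ContinuousAt.comp (f := fun x : Euc N => ‖x‖) (hg.continuousAt (Ioi_mem_nhds h0)) continuous_norm.continuousAt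
  exact ((coord_continuous i).continuousAt.div continuous_norm.continuousAt h0.ne').mul h1

lemma norm_smul_E1 [NeZero N] {t : ℝ} (ht : 0 ≤ t) : ‖t • E1 N 0‖ = t := by
  rw [norm_smul, E1_norm, mul_one, Real.norm_of_nonneg ht]

theorem Fam.cont_form [NeZero N] {α : ℝ} (hN2 : 2 ≤ N) (hs : s ∈ Ioo (sst N) 1) (hR : 0 < R) (F : Fam N s R α w) :
    ∃ g : ℝ → ℝ, ContinuousOn g (Ioi 0) ∧ (∀ i, w i =ᵐ[volume] Vf g i) ∧ (∀ t, 0 < t → 0 ≤ g t) ∧ (∀ t, R < t → 0 < g t) ∧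
      (∀ ρ > 0, ∃ C, ∀ t, ρ ≤ t → g t ≤ C) := by
  obtain ⟨γ, hγ, hγw⟩ := F.radial_form hN2 hs hR
  have hs' : s ∈ Ioo (0:ℝ) 1 := ⟨by linarith [(sst_mem (N := N)).1, hs.1], hs.2⟩
  have hwi : ∀ i, IntegrableOn (w i) (BB N R) := fun i => (F.eig i).mem.integrable vol_BB_ne_top
  set χ : ℝ → ℝ := fun t => Xf s R (w 0) (t • E1 N 0) with hχ
  have hχp : ∀ t, R < t → 0 < χ t := by
    intro t ht
    have h0 : (0:ℝ) ≤ t := by linarith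
    refine Xf_pos hs' hR (E1_norm 0) (F.eig 0) (F.asym 0) (F.ne_zero 0) (F.nonneg 0) (by rw [norm_smul_E1 h0]; exact ht) ?_
    rw [mem_HH, inner_E1]; simp; linarith
  have hχc : ∀ t, R < t → ContinuousAt χ t := by
    intro t ht
    have h0 : (0:ℝ) ≤ t := by linarith
    exact ContinuousAt.comp (f := fun t : ℝ => t • E1 N 0) (Xf_cont hs'.1 hR (hwi 0) (by rw [norm_smul_E1 h0]; exact ht))
      (continuous_id.smul continuous_const).continuousAt
  have hχl : Tendsto χ (𝓝[>] R) (𝓝 (γ R)) := by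
    refine Xf_lim hs'.1 hR (E1_norm 0) (hwi 0) ?_
    intro ε hε
    set S : Set (Euc N) := {x | ‖x‖ ∈ Ioc 0 R} with hS
    have hzS : R • E1 N 0 ∈ S := by
      change ‖R • E1 N 0‖ ∈ Ioc 0 R
      rw [norm_smul_E1 hR.le]; exact ⟨hR, le_rfl⟩
    have hc : ContinuousOn (fun x : Euc N => x 0 / ‖x‖ * γ ‖x‖) S := by
      refine ContinuousOn.mul ?_ (hγ.comp continuous_norm.continuousOn fun x hx => hx)
      exact (coord_continuous 0).continuousOn.div continuous_norm.continuousOn fun x hx => hx.1.ne'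
    have h1 := (Metric.continuousWithinAt_iff.1 (hc _ hzS)) ε hε
    obtain ⟨η, hη, h2⟩ := h1
    refine ⟨min η R, lt_min hη hR, ?_⟩
    filter_upwards [hγw 0] with x hx hxB hxn
    rw [hx hxB]
    have hxB' := mem_ball_zero_iff.1 hxB
    have h3 : x ∈ S := by
      refine ⟨?_, hxB'.le⟩
      rw [norm_pos_iff]; rintro rfl
      rw [zero_sub, norm_neg, norm_smul_E1 hR.le] at hxn
      linarith [min_le_right η R]
    have h4 := h2 h3 (by rw [dist_eq_norm]; exact hxn.trans_le (min_le_left _ _))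
    rw [Real.dist_eq] at h4
    have h5 : (R • E1 N 0) 0 / ‖R • E1 N 0‖ * γ ‖R • E1 N 0‖ = γ R := by
      rw [norm_smul_E1 hR.le]; simp [hR.ne']
    rw [h5] at h4
    exact h4.le
  set g : ℝ → ℝ := fun t => if t ≤ R then γ t else χ t with hg
  have hg1 : ∀ t, t ≤ R → g t = γ t := fun t ht => if_pos ht
  have hg2 : ∀ t, R < t → g t = χ t := fun t ht => if_neg (not_le.2 ht)
  have hgc : ContinuousOn g (Ioi 0) := by
    intro t ht
    have ht0 : 0 < t := ht
    apply ContinuousAt.continuousWithinAt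
    rcases lt_trichotomy t R with h | h | h
    · have h1 : ContinuousAt γ t := hγ.continuousAt (Ioc_mem_nhds ht0 h)
      refine h1.congr ?_
      filter_upwards [Iio_mem_nhds h] with t' ht'
      exact (hg1 t' (le_of_lt ht')).symm
    · subst h
      rw [continuousAt_iff_continuous_left'_right']
      constructor
      · have h1 : ContinuousWithinAt γ (Ioc 0 t) t := hγ t ⟨ht0, le_rfl⟩
        have h2 : ContinuousWithinAt γ (Iio t) t := by
          refine (h1.mono_of_mem_nhdsWithin ?_)
          filter_upwards [Ioo_mem_nhdsLT ht0] with x hx using ⟨hx.1, hx.2.le⟩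
        exact h2.congr (fun x hx => hg1 x (le_of_lt hx)) (hg1 t le_rfl)
      · change Tendsto g (𝓝[>] t) (𝓝 (g t))
        rw [hg1 t le_rfl]
        refine hχl.congr' ?_
        filter_upwards [self_mem_nhdsWithin] with x hx
        exact (hg2 x hx).symm
    · refine (hχc t h).congr ?_
      filter_upwards [Ioi_mem_nhds h] with t' ht'
      exact (hg2 t' ht').symm
  have hgw : ∀ i, w i =ᵐ[volume] Vf g i := by
    intro i
    have hsph : ∀ᵐ x : Euc N, ‖x‖ ≠ R := by
      have : volume (Metric.sphere (0 : Euc N) R) = 0 := Measure.addHaar_sphere _ _ _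
      filter_upwards [compl_mem_ae_iff.2 this] with x hx h
      exact hx (by simpa using h)
    have hEq := Xf_equi (s := s) (R := R) hs'.1 hwi (fun Q i => F.equi hN2 hs hR Q i)
    filter_upwards [hγw i, ext_formula hs' hR (F.eig i), hsph] with x h1 h2 h3
    rcases lt_or_gt_of_ne h3 with h | h
    · rw [h1 (mem_ball_zero_iff.2 h), Vf, hg1 _ h.le]
    · rw [h2 h]
      have hx0 : x ≠ 0 := norm_pos_iff.1 (hR.trans h)
      have h4 := hEq.form hx0 i
      simp only [norm_smul_E1 (norm_nonneg x), if_pos h] at h4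
      rw [Vf, hg2 _ h]
      exact h4
  have hgn1 : ∀ t ∈ Ioo 0 R, 0 ≤ g t := by
    set U : Set (Euc N) := (BB N R ∩ HH (E1 N 0)) ∩ {x | g ‖x‖ < 0} with hU
    have hne0 : ∀ x ∈ HH (E1 N 0), x ≠ 0 := by
      rintro x hx rfl
      rw [mem_HH] at hx; simp at hx
    have hUo : IsOpen U := by
      have hc : ContinuousOn (fun x : Euc N => g ‖x‖) (BB N R ∩ HH (E1 N 0)) :=
        hgc.comp continuous_norm.continuousOn fun x hx => norm_pos_iff.2 (hne0 x hx.2)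
      exact hc.isOpen_inter_preimage (Metric.isOpen_ball.inter isOpen_HH) isOpen_Iio
    have hUn : volume U = 0 := by
      have : ∀ᵐ x, x ∉ U := by
        filter_upwards [hgw 0, F.nonneg 0] with x h1 h2 hxU
        have h3 := h2 hxU.1.2 hxU.1.1
        rw [h1, Vf] at h3
        have h4 : 0 < x 0 := by have := hxU.1.2; rwa [mem_HH, inner_E1] at this
        have h5 : 0 < ‖x‖ := norm_pos_iff.2 (hne0 x hxU.1.2)
        have h6 : g ‖x‖ < 0 := hxU.2
        have := mul_neg_of_pos_of_neg (div_pos h4 h5) h6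
        linarith
      rw [ae_iff] at this; simpa using this
    have hUe := (hUo.measure_eq_zero_iff volume).1 hUn
    intro t ht
    by_contra hneg
    have : t • E1 N 0 ∈ U := by
      refine ⟨⟨?_, ?_⟩, ?_⟩
      · rw [mem_ball_zero_iff, norm_smul_E1 ht.1.le]; exact ht.2
      · rw [mem_HH, inner_E1]; simp; exact ht.1
      · change g ‖t • E1 N 0‖ < 0
        rw [norm_smul_E1 ht.1.le]; exact not_le.1 hneg
    rw [hUe] at this; exact this
  have hgp : ∀ t, R < t → 0 < g t := fun t ht => by rw [hg2 t ht]; exact hχp t ht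
  refine ⟨g, hgc, hgw, ?_, hgp, ?_⟩
  · intro t ht
    rcases lt_trichotomy t R with h | h | h
    · exact hgn1 t ⟨ht, h⟩
    · subst h
      have h1 : ContinuousAt g t := hgc.continuousAt (Ioi_mem_nhds ht)
      refine ge_of_tendsto (h1.tendsto.mono_left (nhdsWithin_le_nhds (s := Ioi t))) ?_
      filter_upwards [self_mem_nhdsWithin] with x hx
      exact (hgp x hx).le
    · exact (hgp t h).le
  · intro ρ hρ
    obtain ⟨C1, hC1⟩ := Xf_bdd hs'.1 hR (hwi 0)
    obtain ⟨C2, hC2⟩ := (isCompact_Icc (a := ρ) (b := 2 * R)).bddAbove_image (hgc.mono fun t ht => lt_of_lt_of_le hρ ht.1)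
    refine ⟨max C1 C2, fun t ht => ?_⟩
    by_cases h : t ≤ 2 * R
    · exact (hC2 ⟨t, ⟨ht, h⟩, rfl⟩).trans (le_max_right _ _)
    · have h' : 2 * R < t := not_le.1 h
      rw [hg2 t (by linarith)]
      have := hC1 (t • E1 N 0) (by rw [norm_smul_E1 (by linarith)]; exact h'.le)
      exact (le_abs_self _).trans (this.trans (le_max_left _ _))

end

section

variable {N : ℕ} {s : ℝ} {Ω : Set (Euc N)} {u v : Euc N → ℝ} {R : ℝ} {e : Euc N} {w : Fin N → Euc N → ℝ}

/-- Truncated kernel. -/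
def kt (N : ℕ) (s ε : ℝ) : Euc N → ℝ := {h : Euc N | ε ≤ ‖h‖}.indicator (Kf N s)

lemma kt_nonneg {ε : ℝ} (h : Euc N) : 0 ≤ kt N s ε h := indicator_nonneg (fun x _ => Kf_nonneg x) h

lemma kt_neg {ε : ℝ} (h : Euc N) : kt N s ε (-h) = kt N s ε h := by
  unfold kt
  by_cases hh : ε ≤ ‖h‖
  · rw [indicator_of_mem (show -h ∈ {h : Euc N | ε ≤ ‖h‖} by simpa using hh), indicator_of_mem (show h ∈ {h : Euc N | ε ≤ ‖h‖} from hh), Kf_neg]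
  · rw [indicator_of_notMem (show -h ∉ {h : Euc N | ε ≤ ‖h‖} by simpa using hh), indicator_of_notMem (show h ∉ {h : Euc N | ε ≤ ‖h‖} from hh)]

lemma kt_int [NeZero N] (hs : 0 < s) {ε : ℝ} (hε : 0 < ε) : Integrable (kt N s ε) :=
  (integrable_indicator_iff (measurableSet_tail ε)).2 (Kf_tail_integrableOn hs hε)

lemma kt_meas {ε : ℝ} : Measurable (kt N s ε) := measurable_Kf.indicator (measurableSet_tail ε)

lemma sub_kt_int [NeZero N] (hs : 0 < s) {ε : ℝ} (hε : 0 < ε) {φ : Euc N → ℝ} (hφm : Measurable φ) {M : ℝ} (hM : ∀ x, |φ x| ≤ M) (x : Euc N) :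
    Integrable (fun h => (φ x - φ (x + h)) * kt N s ε h) := by
  refine Integrable.bdd_mul (c := 2 * M) (kt_int hs hε) (measurable_const.sub (hφm.comp (measurable_const.add measurable_id))).aestronglyMeasurable ?_
  refine Eventually.of_forall fun h => ?_
  rw [Real.norm_eq_abs]
  have := abs_sub (φ x) (φ (x + h))
  linarith [hM x, hM (x + h)]

lemma trunc_formula [NeZero N] (hs : 0 < s) {ε : ℝ} (hε : 0 < ε) {φ : Euc N → ℝ} (hφm : Measurable φ) {M : ℝ} (hM : ∀ x, |φ x| ≤ M)
    (hv : Integrable v) :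
    Integrable (fun x => v x * ∫ h, (2 * φ x - φ (x + h) - φ (x - h)) * kt N s ε h) ∧
    ∫ q : Euc N × Euc N, (φ q.1 - φ q.2) * (v q.1 - v q.2) * kt N s ε (q.1 - q.2)
      = ∫ x, v x * ∫ h, (2 * φ x - φ (x + h) - φ (x - h)) * kt N s ε h := by
  set G : Euc N × Euc N → ℝ := fun q => (φ q.1 - φ q.2) * (v q.1 * kt N s ε (q.1 - q.2)) with hG
  have hGi : Integrable G := by
    have h1 := Integrable.convolution_integrand (ContinuousLinearMap.mul ℝ ℝ) hv (kt_int (N := N) hs hε)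
    have h2 := h1.swap
    have h3 : Integrable (fun q : Euc N × Euc N => v q.1 * kt N s ε (q.1 - q.2)) := by
      refine h2.congr (Eventually.of_forall fun q => ?_)
      simp only [Function.comp, Prod.fst_swap, Prod.snd_swap, ContinuousLinearMap.mul_apply']
      rw [← kt_neg, neg_sub]
    refine Integrable.bdd_mul (c := 2 * M) h3 ((hφm.comp measurable_fst).sub (hφm.comp measurable_snd)).aestronglyMeasurable ?_
    refine Eventually.of_forall fun q => ?_
    rw [Real.norm_eq_abs]
    have := abs_sub (φ q.1) (φ q.2)
    linarith [hM q.1, hM q.2]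
  have hGs : Integrable (fun q : Euc N × Euc N => G q.swap) := hGi.swap
  have e1 : ∫ q : Euc N × Euc N, (φ q.1 - φ q.2) * (v q.1 - v q.2) * kt N s ε (q.1 - q.2) = 2 * ∫ q, G q := by
    have : ∀ q : Euc N × Euc N, (φ q.1 - φ q.2) * (v q.1 - v q.2) * kt N s ε (q.1 - q.2) = G q + G q.swap := by
      intro q
      simp only [hG, Prod.fst_swap, Prod.snd_swap]
      rw [← kt_neg (q.2 - q.1), neg_sub]; ring
    simp_rw [this]
    rw [integral_add hGi hGs]
    have : ∫ q : Euc N × Euc N, G q.swap = ∫ q, G q := integral_prod_swap G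
    rw [this]; ring
  have e2 : ∀ x, ∫ y, G (x, y) = v x * ∫ h, (φ x - φ (x + h)) * kt N s ε h := by
    intro x
    rw [← integral_add_left_eq_self _ x, ← integral_const_mul]
    congr 1; ext h
    simp only [hG]
    rw [show x - (x + h) = -h by abel, kt_neg]; ring
  have e3 : ∀ x, 2 * ∫ h, (φ x - φ (x + h)) * kt N s ε h = ∫ h, (2 * φ x - φ (x + h) - φ (x - h)) * kt N s ε h := by
    intro x
    have i1 := sub_kt_int (N := N) hs hε hφm hM x
    have i2 : Integrable (fun h => (φ x - φ (x - h)) * kt N s ε h) := by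
      refine i1.comp_neg.congr (Eventually.of_forall fun h => ?_)
      simp only [kt_neg, sub_eq_add_neg]
    have h1 : ∫ h, (φ x - φ (x - h)) * kt N s ε h = ∫ h, (φ x - φ (x + h)) * kt N s ε h := by
      rw [← integral_neg_eq_self]
      congr 1; ext h
      rw [kt_neg, sub_neg_eq_add]
    rw [two_mul]
    nth_rw 2 [← h1]
    rw [← integral_add i1 i2]
    congr 1; ext h; ring
  have e4 : ∀ x, 2 * ∫ y, G (x, y) = v x * ∫ h, (2 * φ x - φ (x + h) - φ (x - h)) * kt N s ε h := by
    intro x; rw [e2, ← e3]; ring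
  constructor
  · have := (hGi.integral_prod_left).const_mul 2
    exact this.congr (Eventually.of_forall fun x => e4 x)
  · rw [e1, Measure.volume_eq_prod, integral_prod _ hGi, ← integral_const_mul]
    exact integral_congr_ae (Eventually.of_forall fun x => e4 x)

lemma memHs.integrable_of_supp (hv : memHs N s (BB N R) v) (hvs : ∀ x, x ∉ BB N R → v x = 0) : Integrable v := by
  rw [← integrableOn_iff_integrable_of_support_subset (s := BB N R)]
  · exact hv.integrable vol_BB_ne_top
  · intro x hx
    by_contra h
    exact hx (hvs x h)

theorem second_diff [NeZero N] (hs : s ∈ Ioo (0:ℝ) 1) {φ : Euc N → ℝ} (hφ : memHs N s (BB N R) φ) {M : ℝ} (hM : ∀ x, |φ x| ≤ M)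
    (hv : memHs N s (BB N R) v) (hv0 : ∀ x, 0 ≤ v x) (hvs : ∀ x, x ∉ BB N R → v x = 0) {C : Euc N → ℝ}
    (hC : Integrable (fun x => C x * v x)) {ε0 : ℝ} (hε0 : 0 < ε0)
    (h : ∀ ε, 0 < ε → ε < ε0 → ∀ x, v x ≠ 0 → ∫ h, (2 * φ x - φ (x + h) - φ (x - h)) * kt N s ε h ≤ C x) :
    bform N s (BB N R) φ v ≤ ∫ x, C x * v x := by
  have hvi := hv.integrable_of_supp hvs
  set F : Euc N × Euc N → ℝ := fun q => (φ q.1 - φ q.2) * (v q.1 - v q.2) * Kf N s (q.1 - q.2) with hF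
  have hF0 : ∀ q, q ∉ reg N (BB N R) → F q = 0 := by
    intro q hq
    have h1 : q.1 ∉ BB N R := fun h => hq (Or.inl (subset_closure h))
    have h2 : q.2 ∉ BB N R := fun h => hq (Or.inr (subset_closure h))
    simp only [hF]; rw [hvs _ h1, hvs _ h2]; ring
  have hFi : Integrable F := by
    rw [← integrableOn_iff_integrable_of_support_subset (s := reg N (BB N R))]
    · exact integrable_rv hφ hv
    · intro q hq
      by_contra h
      exact hq (hF0 q h)
  have hb : bform N s (BB N R) φ v = ∫ q, F q := by
    rw [bform_rv]
    exact setIntegral_eq_integral_of_forall_compl_eq_zero hF0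
  set T : ℕ → Set (Euc N × Euc N) := fun n => {q | 1 / ((n:ℝ) + 1) ≤ ‖q.1 - q.2‖} with hT
  have hTm : ∀ n, MeasurableSet (T n) := fun n => measurableSet_le measurable_const (measurable_fst.sub measurable_snd).norm
  have hTmono : Monotone T := by
    intro n m hnm q hq
    have : 1 / ((m:ℝ) + 1) ≤ 1 / ((n:ℝ) + 1) := one_div_le_one_div_of_le (by positivity) (by exact_mod_cast Nat.succ_le_succ hnm)
    exact this.trans hq
  have hlim := tendsto_setIntegral_of_monotone hTm hTmono (hFi.integrableOn (s := ⋃ n, T n))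
  have hU : ∫ q in ⋃ n, T n, F q = ∫ q, F q := by
    have : (⋃ n, T n) =ᵐ[volume] (univ : Set (Euc N × Euc N)) := by
      rw [eventuallyEq_univ]
      filter_upwards [ae_diag (N := N)] with q hq
      obtain ⟨n, hn⟩ := exists_nat_one_div_lt (norm_pos_iff.2 (sub_ne_zero.2 hq))
      exact mem_iUnion.2 ⟨n, hn.le⟩
    rw [setIntegral_congr_set this, setIntegral_univ]
  rw [hU] at hlim
  rw [hb]
  refine le_of_tendsto hlim ?_
  have hsmall : ∀ᶠ n : ℕ in atTop, 1 / ((n:ℝ) + 1) < ε0 := tendsto_one_div_add_atTop_nhds_zero_nat.eventually (gt_mem_nhds hε0)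
  filter_upwards [hsmall] with n hn
  have hp : 0 < 1 / ((n:ℝ) + 1) := by positivity
  obtain ⟨t1, t2⟩ := trunc_formula (N := N) hs.1 hp hφ.meas hM hvi
  have e1 : ∫ q in T n, F q = ∫ q : Euc N × Euc N, (φ q.1 - φ q.2) * (v q.1 - v q.2) * kt N s (1 / ((n:ℝ) + 1)) (q.1 - q.2) := by
    rw [← integral_indicator (hTm n)]
    congr 1; ext q
    by_cases hq : q ∈ T n
    · rw [indicator_of_mem hq, kt, indicator_of_mem (show q.1 - q.2 ∈ {h : Euc N | 1 / ((n:ℝ) + 1) ≤ ‖h‖} from hq)]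
    · rw [indicator_of_notMem hq, kt, indicator_of_notMem (show q.1 - q.2 ∉ {h : Euc N | 1 / ((n:ℝ) + 1) ≤ ‖h‖} from hq), mul_zero]
  rw [e1, t2]
  refine integral_mono t1 hC fun x => ?_
  simp only
  by_cases hx : v x = 0
  · rw [hx]; simp
  · rw [mul_comm]
    exact mul_le_mul_of_nonneg_right (h _ hp hn x hx) (hv0 x)

end

section

variable {N : ℕ} {s : ℝ} {Ω : Set (Euc N)} {u v : Euc N → ℝ} {R : ℝ} {e : Euc N} {w : Fin N → Euc N → ℝ}

lemma half_dec (he : ‖e‖ = 1) (av : Asym e v) (x : Euc N) : v x = (HH e).indicator v x - (HH e).indicator v (refl e x) := by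
  rcases lt_trichotomy (inner ℝ x e : ℝ) 0 with h | h | h
  · rw [indicator_of_notMem (by rw [mem_HH]; linarith), indicator_of_mem ((refl_mem_HH he).2 h), av x]; ring
  · rw [indicator_of_notMem (by rw [mem_HH]; linarith), indicator_of_notMem (by rw [refl_mem_HH he]; linarith), av.zero he h]; ring
  · rw [indicator_of_mem (mem_HH.2 h), indicator_of_notMem (by rw [refl_mem_HH he]; linarith)]; ring

lemma half_bform [NeZero N] (hs : s ∈ Ioo (0 : ℝ) 1) (hR : 0 < R) (he : ‖e‖ = 1) (hu : memHs N s (BB N R) u) (au : Asym e u)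
    (hv : memHs N s (BB N R) v) (av : Asym e v) :
    bform N s (BB N R) u v = 2 * bform N s (BB N R) u ((HH e).indicator v) := by
  have h1 := memHs_half hs hR he hv av
  have h2 := h1.comp hR (refl e)
  have h3 : v = fun x => (HH e).indicator v x - (HH e).indicator v (refl e x) := funext fun x => half_dec he av x
  conv_lhs => rw [h3]
  rw [bform_sub_right h1 h2 hu]
  have h4 : bform N s (BB N R) u (fun x => (HH e).indicator v (refl e x)) = - bform N s (BB N R) u ((HH e).indicator v) := by
    rw [← bform_comp hR (refl e)]
    simp only [refl_refl]
    have : (fun x => u (refl e x)) = fun x => (-1) * u x := funext fun x => by rw [au x]; ring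
    rw [this, bform_smul_left]; ring
  rw [h4]; ring

lemma half_int [NeZero N] (hs : s ∈ Ioo (0 : ℝ) 1) (hR : 0 < R) (he : ‖e‖ = 1) (hu : memHs N s (BB N R) u) (au : Asym e u)
    (hv : memHs N s (BB N R) v) (av : Asym e v) :
    ∫ x in BB N R, u x * v x = 2 * ∫ x in BB N R, u x * (HH e).indicator v x := by
  have h1 := memHs_half hs hR he hv av
  have i1 := hu.integrable_mul h1
  have i2 := hu.integrable_mul (h1.comp hR (refl e))
  have e1 : ∫ x in BB N R, u x * v x = ∫ x in BB N R, (u x * (HH e).indicator v x - u x * (HH e).indicator v (refl e x)) := by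
    refine integral_congr_ae (Eventually.of_forall fun x => ?_)
    simp only
    rw [← mul_sub, ← half_dec he av x]
  rw [e1, integral_sub i1 i2]
  have e2 : ∫ x in BB N R, u x * (HH e).indicator v (refl e x) = - ∫ x in BB N R, u x * (HH e).indicator v x := by
    rw [← setIntegral_comp_iso (refl e), ← integral_neg]
    refine integral_congr_ae (Eventually.of_forall fun x => ?_)
    simp only
    rw [refl_refl, au x]; ring
  rw [e2]; ring

lemma refl_E1 (i : Fin N) (x : Euc N) : (refl (E1 N i) x) i = - x i := by
  rw [← inner_E1, inner_refl (E1_norm i), inner_E1]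

lemma Vf_asym (g : ℝ → ℝ) (i : Fin N) : Asym (E1 N i) (Vf g i) := by
  intro x
  rw [Vf, Vf, refl_E1, (refl (E1 N i)).norm_map]; ring

lemma cl_asym {ρ : ℝ} (hρ : 0 ≤ ρ) (i : Fin N) : Asym (E1 N i) (cl N ρ i) := by
  intro x
  rw [cl, cl, refl_E1]
  rcases le_total (x i) ρ with h1 | h1 <;> rcases le_total (-ρ) (x i) with h2 | h2
  · rw [min_eq_right (by linarith), max_eq_right (by linarith), min_eq_right h1, max_eq_right h2]
  · rw [min_eq_left (by linarith), max_eq_right (by linarith), min_eq_right h1, max_eq_left h2]; simp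
  · rw [min_eq_right (by linarith), max_eq_left (by linarith), min_eq_left h1, max_eq_right (by linarith)]
  · rw [min_eq_left (by linarith), max_eq_right (by linarith), min_eq_left h1, max_eq_right (by linarith)]; linarith

lemma clamp_sum {ρ a b : ℝ} (ha : 0 ≤ a) (ha' : a ≤ ρ) :
    max (-ρ) (min ρ (a + b)) + max (-ρ) (min ρ (a - b)) ≤ 2 * a := by
  rcases le_total (a + b) ρ with h1 | h1 <;> rcases le_total (a - b) ρ with h2 | h2 <;>
  rcases le_total (-ρ) (a + b) with h3 | h3 <;> rcases le_total (-ρ) (a - b) with h4 | h4 <;>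
  simp [h1, h2, h3, h4] <;>
  first
  | linarith
  | (constructor <;> linarith)
  | (rw [max_eq_right (by linarith)]; linarith)

lemma clamp_sum_far {ρ a b : ℝ} (ha : 0 ≤ a) (ha' : a ≤ ρ) (hb : 2 * ρ ≤ b) :
    max (-ρ) (min ρ (a + b)) + max (-ρ) (min ρ (a - b)) = 0 := by
  rw [min_eq_left (by linarith), max_eq_right (by linarith), min_eq_right (by linarith), max_eq_left (by linarith)]; ring

lemma cl_second [NeZero N] (hs : 0 < s) {ρ A : ℝ} (hρ : 0 < ρ) (hA : 0 < A) {ε : ℝ} (hε : 0 < ε) (hε' : ε < 2 * ρ) (i : Fin N)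
    {x : Euc N} (hx : 0 ≤ x i) (hx' : x i ≤ ρ) :
    ∫ h, (2 * (-(A * cl N ρ i x)) - (-(A * cl N ρ i (x + h))) - (-(A * cl N ρ i (x - h)))) * kt N s ε h ≤
      -(2 * (om N * (5 ^ ((N:ℝ) + 2 * s))⁻¹ * ρ ^ (-(2 * s))) * (A * cl N ρ i x)) := by
  set D : Set (Euc N) := Metric.ball ((4 * ρ) • E1 N i) ρ with hD
  set k := ((5 * ρ) ^ ((N:ℝ) + 2 * s))⁻¹ with hk
  have hk0 : 0 ≤ k := by positivity
  have hclx : cl N ρ i x = x i := cl_eq i (by rw [abs_of_nonneg hx]; exact hx')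
  have hDi : ∀ h ∈ D, 2 * ρ ≤ h i ∧ 2 * ρ ≤ ‖h‖ ∧ ‖h‖ ≤ 5 * ρ := by
    intro h hh
    have h1 : ‖h - (4 * ρ) • E1 N i‖ < ρ := by rwa [← mem_ball_iff_norm]
    have h2 := coord_le_norm (h - (4 * ρ) • E1 N i) i
    have h3 : (h - (4 * ρ) • E1 N i) i = h i - 4 * ρ := by simp
    rw [h3] at h2
    have h4 := (abs_le.1 h2).1
    have h5 : 2 * ρ ≤ h i := by linarith
    refine ⟨h5, ?_, ?_⟩
    · exact h5.trans ((le_abs_self _).trans (coord_le_norm h i))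
    · have h6 := norm_add_le (h - (4 * ρ) • E1 N i) ((4 * ρ) • E1 N i)
      rw [sub_add_cancel, norm_smul, E1_norm, mul_one, Real.norm_of_nonneg (by positivity)] at h6
      linarith
  have hIntg0 : Integrable (fun h => (2 * (-(A * cl N ρ i x)) - (-(A * cl N ρ i (x + h))) - (-(A * cl N ρ i (x - h)))) * kt N s ε h) := by
    refine Integrable.bdd_mul (c := 4 * (A * ρ)) (kt_int hs hε) ?_ ?_
    · have m1 : Measurable (fun h => cl N ρ i (x + h)) := (measurable_cl ρ i).comp (measurable_const.add measurable_id)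
      have m2 : Measurable (fun h => cl N ρ i (x - h)) := (measurable_cl ρ i).comp (measurable_const.sub measurable_id)
      exact ((measurable_const.sub (m1.const_mul A).neg).sub (m2.const_mul A).neg).aestronglyMeasurable
    · refine Eventually.of_forall fun h => ?_
      have b1 := abs_le.1 (cl_bdd hρ.le i x)
      have b2 := abs_le.1 (cl_bdd hρ.le i (x + h))
      have b3 := abs_le.1 (cl_bdd hρ.le i (x - h))
      rw [Real.norm_eq_abs, show 2 * (-(A * cl N ρ i x)) - (-(A * cl N ρ i (x + h))) - (-(A * cl N ρ i (x - h))) = 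
        A * (cl N ρ i (x + h) + cl N ρ i (x - h) - 2 * cl N ρ i x) by ring, abs_mul, abs_of_pos hA, show 4 * (A * ρ) = A * (4 * ρ) by ring]
      refine mul_le_mul_of_nonneg_left ?_ hA.le
      rw [abs_le]; constructor <;> linarith [b1.1, b1.2, b2.1, b2.2, b3.1, b3.2]
  have hfin : volume D ≠ ⊤ := measure_ball_lt_top.ne
  have hDint : Integrable (D.indicator (fun _ => -(2 * (A * x i)) * k)) :=
    (integrable_indicator_iff measurableSet_ball).2 (integrableOn_const hfin)
  have e1 : -(2 * (om N * (5 ^ ((N:ℝ) + 2 * s))⁻¹ * ρ ^ (-(2 * s))) * (A * cl N ρ i x)) = ∫ h, D.indicator (fun _ => -(2 * (A * x i)) * k) h := by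
    rw [integral_indicator measurableSet_ball, setIntegral_const, smul_eq_mul, vol_ball hρ.le, hclx, hk,
      Real.mul_rpow (by norm_num) hρ.le, Real.rpow_add hρ, Real.rpow_neg hρ.le, Real.rpow_natCast]
    field_simp
  rw [e1]
  refine integral_mono hIntg0 hDint fun h => ?_
  simp only
  rw [show 2 * (-(A * cl N ρ i x)) - (-(A * cl N ρ i (x + h))) - (-(A * cl N ρ i (x - h))) = 
        A * (cl N ρ i (x + h) + cl N ρ i (x - h) - 2 * cl N ρ i x) by ring, hclx]
  have c1 : cl N ρ i (x + h) = max (-ρ) (min ρ (x i + h i)) := rfl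
  have c2 : cl N ρ i (x - h) = max (-ρ) (min ρ (x i - h i)) := rfl
  rw [c1, c2]
  by_cases hh : h ∈ D
  · obtain ⟨d1, d2, d3⟩ := hDi h hh
    rw [indicator_of_mem hh, clamp_sum_far hx hx' d1]
    have hkt : k ≤ kt N s ε h := by
      rw [kt, indicator_of_mem (show h ∈ {h : Euc N | ε ≤ ‖h‖} from by change ε ≤ ‖h‖; linarith)]
      exact Kf_ge_of_le hs (norm_pos_iff.1 (by linarith)) d3
    have : 0 ≤ 2 * (A * x i) := by positivity
    have := mul_le_mul_of_nonneg_left hkt this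
    linarith
  · rw [indicator_of_notMem hh]
    have h1 := clamp_sum (b := h i) hx hx'
    exact mul_nonpos_of_nonpos_of_nonneg (mul_nonpos_of_nonneg_of_nonpos hA.le (by linarith)) (kt_nonneg h)

end

section

variable {N : ℕ} {s : ℝ} {Ω : Set (Euc N)} {u v : Euc N → ℝ} {R : ℝ} {e : Euc N} {w : Fin N → Euc N → ℝ}

lemma kappa_large [NeZero N] (hs : 0 < s) (hR : 0 < R) (l : ℝ) :
    ∃ ρ, 0 < ρ ∧ ρ < R ∧ l < 2 * (om N * (5 ^ ((N:ℝ) + 2 * s))⁻¹ * ρ ^ (-(2 * s))) := by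
  have hc : 0 < 2 * (om N * (5 ^ ((N:ℝ) + 2 * s))⁻¹) := mul_pos two_pos (mul_pos om_pos (by positivity))
  have h2 : Tendsto (fun d : ℝ => d ^ (-(2 * s))) (𝓝[>] 0) atTop := tendsto_rpow_neg_nhdsGT_zero (by linarith)
  have h3 := (h2.const_mul_atTop hc).eventually_gt_atTop l
  obtain ⟨ρ, h4, h5⟩ := (h3.and (Ioo_mem_nhdsGT hR)).exists
  exact ⟨ρ, h5.1, h5.2, by linarith⟩

theorem barrier [NeZero N] (hs : s ∈ Ioo (0:ℝ) 1) (hR : 0 < R) {g : ℝ → ℝ} (hgc : ContinuousOn g (Ioi 0)) (hg0 : ∀ t, 0 < t → 0 ≤ g t)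
    (hgb : ∀ ρ > 0, ∃ C, ∀ t, ρ ≤ t → g t ≤ C) (hu : IsEig N s (BB N R) (Vf g 0)) :
    ∃ A > 0, ∃ ρ > 0, ∀ t, 0 < t → t < ρ → g t ≤ A * t := by
  obtain ⟨ρ, hρ, hρR, hκ⟩ := kappa_large (N := N) hs.1 hR (lam N s (BB N R))
  set κ := om N * (5 ^ ((N:ℝ) + 2 * s))⁻¹ * ρ ^ (-(2 * s)) with hκd
  obtain ⟨C0, hC0⟩ := hgb ρ hρ
  set C := max C0 1 with hC
  have hC1 : 0 < C := lt_of_lt_of_le one_pos (le_max_right _ _)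
  have hCg : ∀ t, ρ ≤ t → g t ≤ C := fun t ht => (hC0 t ht).trans (le_max_left _ _)
  set A := C / ρ with hA
  have hA0 : 0 < A := div_pos hC1 hρ
  set e := E1 N 0 with he
  have hen : ‖e‖ = 1 := E1_norm 0
  set u := Vf g (0 : Fin N) with hud
  set φ : Euc N → ℝ := fun x => A * cl N ρ 0 x with hφd
  have hcm := memHs_cl (N := N) hs (vol_closure_ball R) hρ.le 0
  have hφ : memHs N s (BB N R) φ := hcm.smul A
  have aφ : Asym e φ := (cl_asym hρ.le 0).smul A
  have au : Asym e u := Vf_asym g 0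
  set f : Euc N → ℝ := fun x => u x - φ x with hfd
  have hf : memHs N s (BB N R) f := hu.mem.sub hφ
  have af : Asym e f := au.sub aφ
  set V := pp e f with hV
  have hVm : memHs N s (BB N R) V := pp_mem hs hR hen hf af
  have aV : Asym e V := pp_asym e f
  set V1 := (HH e).indicator V with hV1
  have hV1m : memHs N s (BB N R) V1 := memHs_half hs hR hen hVm aV
  have hH : ∀ x : Euc N, x ∈ HH e ↔ 0 < x 0 := fun x => by rw [mem_HH, he, inner_E1]
  have hV1v : ∀ x, x ∈ HH e → V1 x = max (f x) 0 := fun x hx => by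
    rw [hV1, indicator_of_mem hx, hV, pp_of_pos hen hx]
  have hV1o : ∀ x, x ∉ HH e → V1 x = 0 := fun x hx => indicator_of_notMem hx _
  have hV10 : ∀ x, 0 ≤ V1 x := by
    intro x
    by_cases hx : x ∈ HH e
    · rw [hV1v x hx]; exact le_max_right _ _
    · rw [hV1o x hx]
  have hfar : ∀ x, ρ ≤ ‖x‖ → V1 x = 0 := by
    intro x hxρ
    by_cases hx : x ∈ HH e
    · rw [hV1v x hx]
      apply max_eq_right
      have hx0 := (hH x).1 hx
      have hn : 0 < ‖x‖ := by linarith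
      have h1 : u x ≤ x 0 / ‖x‖ * C := mul_le_mul_of_nonneg_left (hCg _ hxρ) (by positivity)
      have h2 : x 0 / ‖x‖ * C ≤ φ x := by
        have hm : x 0 / ‖x‖ * ρ ≤ cl N ρ 0 x := by
          refine le_max_of_le_right (le_min ?_ ?_)
          · have : x 0 / ‖x‖ ≤ 1 := (div_le_one hn).2 ((le_abs_self _).trans (coord_le_norm x 0))
            nlinarith
          · rw [div_mul_eq_mul_div, div_le_iff₀ hn]
            exact mul_le_mul_of_nonneg_left hxρ hx0.le
        have := mul_le_mul_of_nonneg_left hm hA0.le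
        calc x 0 / ‖x‖ * C = A * (x 0 / ‖x‖ * ρ) := by rw [hA]; field_simp
          _ ≤ _ := this
      simp only [hfd]; linarith
    · exact hV1o x hx
  have hsupp : ∀ x, x ∉ BB N R → V1 x = 0 := by
    intro x hx
    apply hfar
    rw [mem_ball_zero_iff, not_lt] at hx; linarith
  have hprop : ∀ x, V1 x ≠ 0 → 0 < x 0 ∧ x 0 ≤ ρ ∧ φ x = A * x 0 ∧ V1 x = f x := by
    intro x hx
    have hxH : x ∈ HH e := by by_contra h; exact hx (hV1o x h)
    have hxn : ‖x‖ < ρ := by by_contra h; exact hx (hfar x (not_lt.1 h))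
    have hx0 := (hH x).1 hxH
    have hab := coord_le_norm x 0
    rw [abs_of_pos hx0] at hab
    refine ⟨hx0, by linarith, ?_, ?_⟩
    · simp only [hφd]; rw [cl_eq 0 (by rw [abs_of_pos hx0]; linarith)]
    · rw [hV1v x hxH] at hx ⊢
      by_cases h : f x ≤ 0
      · exact absurd (max_eq_right h) hx
      · exact max_eq_left (not_le.1 h).le
  have hV1i := hV1m.integrable_of_supp hsupp
  have hφm : Measurable φ := hφ.meas
  have hφb : ∀ x, |φ x| ≤ A * ρ := fun x => by
    simp only [hφd]; rw [abs_mul, abs_of_pos hA0]; exact mul_le_mul_of_nonneg_left (cl_bdd hρ.le 0 x) hA0.le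
  have hφV : Integrable (fun x => φ x * V1 x) :=
    Integrable.bdd_mul (c := A * ρ) hV1i hφm.aestronglyMeasurable (Eventually.of_forall fun x => hφb x)
  -- second difference estimate
  have hE1 : bform N s (BB N R) (fun x => -φ x) V1 ≤ ∫ x, -(2 * κ * φ x) * V1 x := by
    refine second_diff hs (M := A * ρ) (by simpa using hφ.smul (-1)) (fun x => by rw [abs_neg]; exact hφb x) hV1m hV10 hsupp ?_
      (ε0 := 2 * ρ) (by positivity) ?_
    · refine (hφV.const_mul (-(2 * κ))).congr (Eventually.of_forall fun x => ?_)
      simp only; ring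
    · intro ε hε hε' x hx
      obtain ⟨h1, h2, -, -⟩ := hprop x hx
      exact cl_second hs.1 hρ hA0 hε hε' 0 h1.le h2
  have hE2 : bform N s (BB N R) (fun x => -φ x) V1 = - bform N s (BB N R) φ V1 := by
    have := bform_smul_left (N := N) (s := s) (Ω := BB N R) (u := φ) (w := V1) (-1)
    simpa using this
  have hE3 : ∫ x, -(2 * κ * φ x) * V1 x = -(2 * κ) * ∫ x, φ x * V1 x := by
    rw [← integral_const_mul]; congr 1; ext x; ring
  -- the tests
  have hT := pp_test hs hR hen hf af
  have hX := cross_le hs hR hen hf af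
  have hS : bform N s (BB N R) f V = bform N s (BB N R) u V - bform N s (BB N R) φ V := bform_sub_left hu.mem hφ hVm
  have hφE := half_bform hs hR hen hφ aφ hVm aV
  have huE := hu.weak' hs hVm
  have huI := half_int hs hR hen hu.mem au hVm aV
  have hVI := half_int hs hR hen hVm aV hVm aV
  have hray := rayleigh' hs hVm aV.mean
  have hset : ∀ F : Euc N → ℝ, ∫ x in BB N R, F x * V1 x = ∫ x, F x * V1 x := fun F =>
    setIntegral_eq_integral_of_forall_compl_eq_zero fun x hx => by rw [hsupp x hx, mul_zero]
  have hsq : ∫ x in BB N R, V x ^ 2 = ∫ x in BB N R, V x * V x := by congr 1; ext x; ring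
  have hsplit : ∫ x in BB N R, u x * V1 x = (∫ x in BB N R, V x * V1 x) + ∫ x in BB N R, φ x * V1 x := by
    rw [← integral_add (hVm.integrable_mul hV1m) (hφ.integrable_mul hV1m)]
    refine integral_congr_ae (Eventually.of_forall fun x => ?_)
    simp only
    by_cases hx : V1 x = 0
    · rw [hx]; ring
    · obtain ⟨h1, -, -, h4⟩ := hprop x hx
      have h5 : V x = V1 x := by rw [hV1, indicator_of_mem ((hH x).2 h1)]
      rw [h5, h4, hfd]; ring
  have hlam := lam_nonneg (N := N) (Ω := BB N R) hs
  set I := ∫ x, φ x * V1 x with hI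
  have hIset : ∫ x in BB N R, φ x * V1 x = I := hset φ
  have hφVnn : ∀ x, 0 ≤ φ x * V1 x := by
    intro x
    by_cases hx : V1 x = 0
    · rw [hx, mul_zero]
    · obtain ⟨h1, -, h3, -⟩ := hprop x hx
      rw [h3]; exact mul_nonneg (by positivity) (hV10 x)
  have hI0 : 0 ≤ I := integral_nonneg hφVnn
  rw [hIset] at hsplit
  rw [hsq, hVI] at hray
  rw [huI, hsplit] at huE
  rw [hE2, hE3] at hE1
  have hfinal : (2 * κ - lam N s (BB N R)) * I ≤ 0 := by
    nlinarith
  have hIz : I = 0 := by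
    have : 0 < 2 * κ - lam N s (BB N R) := by linarith
    nlinarith
  have hae := (integral_eq_zero_iff_of_nonneg hφVnn hφV).1 hIz
  -- conclusion
  refine ⟨A, hA0, ρ, hρ, ?_⟩
  have hcf : ContinuousOn f (HH e) := by
    intro x hx
    have hx0 := (hH x).1 hx
    have hne : x ≠ 0 := by rintro rfl; simp at hx0
    have hcl : Continuous (cl N ρ 0) := by unfold cl; fun_prop
    exact ((Vf_contAt hgc 0 hne).sub (continuous_const.mul hcl).continuousAt).continuousWithinAt
  have hUo : IsOpen (HH e ∩ f ⁻¹' Ioi 0) := hcf.isOpen_inter_preimage isOpen_HH isOpen_Ioi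
  have hUn : volume (HH e ∩ f ⁻¹' Ioi 0) = 0 := by
    have : ∀ᵐ x, x ∉ HH e ∩ f ⁻¹' Ioi 0 := by
      filter_upwards [hae] with x hx hxU
      have h1 : 0 < f x := hxU.2
      have h2 : V1 x = f x := by rw [hV1v x hxU.1, max_eq_left h1.le]
      obtain ⟨h3, -, h5, -⟩ := hprop x (by rw [h2]; exact h1.ne')
      have h6 : φ x * V1 x = 0 := hx
      rw [h5, h2] at h6
      have : 0 < A * x 0 * f x := by positivity
      linarith
    exact measure_eq_zero_iff_ae_notMem.2 this
  have hUe := (hUo.measure_eq_zero_iff volume).1 hUn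
  intro t ht htρ
  by_contra hcon
  have hn : ‖t • E1 N 0‖ = t := norm_smul_E1 ht.le
  have hc0 : (t • E1 N 0) 0 = t := by simp
  have : t • E1 N 0 ∈ HH e ∩ f ⁻¹' Ioi 0 := by
    refine ⟨(hH _).2 (by rw [hc0]; exact ht), ?_⟩
    change 0 < f (t • E1 N 0)
    simp only [hfd, hud, hφd, Vf]
    rw [cl_eq 0 (by rw [hc0, abs_of_pos ht]; exact htρ.le), hn, hc0, div_self ht.ne', one_mul]
    linarith [not_le.1 hcon]
  rw [hUe] at this; exact this

end

section

variable {N : ℕ} {s : ℝ} {Ω : Set (Euc N)} {u v : Euc N → ℝ} {R : ℝ} {e : Euc N} {w : Fin N → Euc N → ℝ}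

def zt (x0 : Euc N) (ρ : ℝ) (x : Euc N) : ℝ := max (1 - (‖x - x0‖ / ρ) ^ 2) 0

lemma zt_nonneg {x0 : Euc N} {ρ : ℝ} (x : Euc N) : 0 ≤ zt x0 ρ x := le_max_right _ _

lemma zt_le_one {x0 : Euc N} {ρ : ℝ} (x : Euc N) : zt x0 ρ x ≤ 1 :=
  max_le (by nlinarith [sq_nonneg (‖x - x0‖ / ρ)]) zero_le_one

lemma zt_cont (x0 : Euc N) (ρ : ℝ) : Continuous (zt x0 ρ) := by unfold zt; fun_prop

lemma zt_center (x0 : Euc N) (ρ : ℝ) : zt x0 ρ x0 = 1 := by simp [zt]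

lemma zt_far {x0 x : Euc N} {ρ : ℝ} (hρ : 0 < ρ) (h : ρ ≤ ‖x - x0‖) : zt x0 ρ x = 0 := by
  apply max_eq_right
  have : 1 ≤ ‖x - x0‖ / ρ := (one_le_div hρ).2 h
  nlinarith

lemma clip_lip {a b : ℝ} (ha : 0 ≤ a) (hb : 0 ≤ b) : max (1 - a ^ 2) 0 - max (1 - b ^ 2) 0 ≤ 2 * |a - b| := by
  rw [sub_le_iff_le_add]
  have h1 := le_abs_self (a - b)
  have h2 := neg_le_abs (a - b)
  refine max_le ?_ (by have := le_max_right (1 - b ^ 2) 0; linarith [abs_nonneg (a - b)])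
  rcases le_total b 1 with hb1 | hb1
  · have h3 := le_max_left (1 - b ^ 2) 0
    rcases le_total a b with h | h
    · nlinarith
    · nlinarith [abs_nonneg (a - b)]
  · have h3 := le_max_right (1 - b ^ 2) 0
    rcases le_total a 1 with h | h
    · nlinarith
    · nlinarith [abs_nonneg (a - b)]

lemma zt_lip (x0 : Euc N) {ρ : ℝ} (hρ : 0 < ρ) (x y : Euc N) : |zt x0 ρ x - zt x0 ρ y| ≤ 2 / ρ * ‖x - y‖ := by
  have key : ∀ x y : Euc N, zt x0 ρ x - zt x0 ρ y ≤ 2 / ρ * ‖x - y‖ := by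
    intro x y
    refine (clip_lip (by positivity) (by positivity)).trans ?_
    rw [← sub_div, abs_div, abs_of_pos hρ]
    have h := abs_norm_sub_norm_le (x - x0) (y - x0)
    rw [sub_sub_sub_cancel_right] at h
    have := div_le_div_of_nonneg_right h hρ.le
    calc _ ≤ 2 * (‖x - y‖ / ρ) := by linarith
      _ = _ := by ring
  rw [abs_le]
  have h := key y x
  rw [norm_sub_rev] at h
  exact ⟨by linarith, key x y⟩

def zz (e x0 : Euc N) (ρ : ℝ) (x : Euc N) : ℝ := zt x0 ρ x - zt x0 ρ (refl e x)

lemma zz_mem [NeZero N] (hs : s ∈ Ioo (0:ℝ) 1) (hR : 0 < R) (e x0 : Euc N) {ρ : ℝ} (hρ : 0 < ρ) : memHs N s (BB N R) (zz e x0 ρ) := by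
  have h : memHs N s (BB N R) (zt x0 ρ) := memHs_of_lip hs (vol_closure_ball R) (M := 1) (zt_cont x0 ρ).measurable (zt_lip x0 hρ)
    (fun x => by rw [abs_of_nonneg (zt_nonneg x)]; exact zt_le_one x)
  exact h.sub (h.comp hR (refl e))

lemma zz_bdd {e x0 : Euc N} {ρ : ℝ} (x : Euc N) : |zz e x0 ρ x| ≤ 1 := by
  have h1 := zt_nonneg (x0 := x0) (ρ := ρ) x
  have h2 := zt_le_one (x0 := x0) (ρ := ρ) x
  have h3 := zt_nonneg (x0 := x0) (ρ := ρ) (refl e x)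
  have h4 := zt_le_one (x0 := x0) (ρ := ρ) (refl e x)
  rw [zz, abs_le]; constructor <;> linarith

lemma zz_cont (e x0 : Euc N) (ρ : ℝ) : Continuous (zz e x0 ρ) :=
  (zt_cont x0 ρ).sub ((zt_cont x0 ρ).comp (refl e).continuous)

/-- points with nonzero bump have large inner product with e -/
lemma zt_inner (he : ‖e‖ = 1) {r0 ρ : ℝ} (hρ : 0 < ρ) {x : Euc N} (h : zt (r0 • e) ρ x ≠ 0) : r0 - ρ < (inner ℝ x e : ℝ) := by
  have h1 : ‖x - r0 • e‖ < ρ := by by_contra hc; exact h (zt_far hρ (not_lt.1 hc))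
  have h2 := neg_le_of_abs_le (abs_real_inner_le_norm (x - r0 • e) e)
  rw [inner_sub_left, inner_smul_left, real_inner_self_eq_norm_sq, he] at h2
  simp at h2
  linarith

lemma zz_second (he : ‖e‖ = 1) {r0 ρ : ℝ} (hρ : 0 < ρ) (hr : 2 * ρ ≤ r0) {x : Euc N} (hx : ‖x - r0 • e‖ < ρ) (h : Euc N) :
    2 * zz e (r0 • e) ρ x - zz e (r0 • e) ρ (x + h) - zz e (r0 • e) ρ (x - h) ≤ min ((2 / ρ ^ 2 + 2 / r0 ^ 2) * ‖h‖ ^ 2) 4 := by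
  set x0 := r0 • e with hx0
  have hr0 : 0 < r0 := by linarith
  have hb := fun y => (abs_le.1 (zz_bdd (e := e) (x0 := x0) (ρ := ρ) y))
  refine le_min ?_ (by linarith [(hb x).2, (hb (x + h)).1, (hb (x - h)).1])
  -- first part
  have h1 : 2 * zt x0 ρ x - zt x0 ρ (x + h) - zt x0 ρ (x - h) ≤ 2 / ρ ^ 2 * ‖h‖ ^ 2 := by
    have e1 : zt x0 ρ x = 1 - (‖x - x0‖ / ρ) ^ 2 := by
      apply max_eq_left
      have h2 : ‖x - x0‖ / ρ ≤ 1 := (div_le_one hρ).2 hx.le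
      have h3 : 0 ≤ ‖x - x0‖ / ρ := by positivity
      nlinarith
    have e2 : 1 - (‖x + h - x0‖ / ρ) ^ 2 ≤ zt x0 ρ (x + h) := le_max_left _ _
    have e3 : 1 - (‖x - h - x0‖ / ρ) ^ 2 ≤ zt x0 ρ (x - h) := le_max_left _ _
    have hp := parallelogram_law_with_norm ℝ (x - x0) h
    have a1 : x - x0 + h = x + h - x0 := by abel
    have a2 : x - x0 - h = x - h - x0 := by abel
    rw [a1, a2] at hp
    have hp2 : (‖x + h - x0‖ / ρ) ^ 2 + (‖x - h - x0‖ / ρ) ^ 2 = 2 * ((‖x - x0‖ / ρ) ^ 2) + 2 / ρ ^ 2 * ‖h‖ ^ 2 := by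
      field_simp
      linarith
    linarith
  have hxi : r0 - ρ < (inner ℝ x e : ℝ) := by
    have h2 := neg_le_of_abs_le (abs_real_inner_le_norm (x - x0) e)
    rw [hx0, inner_sub_left, inner_smul_left, real_inner_self_eq_norm_sq, he, ← hx0] at h2
    simp at h2
    linarith
  have h2 : ∀ k : Euc N, ‖k‖ = ‖h‖ → zt x0 ρ (refl e (x + k)) ≤ 1 / r0 ^ 2 * ‖h‖ ^ 2 := by
    intro k hk
    by_cases hz : zt x0 ρ (refl e (x + k)) = 0
    · rw [hz]; positivity
    · have h3 := zt_inner he hρ hz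
      rw [inner_refl he, inner_add_left] at h3
      have h4 := neg_le_of_abs_le (abs_real_inner_le_norm k e)
      rw [he, mul_one, hk] at h4
      have h5 : r0 ≤ ‖h‖ := by linarith
      refine (zt_le_one _).trans ?_
      rw [one_div_mul_eq_div, one_le_div (by positivity)]
      exact pow_le_pow_left₀ hr0.le h5 2
  have h3 := h2 h rfl
  have h4 := h2 (-h) (norm_neg h)
  rw [← sub_eq_add_neg] at h4
  have h5 := zt_nonneg (x0 := x0) (ρ := ρ) (refl e x)
  have h6 : (2 / ρ ^ 2 + 2 / r0 ^ 2) * ‖h‖ ^ 2 = 2 / ρ ^ 2 * ‖h‖ ^ 2 + 1 / r0 ^ 2 * ‖h‖ ^ 2 + 1 / r0 ^ 2 * ‖h‖ ^ 2 := by ring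
  rw [h6]
  unfold zz
  linarith

lemma zz_second_int [NeZero N] (hs : s ∈ Ioo (0:ℝ) 1) (he : ‖e‖ = 1) {r0 ρ ε : ℝ} (hρ : 0 < ρ) (hr : 2 * ρ ≤ r0) (hε : 0 < ε) {x : Euc N}
    (hx : ‖x - r0 • e‖ < ρ) :
    ∫ h, (2 * zz e (r0 • e) ρ x - zz e (r0 • e) ρ (x + h) - zz e (r0 • e) ρ (x - h)) * kt N s ε h ≤
      ∫ h, min ((2 / ρ ^ 2 + 2 / r0 ^ 2) * ‖h‖ ^ 2) 4 * Kf N s h := by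
  have hc := zz_cont e (r0 • e) ρ
  refine integral_mono ?_ (integrable_min_Kf hs (by positivity) (by norm_num)) ?_
  · refine Integrable.bdd_mul (c := 4) (kt_int hs.1 hε) (by fun_prop) (Eventually.of_forall fun h => ?_)
    have hb := fun y => (abs_le.1 (zz_bdd (e := e) (x0 := r0 • e) (ρ := ρ) y))
    rw [Real.norm_eq_abs, abs_le]
    constructor <;> linarith [(hb x).1, (hb (x + h)).1, (hb (x - h)).1, (hb x).2, (hb (x + h)).2, (hb (x - h)).2]
  · intro h
    have h1 := zz_second he hρ hr hx h
    have h2 : kt N s ε h ≤ Kf N s h := indicator_le_self' (fun _ _ => Kf_nonneg _) h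
    exact (mul_le_mul_of_nonneg_right h1 (kt_nonneg h)).trans (mul_le_mul_of_nonneg_left h2 (le_min (by positivity) (by norm_num)))

lemma cross_lower {J : Euc N × Euc N → ℝ} (hJi : Integrable J (rv N R)) (hJ0 : ∀ᵐ q ∂(rv N R), 0 ≤ J q) {P S : Set (Euc N)}
    (hP : MeasurableSet P) (hPc : P ⊆ closure (BB N R)) (hS : MeasurableSet S) (hSf : volume S ≠ ⊤) {V : Euc N → ℝ} (hV : IntegrableOn V P) {c : ℝ}
    (hJ : ∀ x ∈ P, ∀ y ∈ S, c * V x ≤ J (x, y)) :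
    c * volume.real S * ∫ x in P, V x ≤ ∫ q, J q ∂(rv N R) := by
  have hsub : P ×ˢ S ⊆ reg N (BB N R) := fun q hq => Or.inl (hPc hq.1)
  have h1 : ∫ q in P ×ˢ S, J q ≤ ∫ q, J q ∂(rv N R) := setIntegral_mono_set hJi hJ0 hsub.eventuallyLE
  refine le_trans ?_ h1
  have h2 := setIntegral_prod_mul (μ := (volume : Measure (Euc N))) (ν := (volume : Measure (Euc N))) V (fun _ => c) P S
  rw [setIntegral_const, smul_eq_mul] at h2
  have h3 : c * volume.real S * ∫ x in P, V x = ∫ q in P ×ˢ S, V q.1 * c := by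
    rw [Measure.volume_eq_prod, h2]; ring
  rw [h3]
  refine setIntegral_mono_on ?_ (IntegrableOn.mono_set hJi hsub) (hP.prod hS) fun q hq => ?_
  · have : Integrable (fun _ : Euc N => c) (volume.restrict S) := integrableOn_const hSf
    have h4 := hV.mul_prod this
    rw [Measure.prod_restrict] at h4
    exact h4
  · rw [mul_comm]; exact hJ q.1 hq.1 q.2 hq.2

end

section

variable {N : ℕ} {s : ℝ} {Ω : Set (Euc N)} {u v : Euc N → ℝ} {R : ℝ} {e : Euc N} {w : Fin N → Euc N → ℝ}

lemma cball_props (he : ‖e‖ = 1) {a b : ℝ} (ha : 0 ≤ a) {x : Euc N} (hx : x ∈ Metric.closedBall (a • e) b) :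
    a - b ≤ ‖x‖ ∧ ‖x‖ ≤ a + b ∧ a - b ≤ (inner ℝ x e : ℝ) := by
  have h1 : ‖x - a • e‖ ≤ b := by rwa [Metric.mem_closedBall, dist_eq_norm] at hx
  have hn : ‖a • e‖ = a := by rw [norm_smul, he, mul_one, Real.norm_eq_abs, abs_of_nonneg ha]
  have h2 := neg_le_of_abs_le (abs_real_inner_le_norm (x - a • e) e)
  rw [inner_sub_left, inner_smul_left, real_inner_self_eq_norm_sq, he] at h2
  simp at h2
  have h3 := norm_sub_norm_le x (a • e)
  have h4 := norm_sub_norm_le (a • e) x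
  rw [norm_sub_rev] at h4
  exact ⟨by linarith, by linarith, by linarith⟩

lemma dK_contAt (hs : 0 < s) {q : Euc N × Euc N} (h1 : q.1 ≠ q.2) (h2 : q.1 ≠ refl e q.2) : ContinuousAt (dK N s e) q := by
  have c1 : ContinuousAt (fun q : Euc N × Euc N => Kf N s (q.1 - q.2)) q :=
    ContinuousAt.comp (f := fun q : Euc N × Euc N => q.1 - q.2) (Kf_continuousAt hs (sub_ne_zero.2 h1)) (by fun_prop)
  have c2 : ContinuousAt (fun q : Euc N × Euc N => Kf N s (q.1 - refl e q.2)) q := by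
    refine ContinuousAt.comp (f := fun q : Euc N × Euc N => q.1 - refl e q.2) (Kf_continuousAt hs (sub_ne_zero.2 h2)) ?_
    exact (continuous_fst.sub ((refl e).continuous.comp continuous_snd)).continuousAt
  exact c1.sub c2

lemma c0_exists [NeZero N] (hs : 0 < s) (hR : 0 < R) {g : ℝ → ℝ} (hgc : ContinuousOn g (Ioi 0)) (hgp : ∀ t, R < t → 0 < g t)
    {r0 ρ : ℝ} (hρ : 0 < ρ) (hr : 2 * ρ ≤ r0) (hrR : r0 + 2 * ρ ≤ R) :
    ∃ c > 0, ∀ x ∈ Metric.closedBall (r0 • E1 N 0) ρ, ∀ y ∈ Metric.closedBall ((2 * R) • E1 N 0) (R / 2), 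
      c ≤ Vf g 0 y * dK N s (E1 N 0) (x, y) := by
  have he : ‖E1 N 0‖ = 1 := E1_norm 0
  have hPp : ∀ x ∈ Metric.closedBall (r0 • E1 N 0) ρ, _ := fun x hx => cball_props he (by linarith) hx
  have hSp : ∀ x ∈ Metric.closedBall ((2 * R) • E1 N 0) (R / 2), _ := fun x hx => cball_props he (by linarith) hx
  have hne : ∀ x ∈ Metric.closedBall (r0 • E1 N 0) ρ, ∀ y ∈ Metric.closedBall ((2 * R) • E1 N 0) (R / 2), x ≠ y ∧ x ≠ refl (E1 N 0) y ∧ y ≠ 0 := by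
    intro x hx y hy
    have h1 := hPp x hx
    have h2 := hSp y hy
    refine ⟨?_, ?_, ?_⟩
    · rintro rfl; linarith
    · rintro rfl; rw [(refl (E1 N 0)).norm_map] at h1; linarith
    · rintro rfl; rw [norm_zero] at h2; linarith
  have hK : IsCompact (Metric.closedBall (r0 • E1 N 0) ρ ×ˢ Metric.closedBall ((2 * R) • E1 N 0) (R / 2)) :=
    (isCompact_closedBall _ _).prod (isCompact_closedBall _ _)
  have hKn : (Metric.closedBall (r0 • E1 N 0) ρ ×ˢ Metric.closedBall ((2 * R) • E1 N 0) (R / 2)).Nonempty :=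
    ⟨(r0 • E1 N 0, (2 * R) • E1 N 0), Metric.mem_closedBall_self hρ.le, Metric.mem_closedBall_self (by linarith)⟩
  have hc : ContinuousOn (fun q : Euc N × Euc N => Vf g 0 q.2 * dK N s (E1 N 0) q)
      (Metric.closedBall (r0 • E1 N 0) ρ ×ˢ Metric.closedBall ((2 * R) • E1 N 0) (R / 2)) := by
    intro q hq
    obtain ⟨h1, h2, h3⟩ := hne q.1 hq.1 q.2 hq.2
    have c1 : ContinuousAt (fun q : Euc N × Euc N => Vf g 0 q.2) q :=
      ContinuousAt.comp (f := fun q : Euc N × Euc N => q.2) (Vf_contAt hgc 0 h3) (by fun_prop)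
    exact (c1.mul (dK_contAt hs h1 h2)).continuousWithinAt
  obtain ⟨q, hq, hmin⟩ := hK.exists_isMinOn hKn hc
  refine ⟨Vf g 0 q.2 * dK N s (E1 N 0) q, ?_, fun x hx y hy => hmin (a := (x, y)) ⟨hx, hy⟩⟩
  have h1 := hPp q.1 hq.1
  have h2 := hSp q.2 hq.2
  have hx0 : 0 < (inner ℝ q.1 (E1 N 0) : ℝ) := by linarith
  have hy0 : 0 < (inner ℝ q.2 (E1 N 0) : ℝ) := by linarith
  have hd := dK_pos hs he (hne q.1 hq.1 q.2 hq.2).1 (mul_pos hx0 hy0)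
  rw [inner_E1] at hy0
  have hn : 0 < ‖q.2‖ := by linarith
  have hg := hgp ‖q.2‖ (by linarith)
  refine mul_pos ?_ hd
  unfold Vf; positivity

set_option maxHeartbeats 1000000 in
theorem g_pos [NeZero N] (hs : s ∈ Ioo (0:ℝ) 1) (hR : 0 < R) {g : ℝ → ℝ} (hgc : ContinuousOn g (Ioi 0)) (hg0 : ∀ t, 0 < t → 0 ≤ g t)
    (hgp : ∀ t, R < t → 0 < g t) (hu : IsEig N s (BB N R) (Vf g 0)) {r0 : ℝ} (hr0 : 0 < r0) (hr0R : r0 < R) : 0 < g r0 := by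
  obtain ⟨ρ, hρ, hr, hrR⟩ : ∃ ρ, 0 < ρ ∧ 2 * ρ ≤ r0 ∧ r0 + 2 * ρ ≤ R := by
    refine ⟨min r0 (R - r0) / 2, ?_, ?_, ?_⟩
    · have := lt_min hr0 (sub_pos.2 hr0R); linarith
    · have := min_le_left r0 (R - r0); linarith
    · have := min_le_right r0 (R - r0); linarith
  obtain ⟨c0, hc0, hc⟩ := c0_exists hs.1 hR hgc hgp (N := N) hρ hr hrR
  set e := E1 N 0 with he
  have hen : ‖e‖ = 1 := E1_norm 0
  set u := Vf g (0 : Fin N) with hud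
  set x0 := r0 • e with hx0
  set P := Metric.closedBall x0 ρ with hP
  set S := Metric.closedBall ((2 * R) • e) (R / 2) with hS
  have hPp : ∀ x ∈ P, _ := fun x hx => cball_props hen hr0.le hx
  have hSp : ∀ x ∈ S, _ := fun x hx => cball_props hen (by linarith) hx
  have hSvol : 0 < volume.real S := by
    rw [measureReal_def, ENNReal.toReal_pos_iff]
    exact ⟨Metric.measure_closedBall_pos volume _ (by linarith), measure_closedBall_lt_top⟩
  obtain ⟨C, hC⟩ : ∃ C, C = ∫ h : Euc N, min ((2 / ρ ^ 2 + 2 / r0 ^ 2) * ‖h‖ ^ 2) 4 * Kf N s h := ⟨_, rfl⟩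
  have hC0 : 0 ≤ C := hC ▸ integral_nonneg fun h => mul_nonneg (le_min (by positivity) (by norm_num)) (Kf_nonneg h)
  obtain ⟨c, hcd⟩ : ∃ c, c = 1 / 2 * (c0 * volume.real S) := ⟨_, rfl⟩
  have hcp : 0 < c := hcd ▸ mul_pos one_half_pos (mul_pos hc0 hSvol)
  obtain ⟨δ, hδ⟩ : ∃ δ, δ = c / (4 * C + 4) := ⟨_, rfl⟩
  have hδ0 : 0 < δ := hδ ▸ div_pos hcp (by linarith)
  have hδC : 2 * δ * C < c := by
    have h4 : δ * (4 * C + 4) = c := by rw [hδ]; exact div_mul_cancel₀ _ (by linarith)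
    nlinarith
  set φ : Euc N → ℝ := zz e x0 ρ with hφd
  have hφ : memHs N s (BB N R) φ := zz_mem hs hR e x0 hρ
  have aφ : Asym e φ := Asym.mk e (zt x0 ρ)
  have au : Asym e u := Vf_asym g 0
  set f : Euc N → ℝ := fun x => δ * φ x - u x with hfd
  have hf : memHs N s (BB N R) f := (hφ.smul δ).sub hu.mem
  have af : Asym e f := (aφ.smul δ).sub au
  have hf' : memHs N s (BB N R) (fun y => - f y) := by simpa using hf.smul (-1)
  have af' : Asym e (fun y => - f y) := fun y => by simp [af y]
  set V := pp e f with hV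
  have hVm : memHs N s (BB N R) V := pp_mem hs hR hen hf af
  have aV : Asym e V := pp_asym e f
  set V' := pp e (fun y => - f y) with hV'
  have hVm' : memHs N s (BB N R) V' := pp_mem hs hR hen hf' af'
  set V1 := (HH e).indicator V with hV1
  have hV1m : memHs N s (BB N R) V1 := memHs_half hs hR hen hVm aV
  have hH : ∀ x : Euc N, x ∈ HH e ↔ 0 < x 0 := fun x => by rw [mem_HH, he, inner_E1]
  have hV1v : ∀ x, x ∈ HH e → V1 x = max (f x) 0 := fun x hx => by
    rw [hV1, indicator_of_mem hx, hV, pp_of_pos hen hx]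
  have hV1o : ∀ x, x ∉ HH e → V1 x = 0 := fun x hx => indicator_of_notMem hx _
  have hV10 : ∀ x, 0 ≤ V1 x := by
    intro x
    by_cases hx : x ∈ HH e
    · rw [hV1v x hx]; exact le_max_right _ _
    · rw [hV1o x hx]
  have huH : ∀ x, x ∈ HH e → 0 ≤ u x := by
    intro x hx
    have hx0 := (hH x).1 hx
    have hn : 0 < ‖x‖ := norm_pos_iff.2 (by rintro rfl; simp at hx0)
    have := hg0 _ hn
    simp only [hud, Vf]; positivity
  have hφH : ∀ x, x ∈ HH e → φ x = zt x0 ρ x := by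
    intro x hx
    have : zt x0 ρ (refl e x) = 0 := by
      by_contra hz
      have h1 := zt_inner hen hρ hz
      rw [inner_refl hen] at h1
      have := mem_HH.1 hx
      linarith
    simp only [hφd, zz, this, sub_zero]
  have hfar : ∀ x, ρ ≤ ‖x - x0‖ → V1 x = 0 := by
    intro x hxρ
    by_cases hx : x ∈ HH e
    · rw [hV1v x hx]
      apply max_eq_right
      simp only [hfd]
      rw [hφH x hx, zt_far hρ hxρ]
      linarith [huH x hx]
    · exact hV1o x hx
  have hV1P : ∀ x, x ∉ P → V1 x = 0 := by
    intro x hx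
    apply hfar
    rw [hP, Metric.mem_closedBall, dist_eq_norm, not_le] at hx; exact hx.le
  have hPB : P ⊆ BB N R := fun x hx => by
    rw [mem_ball_zero_iff]; linarith [(hPp x hx).2.1]
  have hsupp : ∀ x, x ∉ BB N R → V1 x = 0 := fun x hx => hV1P x fun h => hx (hPB h)
  have hV1i := hV1m.integrable_of_supp hsupp
  set I := ∫ x, V1 x with hI
  have hI0 : 0 ≤ I := integral_nonneg hV10
  -- lower bound for the cross term
  have hPH : ∀ x ∈ P, x ∈ HH e := fun x hx => mem_HH.2 (by linarith [(hPp x hx).2.2])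
  have hSH : ∀ x ∈ S, x ∈ HH e := fun x hx => mem_HH.2 (by linarith [(hSp x hx).2.2])
  obtain ⟨hJi, hJe⟩ := cross_formula hR hVm hVm' aV (pp_asym _ _) (pp_mul hen af)
  have hJ0 := ae_restrict_of_ae (s := reg N (BB N R)) (cross_nonneg (e := e) (a := V) (b := V') hs.1 hen (fun x => pp_nonneg hen) (fun x => pp_nonpos hen)
    (fun x => pp_nonneg hen) (fun x => pp_nonpos hen))
  have hJl := cross_lower (V := V1) (c := c0) (P := P) (S := S) hJi hJ0 Metric.isClosed_closedBall.measurableSet (hPB.trans subset_closure)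
    Metric.isClosed_closedBall.measurableSet measure_closedBall_lt_top.ne hV1i.integrableOn (by
      intro x hx y hy
      have hxH := hPH x hx
      have hyH := hSH y hy
      have hzy : zt x0 ρ y = 0 := by
        apply zt_far hρ
        have h1 := norm_sub_norm_le y x0
        have hn : ‖x0‖ = r0 := norm_smul_E1 hr0.le
        have := (hSp y hy).1
        rw [hn] at h1; linarith
      have hfy : f y = - u y := by simp only [hfd]; rw [hφH y hyH, hzy]; ring
      have h1 : V y = 0 := by
        rw [hV, pp_of_pos hen hyH, hfy]; exact max_eq_right (by linarith [huH y hyH])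
      have h2 : V' y = u y := by
        rw [hV', pp_of_pos hen hyH, hfy, neg_neg]; exact max_eq_left (huH y hyH)
      have h3 : V1 x = V x := indicator_of_mem hxH _
      simp only
      rw [h1, h2, ← h3]
      have := mul_le_mul_of_nonneg_left (hc x hx y hy) (hV10 x)
      linarith)
  have hIP : ∫ x in P, V1 x = I := setIntegral_eq_integral_of_forall_compl_eq_zero hV1P
  rw [hIP] at hJl
  have hcross : bform N s (BB N R) V V' ≤ - (c * I) := by
    rw [hJe, hcd]; linarith
  -- upper bound
  have hE1 : bform N s (BB N R) φ V1 ≤ ∫ x, C * V1 x := by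
    refine second_diff hs (M := 1) hφ (fun x => zz_bdd x) hV1m hV10 hsupp (hV1i.const_mul C) (ε0 := 1) one_pos ?_
    intro ε hε _ x hx
    rw [hC]
    refine zz_second_int hs hen hρ hr hε ?_
    by_contra hcon
    exact hx (hfar x (not_lt.1 hcon))
  rw [integral_const_mul] at hE1
  have hT := pp_test hs hR hen hf af
  have hVV := bform_self_nonneg (N := N) (s := s) (Ω := BB N R) (u := V)
  have hSb : bform N s (BB N R) f V = bform N s (BB N R) (fun x => δ * φ x) V - bform N s (BB N R) u V :=
    bform_sub_left (hφ.smul δ) hu.mem hVm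
  have hSm : bform N s (BB N R) (fun x => δ * φ x) V = δ * bform N s (BB N R) φ V := bform_smul_left δ
  have hφE := half_bform hs hR hen hφ aφ hVm aV
  have huE := hu.weak' hs hVm
  have huI := half_int hs hR hen hu.mem au hVm aV
  have huV : 0 ≤ ∫ x in BB N R, u x * V1 x := by
    refine integral_nonneg fun x => ?_
    by_cases hx : x ∈ HH e
    · exact mul_nonneg (huH x hx) (hV10 x)
    · simp only [hV1o x hx, mul_zero]; exact le_rfl
  have hlam := lam_nonneg (N := N) (Ω := BB N R) hs
  have huE0 : 0 ≤ bform N s (BB N R) u V := by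
    rw [huE, huI]; exact mul_nonneg hlam (by linarith)
  have hfin : c * I ≤ 2 * δ * C * I := by
    have h1 : bform N s (BB N R) f V ≤ δ * (2 * (C * I)) := by
      rw [hSb, hSm, hφE]
      have := mul_le_mul_of_nonneg_left hE1 hδ0.le
      linarith
    linarith
  have hIz : I = 0 := by nlinarith
  have hae := (integral_eq_zero_iff_of_nonneg hV10 hV1i).1 hIz
  have hcf : ContinuousOn f (HH e) := by
    intro x hx
    have hx0 := (hH x).1 hx
    have hne : x ≠ 0 := by rintro rfl; simp at hx0
    exact ((continuous_const.mul (zz_cont e _ ρ)).continuousAt.sub (Vf_contAt hgc 0 hne)).continuousWithinAt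
  have hUo : IsOpen (HH e ∩ f ⁻¹' Ioi 0) := hcf.isOpen_inter_preimage isOpen_HH isOpen_Ioi
  have hUn : volume (HH e ∩ f ⁻¹' Ioi 0) = 0 := by
    have : ∀ᵐ x, x ∉ HH e ∩ f ⁻¹' Ioi 0 := by
      filter_upwards [hae] with x hx hxU
      have h1 : 0 < f x := hxU.2
      have h2 : V1 x = f x := by rw [hV1v x hxU.1, max_eq_left h1.le]
      have h6 : V1 x = 0 := hx
      linarith
    exact measure_eq_zero_iff_ae_notMem.2 this
  have hUe := (hUo.measure_eq_zero_iff volume).1 hUn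
  by_contra hcon
  have hxP : x0 ∈ P := Metric.mem_closedBall_self hρ.le
  have hcc : x0 0 = r0 := by simp [hx0, he]
  have hn : ‖x0‖ = r0 := norm_smul_E1 hr0.le
  have : x0 ∈ HH e ∩ f ⁻¹' Ioi 0 := by
    refine ⟨hPH _ hxP, ?_⟩
    change 0 < f x0
    simp only [hfd]
    rw [hφH _ (hPH _ hxP), zt_center, hud, Vf, hn, hcc, div_self hr0.ne']
    linarith [not_lt.1 hcon]
  rw [hUe] at this; exact this

end

section

variable {N : ℕ} {s : ℝ} {Ω : Set (Euc N)} {u v : Euc N → ℝ} {R : ℝ} {e : Euc N} {w : Fin N → Euc N → ℝ}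

lemma convex_half_pos (R : ℝ) (i : Fin N) : Convex ℝ (BB N R ∩ {x : Euc N | 0 < x i}) := by
  refine (convex_ball _ _).inter ?_
  intro x hx y hy a b ha hb hab
  have hx' : 0 < x i := hx
  have hy' : 0 < y i := hy
  change 0 < (a • x + b • y) i
  simp only [PiLp.add_apply, PiLp.smul_apply, smul_eq_mul]
  rcases ha.eq_or_lt with h | h
  · have : b = 1 := by linarith
    rw [← h, this]; linarith
  · have h1 := mul_pos h hx'
    have h2 := mul_nonneg hb hy'.le
    linarith

lemma convex_half_neg (R : ℝ) (i : Fin N) : Convex ℝ (BB N R ∩ {x : Euc N | x i < 0}) := by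
  refine (convex_ball _ _).inter ?_
  intro x hx y hy a b ha hb hab
  have hx' : x i < 0 := hx
  have hy' : y i < 0 := hy
  change (a • x + b • y) i < 0
  simp only [PiLp.add_apply, PiLp.smul_apply, smul_eq_mul]
  rcases ha.eq_or_lt with h | h
  · have : b = 1 := by linarith
    rw [← h, this]; linarith
  · have h1 := mul_neg_of_pos_of_neg h hx'
    have h2 := mul_nonpos_of_nonneg_of_nonpos hb hy'.le
    linarith

lemma twoNodal_of (hR : 0 < R) (i : Fin N) (hu : ∀ x ∈ BB N R, u x ≠ 0 ↔ x i ≠ 0) : TwoNodal N (BB N R) u := by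
  unfold TwoNodal
  set X := {x : Euc N // x ∈ BB N R ∧ u x ≠ 0} with hX
  have hne : ∀ x : X, x.1 i ≠ 0 := fun x => (hu x.1 x.2.1).1 x.2.2
  have hci : Continuous (fun x : X => x.1 i) := (coord_continuous i).comp continuous_subtype_val
  set F : X → Bool := fun x => decide (0 < x.1 i) with hF
  have hFc : Continuous F := by
    rw [continuous_discrete_rng]
    intro b
    cases b
    · have : F ⁻¹' {false} = (fun x : X => x.1 i) ⁻¹' Iio 0 := by
        ext x
        simp only [hF, mem_preimage, mem_singleton_iff, decide_eq_false_iff_not, not_lt, mem_Iio]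
        exact ⟨fun h => lt_of_le_of_ne h (hne x), le_of_lt⟩
      rw [this]; exact isOpen_Iio.preimage hci
    · have : F ⁻¹' {true} = (fun x : X => x.1 i) ⁻¹' Ioi 0 := by
        ext x
        simp [hF]
      rw [this]; exact isOpen_Ioi.preimage hci
  have hpre : ∀ b, IsPreconnected (F ⁻¹' {b}) := by
    intro b
    have hind : Topology.IsInducing (fun x : X => x.1) := Topology.IsInducing.subtypeVal
    refine hind.isPreconnected_image.1 ?_
    cases b
    · convert (convex_half_neg R i).isPreconnected using 1
      ext x
      constructor
      · rintro ⟨y, hy, rfl⟩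
        simp only [hF, mem_preimage, mem_singleton_iff, decide_eq_false_iff_not, not_lt] at hy
        exact ⟨y.2.1, lt_of_le_of_ne hy (hne y)⟩
      · rintro ⟨h1, h2⟩
        have h2' : x i < 0 := h2
        refine ⟨⟨x, h1, (hu x h1).2 h2'.ne⟩, ?_, rfl⟩
        simp [hF, h2'.le]
    · convert (convex_half_pos R i).isPreconnected using 1
      ext x
      constructor
      · rintro ⟨y, hy, rfl⟩
        simp only [hF, mem_preimage, mem_singleton_iff, decide_eq_true_eq] at hy
        exact ⟨y.2.1, hy⟩
      · rintro ⟨h1, h2⟩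
        have h2' : 0 < x i := h2
        refine ⟨⟨x, h1, (hu x h1).2 h2'.ne'⟩, ?_, rfl⟩
        simp [hF, h2']
  have hbij : Function.Bijective hFc.connectedComponentsLift := by
    constructor
    · intro a b hab
      obtain ⟨x, rfl⟩ := ConnectedComponents.surjective_coe a
      obtain ⟨y, rfl⟩ := ConnectedComponents.surjective_coe b
      rw [Continuous.connectedComponentsLift_apply_coe, Continuous.connectedComponentsLift_apply_coe] at hab
      rw [ConnectedComponents.coe_eq_coe']
      exact (hpre (F y)).subset_connectedComponent (x := y) rfl hab
    · have hmem : ∀ t : ℝ, |t| = R / 2 → ∃ x : X, x.1 i = t := by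
        intro t ht
        have h1 : (t • E1 N i) i = t := by simp
        have h2 : t • E1 N i ∈ BB N R := by
          rw [mem_ball_zero_iff, norm_smul, E1_norm, mul_one, Real.norm_eq_abs, ht]; linarith
        refine ⟨⟨t • E1 N i, h2, (hu _ h2).2 ?_⟩, h1⟩
        rw [h1]; intro h; rw [h, abs_zero] at ht; linarith
      intro b
      cases b
      · obtain ⟨x, hx⟩ := hmem (-(R / 2)) (by rw [abs_neg, abs_of_pos (by linarith)])
        refine ⟨ConnectedComponents.mk x, ?_⟩
        rw [Continuous.connectedComponentsLift_apply_coe]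
        simp only [hF, hx, decide_eq_false_iff_not]; linarith
      · obtain ⟨x, hx⟩ := hmem (R / 2) (abs_of_pos (by linarith))
        refine ⟨ConnectedComponents.mk x, ?_⟩
        rw [Continuous.connectedComponentsLift_apply_coe]
        simp only [hF, hx, decide_eq_true_eq]; linarith
  rw [Nat.card_eq_of_bijective _ hbij]
  simp

lemma Vf_continuous {g : ℝ → ℝ} (hgc : ContinuousOn g (Ioi 0)) (hg0 : ∀ t, 0 < t → 0 ≤ g t) {A ρ : ℝ} (hA : 0 < A) (hρ : 0 < ρ)
    (hb : ∀ t, 0 < t → t < ρ → g t ≤ A * t) (i : Fin N) : Continuous (Vf g i : Euc N → ℝ) := by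
  rw [continuous_iff_continuousAt]
  intro x
  by_cases hx : x = 0
  · subst hx
    have h0 : Vf g i (0 : Euc N) = 0 := by simp [Vf]
    have hbd : ∀ᶠ x : Euc N in 𝓝 0, ‖Vf g i x‖ ≤ A * ‖x‖ := by
      filter_upwards [Metric.ball_mem_nhds (0 : Euc N) hρ] with x hx
      rw [mem_ball_zero_iff] at hx
      by_cases hx0 : x = 0
      · rw [hx0, h0]; simp
      · have hn : 0 < ‖x‖ := norm_pos_iff.2 hx0
        have h1 : |x i / ‖x‖| ≤ 1 := by
          rw [abs_div, abs_of_pos hn]; exact (div_le_one hn).2 (coord_le_norm x i)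
        rw [Vf, Real.norm_eq_abs, abs_mul, abs_of_nonneg (hg0 _ hn)]
        calc _ ≤ 1 * g ‖x‖ := mul_le_mul_of_nonneg_right h1 (hg0 _ hn)
          _ ≤ _ := by rw [one_mul]; exact hb _ hn hx
    rw [ContinuousAt, h0]
    refine squeeze_zero_norm' hbd ?_
    have : Continuous (fun x : Euc N => A * ‖x‖) := by fun_prop
    simpa using this.tendsto 0
  · exact Vf_contAt hgc i hx

theorem main_thm [NeZero N] (hN : 2 ≤ N) (hR : 0 < R) (hs : s ∈ Ioo (sst N) 1) :
    ∃ v : Fin N → Euc N → ℝ,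
      (∀ i, IsFirstEigen N s (BB N R) (v i) ∧ Continuous (v i) ∧
        (∀ x, v i (reflect N (EuclideanSpace.single i 1) x) = - v i x) ∧ TwoNodal N (BB N R) (v i)) ∧
      (∀ u, IsFirstEigen N s (BB N R) u → ∃ b : Fin N → ℝ, ∀ᵐ x, u x = ∑ i, b i * v i x) := by
  have hs' : s ∈ Ioo (0:ℝ) 1 := ⟨by linarith [hs.1, (sst_mem (N := N)).1], hs.2⟩
  obtain ⟨α, w, F⟩ := exists_fam hN hs hR
  obtain ⟨g, hgc, hgw, hg0, hgR, hgb⟩ := F.cont_form hN hs hR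
  have hmeas : ∀ i : Fin N, Measurable (Vf g i : Euc N → ℝ) := fun i =>
    measurable_of_continuousOn_compl_singleton 0 fun x hx => (Vf_contAt hgc i hx).continuousWithinAt
  have hE : ∀ i, IsEig N s (BB N R) (Vf g i) := fun i => (F.eig i).congr_ae (hmeas i) (hgw i)
  obtain ⟨A, hA, ρ, hρ, hb⟩ := barrier hs' hR hgc hg0 hgb (hE 0)
  have hpos : ∀ t, 0 < t → t < R → 0 < g t := fun t h1 h2 => g_pos hs' hR hgc hg0 hgR (hE 0) h1 h2
  refine ⟨fun i => Vf g i, fun i => ⟨?_, Vf_continuous hgc hg0 hA hρ hb i, ?_, ?_⟩, ?_⟩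
  · refine isFirstEigen_iff.2 ⟨hE i, fun h => F.ne_zero i ?_⟩
    exact (hgw i).trans ((hE i).eq_zero_of hs' (vol_BB_ne_zero hR) h meas_BB)
  · intro x
    rw [← refl_eq (E1_norm i)]
    exact Vf_asym g i x
  · refine twoNodal_of hR i fun x hx => ?_
    rw [mem_ball_zero_iff] at hx
    constructor
    · intro h h0
      exact h (by simp [Vf, h0])
    · intro h
      have hx0 : x ≠ 0 := by rintro rfl; simp at h
      have hn : 0 < ‖x‖ := norm_pos_iff.2 hx0
      exact mul_ne_zero (div_ne_zero h hn.ne') (hpos _ hn hx).ne'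
  · intro u hu
    obtain ⟨b, hb⟩ := F.span hN hs hR (isFirstEigen_iff.1 hu).1
    refine ⟨b, ?_⟩
    filter_upwards [hb, ae_all_iff.2 hgw] with x hx hw
    rw [hx]
    exact Finset.sum_congr rfl fun i _ => by rw [hw i]

end

end FracNeumann
namespace FracNeumann

/-- Theorem 1.2: for `s` close enough to `1`, the first nontrivial eigenspace
in a ball is spanned by `N` antisymmetric eigenfunctions with exactly two nodal domains. -/
theorem statement1 (N : ℕ) (hN : 2 ≤ N) (R : ℝ) (hR : 0 < R)
    (B : Set (Euc N)) (hB : B = Metric.ball (0 : Euc N) R) :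
    ∃ sstar : ℝ, sstar ∈ Set.Ioo (0 : ℝ) 1 ∧
      ∀ s ∈ Set.Ioo sstar 1,
        ∃ v : Fin N → Euc N → ℝ,
          (∀ i : Fin N, IsFirstEigen N s B (v i) ∧ Continuous (v i) ∧
            (∀ x : Euc N, v i (reflect N (EuclideanSpace.single i 1) x) = - v i x) ∧
            TwoNodal N B (v i)) ∧
          (∀ u : Euc N → ℝ, IsFirstEigen N s B u →
            ∃ b : Fin N → ℝ, ∀ᵐ x : Euc N ∂volume, u x = ∑ i, b i * v i x) := by
  have : NeZero N := ⟨by omega⟩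
  subst hB
  have h := sst_mem (N := N)
  exact ⟨sst N, ⟨by linarith [h.1], h.2⟩, fun s hs => main_thm hN hR hs⟩
end FracNeumann
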